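/- There exist two open triangular regions A and B in ℝ² that are not isometric to each other (no isometry of ℝ² maps A onto B) such that λ_1(A) = λ_1(B), λ_2(A) = λ_2(B), and λ_4(A) = λ_4(B), where λ_k denotes the k-th Dirichlet eigenvalue of the Laplacian. -/

import Mathlib

open MeasureTheory Real

/-- The k-th Dirichlet eigenvalue of the Laplacian on `Ω ⊆ ℝⁿ`, defined variationally as
the infimum, over all `k`-dimensional subspaces `E` of the space of smooth compactly
supported functions with support in `Ω`, of the supremum of the Rayleigh quotient
`(∫_Ω ‖∇u‖²) / (∫_Ω u²)` over nonzero `u ∈ E`. -/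
noncomputable def dirichletEig {n : ℕ} (Ω : Set (EuclideanSpace ℝ (Fin n))) (k : ℕ) : ℝ :=
  sInf { r : ℝ | ∃ E : Submodule ℝ (EuclideanSpace ℝ (Fin n) → ℝ),
    Module.finrank ℝ E = k ∧
    (∀ u ∈ E, ContDiff ℝ (⊤ : ℕ∞) u ∧ HasCompactSupport u ∧ tsupport u ⊆ Ω) ∧
    r = sSup { q : ℝ | ∃ u ∈ E, u ≠ (0 : EuclideanSpace ℝ (Fin n) → ℝ) ∧
        q = (∫ x in Ω, ‖gradient u x‖ ^ 2) / (∫ x in Ω, (u x) ^ 2) } }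

open scoped Topology

/-- A continuous nowhere vanishing function on the plane has a continuous logarithm. -/
theorem exists_continuous_log (H : ℝ × ℝ → ℂ) (hc : Continuous H) (h0 : ∀ z, H z ≠ 0) :
    ∃ L : ℝ × ℝ → ℂ, Continuous L ∧ ∀ z, Complex.exp (L z) = H z := by
  obtain ⟨w, hw⟩ : ∃ w, Complex.exp w = H (0, 0) := ⟨Complex.log (H (0, 0)), Complex.exp_log (h0 _)⟩
  obtain ⟨L, ⟨-, hL⟩, -⟩ := Complex.isCoveringMapOn_exp.existsUnique_continuousMap_lifts
    ⟨H, hc⟩ (a₀ := ((0 : ℝ), (0 : ℝ))) hw (by simpa using h0)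
  exact ⟨L, L.continuous, fun z => congrFun hL z⟩

theorem abs_im_sub_lt_pi (L : ℝ → ℂ) (hL : Continuous L) (α : ℂ →ₗ[ℝ] ℝ) {s t : ℝ} (hst : s ≤ t)
    (h : ∀ τ ∈ Set.Icc s t, 0 < α (Complex.exp (L τ))) :
    |(L t).im - (L s).im| < π := by
  by_contra! hcon
  have key : ∃ τ ∈ Set.Icc s t, (L τ).im - (L s).im = π ∨ (L τ).im - (L s).im = -π := by
    have hcont : ContinuousOn (fun τ => |(L τ).im - (L s).im|) (Set.Icc s t) := by fun_prop
    obtain ⟨τ, hτ, e⟩ := intermediate_value_Icc hst hcont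
      (show π ∈ Set.Icc _ _ by simpa using ⟨pi_pos.le, hcon⟩)
    refine ⟨τ, hτ, ?_⟩
    exact (abs_eq pi_pos.le).1 e
  obtain ⟨τ, hτ, hτ'⟩ := key
  have e : Complex.exp (L τ) = (-(Real.exp ((L τ).re - (L s).re)) : ℝ) • Complex.exp (L s) := by
    have : L τ = L s + (((L τ).re - (L s).re : ℝ) : ℂ) + (((L τ).im - (L s).im : ℝ) : ℂ) * Complex.I := by
      apply Complex.ext <;> simp
    rw [this, Complex.exp_add, Complex.exp_add]
    have e2 : Complex.exp ((((L τ).im - (L s).im : ℝ) : ℂ) * Complex.I) = -1 := by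
      rcases hτ' with h | h <;> rw [h]
      · exact Complex.exp_pi_mul_I
      · push_cast; rw [neg_mul, Complex.exp_neg, Complex.exp_pi_mul_I]; norm_num
    rw [e2, ← Complex.ofReal_exp]
    simp; ring
  have h1 := h τ hτ
  have h2 := h s ⟨le_rfl, hst⟩
  rw [e, map_smul, smul_eq_mul] at h1
  nlinarith [Real.exp_pos ((L τ).re - (L s).re)]

theorem cross_exp (z w : ℂ) : (Complex.exp z).re * (Complex.exp w).im
    - (Complex.exp z).im * (Complex.exp w).re =
    Real.exp (z.re + w.re) * Real.sin (w.im - z.im) := by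
  simp only [Complex.exp_re, Complex.exp_im, Real.exp_add, Real.sin_sub]; ring

/-- The angle swept by an odd path that stays in a half plane on each half. -/
theorem angle_eq_pi (L : ℝ → ℂ) (hL : Continuous L) (α β : ℂ →ₗ[ℝ] ℝ)
    (hodd : Complex.exp (L 1) = - Complex.exp (L 0))
    (hα : ∀ τ ∈ Set.Icc (0 : ℝ) (1 / 2), 0 < α (Complex.exp (L τ)))
    (hβ : ∀ τ ∈ Set.Icc (1 / 2 : ℝ) 1, 0 < β (Complex.exp (L τ)))
    (hcr : 0 < (Complex.exp (L 0)).re * (Complex.exp (L (1 / 2))).im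
      - (Complex.exp (L 0)).im * (Complex.exp (L (1 / 2))).re) :
    (L 1).im - (L 0).im = π := by
  have h1 := abs_lt.1 (abs_im_sub_lt_pi L hL α (by norm_num) hα)
  have h2 := abs_lt.1 (abs_im_sub_lt_pi L hL β (by norm_num) hβ)
  have hcr' : 0 < (Complex.exp (L (1 / 2))).re * (Complex.exp (L 1)).im
      - (Complex.exp (L (1 / 2))).im * (Complex.exp (L 1)).re := by
    rw [hodd]; simp only [Complex.neg_re, Complex.neg_im]; linarith
  rw [cross_exp] at hcr hcr'
  have s1 := (pos_iff_pos_of_mul_pos hcr).1 (Real.exp_pos _)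
  have s2 := (pos_iff_pos_of_mul_pos hcr').1 (Real.exp_pos _)
  have p1 : 0 < (L (1 / 2)).im - (L 0).im := by
    by_contra! h
    have := Real.sin_nonpos_of_nonpos_of_neg_pi_le h h1.1.le
    linarith
  have p2 : 0 < (L 1).im - (L (1 / 2)).im := by
    by_contra! h
    have := Real.sin_nonpos_of_nonpos_of_neg_pi_le h h2.1.le
    linarith
  have hs : Real.sin ((L 1).im - (L 0).im) = 0 := by
    have := cross_exp (L 0) (L 1)
    rw [hodd] at this
    simp only [Complex.neg_re, Complex.neg_im] at this
    have h3 : Real.exp ((L 0).re + (L 1).re) * Real.sin ((L 1).im - (L 0).im) = 0 := by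
      rw [← this]; ring
    exact (mul_eq_zero.1 h3).resolve_left (Real.exp_pos _).ne'
  have h4 : Real.sin ((L 1).im - (L 0).im - π) = 0 := by rw [Real.sin_sub_pi, hs]; simp
  have := (Real.sin_eq_zero_iff_of_lt_of_lt (by linarith) (by linarith)).1 h4
  linarith

/-- Two odd paths winding in opposite directions are not homotopic through odd paths. -/
theorem false_of_opposite_winding (H : ℝ × ℝ → ℂ) (hc : Continuous H) (h0 : ∀ z, H z ≠ 0)
    (hodd : ∀ σ, H (σ, 1) = - H (σ, 0)) (α₀ β₀ α₁ β₁ : ℂ →ₗ[ℝ] ℝ)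
    (hα₀ : ∀ τ ∈ Set.Icc (0 : ℝ) (1 / 2), 0 < α₀ (H (0, τ)))
    (hβ₀ : ∀ τ ∈ Set.Icc (1 / 2 : ℝ) 1, 0 < β₀ (H (0, τ)))
    (hα₁ : ∀ τ ∈ Set.Icc (0 : ℝ) (1 / 2), 0 < α₁ (H (1, τ)))
    (hβ₁ : ∀ τ ∈ Set.Icc (1 / 2 : ℝ) 1, 0 < β₁ (H (1, τ)))
    (hc₀ : 0 < (H (0, 0)).re * (H (0, 1 / 2)).im - (H (0, 0)).im * (H (0, 1 / 2)).re)
    (hc₁ : (H (1, 0)).re * (H (1, 1 / 2)).im - (H (1, 0)).im * (H (1, 1 / 2)).re < 0) : False := by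
  obtain ⟨L, hL, hLH⟩ := exists_continuous_log H hc h0
  have hs : ∀ σ, Real.sin ((L (σ, 1)).im - (L (σ, 0)).im) = 0 := by
    intro σ
    have := cross_exp (L (σ, 0)) (L (σ, 1))
    rw [hLH, hLH, hodd] at this
    simp only [Complex.neg_re, Complex.neg_im] at this
    have h3 : Real.exp ((L (σ, 0)).re + (L (σ, 1)).re) *
        Real.sin ((L (σ, 1)).im - (L (σ, 0)).im) = 0 := by
      rw [← this]; ring
    exact (mul_eq_zero.1 h3).resolve_left (Real.exp_pos _).ne'
  have e0 : (L (0, 1)).im - (L (0, 0)).im = π :=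
    angle_eq_pi (fun τ => L (0, τ)) (by fun_prop) α₀ β₀ (by simp only [hLH, hodd])
      (by simpa only [hLH] using hα₀) (by simpa only [hLH] using hβ₀) (by simpa only [hLH] using hc₀)
  have e1 : (L (1, 1)).im - (L (1, 0)).im = -π := by
    have key := angle_eq_pi (fun τ => (starRingEnd ℂ) (L (1, τ)))
      (Complex.continuous_conj.comp (by fun_prop))
      (α₁ ∘ₗ Complex.conjAe.toLinearMap) (β₁ ∘ₗ Complex.conjAe.toLinearMap)
      (by simp only [Complex.exp_conj, hLH, hodd, map_neg])
      (by simpa [Complex.exp_conj, hLH] using hα₁) (by simpa [Complex.exp_conj, hLH] using hβ₁)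
      (by simp only [Complex.exp_conj, hLH, Complex.conj_re, Complex.conj_im]; linarith)
    simp only [Complex.conj_im] at key
    linarith
  have hcont : ContinuousOn (fun σ : ℝ => (L (σ, 1)).im - (L (σ, 0)).im) (Set.Icc 0 1) := by
    fun_prop
  obtain ⟨σ, -, hσ⟩ := intermediate_value_Icc' (by norm_num) hcont
    (show π / 2 ∈ Set.Icc _ _ by rw [e0, e1]; constructor <;> linarith [pi_pos])
  have := hs σ
  simp only at hσ
  rw [hσ, Real.sin_pi_div_two] at this
  norm_num at this

/-- The `k`-th min-max value of the Rayleigh quotient `q u u / m u u`. -/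
noncomputable def minmax {V : Type*} [AddCommGroup V] [Module ℝ V] (q m : LinearMap.BilinForm ℝ V)
    (k : ℕ) : ℝ :=
  sInf {r : ℝ | ∃ E : Submodule ℝ V, Module.finrank ℝ E = k ∧
    r = sSup {x : ℝ | ∃ u ∈ E, u ≠ 0 ∧ x = q u u / m u u}}

section minmax

variable {V W : Type*} [AddCommGroup V] [Module ℝ V] [AddCommGroup W] [Module ℝ W]
  {q m : LinearMap.BilinForm ℝ V} {q' m' : LinearMap.BilinForm ℝ W}

theorem exists_form_le (hm : ∀ u, u ≠ 0 → 0 < m u u) (E : Submodule ℝ V) [FiniteDimensional ℝ E] :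
    ∃ C : ℝ, ∀ u ∈ E, q u u ≤ C * m u u := by
  classical
  let b := Module.finBasis ℝ E
  set n := Module.finrank ℝ E
  let f : (Fin n → ℝ) →ₗ[ℝ] V := E.subtype ∘ₗ (b.equivFun.symm : (Fin n → ℝ) →ₗ[ℝ] E)
  have hf : Function.Injective f := E.injective_subtype.comp b.equivFun.symm.injective
  have hcont : ∀ r : LinearMap.BilinForm ℝ V, Continuous fun x => r (f x) (f x) := by
    intro r
    have h : ∀ x, r (f x) (f x) = ∑ i, ∑ j, x i * x j * r (f (Pi.single i 1)) (f (Pi.single j 1)) := by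
      intro x
      have hx : f x = ∑ i, x i • f (Pi.single i 1) := by
        conv_lhs => rw [pi_eq_sum_univ' x]
        simp [map_sum, map_smul]
      rw [hx]
      simp only [map_sum, LinearMap.sum_apply, map_smul, LinearMap.smul_apply, smul_eq_mul]
      rw [Finset.sum_comm]
      refine Finset.sum_congr rfl fun i _ => ?_
      rw [Finset.mul_sum]
      refine Finset.sum_congr rfl fun j _ => by ring
    simp only [h]
    fun_prop
  obtain ⟨C, hC⟩ : ∃ C, ∀ x ∈ Metric.sphere (0 : Fin n → ℝ) 1, q (f x) (f x) / m (f x) (f x) ≤ C := by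
    have hco : ContinuousOn (fun x => q (f x) (f x) / m (f x) (f x)) (Metric.sphere 0 1) := by
      apply (hcont q).continuousOn.div (hcont m).continuousOn
      intro x hx
      refine (hm _ ?_).ne'
      intro h0
      have : x = 0 := hf (by simpa using h0)
      simp [this] at hx
    obtain ⟨C, hC⟩ := ((isCompact_sphere (0 : Fin n → ℝ) 1).image_of_continuousOn hco).bddAbove
    exact ⟨C, fun x hx => hC ⟨x, hx, rfl⟩⟩
  refine ⟨C, fun u hu => ?_⟩
  by_cases h0 : u = 0
  · simp [h0]
  obtain ⟨x, rfl⟩ : ∃ x, f x = u := ⟨b.equivFun ⟨u, hu⟩, by simp [f]⟩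
  have hx : x ≠ 0 := by rintro rfl; simp at h0
  have hnx : 0 < ‖x‖ := norm_pos_iff.2 hx
  have h1 := hC (‖x‖⁻¹ • x) (by simp [norm_smul, hnx.ne'])
  simp only [map_smul, LinearMap.smul_apply, smul_eq_mul] at h1
  rw [← mul_assoc, ← mul_assoc,
    mul_div_mul_left _ _ (by positivity), div_le_iff₀ (hm _ h0)] at h1
  exact h1

theorem bddAbove_rayleigh (hm : ∀ u, u ≠ 0 → 0 < m u u) (E : Submodule ℝ V)
    [FiniteDimensional ℝ E] : BddAbove {x : ℝ | ∃ u ∈ E, u ≠ 0 ∧ x = q u u / m u u} := by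
  obtain ⟨C, hC⟩ := exists_form_le (q := q) hm E
  refine ⟨C, ?_⟩
  rintro x ⟨u, hu, h0, rfl⟩
  rw [div_le_iff₀ (hm _ h0)]
  exact hC u hu

theorem minmax_bddBelow (hq : ∀ u, 0 ≤ q u u) (hm : ∀ u, u ≠ 0 → 0 < m u u) (k : ℕ) :
    BddBelow {r : ℝ | ∃ E : Submodule ℝ V, Module.finrank ℝ E = k ∧
      r = sSup {x : ℝ | ∃ u ∈ E, u ≠ 0 ∧ x = q u u / m u u}} := by
  refine ⟨0, ?_⟩
  rintro r ⟨E, -, rfl⟩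
  apply Real.sSup_nonneg
  rintro x ⟨u, -, h0, rfl⟩
  exact div_nonneg (hq _) (hm _ h0).le

theorem minmax_le (hq : ∀ u, 0 ≤ q u u) (hm : ∀ u, u ≠ 0 → 0 < m u u) {k : ℕ} (hk : k ≠ 0)
    (E : Submodule ℝ V) (hE : Module.finrank ℝ E = k) {μ : ℝ}
    (h : ∀ u ∈ E, q u u ≤ μ * m u u) : minmax q m k ≤ μ := by
  refine (csInf_le (minmax_bddBelow hq hm k) ⟨E, hE, rfl⟩).trans ?_
  have : Nontrivial E := Module.nontrivial_of_finrank_pos (R := ℝ) (by omega)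
  obtain ⟨u, hu⟩ := exists_ne (0 : E)
  refine csSup_le ⟨_, (u : V), u.2, by simpa using hu, rfl⟩ ?_
  rintro x ⟨u, hu, h0, rfl⟩
  rw [div_le_iff₀ (hm _ h0)]
  exact h u hu

/-- Upper bound from `k` vectors on whose combinations the Rayleigh quotient is at most `μ`. -/
theorem minmax_le_of_family (hq : ∀ u, 0 ≤ q u u) (hm : ∀ u, u ≠ 0 → 0 < m u u) {k : ℕ}
    (hk : k ≠ 0) (v : Fin k → V) (hv : LinearIndependent ℝ v) {μ : ℝ}
    (h : ∀ x : Fin k → ℝ, q (∑ i, x i • v i) (∑ i, x i • v i) ≤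
      μ * m (∑ i, x i • v i) (∑ i, x i • v i)) : minmax q m k ≤ μ := by
  apply minmax_le hq hm hk (Submodule.span ℝ (Set.range v))
  · rw [finrank_span_eq_card hv, Fintype.card_fin]
  · intro u hu
    obtain ⟨x, rfl⟩ := (Submodule.mem_span_range_iff_exists_fun ℝ).1 hu
    exact h x

/-- Lower bound from fewer than `k` linear constraints. -/
theorem le_minmax (hm : ∀ u, u ≠ 0 → 0 < m u u) {k : ℕ}
    (hne : ∃ E : Submodule ℝ V, Module.finrank ℝ E = k) {n : ℕ} (hn : n < k)
    (L : V →ₗ[ℝ] (Fin n → ℝ)) {μ : ℝ} (h : ∀ u, L u = 0 → μ * m u u ≤ q u u) :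
    μ ≤ minmax q m k := by
  obtain ⟨E₀, hE₀⟩ := hne
  refine le_csInf ⟨_, E₀, hE₀, rfl⟩ ?_
  rintro r ⟨E, hE, rfl⟩
  have : FiniteDimensional ℝ E := Module.finite_of_finrank_pos (by omega)
  obtain ⟨u, hu, hu0⟩ : ∃ u ∈ LinearMap.ker (L ∘ₗ E.subtype), u ≠ 0 := by
    apply Submodule.exists_mem_ne_zero_of_ne_bot
    apply LinearMap.ker_ne_bot_of_finrank_lt
    simp; omega
  have hu0' : (u : V) ≠ 0 := by simpa using hu0
  have h1 := h u (by simpa using hu)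
  rw [← le_div_iff₀ (hm _ hu0')] at h1
  exact h1.trans (le_csSup (bddAbove_rayleigh hm E) ⟨u, u.2, hu0', rfl⟩)

/-- Comparison of min-max values along an injective linear map. -/
theorem minmax_le_of_map (hm : ∀ u, u ≠ 0 → 0 < m u u) (hq' : ∀ u, 0 ≤ q' u u)
    (hm' : ∀ u, u ≠ 0 → 0 < m' u u) {k : ℕ} (hk : k ≠ 0)
    (hne : ∃ E : Submodule ℝ V, Module.finrank ℝ E = k) (f : V →ₗ[ℝ] W)
    (hf : Function.Injective f) {s t : ℝ} (hs : 0 ≤ s) (ht : 0 < t)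
    (hqf : ∀ u, q' (f u) (f u) ≤ s * q u u) (hmf : ∀ u, t * m u u ≤ m' (f u) (f u)) :
    t * minmax q' m' k ≤ s * minmax q m k := by
  obtain ⟨E₀, hE₀⟩ := hne
  rcases hs.eq_or_lt with rfl | hs
  · rw [zero_mul]
    have : minmax q' m' k ≤ 0 := by
      apply minmax_le hq' hm' hk (E₀.map f)
      · rwa [← (Submodule.equivMapOfInjective f hf _).finrank_eq]
      · rintro _ ⟨u, hu, rfl⟩
        simpa using hqf u
    nlinarith
  rw [← div_le_iff₀' hs]
  refine le_csInf ⟨_, E₀, hE₀, rfl⟩ ?_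
  rintro r ⟨E, hE, rfl⟩
  have : FiniteDimensional ℝ E := Module.finite_of_finrank_pos (by omega)
  rw [div_le_iff₀' hs, ← le_div_iff₀' ht]
  have hb := bddAbove_rayleigh (q := q) hm E
  set R := sSup {x : ℝ | ∃ u ∈ E, u ≠ 0 ∧ x = q u u / m u u}
  have hR : ∀ u ∈ E, q u u ≤ R * m u u := by
    intro u hu
    by_cases h0 : u = 0
    · simp [h0]
    rw [← div_le_iff₀ (hm _ h0)]
    exact le_csSup hb ⟨u, hu, h0, rfl⟩
  by_cases hR0 : 0 ≤ R
  · apply minmax_le hq' hm' hk (E.map f)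
    · rwa [← (Submodule.equivMapOfInjective f hf _).finrank_eq]
    · rintro _ ⟨u, hu, rfl⟩
      calc q' (f u) (f u) ≤ s * q u u := hqf u
        _ ≤ s * (R * m u u) := by gcongr; exact hR u hu
        _ = (s * R / t) * (t * m u u) := by field_simp
        _ ≤ _ := by gcongr; exact hmf u
  · exfalso
    have : Nontrivial E := Module.nontrivial_of_finrank_pos (R := ℝ) (by omega)
    obtain ⟨u, hu⟩ := exists_ne (0 : E)
    have h0 : (u : V) ≠ 0 := by simpa using hu
    have h1 := hqf u
    have h2 := hq' (f u)
    have h3 := hR u u.2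
    have h4 := hm _ h0
    have h5 : R * m u u < 0 := mul_neg_of_neg_of_pos (not_le.1 hR0) h4
    nlinarith

end minmax

/-- Partial derivative in the first variable. -/
noncomputable def px (u : ℝ × ℝ → ℝ) (z : ℝ × ℝ) : ℝ := fderiv ℝ u z (1, 0)

/-- Partial derivative in the second variable. -/
noncomputable def py (u : ℝ × ℝ → ℝ) (z : ℝ × ℝ) : ℝ := fderiv ℝ u z (0, 1)

/-- Test functions on `Ω`. -/
def TF (Ω : Set (ℝ × ℝ)) : Submodule ℝ (ℝ × ℝ → ℝ) where
  carrier := {u | ContDiff ℝ (⊤ : ℕ∞) u ∧ HasCompactSupport u ∧ tsupport u ⊆ Ω}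
  add_mem' {u v} hu hv := ⟨hu.1.add hv.1, hu.2.1.add hv.2.1,
    (tsupport_add u v).trans (Set.union_subset hu.2.2 hv.2.2)⟩
  zero_mem' := ⟨contDiff_const, HasCompactSupport.zero, by
    simp [tsupport]⟩
  smul_mem' c u hu := ⟨hu.1.const_smul c, hu.2.1.smul_left (f := fun _ => c),
    (tsupport_smul_subset_right (fun _ => c) u).trans hu.2.2⟩

section

variable {u v : ℝ × ℝ → ℝ}

theorem continuous_px (hu : ContDiff ℝ (⊤ : ℕ∞) u) : Continuous (px u) :=
  (hu.continuous_fderiv (by simp)).clm_apply continuous_const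

theorem continuous_py (hu : ContDiff ℝ (⊤ : ℕ∞) u) : Continuous (py u) :=
  (hu.continuous_fderiv (by simp)).clm_apply continuous_const

theorem hasCompactSupport_px (hu : HasCompactSupport u) : HasCompactSupport (px u) :=
  hu.fderiv_apply (𝕜 := ℝ) (1, 0)

theorem hasCompactSupport_py (hu : HasCompactSupport u) : HasCompactSupport (py u) :=
  hu.fderiv_apply (𝕜 := ℝ) (0, 1)

theorem px_add (hu : ContDiff ℝ (⊤ : ℕ∞) u) (hv : ContDiff ℝ (⊤ : ℕ∞) v) (z : ℝ × ℝ) :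
    px (u + v) z = px u z + px v z := by
  simp only [px]
  rw [fderiv_add (hu.differentiable (by simp) z) (hv.differentiable (by simp) z)]; rfl

theorem py_add (hu : ContDiff ℝ (⊤ : ℕ∞) u) (hv : ContDiff ℝ (⊤ : ℕ∞) v) (z : ℝ × ℝ) :
    py (u + v) z = py u z + py v z := by
  simp only [py]
  rw [fderiv_add (hu.differentiable (by simp) z) (hv.differentiable (by simp) z)]; rfl

theorem px_smul (hu : ContDiff ℝ (⊤ : ℕ∞) u) (c : ℝ) (z : ℝ × ℝ) :
    px (c • u) z = c * px u z := by
  simp only [px]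
  rw [fderiv_const_smul (hu.differentiable (by simp) z)]; rfl

theorem py_smul (hu : ContDiff ℝ (⊤ : ℕ∞) u) (c : ℝ) (z : ℝ × ℝ) :
    py (c • u) z = c * py u z := by
  simp only [py]
  rw [fderiv_const_smul (hu.differentiable (by simp) z)]; rfl

theorem px_eq_zero_of_notMem {z : ℝ × ℝ} (hz : z ∉ tsupport u) : px u z = 0 := by
  rw [px, fderiv_of_notMem_tsupport (𝕜 := ℝ) hz]; rfl

theorem py_eq_zero_of_notMem {z : ℝ × ℝ} (hz : z ∉ tsupport u) : py u z = 0 := by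
  rw [py, fderiv_of_notMem_tsupport (𝕜 := ℝ) hz]; rfl

end

section DirichletForm

variable {Ω Ω' : Set (ℝ × ℝ)} {a b c a' b' c' : ℝ} {k : ℕ}

namespace TF

theorem smooth (u : TF Ω) : ContDiff ℝ (⊤ : ℕ∞) u.1 := u.2.1
theorem cpt (u : TF Ω) : HasCompactSupport u.1 := u.2.2.1
theorem supp (u : TF Ω) : tsupport u.1 ⊆ Ω := u.2.2.2
theorem cont (u : TF Ω) : Continuous u.1 := (TF.smooth u).continuous
theorem integrable (u : TF Ω) {g : ℝ × ℝ → ℝ} (hg : Continuous g) :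
    Integrable (fun z => u.1 z * g z) :=
  ((TF.cont u).mul hg).integrable_of_hasCompactSupport (TF.cpt u).mul_right
theorem integrable_px (u : TF Ω) {g : ℝ × ℝ → ℝ} (hg : Continuous g) :
    Integrable (fun z => px u.1 z * g z) :=
  ((continuous_px (TF.smooth u)).mul hg).integrable_of_hasCompactSupport
    (hasCompactSupport_px (TF.cpt u)).mul_right
theorem integrable_py (u : TF Ω) {g : ℝ × ℝ → ℝ} (hg : Continuous g) :
    Integrable (fun z => py u.1 z * g z) :=
  ((continuous_py (TF.smooth u)).mul hg).integrable_of_hasCompactSupport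
    (hasCompactSupport_py (TF.cpt u)).mul_right
theorem integrable_xx (u v : TF Ω) : Integrable (fun z => px u.1 z * px v.1 z) :=
  TF.integrable_px u (continuous_px (TF.smooth v))
theorem integrable_xy (u v : TF Ω) : Integrable (fun z => px u.1 z * py v.1 z) :=
  TF.integrable_px u (continuous_py (TF.smooth v))
theorem integrable_yx (u v : TF Ω) : Integrable (fun z => py u.1 z * px v.1 z) :=
  TF.integrable_py u (continuous_px (TF.smooth v))
theorem integrable_yy (u v : TF Ω) : Integrable (fun z => py u.1 z * py v.1 z) :=
  TF.integrable_py u (continuous_py (TF.smooth v))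

end TF

/-- The `L²` inner product. -/
noncomputable def mass (Ω : Set (ℝ × ℝ)) : LinearMap.BilinForm ℝ (TF Ω) :=
  LinearMap.mk₂ ℝ (fun u v => ∫ z, u.1 z * v.1 z)
    (fun u u' v => by
      rw [← integral_add (TF.integrable u (TF.cont v)) (TF.integrable u' (TF.cont v))]
      congr 1; ext z; simp; ring)
    (fun c u v => by
      rw [smul_eq_mul, ← integral_const_mul]
      congr 1; ext z; simp; ring)
    (fun u v v' => by
      rw [← integral_add (TF.integrable u (TF.cont v)) (TF.integrable u (TF.cont v'))]
      congr 1; ext z; simp; ring)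
    (fun c u v => by
      rw [smul_eq_mul, ← integral_const_mul]
      congr 1; ext z; simp; ring)

theorem mass_apply (u v : TF Ω) : mass Ω u v = ∫ z, u.1 z * v.1 z := rfl

/-- The integrand of the energy form. -/
noncomputable def enDensity (a b c : ℝ) (u v : ℝ × ℝ → ℝ) (z : ℝ × ℝ) : ℝ :=
  a * (px u z * px v z) + b * (px u z * py v z + py u z * px v z) + c * (py u z * py v z)

theorem TF.integrable_en (u v : TF Ω) : Integrable (enDensity a b c u.1 v.1) :=
  (((TF.integrable_xx u v).const_mul a).add
    (((TF.integrable_xy u v).add (TF.integrable_yx u v)).const_mul b)).add ((TF.integrable_yy u v).const_mul c)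

/-- The energy form with constant coefficients. -/
noncomputable def energy (Ω : Set (ℝ × ℝ)) (a b c : ℝ) : LinearMap.BilinForm ℝ (TF Ω) :=
  LinearMap.mk₂ ℝ (fun u v => ∫ z, enDensity a b c u.1 v.1 z)
    (fun u u' v => by
      rw [← integral_add (TF.integrable_en u v) (TF.integrable_en u' v)]
      congr 1; ext z; simp [enDensity, px_add (TF.smooth u) (TF.smooth u'), py_add (TF.smooth u) (TF.smooth u')]; ring)
    (fun t u v => by
      rw [smul_eq_mul, ← integral_const_mul]
      congr 1; ext z; simp [enDensity, px_smul (TF.smooth u), py_smul (TF.smooth u)]; ring)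
    (fun u v v' => by
      rw [← integral_add (TF.integrable_en u v) (TF.integrable_en u v')]
      congr 1; ext z; simp [enDensity, px_add (TF.smooth v) (TF.smooth v'), py_add (TF.smooth v) (TF.smooth v')]; ring)
    (fun t u v => by
      rw [smul_eq_mul, ← integral_const_mul]
      congr 1; ext z; simp [enDensity, px_smul (TF.smooth v), py_smul (TF.smooth v)]; ring)

theorem energy_apply (u v : TF Ω) : energy Ω a b c u v = ∫ z, enDensity a b c u.1 v.1 z := rfl

theorem mass_pos (u : TF Ω) (hu : u ≠ 0) : 0 < mass Ω u u := by
  rw [mass_apply]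
  have h0 : (u : ℝ × ℝ → ℝ) ≠ 0 := by simpa using hu
  obtain ⟨z, hz⟩ := Function.ne_iff.1 h0
  refine ((TF.cont u).mul (TF.cont u)).integral_pos_of_hasCompactSupport_nonneg_nonzero
    (TF.cpt u).mul_right (fun z => mul_self_nonneg _) (x := z) (by simpa using hz)

/-- Nonnegativity of a binary quadratic form. -/
def PosForm (a b c : ℝ) : Prop := ∀ X Y : ℝ, 0 ≤ a * X ^ 2 + 2 * b * X * Y + c * Y ^ 2

theorem enDensity_self (u : ℝ × ℝ → ℝ) (z : ℝ × ℝ) : enDensity a b c u u z =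
    a * px u z ^ 2 + 2 * b * px u z * py u z + c * py u z ^ 2 := by
  rw [enDensity]; ring

theorem energy_nonneg (h : PosForm a b c) (u : TF Ω) : 0 ≤ energy Ω a b c u u := by
  rw [energy_apply]
  apply integral_nonneg
  intro z
  simp only [enDensity_self]
  exact h _ _

/-- The `k`-th Dirichlet eigenvalue of the form with coefficients `a, b, c`. -/
noncomputable def ev (Ω : Set (ℝ × ℝ)) (a b c : ℝ) (k : ℕ) : ℝ :=
  minmax (energy Ω a b c) (mass Ω) k

theorem exists_finrank_eq (hΩ : IsOpen Ω) (hne : Ω.Nonempty) (k : ℕ) :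
    ∃ E : Submodule ℝ (TF Ω), Module.finrank ℝ E = k := by
  classical
  obtain ⟨z₀, hz₀⟩ := hne
  obtain ⟨ε, hε, hball⟩ := Metric.isOpen_iff.1 hΩ z₀ hz₀
  let p : Fin k → ℝ × ℝ := fun i => z₀ + (ε / 2 / (k + 1) * i, 0)
  have hp : ∀ i, p i ∈ Ω := by
    intro i
    apply hball
    rw [Metric.mem_ball, dist_eq_norm]
    simp only [p, add_sub_cancel_left, Prod.norm_def, norm_zero]
    rw [max_eq_left (norm_nonneg _), Real.norm_of_nonneg (by positivity)]
    have : (i : ℝ) < k + 1 := by exact_mod_cast i.2.trans (Nat.lt_succ_self _)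
    have h2 : (i : ℝ) / (k + 1) < 1 := by rw [div_lt_one (by positivity)]; exact this
    calc ε / 2 / (k + 1) * i = ε / 2 * (i / (k + 1)) := by ring
      _ ≤ ε / 2 * 1 := by gcongr
      _ < ε := by linarith
  have hinj : Function.Injective p := by
    intro i j h
    have := congrArg Prod.fst (add_left_cancel h)
    simp only at this
    have h3 : (i : ℝ) = j := by
      have h4 : ε / 2 / (k + 1) ≠ 0 := by positivity
      exact mul_left_cancel₀ h4 this
    exact Fin.ext (by exact_mod_cast h3)
  have hs : ∀ i, Ω ∩ {x | ∀ j, j ≠ i → x ≠ p j} ∈ nhds (p i) := by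
    intro i
    apply Filter.inter_mem (hΩ.mem_nhds (hp i))
    have : {x | ∀ j, j ≠ i → x ≠ p j} = ⋂ j ∈ {j | j ≠ i}, {x | x ≠ p j} := by ext; simp
    rw [this, Filter.biInter_mem (Set.toFinite _)]
    intro j hj
    exact isOpen_ne.mem_nhds (fun h => hj (hinj h).symm)
  choose f hf1 hf2 hf3 hf4 hf5 using fun i => exists_contDiff_tsupport_subset (n := (⊤ : ℕ∞)) (hs i)
  let v : Fin k → TF Ω := fun i => ⟨f i, hf3 i, hf2 i, (hf1 i).trans Set.inter_subset_left⟩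
  have hv : LinearIndependent ℝ v := by
    rw [Fintype.linearIndependent_iff]
    intro g hg i
    have h1 : (∑ j, g j • v j).1 (p i) = 0 := by rw [hg]; rfl
    have h2 : (∑ j, g j • v j).1 (p i) = ∑ j, g j * f j (p i) := by
      simp [v, Finset.sum_apply]
    rw [h2, Finset.sum_eq_single i, hf5, mul_one] at h1
    · exact h1
    · intro j _ hji
      have : p i ∉ tsupport (f j) := fun h => (hf1 j h).2 i hji.symm rfl
      rw [image_eq_zero_of_notMem_tsupport this, mul_zero]
    · simp
  exact ⟨Submodule.span ℝ (Set.range v), by rw [finrank_span_eq_card hv, Fintype.card_fin]⟩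

theorem le_ev (hΩ : IsOpen Ω) (hne : Ω.Nonempty) {n : ℕ} (hn : n < k) (L : Fin n → TF Ω →ₗ[ℝ] ℝ)
    {μ : ℝ} (h : ∀ u : TF Ω, (∀ i, L i u = 0) → μ * mass Ω u u ≤ energy Ω a b c u u) :
    μ ≤ ev Ω a b c k :=
  le_minmax mass_pos (exists_finrank_eq hΩ hne k) hn (LinearMap.pi L)
    fun u hu => h u fun i => congrFun hu i

theorem ev_mono (h : PosForm a' b' c') (hΩ : IsOpen Ω) (hne : Ω.Nonempty) (hk : k ≠ 0)
    (hsub : Ω ⊆ Ω') {K : ℝ} (hK : 0 ≤ K)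
    (hform : PosForm (K * a - a') (K * b - b') (K * c - c')) :
    ev Ω' a' b' c' k ≤ K * ev Ω a b c k := by
  have hle : TF Ω ≤ TF Ω' := fun u hu => ⟨hu.1, hu.2.1, hu.2.2.trans hsub⟩
  have := minmax_le_of_map (q := energy Ω a b c) mass_pos (energy_nonneg h) mass_pos hk
    (exists_finrank_eq hΩ hne k) (Submodule.inclusion hle) (Submodule.inclusion_injective hle)
    hK one_pos (fun u => ?_) (fun u => (one_mul _).le)
  · simpa only [one_mul, ev] using this
  · rw [energy_apply, energy_apply, ← integral_const_mul]
    refine integral_mono (TF.integrable_en (Submodule.inclusion hle u) _)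
      ((TF.integrable_en u _).const_mul _) fun z => ?_
    simp only [enDensity_self, Submodule.coe_inclusion]
    have := hform (px u.1 z) (py u.1 z)
    linarith

theorem exists_integral_comp_eq {E F : Type*} [NormedAddCommGroup E] [NormedSpace ℝ E]
    [FiniteDimensional ℝ E] [MeasurableSpace E] [BorelSpace E] (μ : Measure E) [μ.IsAddHaarMeasure]
    [NormedAddCommGroup F] [NormedSpace ℝ F] [FiniteDimensional ℝ F] [MeasurableSpace F]
    [BorelSpace F] (ν : Measure F) [ν.IsAddHaarMeasure] (A : E ≃L[ℝ] F) :
    ∃ κ : ℝ, 0 < κ ∧ ∀ g : F → ℝ, ∫ x, g (A x) ∂μ = κ * ∫ y, g y ∂ν := by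
  have h1 : (μ.map A).IsAddHaarMeasure := A.isAddHaarMeasure_map μ
  set κ := Measure.addHaarScalarFactor (μ.map A) ν
  have h2 : μ.map A = κ • ν := Measure.isAddLeftInvariant_eq_smul _ _
  refine ⟨κ, Measure.addHaarScalarFactor_pos_of_isAddHaarMeasure _ _, fun g => ?_⟩
  have h3 := integral_map_equiv (μ := μ) A.toHomeomorph.toMeasurableEquiv g
  have h4 : μ.map A.toHomeomorph.toMeasurableEquiv = κ • ν := h2
  rw [h4, integral_smul_nnreal_measure] at h3
  rw [NNReal.smul_def, smul_eq_mul] at h3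
  exact h3.symm

theorem ev_image (hΩ : IsOpen Ω) (hne : Ω.Nonempty) (hk : k ≠ 0) (h : PosForm a b c)
    (A : (ℝ × ℝ) ≃L[ℝ] (ℝ × ℝ)) {p q r s : ℝ}
    (h10 : A (1, 0) = (p, r)) (h01 : A (0, 1) = (q, s)) (hA : A ⁻¹' Ω' = Ω) :
    ev Ω a b c k = ev Ω' (a * p ^ 2 + 2 * b * p * q + c * q ^ 2)
      (a * p * r + b * (p * s + q * r) + c * q * s) (a * r ^ 2 + 2 * b * r * s + c * s ^ 2) k := by
  obtain ⟨κ, hκ, hint⟩ := exists_integral_comp_eq volume volume A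
  set a' := a * p ^ 2 + 2 * b * p * q + c * q ^ 2 with ha'
  set b' := a * p * r + b * (p * s + q * r) + c * q * s with hb'
  set c' := a * r ^ 2 + 2 * b * r * s + c * s ^ 2 with hc'
  have h' : PosForm a' b' c' := by
    intro X Y
    have := h (p * X + r * Y) (q * X + s * Y)
    rw [ha', hb', hc']; linarith
  have hΩ' : Ω' = A.symm ⁻¹' Ω := by rw [← hA]; ext z; simp
  have hop' : IsOpen Ω' := by rw [hΩ']; exact hΩ.preimage A.symm.continuous
  have hne' : Ω'.Nonempty := by
    obtain ⟨z, hz⟩ := hne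
    exact ⟨A z, by rw [hΩ']; simpa using hz⟩
  have tr : ∀ (B : (ℝ × ℝ) ≃L[ℝ] (ℝ × ℝ)) (Ω₁ Ω₂ : Set (ℝ × ℝ)), B ⁻¹' Ω₂ = Ω₁ → ∀ u ∈ TF Ω₂,
      u ∘ B ∈ TF Ω₁ := by
    intro B Ω₁ Ω₂ hB u hu
    refine ⟨hu.1.comp B.contDiff, hu.2.1.comp_homeomorph B.toHomeomorph, ?_⟩
    rw [← hB]
    refine (tsupport_comp_subset_preimage u B.continuous).trans (Set.preimage_mono hu.2.2)
  let f : TF Ω' →ₗ[ℝ] TF Ω :=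
    { toFun := fun u => ⟨u.1 ∘ A, tr A Ω Ω' hA u.1 u.2⟩, map_add' := fun _ _ => rfl,
      map_smul' := fun _ _ => rfl }
  let g : TF Ω →ₗ[ℝ] TF Ω' :=
    { toFun := fun u => ⟨u.1 ∘ A.symm, tr A.symm Ω' Ω hΩ'.symm u.1 u.2⟩, map_add' := fun _ _ => rfl,
      map_smul' := fun _ _ => rfl }
  have hgf : ∀ u, g (f u) = u := fun u => Subtype.ext (by ext z; simp [f, g])
  have hfg : ∀ u, f (g u) = u := fun u => Subtype.ext (by ext z; simp [f, g])
  have hm : ∀ u, mass Ω (f u) (f u) = κ * mass Ω' u u := fun u => hint (fun z => u.1 z * u.1 z)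
  have he : ∀ u, energy Ω a b c (f u) (f u) = κ * energy Ω' a' b' c' u u := by
    intro u
    rw [energy_apply, energy_apply, ← hint (enDensity a' b' c' u.1 u.1)]
    congr 1
    ext z
    have hd : ∀ w, fderiv ℝ (u.1 ∘ A) z w = fderiv ℝ u.1 (A z) (A w) := by
      intro w
      rw [fderiv_comp z ((TF.smooth u).differentiable (by simp) _) A.differentiableAt, A.fderiv]
      rfl
    have e1 : px (u.1 ∘ A) z = p * px u.1 (A z) + r * py u.1 (A z) := by
      rw [px, hd, h10, px, py, show ((p, r) : ℝ × ℝ) = p • (1, 0) + r • (0, 1) by simp, map_add,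
        map_smul, map_smul]; rfl
    have e2 : py (u.1 ∘ A) z = q * px u.1 (A z) + s * py u.1 (A z) := by
      rw [py, hd, h01, px, py, show ((q, s) : ℝ × ℝ) = q • (1, 0) + s • (0, 1) by simp, map_add,
        map_smul, map_smul]; rfl
    show enDensity a b c (u.1 ∘ A) (u.1 ∘ A) z = _
    rw [enDensity_self, enDensity_self, e1, e2, ha', hb', hc']
    ring
  have h1 : ev Ω a b c k ≤ ev Ω' a' b' c' k := by
    have := minmax_le_of_map (q := energy Ω' a' b' c') mass_pos (energy_nonneg h) mass_pos hk
      (exists_finrank_eq hop' hne' k) f (Function.LeftInverse.injective hgf) hκ.le hκ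
      (fun u => (he u).le) (fun u => (hm u).ge)
    exact le_of_mul_le_mul_left this hκ
  have h2 : ev Ω' a' b' c' k ≤ ev Ω a b c k := by
    have := minmax_le_of_map (q := energy Ω a b c) mass_pos (energy_nonneg h') mass_pos hk
      (exists_finrank_eq hΩ hne k) g (Function.LeftInverse.injective hfg) (inv_pos.2 hκ).le
      (inv_pos.2 hκ)
      (fun u => by rw [← hfg u, he, hfg, ← mul_assoc, inv_mul_cancel₀ hκ.ne', one_mul])
      (fun u => by rw [← hfg u, hm, hfg, ← mul_assoc, inv_mul_cancel₀ hκ.ne', one_mul])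
    exact le_of_mul_le_mul_left this (inv_pos.2 hκ)
  exact le_antisymm h1 h2

end DirichletForm

/-- The linear automorphism of the plane with matrix rows `(p, q)` and `(r, s)`. -/
noncomputable def planeEquiv (p q r s : ℝ) (h : p * s - q * r ≠ 0) : (ℝ × ℝ) ≃L[ℝ] (ℝ × ℝ) :=
  let D := p * s - q * r
  let l (a b : ℝ) : ℝ × ℝ →L[ℝ] ℝ :=
    a • ContinuousLinearMap.fst ℝ ℝ ℝ + b • ContinuousLinearMap.snd ℝ ℝ ℝ
  ContinuousLinearEquiv.equivOfInverse
    ((l p q).prod (l r s)) ((l (s / D) (-q / D)).prod (l (-r / D) (p / D)))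
    (fun z => by
      simp only [l, D]
      ext
      · simp; linear_combination z.1 * (mul_inv_cancel₀ h)
      · simp; linear_combination z.2 * (mul_inv_cancel₀ h))
    (fun z => by
      simp only [l, D]
      ext
      · simp; linear_combination z.1 * (mul_inv_cancel₀ h)
      · simp; linear_combination z.2 * (mul_inv_cancel₀ h))

theorem planeEquiv_apply {p q r s : ℝ} (h : p * s - q * r ≠ 0) (z : ℝ × ℝ) :
    planeEquiv p q r s h z = (p * z.1 + q * z.2, r * z.1 + s * z.2) := by
  simp [planeEquiv]

/-- The open standard triangle. -/
def stdTri : Set (ℝ × ℝ) := {z | 0 < z.1 ∧ 0 < z.2 ∧ z.1 + z.2 < 1}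

theorem isOpen_stdTri : IsOpen stdTri :=
  (isOpen_lt continuous_const continuous_fst).inter ((isOpen_lt continuous_const continuous_snd).inter
    (isOpen_lt (continuous_fst.add continuous_snd) continuous_const))

theorem stdTri_nonempty : stdTri.Nonempty := ⟨(1 / 3, 1 / 3), by norm_num [stdTri]⟩

theorem convexHull_std : convexHull ℝ ({(0, 0), (1, 0), (0, 1)} : Set (ℝ × ℝ)) =
    {z | 0 ≤ z.1 ∧ 0 ≤ z.2 ∧ z.1 + z.2 ≤ 1} := by
  apply subset_antisymm
  · apply convexHull_min
    · rintro z (rfl | rfl | rfl) <;> norm_num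
    · intro z hz w hw a b ha hb hab
      simp only [Set.mem_ofPred_eq, Prod.fst_add, Prod.snd_add, Prod.smul_fst, Prod.smul_snd,
        smul_eq_mul] at *
      refine ⟨by nlinarith [mul_nonneg ha hz.1, mul_nonneg hb hw.1],
        by nlinarith [mul_nonneg ha hz.2.1, mul_nonneg hb hw.2.1],
        by nlinarith [mul_le_mul_of_nonneg_left hz.2.2 ha, mul_le_mul_of_nonneg_left hw.2.2 hb]⟩
  · rintro ⟨x, y⟩ ⟨h1, h2, h3⟩
    simp only at h1 h2 h3
    have key := (convex_convexHull ℝ ({(0, 0), (1, 0), (0, 1)} : Set (ℝ × ℝ))).sum_mem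
      (t := Finset.univ) (w := ![1 - x - y, x, y]) (z := ![(0, 0), (1, 0), (0, 1)])
      (by intro i _; fin_cases i <;> simp <;> linarith)
      (by simp [Fin.sum_univ_three]; ring)
      (by intro i _; apply subset_convexHull; fin_cases i <;> simp)
    simpa [Fin.sum_univ_three] using key

theorem interior_convexHull_std :
    interior (convexHull ℝ ({(0, 0), (1, 0), (0, 1)} : Set (ℝ × ℝ))) = stdTri := by
  rw [convexHull_std]
  have e : {z : ℝ × ℝ | 0 ≤ z.1 ∧ 0 ≤ z.2 ∧ z.1 + z.2 ≤ 1} =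
      (Prod.fst ⁻¹' Set.Ici 0) ∩ ((Prod.snd ⁻¹' Set.Ici 0) ∩
        ((ContinuousLinearMap.fst ℝ ℝ ℝ + ContinuousLinearMap.snd ℝ ℝ ℝ) ⁻¹' Set.Iic 1)) := by
    ext; simp
  have hs : Function.Surjective (ContinuousLinearMap.fst ℝ ℝ ℝ + ContinuousLinearMap.snd ℝ ℝ ℝ) :=
    fun x => ⟨(x, 0), by simp⟩
  rw [e, interior_inter, interior_inter,
    ← isOpenMap_fst.preimage_interior_eq_interior_preimage continuous_fst,
    ← isOpenMap_snd.preimage_interior_eq_interior_preimage continuous_snd,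
    ← (ContinuousLinearMap.isOpenMap _ hs).preimage_interior_eq_interior_preimage
      (ContinuousLinearMap.continuous _), interior_Ici, interior_Iic]
  ext; simp [stdTri]

/-- The linear map sending the standard triangle to the triangle with vertices
`0`, `r • (1, 0)`, `r • (c, d)`. -/
noncomputable def triEquiv (r c d : ℝ) (h : r * (r * d) - (r * c) * 0 ≠ 0) :
    (ℝ × ℝ) ≃L[ℝ] EuclideanSpace ℝ (Fin 2) :=
  (planeEquiv r (r * c) 0 (r * d) h).trans
    ((ContinuousLinearEquiv.finTwoArrow ℝ ℝ).symm.trans (EuclideanSpace.equiv (Fin 2) ℝ).symm)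

theorem triEquiv_apply {r c d : ℝ} (h : r * (r * d) - (r * c) * 0 ≠ 0) (z : ℝ × ℝ) :
    triEquiv r c d h z = !₂[r * z.1 + r * c * z.2, r * d * z.2] := by
  ext i; fin_cases i <;> simp [triEquiv, planeEquiv_apply]

theorem triEquiv_symm_apply {r c d : ℝ} (hr : 0 < r) (hd : 0 < d)
    (h : r * (r * d) - (r * c) * 0 ≠ 0) (x : EuclideanSpace ℝ (Fin 2)) :
    (triEquiv r c d h).symm x = ((x 0 - c * x 1 / d) / r, x 1 / (r * d)) := by
  rw [ContinuousLinearEquiv.symm_apply_eq, triEquiv_apply]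
  ext i; fin_cases i <;> simp <;> field_simp <;> ring

theorem triEquiv_preimage {r c d : ℝ} (h : r * (r * d) - (r * c) * 0 ≠ 0) :
    triEquiv r c d h ⁻¹' interior (convexHull ℝ
      ({0, !₂[r, 0], !₂[r * c, r * d]} : Set (EuclideanSpace ℝ (Fin 2)))) = stdTri := by
  have e : ({0, !₂[r, 0], !₂[r * c, r * d]} : Set (EuclideanSpace ℝ (Fin 2))) =
      triEquiv r c d h '' {(0, 0), (1, 0), (0, 1)} := by
    simp only [Set.image_insert_eq, Set.image_singleton, triEquiv_apply]
    congr! 1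
    · ext i; fin_cases i <;> simp
    · congr! 1
      · ext i; fin_cases i <;> simp
      · congr! 1; ext i; fin_cases i <;> simp
  have e2 := (triEquiv r c d h).toLinearMap.image_convexHull
    ({(0, 0), (1, 0), (0, 1)} : Set (ℝ × ℝ))
  have e3 : convexHull ℝ (triEquiv r c d h '' {(0, 0), (1, 0), (0, 1)}) =
      triEquiv r c d h '' convexHull ℝ {(0, 0), (1, 0), (0, 1)} := e2.symm
  rw [e, e3]
  have e4 := (triEquiv r c d h).toHomeomorph.image_interior
    (convexHull ℝ {(0, 0), (1, 0), (0, 1)})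
  have e5 : interior (triEquiv r c d h '' convexHull ℝ {(0, 0), (1, 0), (0, 1)}) =
    triEquiv r c d h '' interior (convexHull ℝ {(0, 0), (1, 0), (0, 1)}) := e4.symm
  rw [e5, interior_convexHull_std, Set.preimage_image_eq _ (triEquiv r c d h).injective]

theorem norm_gradient_sq {w : EuclideanSpace ℝ (Fin 2) → ℝ} (x : EuclideanSpace ℝ (Fin 2)) :
    ‖gradient w x‖ ^ 2 = (fderiv ℝ w x !₂[1, 0]) ^ 2 + (fderiv ℝ w x !₂[0, 1]) ^ 2 := by
  have h : ∀ v, fderiv ℝ w x v = inner ℝ (gradient w x) v := by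
    intro v
    rw [gradient, InnerProductSpace.toDual_symm_apply]
  rw [EuclideanSpace.real_norm_sq_eq, Fin.sum_univ_two, h, h]
  simp only [PiLp.inner_apply, Fin.sum_univ_two]
  simp

theorem dirichletEig_triangle {r c d : ℝ} (hr : 0 < r) (hd : 0 < d) (k : ℕ) :
    dirichletEig (interior (convexHull ℝ
      ({0, !₂[r, 0], !₂[r * c, r * d]} : Set (EuclideanSpace ℝ (Fin 2))))) k =
    ev stdTri ((c ^ 2 + d ^ 2) / (r ^ 2 * d ^ 2)) (-c / (r ^ 2 * d ^ 2)) (1 / (r ^ 2 * d ^ 2)) k := by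
  have h : r * (r * d) - (r * c) * 0 ≠ 0 := by
    have : 0 < r * (r * d) := by positivity
    simpa using this.ne'
  set A := triEquiv r c d h with hA
  set Ω := interior (convexHull ℝ
      ({0, !₂[r, 0], !₂[r * c, r * d]} : Set (EuclideanSpace ℝ (Fin 2)))) with hΩ
  have hpre : A ⁻¹' Ω = stdTri := triEquiv_preimage h
  have hpre' : A.symm ⁻¹' stdTri = Ω := by rw [← hpre]; ext z; simp
  obtain ⟨κ, hκ, hint⟩ := exists_integral_comp_eq volume volume A
  set a := (c ^ 2 + d ^ 2) / (r ^ 2 * d ^ 2) with ha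
  set b := -c / (r ^ 2 * d ^ 2) with hb
  set c' := 1 / (r ^ 2 * d ^ 2) with hc'
  let g : TF stdTri →ₗ[ℝ] (EuclideanSpace ℝ (Fin 2) → ℝ) :=
    { toFun := fun u => u.1 ∘ A.symm, map_add' := fun _ _ => rfl, map_smul' := fun _ _ => rfl }
  have hginj : Function.Injective g := by
    intro u v huv
    apply Subtype.ext
    ext z
    have := congrFun huv (A z)
    simpa [g] using this
  have hgreg : ∀ u, ContDiff ℝ (⊤ : ℕ∞) (g u) ∧ HasCompactSupport (g u) ∧ tsupport (g u) ⊆ Ω := by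
    intro u
    refine ⟨u.2.1.comp A.symm.contDiff, u.2.2.1.comp_homeomorph A.symm.toHomeomorph, ?_⟩
    rw [← hpre']
    exact (tsupport_comp_subset_preimage u.1 A.symm.continuous).trans (Set.preimage_mono u.2.2.2)
  have hgsurj : ∀ w, ContDiff ℝ (⊤ : ℕ∞) w → HasCompactSupport w → tsupport w ⊆ Ω →
      ∃ u, g u = w := by
    intro w h1 h2 h3
    refine ⟨⟨w ∘ A, h1.comp A.contDiff, h2.comp_homeomorph A.toHomeomorph, ?_⟩, ?_⟩
    · rw [← hpre]
      exact (tsupport_comp_subset_preimage w A.continuous).trans (Set.preimage_mono h3)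
    · ext x; simp [g]
  have hquot : ∀ u, (∫ x in Ω, ‖gradient (g u) x‖ ^ 2) / (∫ x in Ω, (g u x) ^ 2) =
      energy stdTri a b c' u u / mass stdTri u u := by
    intro u
    have m1 : ∫ x in Ω, (g u x) ^ 2 = ∫ x, (g u x) ^ 2 := by
      apply setIntegral_eq_integral_of_forall_compl_eq_zero
      intro x hx
      rw [image_eq_zero_of_notMem_tsupport (fun h => hx ((hgreg u).2.2 h))]; simp
    have m2 : ∫ x in Ω, ‖gradient (g u) x‖ ^ 2 = ∫ x, ‖gradient (g u) x‖ ^ 2 := by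
      apply setIntegral_eq_integral_of_forall_compl_eq_zero
      intro x hx
      rw [norm_gradient_sq, fderiv_of_notMem_tsupport (𝕜 := ℝ) (fun h => hx ((hgreg u).2.2 h))]; simp
    have m3 : mass stdTri u u = κ * ∫ x, (g u x) ^ 2 := by
      rw [← hint, mass_apply]
      congr 1; ext z; simp [g]; ring
    have m4 : energy stdTri a b c' u u = κ * ∫ x, ‖gradient (g u) x‖ ^ 2 := by
      rw [← hint, energy_apply]
      congr 1; ext z
      have hd' : ∀ w, fderiv ℝ (g u) (A z) w = fderiv ℝ u.1 z (A.symm w) := by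
        intro w
        show fderiv ℝ (u.1 ∘ A.symm) (A z) w = _
        rw [fderiv_comp _ (u.2.1.differentiable (by simp) _) A.symm.differentiableAt, A.symm.fderiv]
        simp
      rw [norm_gradient_sq, hd', hd', hA, triEquiv_symm_apply hr hd, triEquiv_symm_apply hr hd,
        enDensity_self]
      have lin : ∀ x y : ℝ, fderiv ℝ u.1 z (x, y) = x * px u.1 z + y * py u.1 z := by
        intro x y
        rw [px, py, show ((x, y) : ℝ × ℝ) = x • (1, 0) + y • (0, 1) by simp, map_add,
          map_smul, map_smul]; rfl
      rw [lin, lin, ha, hb, hc']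
      simp
      field_simp
      ring
    rw [m1, m2, m3, m4, mul_div_mul_left _ _ hκ.ne']
  rw [dirichletEig, ev, minmax]
  congr 1
  ext ρ
  constructor
  · rintro ⟨E, hE, hreg, rfl⟩
    have hmap : (E.comap g).map g = E := by
      rw [Submodule.map_comap_eq, inf_eq_right]
      intro w hw
      obtain ⟨h1, h2, h3⟩ := hreg w hw
      exact hgsurj w h1 h2 h3
    refine ⟨E.comap g, ?_, ?_⟩
    · rw [(Submodule.equivMapOfInjective g hginj (E.comap g)).finrank_eq, hmap, hE]
    · congr 1
      ext x
      constructor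
      · rintro ⟨w, hw, h0, rfl⟩
        obtain ⟨h1, h2, h3⟩ := hreg w hw
        obtain ⟨u, rfl⟩ := hgsurj w h1 h2 h3
        exact ⟨u, hw, by rintro rfl; exact h0 (map_zero g), hquot u⟩
      · rintro ⟨u, hu, h0, rfl⟩
        exact ⟨g u, hu, fun h => h0 (hginj (by rw [h, map_zero])), (hquot u).symm⟩
  · rintro ⟨E, hE, rfl⟩
    refine ⟨E.map g, ?_, ?_, ?_⟩
    · rw [← (Submodule.equivMapOfInjective g hginj E).finrank_eq, hE]
    · rintro _ ⟨u, -, rfl⟩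
      exact hgreg u
    · congr 1
      ext x
      constructor
      · rintro ⟨u, hu, h0, rfl⟩
        exact ⟨g u, ⟨u, hu, rfl⟩, fun h => h0 (hginj (by rw [h, map_zero])), (hquot u).symm⟩
      · rintro ⟨_, ⟨u, hu, rfl⟩, h0, rfl⟩
        exact ⟨u, hu, by rintro rfl; exact h0 (map_zero g), hquot u⟩

theorem std_subset_extremePoints : ({(0, 0), (1, 0), (0, 1)} : Set (ℝ × ℝ)) ⊆
    (convexHull ℝ ({(0, 0), (1, 0), (0, 1)} : Set (ℝ × ℝ))).extremePoints ℝ := by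
  rw [convexHull_std]
  intro v hv
  rw [mem_extremePoints_iff_left]
  have key : ∀ l : ℝ × ℝ → ℝ, (∀ x y, ∀ a b : ℝ, l (a • x + b • y) = a * l x + b * l y) →
      ∀ S : Set (ℝ × ℝ), (∀ z ∈ S, 0 ≤ l z) → ∀ x ∈ S, ∀ y ∈ S, v ∈ openSegment ℝ x y → l v = 0 →
      l x = 0 := by
    rintro l hl S hS x hx y hy ⟨a, b, ha, hb, -, rfl⟩ h0
    rw [hl] at h0
    have h1 := hS x hx
    have h2 := hS y hy
    nlinarith [mul_nonneg ha.le h1, mul_nonneg hb.le h2]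
  have keyc : ∀ x ∈ {z : ℝ × ℝ | 0 ≤ z.1 ∧ 0 ≤ z.2 ∧ z.1 + z.2 ≤ 1},
      ∀ y ∈ {z : ℝ × ℝ | 0 ≤ z.1 ∧ 0 ≤ z.2 ∧ z.1 + z.2 ≤ 1}, v ∈ openSegment ℝ x y →
      v.1 + v.2 = 1 → x.1 + x.2 = 1 := by
    rintro x hx y hy ⟨a, b, ha, hb, hab, rfl⟩ h0
    simp only [Prod.fst_add, Prod.smul_fst, smul_eq_mul, Prod.snd_add, Prod.smul_snd] at h0
    have h1 := hx.2.2
    have h2 := hy.2.2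
    nlinarith [mul_nonneg ha.le (sub_nonneg.2 h1), mul_nonneg hb.le (sub_nonneg.2 h2)]
  have k1 := key Prod.fst (by intros; simp)
    {z : ℝ × ℝ | 0 ≤ z.1 ∧ 0 ≤ z.2 ∧ z.1 + z.2 ≤ 1} (fun z hz => hz.1)
  have k2 := key Prod.snd (by intros; simp)
    {z : ℝ × ℝ | 0 ≤ z.1 ∧ 0 ≤ z.2 ∧ z.1 + z.2 ≤ 1} (fun z hz => hz.2.1)
  refine ⟨by rcases hv with rfl | rfl | rfl <;> norm_num, fun x hx y hy h => ?_⟩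
  rcases hv with rfl | rfl | rfl
  · exact Prod.ext (k1 x hx y hy h rfl) (k2 x hx y hy h rfl)
  · have e1 := k2 x hx y hy h rfl
    have e2 := keyc x hx y hy h (by norm_num)
    exact Prod.ext (by simp only; linarith) e1
  · have e1 := k1 x hx y hy h rfl
    have e2 := keyc x hx y hy h (by norm_num)
    exact Prod.ext e1 (by simp only; linarith)

theorem vertices_eq_image {r c d : ℝ} (h : r * (r * d) - (r * c) * 0 ≠ 0) :
    ({0, !₂[r, 0], !₂[r * c, r * d]} : Set (EuclideanSpace ℝ (Fin 2))) =
      triEquiv r c d h '' {(0, 0), (1, 0), (0, 1)} := by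
  simp only [Set.image_insert_eq, Set.image_singleton, triEquiv_apply]
  congr! 1
  · ext i; fin_cases i <;> simp
  · congr! 1
    · ext i; fin_cases i <;> simp
    · congr! 1; ext i; fin_cases i <;> simp

theorem extremePoints_triangle {r c d : ℝ} (h : r * (r * d) - (r * c) * 0 ≠ 0) :
    (convexHull ℝ ({0, !₂[r, 0], !₂[r * c, r * d]} : Set (EuclideanSpace ℝ (Fin 2)))).extremePoints ℝ
      = {0, !₂[r, 0], !₂[r * c, r * d]} := by
  refine subset_antisymm extremePoints_convexHull_subset ?_
  rw [vertices_eq_image h]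
  have e2 := (triEquiv r c d h).toLinearMap.image_convexHull
    ({(0, 0), (1, 0), (0, 1)} : Set (ℝ × ℝ))
  have e3 : convexHull ℝ (triEquiv r c d h '' {(0, 0), (1, 0), (0, 1)}) =
      triEquiv r c d h '' convexHull ℝ {(0, 0), (1, 0), (0, 1)} := e2.symm
  rw [e3, ← image_extremePoints]
  exact Set.image_mono std_subset_extremePoints

theorem triangle_closure_interior {r c d : ℝ} (h : r * (r * d) - (r * c) * 0 ≠ 0) :
    closure (interior (convexHull ℝ
      ({0, !₂[r, 0], !₂[r * c, r * d]} : Set (EuclideanSpace ℝ (Fin 2))))) =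
      convexHull ℝ {0, !₂[r, 0], !₂[r * c, r * d]} := by
  rw [(convex_convexHull ℝ _).closure_interior_eq_closure_of_nonempty_interior]
  · exact ((Set.toFinite _).isClosed_convexHull ℝ).closure_eq
  · obtain ⟨z, hz⟩ := stdTri_nonempty
    rw [← triEquiv_preimage h] at hz
    exact ⟨_, hz⟩

theorem mem_extremePoints_image (f : EuclideanSpace ℝ (Fin 2) ≃ᵢ EuclideanSpace ℝ (Fin 2))
    {S : Set (EuclideanSpace ℝ (Fin 2))} {x : EuclideanSpace ℝ (Fin 2)}
    (hx : x ∈ S.extremePoints ℝ) : f x ∈ (f '' S).extremePoints ℝ := by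
  rw [mem_extremePoints_iff_left] at hx ⊢
  refine ⟨⟨x, hx.1, rfl⟩, ?_⟩
  rintro _ ⟨y, hy, rfl⟩ _ ⟨z, hz, rfl⟩ h
  have h1 := image_openSegment ℝ f.toRealAffineIsometryEquiv.toAffineEquiv.toAffineMap y z
  have h2 : f '' openSegment ℝ y z = openSegment ℝ (f y) (f z) := h1
  rw [← h2] at h
  obtain ⟨w, hw, hwx⟩ := h
  rw [f.injective hwx] at hw
  rw [hx.2 y hy z hz hw]

theorem sq_dist_plane (x y : EuclideanSpace ℝ (Fin 2)) :
    dist x y ^ 2 = (x 0 - y 0) ^ 2 + (x 1 - y 1) ^ 2 := by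
  rw [EuclideanSpace.dist_eq, Real.sq_sqrt (by positivity), Fin.sum_univ_two, Real.dist_eq,
    Real.dist_eq, sq_abs, sq_abs]

/-- Normal forms of triangles up to similarity. -/
def shapeRegion : Set (ℝ × ℝ) := {p | 1 / 2 ≤ p.1 ∧ 0 < p.2 ∧ p.1 ^ 2 + p.2 ^ 2 ≤ 1}

theorem eq_of_isometric {c d c' d' r : ℝ} (hp : (c, d) ∈ shapeRegion) (hp' : (c', d') ∈ shapeRegion)
    (hr : 0 < r) (f : EuclideanSpace ℝ (Fin 2) ≃ᵢ EuclideanSpace ℝ (Fin 2))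
    (hf : f '' interior (convexHull ℝ
      ({0, !₂[1, 0], !₂[1 * c, 1 * d]} : Set (EuclideanSpace ℝ (Fin 2)))) =
      interior (convexHull ℝ {0, !₂[r, 0], !₂[r * c', r * d']})) : c = c' ∧ d = d' := by
  obtain ⟨h1, h2, h3⟩ := hp
  obtain ⟨h1', h2', h3'⟩ := hp'
  simp only at h1 h2 h3 h1' h2' h3'
  have h : (1 : ℝ) * (1 * d) - (1 * c) * 0 ≠ 0 := by simpa using h2.ne'
  have h' : r * (r * d') - (r * c') * 0 ≠ 0 := by
    have : 0 < r * (r * d') := by positivity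
    simpa using this.ne'
  have hull : f '' (convexHull ℝ
      ({0, !₂[1, 0], !₂[1 * c, 1 * d]} : Set (EuclideanSpace ℝ (Fin 2)))) =
      convexHull ℝ {0, !₂[r, 0], !₂[r * c', r * d']} := by
    rw [← triangle_closure_interior h, ← triangle_closure_interior h', ← hf]
    exact f.toHomeomorph.image_closure _
  have hv : ∀ x ∈ ({0, !₂[1, 0], !₂[1 * c, 1 * d]} : Set (EuclideanSpace ℝ (Fin 2))),
      f x ∈ ({0, !₂[r, 0], !₂[r * c', r * d']} : Set (EuclideanSpace ℝ (Fin 2))) := by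
    intro x hx
    rw [← extremePoints_triangle h] at hx
    rw [← extremePoints_triangle h', ← hull]
    exact mem_extremePoints_image f hx
  have v1 := hv 0 (by simp)
  have v2 := hv !₂[1, 0] (by simp)
  have v3 := hv !₂[1 * c, 1 * d] (by simp)
  have e12 := congrArg (· ^ 2) (f.dist_eq 0 !₂[1, 0])
  have e13 := congrArg (· ^ 2) (f.dist_eq 0 !₂[1 * c, 1 * d])
  have e23 := congrArg (· ^ 2) (f.dist_eq !₂[1, 0] !₂[1 * c, 1 * d])
  generalize f 0 = y1 at *
  generalize f !₂[1, 0] = y2 at *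
  generalize f !₂[1 * c, 1 * d] = y3 at *
  have R0 : 0 < r ^ 2 := by positivity
  have R1 : r ^ 2 * (c' ^ 2 + d' ^ 2) ≤ r ^ 2 * 1 := by gcongr
  have R2 : 0 ≤ r ^ 2 * (2 * c' - 1) := mul_nonneg R0.le (by linarith)
  have R3 : 0 < r ^ 2 * ((1 - c') ^ 2 + d' ^ 2) := by positivity
  have R4 : 0 < (1 - c) ^ 2 + d ^ 2 := by positivity
  have main : r ^ 2 = 1 ∧ r ^ 2 * (c' ^ 2 + d' ^ 2) = c ^ 2 + d ^ 2 ∧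
      r ^ 2 * ((1 - c') ^ 2 + d' ^ 2) = (1 - c) ^ 2 + d ^ 2 := by
    rcases v1 with rfl | rfl | rfl <;> rcases v2 with rfl | rfl | rfl <;>
      rcases v3 with rfl | rfl | rfl <;> simp only [sq_dist_plane] at e12 e13 e23 <;>
      simp [-sq_eq_one_iff] at e12 e13 e23 <;> first
      | (exfalso; linarith)
      | (refine ⟨?_, ?_, ?_⟩ <;> linarith)
  obtain ⟨m1, m2, m3⟩ := main
  rw [m1] at m2 m3
  have hc : c = c' := by linarith
  subst hc
  exact ⟨rfl, by nlinarith⟩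

section SineGap

theorem deriv_eq_zero_of_eq_zero_outside {f f' : ℝ → ℝ} {α β : ℝ}
    (hf : ∀ x, HasDerivAt f (f' x) x)
    (h0 : ∀ x, x ∉ Set.Ioo α β → f x = 0) {x : ℝ} (hx : x ∉ Set.Ioo α β) : f' x = 0 := by
  rcases le_or_gt x α with h | h
  · refine (uniqueDiffWithinAt_Iic x).eq_deriv _ (hf x).hasDerivWithinAt ?_
    refine (hasDerivWithinAt_const x (Set.Iic x) (0 : ℝ)).congr (fun y hy => h0 y ?_) (h0 x hx)
    intro hy'
    exact absurd hy'.1 (not_lt.2 (le_trans hy h))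
  · have h' : β ≤ x := by
      by_contra hh
      exact hx ⟨h, not_le.1 hh⟩
    refine (uniqueDiffWithinAt_Ici x).eq_deriv _ (hf x).hasDerivWithinAt ?_
    refine (hasDerivWithinAt_const x (Set.Ici x) (0 : ℝ)).congr (fun y hy => h0 y ?_) (h0 x hx)
    intro hy'
    exact absurd hy'.2 (not_lt.2 (le_trans h' hy))

variable {f f' : ℝ → ℝ}

theorem integral_eq_of_eq_zero_outside {g : ℝ → ℝ} {α β γ δ : ℝ}
    (h0 : ∀ x, x ∉ Set.Ioo α β → g x = 0) (h1 : γ ≤ α) (h2 : β ≤ δ) :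
    ∫ x in γ..δ, g x = ∫ x, g x := by
  apply intervalIntegral.integral_eq_integral_of_support_subset
  intro x hx
  by_contra h
  refine hx (h0 x fun h' => h ⟨h1.trans_lt h'.1, (h'.2.le.trans h2)⟩)

theorem fourierCoeffOn_odd (hc : Continuous f) (h0 : ∀ x, x ∉ Set.Ioo 0 π → f x = 0) (n : ℤ) :
    ‖fourierCoeffOn (neg_lt_self pi_pos) (fun x => ((f x - f (-x) : ℝ) : ℂ)) n‖ ^ 2 =
      (1 / π ^ 2) * (∫ x, f x * sin (n * x)) ^ 2 := by
  have hpi := pi_pos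
  have key : fourierCoeffOn (neg_lt_self pi_pos) (fun x => ((f x - f (-x) : ℝ) : ℂ)) n =
      -(Complex.I / π) * ((∫ x, f x * sin (n * x) : ℝ) : ℂ) := by
    rw [fourierCoeffOn_eq_integral]
    simp_rw [fourier_coe_apply]
    set e : ℝ → ℂ := fun x => Complex.exp (2 * π * Complex.I * (-n : ℤ) * x / ((π - -π : ℝ) : ℂ))
      with he
    have hee : ∀ x, e x = Complex.exp (-(n * x : ℝ) * Complex.I) := by
      intro x
      rw [he]
      have : (π : ℂ) ≠ 0 := by exact_mod_cast hpi.ne'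
      push_cast
      field_simp
      ring_nf
    have hec : Continuous e := by rw [he]; fun_prop
    have e1 : ∫ x in (-π)..π, e x • ((f x - f (-x) : ℝ) : ℂ) =
        (∫ x in (-π)..π, e x * (f x : ℂ)) - ∫ x in (-π)..π, e x * (f (-x) : ℂ) := by
      rw [← intervalIntegral.integral_sub]
      · congr 1; ext x; push_cast; rw [smul_eq_mul, mul_sub]
      · exact Continuous.intervalIntegrable (by fun_prop) _ _
      · exact Continuous.intervalIntegrable (by fun_prop) _ _
    have e2 : ∫ x in (-π)..π, e x * (f (-x) : ℂ) = ∫ x in (-π)..π, e (-x) * (f x : ℂ) := by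
      have := intervalIntegral.integral_comp_neg (a := -π) (b := π) (fun x => e (-x) * (f x : ℂ))
      simpa using this
    rw [e1, e2, ← intervalIntegral.integral_sub
      (Continuous.intervalIntegrable (by fun_prop) _ _)
      (Continuous.intervalIntegrable (by fun_prop) _ _),
      ← integral_eq_of_eq_zero_outside (γ := -π) (δ := π) (α := 0) (β := π)
        (fun x hx => by rw [h0 x hx, zero_mul]) (by linarith) le_rfl,
      ← intervalIntegral.integral_ofReal]
    rw [Complex.real_smul, ← intervalIntegral.integral_const_mul, ← intervalIntegral.integral_const_mul]
    congr 1
    ext x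
    rw [hee, hee]
    have := Complex.two_sin (n * x : ℝ)
    push_cast at this ⊢
    have h2 : Complex.sin (n * x) = (Complex.exp (-(n * x) * Complex.I) - Complex.exp ((n * x) * Complex.I))
        * Complex.I / 2 := by
      rw [Complex.sin]
    rw [h2]
    have hp : (π : ℂ) ≠ 0 := by exact_mod_cast hpi.ne'
    field_simp
    ring_nf
    rw [Complex.I_sq]
    ring
  rw [key, norm_mul, mul_pow, norm_neg, norm_div, Complex.norm_I, Complex.norm_real, Complex.norm_real,
    div_pow, norm_eq_abs, norm_eq_abs, sq_abs, sq_abs, one_pow]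

theorem hasSum_sq_fourierCoeffOn_symm (hc : Continuous f) (h0 : ∀ x, x ∉ Set.Ioo 0 π → f x = 0)
    {ε : ℝ} (hε : ε ^ 2 = 1) :
    HasSum (fun n : ℤ => ‖fourierCoeffOn (neg_lt_self pi_pos)
      (fun x => ((f x + ε * f (-x) : ℝ) : ℂ)) n‖ ^ 2) ((1 / π) * ∫ x, f x ^ 2) := by
  have hpi := pi_pos
  have hF : Continuous fun x => ((f x + ε * f (-x) : ℝ) : ℂ) := by fun_prop
  have hz : ∀ x, x ∉ Set.Icc (-π) π → ((f x + ε * f (-x) : ℝ) : ℂ) = 0 := by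
    intro x hx
    rw [h0 x fun h => hx ⟨by linarith [h.1], h.2.le⟩,
      h0 (-x) fun h => hx ⟨by linarith [h.2], by linarith [h.1]⟩]
    simp
  have h := hasSum_sq_fourierCoeffOn (neg_lt_self pi_pos) (f := fun x => ((f x + ε * f (-x) : ℝ) : ℂ))
    ((hF.memLp_of_hasCompactSupport (HasCompactSupport.intro isCompact_Icc hz)).restrict _)
  convert h using 1
  have e1 : ∀ x, ‖((f x + ε * f (-x) : ℝ) : ℂ)‖ ^ 2 = f x ^ 2 + f (-x) ^ 2 := by
    intro x
    rw [Complex.norm_real, norm_eq_abs, sq_abs]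
    have : f x * f (-x) = 0 := by
      rcases le_or_gt x 0 with hx | hx
      · rw [h0 x fun h => absurd h.1 (not_lt.2 hx), zero_mul]
      · rw [h0 (-x) fun h => absurd h.1 (by linarith), mul_zero]
    linear_combination 2 * ε * this + f (-x) ^ 2 * hε
  have hsq : ∀ x, x ∉ Set.Ioo 0 π → f x ^ 2 = 0 := fun x hx => by rw [h0 x hx]; norm_num
  have e2 := intervalIntegral.integral_comp_neg (a := -π) (b := π) (fun x => f x ^ 2)
  simp only [neg_neg] at e2
  simp_rw [e1]
  rw [intervalIntegral.integral_add (Continuous.intervalIntegrable (by fun_prop) _ _)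
      (Continuous.intervalIntegrable (by fun_prop) _ _), e2,
      integral_eq_of_eq_zero_outside hsq (by linarith) le_rfl, smul_eq_mul]
  field_simp
  ring

/-- Wirtinger's inequality with the lowest modes split off. -/
theorem sine_gap (hf : ∀ x, HasDerivAt f (f' x) x) (hc : Continuous f')
    (h0 : ∀ x, x ∉ Set.Ioo 0 π → f x = 0) (M : ℕ) :
    (M : ℝ) ^ 2 * ∫ x, f x ^ 2 ≤ (∫ x, f' x ^ 2) +
      ∑ a ∈ Finset.range M, ((M : ℝ) ^ 2 - (a : ℝ) ^ 2) * (2 / π) * (∫ x, f x * sin (a * x)) ^ 2 := by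
  have hpi := pi_pos
  have hfc : Continuous f := continuous_iff_continuousAt.2 fun x => (hf x).continuousAt
  have h0' : ∀ x, x ∉ Set.Ioo 0 π → f' x = 0 := fun x hx =>
    deriv_eq_zero_of_eq_zero_outside hf h0 hx
  set F : ℝ → ℂ := fun x => ((f x + -1 * f (-x) : ℝ) : ℂ) with hF
  set F' : ℝ → ℂ := fun x => ((f' x + 1 * f' (-x) : ℝ) : ℂ) with hF'
  have hd : ∀ x, HasDerivAt F (F' x) x := by
    intro x
    have h1 : HasDerivAt (fun x => f (-x)) (f' (-x) * -1) x :=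
      (hf (-x)).comp x (hasDerivAt_neg x)
    have h2 := ((hf x).add (h1.const_mul (-1))).ofReal_comp
    have e : F' x = ((f' x + -1 * (f' (-x) * -1) : ℝ) : ℂ) := by simp [hF']
    rw [e]
    exact h2
  have hF'c : Continuous F' := by rw [hF']; fun_prop
  have s1 := hasSum_sq_fourierCoeffOn_symm hfc h0 (ε := -1) (by norm_num)
  have s2 := hasSum_sq_fourierCoeffOn_symm hc h0' (ε := 1) (by norm_num)
  have hFpi : F π = 0 ∧ F (-π) = 0 := by
    constructor <;> simp [hF, h0 π (by simp), h0 (-π) (by intro h; linarith [h.1])]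
  have hcoef : ∀ n : ℤ, ‖fourierCoeffOn (neg_lt_self pi_pos) F' n‖ ^ 2 =
      (n : ℝ) ^ 2 * ‖fourierCoeffOn (neg_lt_self pi_pos) F n‖ ^ 2 := by
    intro n
    rcases eq_or_ne n 0 with rfl | hn
    · rw [fourierCoeffOn_eq_integral]
      have := intervalIntegral.integral_eq_sub_of_hasDerivAt (a := -π) (b := π) (fun x _ => hd x)
        (hF'c.intervalIntegrable _ _)
      simp [this, hFpi]
    · have hn' : (n : ℂ) ≠ 0 := by exact_mod_cast hn
      have hp : (π : ℂ) ≠ 0 := by exact_mod_cast hpi.ne'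
      have e1 : fourierCoeffOn (neg_lt_self pi_pos) F' n =
          Complex.I * n * fourierCoeffOn (neg_lt_self pi_pos) F n := by
        rw [fourierCoeffOn_of_hasDerivAt (neg_lt_self pi_pos) hn (fun x _ => hd x)
          (hF'c.intervalIntegrable _ _), hFpi.1, hFpi.2]
        generalize fourierCoeffOn (neg_lt_self pi_pos) F' n = X
        push_cast
        field_simp
        ring
      rw [e1, norm_mul, norm_mul, Complex.norm_I, Complex.norm_intCast, one_mul, mul_pow, sq_abs]
  have s3 := (s2.sub (s1.mul_left ((M : ℝ) ^ 2))).nat_add_neg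
  have hodd : ∀ n : ℤ, ‖fourierCoeffOn (neg_lt_self pi_pos) F n‖ ^ 2 =
      (1 / π ^ 2) * (∫ x, f x * sin (n * x)) ^ 2 := by
    intro n
    rw [← fourierCoeffOn_odd hfc h0 n]
    congr 3
    ext x
    simp [hF, sub_eq_add_neg]
  have hev : ∀ n : ℕ, (∫ x, f x * sin (((-(n : ℤ) : ℤ) : ℝ) * x)) ^ 2 =
      (∫ x, f x * sin (n * x)) ^ 2 := by
    intro n
    rw [← neg_sq, ← integral_neg]
    congr 2
    ext x
    push_cast
    rw [neg_mul, sin_neg]; ring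
  have s4 := sum_le_hasSum (Finset.range M) (fun n hn => ?_) s3
  · have hz : (∫ x, f x * sin (((0 : ℤ) : ℝ) * x)) = 0 := by simp
    have e : ∀ n ∈ Finset.range M, -((π ^ 2)⁻¹ * π * (((M : ℝ) ^ 2 - (n : ℝ) ^ 2) * (2 / π) * (∫ x, f x * sin (n * x)) ^ 2)) =
        ‖fourierCoeffOn (neg_lt_self pi_pos) F' n‖ ^ 2 - (M : ℝ) ^ 2 * ‖fourierCoeffOn (neg_lt_self pi_pos) F n‖ ^ 2 +
        (‖fourierCoeffOn (neg_lt_self pi_pos) F' (-n)‖ ^ 2 - (M : ℝ) ^ 2 * ‖fourierCoeffOn (neg_lt_self pi_pos) F (-n)‖ ^ 2) := by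
      intro n hn
      rw [hcoef, hcoef, hodd, hodd, hev]
      push_cast
      field_simp
      ring
    rw [← Finset.sum_congr rfl e, Finset.sum_neg_distrib, ← Finset.mul_sum, hcoef, hodd, hz] at s4
    have hpp : (0 : ℝ) < π⁻¹ := by positivity
    have e2 : (π ^ 2)⁻¹ * π = π⁻¹ := by field_simp
    rw [e2] at s4
    refine le_of_mul_le_mul_left ?_ hpp
    simp only [one_div] at s4
    norm_num at s4
    linarith
  · have hMn : (M : ℝ) ≤ n := by
      have : M ≤ n := by simpa using hn
      exact_mod_cast this
    rw [hcoef, hcoef, hodd, hodd, hev]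
    push_cast
    have : (M : ℝ) ^ 2 ≤ (n : ℝ) ^ 2 := by gcongr
    have h3 : 0 ≤ 1 / π ^ 2 * (∫ x, f x * sin (n * x)) ^ 2 := by positivity
    nlinarith

/-- Wirtinger's inequality on `(0, ℓ)` with the ground state split off. -/
theorem slice_gap {ℓ : ℝ} (hℓ : 0 < ℓ) (hf : ∀ x, HasDerivAt f (f' x) x) (hc : Continuous f')
    (h0 : ∀ x, x ∉ Set.Ioo 0 ℓ → f x = 0) :
    (π / ℓ) ^ 2 * (4 * (∫ x, f x ^ 2) - 3 * ((2 / ℓ) * (∫ x, f x * sin (π / ℓ * x)) ^ 2)) ≤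
      ∫ x, f' x ^ 2 ∧ (π / ℓ) ^ 2 * (∫ x, f x ^ 2) ≤ ∫ x, f' x ^ 2 := by
  have hpi := pi_pos
  set g : ℝ → ℝ := fun t => f (ℓ / π * t) with hg
  set g' : ℝ → ℝ := fun t => ℓ / π * f' (ℓ / π * t) with hg'
  have hgd : ∀ t, HasDerivAt g (g' t) t := by
    intro t
    have := (hf (ℓ / π * t)).comp t ((hasDerivAt_id t).const_mul (ℓ / π))
    exact this.congr_deriv (by simp [hg', mul_comm])
  have hgc : Continuous g' := by rw [hg']; fun_prop
  have hg0 : ∀ t, t ∉ Set.Ioo 0 π → g t = 0 := by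
    intro t ht
    refine h0 _ fun h => ht ⟨?_, ?_⟩
    · have := h.1
      exact (pos_iff_pos_of_mul_pos this).1 (by positivity)
    · have := h.2
      rw [div_mul_eq_mul_div, div_lt_iff₀ hpi] at this
      exact lt_of_mul_lt_mul_left this hℓ.le
  have hscale : ∀ G : ℝ → ℝ, ∫ t, G (ℓ / π * t) = π / ℓ * ∫ x, G x := by
    intro G
    rw [Measure.integral_comp_mul_left G (ℓ / π), inv_div, abs_of_pos (by positivity), smul_eq_mul]
  have e1 : ∫ t, g t ^ 2 = π / ℓ * ∫ x, f x ^ 2 := hscale fun x => f x ^ 2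
  have e2 : ∫ t, g' t ^ 2 = ℓ / π * ∫ x, f' x ^ 2 := by
    have := hscale fun x => (ℓ / π) ^ 2 * f' x ^ 2
    simp only [hg', mul_pow]
    rw [this, integral_const_mul]
    field_simp
  have e3 : ∫ t, g t * sin t = π / ℓ * ∫ x, f x * sin (π / ℓ * x) := by
    rw [← hscale fun x => f x * sin (π / ℓ * x)]
    congr 1
    ext t
    have : π / ℓ * (ℓ / π * t) = t := by field_simp
    rw [this]
  have h2 := sine_gap hgd hgc hg0 2
  have h1 := sine_gap hgd hgc hg0 1
  simp only [Finset.sum_range_succ, Finset.sum_range_zero] at h1 h2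
  norm_num at h1 h2
  rw [e1, e2] at h1 h2
  rw [e3] at h2
  have hp : 0 < π / ℓ := by positivity
  have hlp : ℓ / π = (π / ℓ)⁻¹ := by rw [inv_div]
  constructor
  · have := mul_le_mul_of_nonneg_left h2 hp.le
    rw [hlp, mul_add, mul_inv_cancel_left₀ hp.ne'] at this
    have e : π / ℓ * (3 * (2 / π) * (π / ℓ * ∫ x, f x * sin (π / ℓ * x)) ^ 2) =
      (π / ℓ) ^ 2 * (3 * ((2 / ℓ) * (∫ x, f x * sin (π / ℓ * x)) ^ 2)) := by
        field_simp
    rw [e] at this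
    linarith
  · have := mul_le_mul_of_nonneg_left h1 hp.le
    rw [hlp, mul_inv_cancel_left₀ hp.ne'] at this
    linarith

end SineGap

/-- The Riccati form of Barta's inequality on an interval. -/
theorem barta {φ φ' f f₁ f₂ V : ℝ → ℝ} {α β c : ℝ} (hαβ : α ≤ β)
    (hφ : ∀ x, HasDerivAt φ (φ' x) x) (hφ' : Continuous φ') (hV : Continuous V)
    (hf : ∀ x, HasDerivAt f (f₁ x) x) (hf₁ : ∀ x, HasDerivAt f₁ (f₂ x) x)
    (hf₂ : Continuous f₂) (hpos : ∀ x ∈ Set.Icc α β, 0 < f x)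
    (hsup : ∀ x ∈ Set.Icc α β, f₂ x ≤ (V x - c) * f x) :
    c * (∫ x in α..β, φ x ^ 2) + (f₁ β / f β * φ β ^ 2 - f₁ α / f α * φ α ^ 2) ≤
      ∫ x in α..β, (φ' x ^ 2 + V x * φ x ^ 2) := by
  have hφc : Continuous φ := continuous_iff_continuousAt.2 fun x => (hφ x).continuousAt
  have hfc : Continuous f := continuous_iff_continuousAt.2 fun x => (hf x).continuousAt
  have hf₁c : Continuous f₁ := continuous_iff_continuousAt.2 fun x => (hf₁ x).continuousAt
  set D : ℝ → ℝ := fun x => (f₂ x * f x - f₁ x * f₁ x) / f x ^ 2 * φ x ^ 2 +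
    f₁ x / f x * (2 * φ x * φ' x) with hD
  have hDd : ∀ x ∈ Set.uIcc α β, HasDerivAt (fun x => f₁ x / f x * φ x ^ 2) (D x) x := by
    intro x hx
    rw [Set.uIcc_of_le hαβ] at hx
    have h1 := ((hf₁ x).div (hf x) (hpos x hx).ne').mul ((hφ x).pow 2)
    exact h1.congr_deriv (by simp [hD])
  have hDc : ContinuousOn D (Set.uIcc α β) := by
    rw [Set.uIcc_of_le hαβ]
    have h1 : ∀ x ∈ Set.Icc α β, f x ≠ 0 := fun x hx => (hpos x hx).ne'
    have h2 : ∀ x ∈ Set.Icc α β, f x ^ 2 ≠ 0 := fun x hx => pow_ne_zero 2 (h1 x hx)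
    rw [hD]
    fun_prop (disch := assumption)
  rw [← intervalIntegral.integral_eq_sub_of_hasDerivAt hDd hDc.intervalIntegrable,
    ← intervalIntegral.integral_const_mul, ← intervalIntegral.integral_add
      (Continuous.intervalIntegrable (by fun_prop) _ _) hDc.intervalIntegrable]
  refine intervalIntegral.integral_mono_on hαβ ?_ (Continuous.intervalIntegrable (by fun_prop) _ _) ?_
  · exact (Continuous.intervalIntegrable (by fun_prop) _ _).add hDc.intervalIntegrable
  · intro x hx
    have hp := hpos x hx
    have h1 : f₂ x / f x ≤ V x - c := by
      rw [div_le_iff₀ hp]; exact hsup x hx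
    have h2 : D x = f₂ x / f x * φ x ^ 2 - (f₁ x / f x * φ x - φ' x) ^ 2 + φ' x ^ 2 := by
      simp only [hD]; field_simp; ring
    rw [h2]
    nlinarith [mul_le_mul_of_nonneg_right h1 (sq_nonneg (φ x)), sq_nonneg (f₁ x / f x * φ x - φ' x)]

section Cutoff

/-- A smooth step vanishing on `(-∞, 1]` and equal to one on `[2, ∞)`. -/
noncomputable def step (x : ℝ) : ℝ := Real.smoothTransition (x - 1)

theorem contDiff_step : ContDiff ℝ (⊤ : ℕ∞) step :=
  Real.smoothTransition.contDiff.comp (contDiff_id.sub contDiff_const)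

theorem step_of_le {x : ℝ} (hx : x ≤ 1) : step x = 0 :=
  Real.smoothTransition.zero_of_nonpos (by linarith)

theorem step_of_ge {x : ℝ} (hx : 2 ≤ x) : step x = 1 :=
  Real.smoothTransition.one_of_one_le (by linarith)

theorem abs_step_le (x : ℝ) : |step x| ≤ 1 := by
  rw [step, abs_of_nonneg (Real.smoothTransition.nonneg _)]
  exact Real.smoothTransition.le_one _

theorem exists_deriv_step_bound : ∃ C, 0 ≤ C ∧ ∀ x, |deriv step x| * |x| ≤ C := by
  have hc : Continuous fun x => deriv step x * x :=
    (contDiff_step.continuous_deriv (by simp)).mul continuous_id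
  obtain ⟨C, hC⟩ := isCompact_Icc.exists_bound_of_continuousOn (s := Set.Icc (0 : ℝ) 3) hc.continuousOn
  refine ⟨max C 0, le_max_right _ _, fun x => ?_⟩
  by_cases hx : x ∈ Set.Icc (0 : ℝ) 3
  · rw [← abs_mul]
    exact (hC x hx).trans (le_max_left _ _)
  · have : deriv step x = 0 := by
      rw [Set.mem_Icc, not_and_or, not_le, not_le] at hx
      rcases hx with hx | hx
      · have : step =ᶠ[nhds x] fun _ => 0 := by
          filter_upwards [Iio_mem_nhds hx] with y hy
          exact step_of_le (by linarith [Set.mem_Iio.1 hy])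
        rw [this.deriv_eq, deriv_const]
      · have : step =ᶠ[nhds x] fun _ => 1 := by
          filter_upwards [Ioi_mem_nhds hx] with y hy
          exact step_of_ge (by linarith [Set.mem_Ioi.1 hy])
        rw [this.deriv_eq, deriv_const]
    rw [this]; simp

/-- Approximation of a function vanishing on the boundary by compactly supported functions with
uniformly bounded derivatives. -/
theorem exists_cutoff {E : Type*} [NormedAddCommGroup E] [NormedSpace ℝ E] [FiniteDimensional ℝ E]
    {Ω : Set E} (hΩ : IsOpen Ω) (hb : Bornology.IsBounded Ω) {f D : E → ℝ}
    (hf : ContDiff ℝ (⊤ : ℕ∞) f) (hD : ContDiff ℝ (⊤ : ℕ∞) D) (hpos : ∀ x ∈ Ω, 0 < D x)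
    (hfr : ∀ x ∈ frontier Ω, D x = 0) {C : ℝ}
    (hfD : ∀ x ∈ Ω, |f x| * ‖fderiv ℝ D x‖ ≤ C * D x) :
    ∃ F : ℕ → E → ℝ, (∀ n, ContDiff ℝ (⊤ : ℕ∞) (F n) ∧ HasCompactSupport (F n) ∧ tsupport (F n) ⊆ Ω) ∧
      (∀ x ∈ Ω, ∀ᶠ n in Filter.atTop, F n x = f x ∧ fderiv ℝ (F n) x = fderiv ℝ f x) ∧
      (∃ B, ∀ n x, |F n x| ≤ B ∧ ‖fderiv ℝ (F n) x‖ ≤ B) ∧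
      (∀ n x, x ∉ Ω → F n x = 0 ∧ fderiv ℝ (F n) x = 0) := by
  classical
  set F : ℕ → E → ℝ := fun n x => if x ∈ Ω then step ((n + 1) * D x) * f x else 0 with hF
  have hloc : ∀ n, ∀ x ∈ Ω, F n =ᶠ[nhds x] fun y => step ((n + 1) * D y) * f y := by
    intro n x hx
    filter_upwards [hΩ.mem_nhds hx] with y hy
    simp [hF, hy]
  have hsm : ∀ n : ℕ, ContDiff ℝ (⊤ : ℕ∞) fun y => step ((n + 1) * D y) * f y := fun n =>
    (contDiff_step.comp (contDiff_const.mul hD)).mul hf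
  have hout : ∀ n, ∀ x ∉ Ω, F n =ᶠ[nhds x] fun _ => 0 := by
    intro n x hx
    by_cases hcl : x ∈ closure Ω
    · have hD0 : D x = 0 := hfr x (by rw [frontier, hΩ.interior_eq]; exact ⟨hcl, hx⟩)
      have : ∀ᶠ y in nhds x, ((n : ℝ) + 1) * D y < 1 := by
        have hcont : Continuous fun y => ((n : ℝ) + 1) * D y := continuous_const.mul hD.continuous
        refine hcont.continuousAt.eventually_lt_const ?_
        simp [hD0]
      filter_upwards [this] with y hy
      simp only [hF]
      split_ifs
      · rw [step_of_le hy.le, zero_mul]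
      · rfl
    · have : ∀ᶠ y in nhds x, y ∉ closure Ω := isClosed_closure.isOpen_compl.mem_nhds hcl
      filter_upwards [this] with y hy
      have : y ∉ Ω := fun h => hy (subset_closure h)
      simp [hF, this]
  have hcd : ∀ n, ContDiff ℝ (⊤ : ℕ∞) (F n) := by
    intro n
    rw [contDiff_iff_contDiffAt]
    intro x
    by_cases hx : x ∈ Ω
    · exact (hsm n).contDiffAt.congr_of_eventuallyEq (hloc n x hx)
    · exact contDiffAt_const.congr_of_eventuallyEq (hout n x hx)
  have hts : ∀ n, tsupport (F n) ⊆ Ω := by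
    intro n x hx
    by_contra h
    exact (notMem_tsupport_iff_eventuallyEq.2 (hout n x h)) hx
  have hcl : IsCompact (closure Ω) := hb.isCompact_closure
  obtain ⟨B₁, hB₁⟩ := hcl.exists_bound_of_continuousOn hf.continuous.continuousOn
  obtain ⟨B₂, hB₂⟩ := hcl.exists_bound_of_continuousOn (hf.continuous_fderiv (by simp)).continuousOn
  obtain ⟨S, hS0, hS⟩ := exists_deriv_step_bound
  have hz : ∀ n x, x ∉ Ω → F n x = 0 ∧ fderiv ℝ (F n) x = 0 := by
    intro n x hx
    refine ⟨by simp [hF, hx], ?_⟩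
    rw [(hout n x hx).fderiv_eq]; simp
  refine ⟨F, fun n => ⟨hcd n, ?_, hts n⟩, ?_, ⟨max 0 (max B₁ (B₂ + S * C)), ?_⟩, hz⟩
  · exact hcl.of_isClosed_subset (isClosed_tsupport _) ((hts n).trans subset_closure)
  · intro x hx
    have hev : ∀ᶠ n : ℕ in Filter.atTop, 2 < ((n : ℝ) + 1) * D x :=
      ((tendsto_natCast_atTop_atTop.atTop_add tendsto_const_nhds).atTop_mul_const
        (hpos x hx)).eventually_gt_atTop 2
    filter_upwards [hev] with n hn
    have hcont : Continuous fun y => ((n : ℝ) + 1) * D y := continuous_const.mul hD.continuous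
    have : F n =ᶠ[nhds x] f := by
      filter_upwards [hloc n x hx, hcont.continuousAt.eventually_const_lt hn] with y hy hy2
      rw [hy, step_of_ge hy2.le, one_mul]
    exact ⟨this.eq_of_nhds, this.fderiv_eq⟩
  · intro n x
    by_cases hx : x ∈ Ω
    · have hxc := subset_closure hx
      constructor
      · refine le_trans ?_ ((le_max_left _ _).trans (le_max_right _ _))
        simp only [hF, hx, if_true, abs_mul]
        exact (mul_le_of_le_one_left (abs_nonneg _) (abs_step_le _)).trans (hB₁ x hxc)
      · refine le_trans ?_ ((le_max_right _ _).trans (le_max_right _ _))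
        rw [(hloc n x hx).fderiv_eq]
        have hd1 : HasFDerivAt (fun y => step (((n : ℝ) + 1) * D y))
            (deriv step (((n : ℝ) + 1) * D x) • (((n : ℝ) + 1) • fderiv ℝ D x)) x := by
          have h1 := (contDiff_step.differentiable (by simp) (((n : ℝ) + 1) * D x)).hasDerivAt
          have h2 : HasFDerivAt (fun y => ((n : ℝ) + 1) * D y) (((n : ℝ) + 1) • fderiv ℝ D x) x :=
            (hD.differentiable (by simp) x).hasFDerivAt.const_mul _
          exact HasDerivAt.comp_hasFDerivAt (h₂ := step) x h1 h2
        have hd2 := (hd1.mul (hf.differentiable (by simp) x).hasFDerivAt).fderiv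
        change ‖fderiv ℝ ((fun y => step (((n : ℝ) + 1) * D y)) * f) x‖ ≤ _
        rw [hd2]
        refine (norm_add_le _ _).trans (add_le_add ?_ ?_)
        · rw [norm_smul]
          exact (mul_le_of_le_one_left (norm_nonneg _) (abs_step_le _)).trans (hB₂ x hxc)
        · rw [norm_smul, norm_smul, norm_smul, norm_eq_abs, norm_eq_abs, norm_eq_abs]
          have hDx := hpos x hx
          have h1 := hS (((n : ℝ) + 1) * D x)
          rw [abs_mul, abs_of_pos hDx] at h1
          have h2 := hfD x hx
          have hC : 0 ≤ C := by
            by_contra hneg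
            have := mul_nonneg (abs_nonneg (f x)) (norm_nonneg (fderiv ℝ D x))
            nlinarith
          calc |f x| * (|deriv step (((n : ℝ) + 1) * D x)| * (|(n : ℝ) + 1| * ‖fderiv ℝ D x‖))
              = |deriv step (((n : ℝ) + 1) * D x)| * |(n : ℝ) + 1| * (|f x| * ‖fderiv ℝ D x‖) := by ring
            _ ≤ |deriv step (((n : ℝ) + 1) * D x)| * |(n : ℝ) + 1| * (C * D x) := by gcongr
            _ = (|deriv step (((n : ℝ) + 1) * D x)| * (|(n : ℝ) + 1| * D x)) * C := by ring
            _ ≤ S * C := by gcongr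
    · simp [hz n x hx]

theorem tendsto_integral_cutoff {E : Type*} [MeasurableSpace E] {μ : Measure E} {Ω : Set E}
    (hΩ : MeasurableSet Ω) (hfin : μ Ω ≠ ⊤) {P : ℕ → E → ℝ} {p : E → ℝ}
    (hm : ∀ n, AEStronglyMeasurable (P n) μ) {B : ℝ} (hB : ∀ n x, x ∈ Ω → |P n x| ≤ B)
    (hz : ∀ n x, x ∉ Ω → P n x = 0)
    (hev : ∀ x ∈ Ω, ∀ᶠ n in Filter.atTop, P n x = p x) :
    Filter.Tendsto (fun n => ∫ x, P n x ∂μ) Filter.atTop (nhds (∫ x in Ω, p x ∂μ)) := by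
  rw [← integral_indicator hΩ]
  refine tendsto_integral_of_dominated_convergence (Ω.indicator fun _ => B) hm ?_ ?_ ?_
  · exact (integrable_indicator_iff hΩ).2 (integrableOn_const hfin)
  · intro n
    refine Filter.Eventually.of_forall fun x => ?_
    by_cases hx : x ∈ Ω
    · simpa [hx] using hB n x hx
    · simp [hx, hz n x hx]
  · refine Filter.Eventually.of_forall fun x => ?_
    by_cases hx : x ∈ Ω
    · simp only [hx, Set.indicator_of_mem]
      exact tendsto_const_nhds.congr' ((hev x hx).mono fun n hn => hn.symm)
    · simp [hx, hz _ x hx]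

theorem exists_bump_lt {f V : ℝ → ℝ} {α β U : ℝ} (hαβ : α < β) (hf : ContDiff ℝ (⊤ : ℕ∞) f)
    (hα : f α = 0) (hβ : f β = 0) (hV : Continuous V)
    (h : ∫ x in α..β, (deriv f x ^ 2 + V x * f x ^ 2) < U * ∫ x in α..β, f x ^ 2) :
    ∃ g : ℝ → ℝ, ContDiff ℝ (⊤ : ℕ∞) g ∧ HasCompactSupport g ∧ tsupport g ⊆ Set.Ioo α β ∧
      ∫ x, (deriv g x ^ 2 + V x * g x ^ 2) < U * ∫ x, g x ^ 2 := by
  set D : ℝ → ℝ := fun t => (t - α) * (β - t) with hD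
  have hDs : ContDiff ℝ (⊤ : ℕ∞) D := by rw [hD]; fun_prop
  have hDd : ∀ t, deriv D t = (β - t) - (t - α) := by
    intro t
    have := ((hasDerivAt_id t).sub_const α).mul ((hasDerivAt_id t).const_sub β)
    rw [show D = (fun t => id t - α) * (fun t => β - id t) from rfl, this.deriv]
    simp; ring
  obtain ⟨L, hL⟩ := isCompact_Icc.exists_bound_of_continuousOn (s := Set.Icc α β)
    (hf.continuous_deriv (by simp)).continuousOn
  have hlip : ∀ x ∈ Set.Icc α β, ∀ y ∈ Set.Icc α β, |f x - f y| ≤ L * |x - y| := by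
    intro x hx y hy
    exact (convex_Icc α β).norm_image_sub_le_of_norm_deriv_le
      (fun t _ => hf.differentiable (by simp) t) hL hy hx
  have hfr : ∀ x ∈ frontier (Set.Ioo α β), D x = 0 := by
    intro x hx
    rw [frontier_Ioo hαβ] at hx
    rcases hx with rfl | rfl <;> simp [hD]
  obtain ⟨F, h1, h2, ⟨B, h3⟩, h4⟩ := exists_cutoff isOpen_Ioo (Metric.isBounded_Ioo _ _) hf hDs
    (fun x hx => mul_pos (by linarith [hx.1]) (by linarith [hx.2])) hfr (C := 2 * L) (by
      intro x hx
      rw [← norm_deriv_eq_norm_fderiv, hDd, norm_eq_abs]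
      have a1 := hlip x ⟨hx.1.le, hx.2.le⟩ α ⟨le_rfl, hαβ.le⟩
      have a2 := hlip x ⟨hx.1.le, hx.2.le⟩ β ⟨hαβ.le, le_rfl⟩
      have hxa : 0 < x - α := by linarith [hx.1]
      have hxb : 0 < β - x := by linarith [hx.2]
      rw [hα, sub_zero, abs_of_pos hxa] at a1
      rw [hβ, sub_zero, abs_sub_comm, abs_of_pos hxb] at a2
      have a3 : |β - x - (x - α)| ≤ (β - x) + (x - α) := by
        rw [abs_le]; constructor <;> linarith
      calc |f x| * |β - x - (x - α)| ≤ |f x| * ((β - x) + (x - α)) := by gcongr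
        _ = |f x| * (β - x) + |f x| * (x - α) := by ring
        _ ≤ L * (x - α) * (β - x) + L * (β - x) * (x - α) := by gcongr
        _ = 2 * L * D x := by rw [hD]; ring)
  have hderiv : ∀ (u : ℝ → ℝ) x, deriv u x = fderiv ℝ u x 1 := fun u x => rfl
  have hfin : volume (Set.Ioo α β) ≠ ⊤ := by simp
  have t1 := tendsto_integral_cutoff (P := fun n x => F n x ^ 2) (p := fun x => f x ^ 2)
    measurableSet_Ioo hfin (fun n => ((h1 n).1.continuous.pow 2).aestronglyMeasurable) (B := B ^ 2)
    (fun n x _ => by rw [abs_pow]; exact pow_le_pow_left₀ (abs_nonneg _) (h3 n x).1 2)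
    (fun n x hx => by simp [h4 n x hx]) (fun x hx => (h2 x hx).mono fun n hn => by simp [hn.1])
  obtain ⟨W, hW⟩ := isCompact_Icc.exists_bound_of_continuousOn (s := Set.Icc α β) hV.continuousOn
  have hdc : ∀ n, Continuous (deriv (F n)) := fun n => (h1 n).1.continuous_deriv (by simp)
  have t2 := tendsto_integral_cutoff (P := fun n x => deriv (F n) x ^ 2 + V x * F n x ^ 2)
    (p := fun x => deriv f x ^ 2 + V x * f x ^ 2)
    measurableSet_Ioo hfin (fun n => (((hdc n).pow 2).add
      (hV.mul ((h1 n).1.continuous.pow 2))).aestronglyMeasurable) (B := B ^ 2 + W * B ^ 2)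
    (fun n x hx => by
      have hB : 0 ≤ B := (abs_nonneg _).trans (h3 n x).1
      refine (abs_add_le _ _).trans (add_le_add ?_ ?_)
      · rw [abs_pow]
        refine pow_le_pow_left₀ (abs_nonneg _) ?_ 2
        rw [← norm_eq_abs, norm_deriv_eq_norm_fderiv]
        exact (h3 n x).2
      · rw [abs_mul, abs_pow]
        have := hW x ⟨hx.1.le, hx.2.le⟩
        rw [norm_eq_abs] at this
        exact mul_le_mul this (pow_le_pow_left₀ (abs_nonneg _) (h3 n x).1 2) (by positivity)
          ((abs_nonneg _).trans this))
    (fun n x hx => by rw [hderiv, (h4 n x hx).1, (h4 n x hx).2]; simp)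
    (fun x hx => (h2 x hx).mono fun n hn => by rw [hderiv, hderiv, hn.1, hn.2])
  rw [← integral_Ioc_eq_integral_Ioo, ← intervalIntegral.integral_of_le hαβ.le] at t1 t2
  obtain ⟨n, hn⟩ := (t2.eventually_lt (t1.const_mul U) h).exists
  exact ⟨F n, (h1 n).1, (h1 n).2.1, (h1 n).2.2, hn⟩

end Cutoff

section Slices

variable {G : ℝ × ℝ → ℝ}

theorem hasDerivAt_slice_left (hG : ContDiff ℝ (⊤ : ℕ∞) G) (x y : ℝ) :
    HasDerivAt (fun t => G (t, y)) (px G (x, y)) x := by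
  have h1 := (hG.differentiable (by simp) (x, y)).hasFDerivAt
  have h2 : HasDerivAt (fun t : ℝ => (t, y)) ((1 : ℝ), (0 : ℝ)) x :=
    (hasDerivAt_id x).prodMk (hasDerivAt_const x y)
  exact h1.comp_hasDerivAt x h2

theorem hasDerivAt_slice_right (hG : ContDiff ℝ (⊤ : ℕ∞) G) (x y : ℝ) :
    HasDerivAt (fun t => G (x, t)) (py G (x, y)) y := by
  have h1 := (hG.differentiable (by simp) (x, y)).hasFDerivAt
  have h2 : HasDerivAt (fun t : ℝ => (x, t)) ((0 : ℝ), (1 : ℝ)) y :=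
    (hasDerivAt_const y x).prodMk (hasDerivAt_id y)
  exact h1.comp_hasDerivAt y h2

theorem exists_slice_bound (hc : HasCompactSupport G) :
    ∃ R : ℝ, 0 < R ∧ ∀ x y, y ∉ Set.Ioo (-R) R → G (x, y) = 0 := by
  obtain ⟨R, hR⟩ := hc.isCompact.isBounded.exists_norm_le
  refine ⟨|R| + 1, by positivity, fun x y hy => ?_⟩
  by_contra h
  have := hR _ (subset_tsupport G h)
  have h2 : |y| ≤ R := (norm_snd_le (x, y)).trans this
  refine hy ?_
  rw [Set.mem_Ioo, ← abs_lt]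
  have := le_abs_self R
  linarith

theorem integral_slice_eq {R : ℝ} (hR : ∀ x y, y ∉ Set.Ioo (-R) R → G (x, y) = 0) (x : ℝ) :
    ∫ y, G (x, y) = ∫ y in Set.Icc (-R) R, G (x, y) := by
  rw [setIntegral_eq_integral_of_forall_compl_eq_zero]
  intro y hy
  exact hR x y fun h => hy ⟨h.1.le, h.2.le⟩

theorem continuous_integral_slice (hG : Continuous G) (hc : HasCompactSupport G) :
    Continuous fun x => ∫ y, G (x, y) := by
  obtain ⟨R, hR0, hR⟩ := exists_slice_bound hc
  simp_rw [integral_slice_eq hR]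
  exact continuous_parametric_integral_of_continuous (f := fun x y => G (x, y)) (by fun_prop) isCompact_Icc

theorem hasDerivAt_integral_slice (hG : ContDiff ℝ (⊤ : ℕ∞) G) (hc : HasCompactSupport G) (x : ℝ) :
    HasDerivAt (fun x => ∫ y, G (x, y)) (∫ y, px G (x, y)) x := by
  obtain ⟨R, hR0, hR⟩ := exists_slice_bound hc
  obtain ⟨R', hR0', hR'⟩ := exists_slice_bound (hasCompactSupport_px hc)
  obtain ⟨C, hC⟩ := (hasCompactSupport_px hc).exists_bound_of_continuous (continuous_px hG)
  have hGc := hG.continuous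
  have hpc := continuous_px hG
  refine (hasDerivAt_integral_of_dominated_loc_of_deriv_le (s := Set.univ)
    (bound := (Set.Icc (-R') R').indicator fun _ => C) (F := fun x y => G (x, y))
    (F' := fun x y => px G (x, y)) Filter.univ_mem ?_ ?_ ?_ ?_ ?_ ?_).2
  · exact Filter.Eventually.of_forall fun x =>
      Continuous.aestronglyMeasurable (by fun_prop)
  · refine Continuous.integrable_of_hasCompactSupport (by fun_prop) ?_
    exact HasCompactSupport.intro isCompact_Icc fun y hy => hR x y fun h => hy ⟨h.1.le, h.2.le⟩
  · exact Continuous.aestronglyMeasurable (by fun_prop)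
  · refine Filter.Eventually.of_forall fun y t _ => ?_
    by_cases hy : y ∈ Set.Icc (-R') R'
    · simpa [hy] using hC (t, y)
    · simp [hy, hR' t y fun h => hy ⟨h.1.le, h.2.le⟩]
  · exact (integrable_indicator_iff measurableSet_Icc).2 (integrableOn_const (by simp))
  · exact Filter.Eventually.of_forall fun y t _ => hasDerivAt_slice_left hG t y

theorem integral_slice_py (hG : ContDiff ℝ (⊤ : ℕ∞) G) (hc : HasCompactSupport G) (x : ℝ) :
    ∫ y, py G (x, y) = 0 := by
  have hpc := continuous_py hG
  have hs : ∀ {F : ℝ × ℝ → ℝ}, HasCompactSupport F → HasCompactSupport fun y => F (x, y) := by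
    intro F hF
    obtain ⟨R, hR0, hR⟩ := exists_slice_bound hF
    exact HasCompactSupport.intro (isCompact_Icc (a := -R) (b := R))
      fun y hy => hR x y fun h => hy ⟨h.1.le, h.2.le⟩
  refine integral_eq_zero_of_hasDerivAt_of_integrable (f := fun y => G (x, y))
    (fun y => hasDerivAt_slice_right hG x y) ?_ ?_
  · exact Continuous.integrable_of_hasCompactSupport (by fun_prop) (hs (hasCompactSupport_py hc))
  · exact Continuous.integrable_of_hasCompactSupport (by have := hG.continuous; fun_prop) (hs hc)

theorem integral_eq_integral_slice (hG : Continuous G) (hc : HasCompactSupport G) :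
    ∫ z, G z = ∫ x, ∫ y, G (x, y) := by
  rw [Measure.volume_eq_prod, integral_prod]
  exact hG.integrable_of_hasCompactSupport hc

end Slices

section ThinLower

/-- The isosceles triangle with base `(-1, 1)` and height `h`. -/
def isoTri (h : ℝ) : Set (ℝ × ℝ) := {z | |z.1| < 1 ∧ 0 < z.2 ∧ z.2 < h * (1 - |z.1|)}

/-- The right triangle with legs `1` and `h`. -/
def rightTri (h : ℝ) : Set (ℝ × ℝ) := {z | 0 < z.1 ∧ 0 < z.2 ∧ z.2 < h * (1 - z.1)}

/-- The normalized first transversal mode. -/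
noncomputable def mode (h : ℝ) (z : ℝ × ℝ) : ℝ :=
  √(2 / h) * (√(1 - z.1))⁻¹ * sin (π * z.2 / (h * (1 - z.1)))

/-- The transversal derivative of `mode`. -/
noncomputable def modeY (h : ℝ) (z : ℝ × ℝ) : ℝ :=
  √(2 / h) * (√(1 - z.1))⁻¹ * (cos (π * z.2 / (h * (1 - z.1))) * (π / (h * (1 - z.1))))

variable {h : ℝ} {u : ℝ × ℝ → ℝ}

theorem hasDerivAt_mode_right (x y : ℝ) :
    HasDerivAt (fun t => mode h (x, t)) (modeY h (x, y)) y := by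
  have h1 : HasDerivAt (fun t => π * t / (h * (1 - x))) (π / (h * (1 - x))) y := by
    simpa using ((hasDerivAt_id y).const_mul π).div_const (h * (1 - x))
  exact h1.sin.const_mul (√(2 / h) * (√(1 - x))⁻¹)

theorem hasDerivAt_mode_left (hh : 0 < h) {x : ℝ} (hx : x < 1) (y : ℝ) :
    HasDerivAt (fun t => mode h (t, y)) ((mode h (x, y) / 2 + y * modeY h (x, y)) / (1 - x)) x := by
  have hx' : 0 < 1 - x := by linarith
  have h0 : HasDerivAt (fun t : ℝ => 1 - t) (-1) x := by simpa using (hasDerivAt_id x).const_sub 1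
  have h1 : HasDerivAt (fun t => π * y / (h * (1 - t))) (π * y / (h * (1 - x)) / (1 - x)) x := by
    have := (h0.const_mul h).inv (by positivity) |>.const_mul (π * y)
    simp only [div_eq_mul_inv]
    refine this.congr_deriv ?_
    field_simp
  have h2 : HasDerivAt (fun t => (√(1 - t))⁻¹) ((√(1 - x))⁻¹ / 2 / (1 - x)) x := by
    have := (h0.sqrt hx'.ne').inv (by positivity)
    refine this.congr_deriv ?_
    rw [sq_sqrt hx'.le]
    have : √(1 - x) ≠ 0 := by positivity
    field_simp
  have h3 := (h2.const_mul √(2 / h)).mul h1.sin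
  refine h3.congr_deriv ?_
  simp only [mode, modeY]
  have : √(1 - x) ≠ 0 := by positivity
  field_simp

theorem contDiff_mul_mode (hh : 0 < h) (hu : ContDiff ℝ (⊤ : ℕ∞) u) (hs : tsupport u ⊆ isoTri h) :
    ContDiff ℝ (⊤ : ℕ∞) (fun z => u z * mode h z) := by
  rw [contDiff_iff_contDiffAt]
  intro z
  by_cases hz : z ∈ tsupport u
  · have h1 : 0 < 1 - z.1 := by
      have := (hs hz).1
      linarith [(abs_lt.1 this).2]
    refine hu.contDiffAt.mul ?_
    have h2 : ContDiffAt ℝ (⊤ : ℕ∞) (fun z : ℝ × ℝ => 1 - z.1) z := by fun_prop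
    refine (contDiffAt_const.mul ((h2.sqrt h1.ne').inv (by positivity))).mul ?_
    refine ContDiffAt.sin (ContDiffAt.div (by fun_prop) (by fun_prop) (by positivity))
  · have := notMem_tsupport_iff_eventuallyEq.1 hz
    refine contDiffAt_const (c := (0 : ℝ)) |>.congr_of_eventuallyEq ?_
    filter_upwards [this] with y hy
    rw [hy]; simp

theorem px_mul_mode (hh : 0 < h) (hu : ContDiff ℝ (⊤ : ℕ∞) u) (hs : tsupport u ⊆ isoTri h)
    {x : ℝ} (hx : x < 1) (y : ℝ) :
    px (fun z => u z * mode h z) (x, y) =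
      (px u (x, y) - (u (x, y) / 2 + y * py u (x, y)) / (1 - x)) * mode h (x, y) +
      (1 / (1 - x)) * py (fun z => z.2 * (u z * mode h z)) (x, y) := by
  have hG := contDiff_mul_mode hh hu hs
  have hYG : ContDiff ℝ (⊤ : ℕ∞) (fun z : ℝ × ℝ => z.2 * (u z * mode h z)) := contDiff_snd.mul hG
  have e1 := (hasDerivAt_slice_left hG x y).unique
    ((hasDerivAt_slice_left hu x y).mul (hasDerivAt_mode_left hh hx y))
  have e2 := (hasDerivAt_slice_right hYG x y).unique
    ((hasDerivAt_id y).mul ((hasDerivAt_slice_right hu x y).mul (hasDerivAt_mode_right x y)))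
  rw [e1, e2]
  have : 1 - x ≠ 0 := by linarith
  simp only [id]
  simp
  field_simp
  ring

theorem integral_mode_sq {ℓ : ℝ} (hh : 0 < h) {x : ℝ} (hx : x < 1) (hℓ : ℓ = h * (1 - x)) :
    ∫ y in (0 : ℝ)..ℓ, mode h (x, y) ^ 2 = 1 := by
  have hx' : 0 < 1 - x := by linarith
  have hpi := pi_pos
  have hℓ0 : 0 < ℓ := by rw [hℓ]; positivity
  have e : ∀ y, mode h (x, y) ^ 2 = 2 / ℓ * sin (π / ℓ * y) ^ 2 := by
    intro y
    simp only [mode]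
    rw [mul_pow, mul_pow, inv_pow, sq_sqrt (by positivity), sq_sqrt hx'.le, hℓ]
    field_simp
  simp_rw [e]
  rw [intervalIntegral.integral_const_mul,
    intervalIntegral.integral_comp_mul_left (fun y => sin y ^ 2) (by positivity), integral_sin_sq]
  have : π / ℓ * ℓ = π := by field_simp
  rw [this]
  simp
  field_simp

theorem sq_integral_mode_le {ℓ : ℝ} (hh : 0 < h) {x : ℝ} (hx : x < 1) (hℓ : ℓ = h * (1 - x))
    {p : ℝ → ℝ} (hp : Continuous p) (h0 : ∀ y, y ∉ Set.Ioo 0 ℓ → p y = 0) :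
    (∫ y, p y * mode h (x, y)) ^ 2 ≤ ∫ y, p y ^ 2 := by
  have hx' : 0 < 1 - x := by linarith
  have hℓ0 : 0 < ℓ := by rw [hℓ]; positivity
  have hm : Continuous fun y => mode h (x, y) :=
    continuous_iff_continuousAt.2 fun y => (hasDerivAt_mode_right x y).continuousAt
  rw [← integral_eq_of_eq_zero_outside (α := 0) (β := ℓ) (γ := 0) (δ := ℓ)
      (fun y hy => by rw [h0 y hy, zero_mul]) le_rfl le_rfl,
    ← integral_eq_of_eq_zero_outside (α := 0) (β := ℓ) (γ := 0) (δ := ℓ)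
      (fun y hy => by rw [h0 y hy]; norm_num) le_rfl le_rfl]
  have e : ∀ r, ∫ y in (0 : ℝ)..ℓ, (p y - r * mode h (x, y)) ^ 2 = (∫ y in (0 : ℝ)..ℓ, p y ^ 2) -
      2 * r * (∫ y in (0 : ℝ)..ℓ, p y * mode h (x, y)) + r ^ 2 * ∫ y in (0 : ℝ)..ℓ, mode h (x, y) ^ 2 := by
    intro r
    rw [← intervalIntegral.integral_const_mul, ← intervalIntegral.integral_const_mul,
      ← intervalIntegral.integral_sub, ← intervalIntegral.integral_add]
    · congr 1; ext y; ring
    all_goals exact Continuous.intervalIntegrable (by fun_prop) _ _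
  have key : 0 ≤ ∫ y in (0 : ℝ)..ℓ, (p y - (∫ y in (0 : ℝ)..ℓ, p y * mode h (x, y)) * mode h (x, y)) ^ 2 :=
    intervalIntegral.integral_nonneg hℓ0.le fun y _ => sq_nonneg _
  rw [e, integral_mode_sq hh hx hℓ] at key
  nlinarith

/-- Projection onto the first transversal mode. -/
noncomputable def modeProj (h : ℝ) (u : ℝ × ℝ → ℝ) (x : ℝ) : ℝ := ∫ y, u (x, y) * mode h (x, y)

/-- The derivative of `modeProj`. -/
noncomputable def modeProj' (h : ℝ) (u : ℝ × ℝ → ℝ) (x : ℝ) : ℝ :=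
  ∫ y, px (fun z => u z * mode h z) (x, y)

theorem hasDerivAt_modeProj (hh : 0 < h) (hu : ContDiff ℝ (⊤ : ℕ∞) u) (hc : HasCompactSupport u)
    (hs : tsupport u ⊆ isoTri h) (x : ℝ) : HasDerivAt (modeProj h u) (modeProj' h u x) x :=
  hasDerivAt_integral_slice (contDiff_mul_mode hh hu hs) hc.mul_right x

theorem continuous_modeProj' (hh : 0 < h) (hu : ContDiff ℝ (⊤ : ℕ∞) u) (hc : HasCompactSupport u)
    (hs : tsupport u ⊆ isoTri h) : Continuous (modeProj' h u) :=
  continuous_integral_slice (continuous_px (contDiff_mul_mode hh hu hs))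
    (hasCompactSupport_px hc.mul_right)

theorem slice_eq_zero (hs : tsupport u ⊆ isoTri h) {x : ℝ} (hx0 : 0 ≤ x) {y : ℝ}
    (hy : y ∉ Set.Ioo 0 (h * (1 - x))) : (x, y) ∉ tsupport u := by
  intro hmem
  have := hs hmem
  refine hy ⟨this.2.1, ?_⟩
  have h2 := this.2.2
  rwa [abs_of_nonneg hx0] at h2

theorem thin_slice (hh : 0 < h) (hh3 : 3 * h ≤ 1) (hu : ContDiff ℝ (⊤ : ℕ∞) u)
    (hc : HasCompactSupport u) (hs : tsupport u ⊆ isoTri h) {x : ℝ} (hx0 : 0 ≤ x) (hx : x < 1) :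
    modeProj h u x ^ 2 ≤ ∫ y, u (x, y) ^ 2 ∧
    (1 - 3 * h) * (modeProj' h u x ^ 2 + (π / h) ^ 2 * ((1 + 2 * x) * modeProj h u x ^ 2 +
      4 * ((∫ y, u (x, y) ^ 2) - modeProj h u x ^ 2))) ≤
      (∫ y, px u (x, y) ^ 2) + ∫ y, py u (x, y) ^ 2 := by
  have hpi := pi_pos
  have hx' : 0 < 1 - x := by linarith
  set ℓ := h * (1 - x) with hℓ
  have hℓ0 : 0 < ℓ := by rw [hℓ]; positivity
  have huc : Continuous u := hu.continuous
  have hpxc := continuous_px hu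
  have hpyc := continuous_py hu
  have z0 : ∀ y, y ∉ Set.Ioo 0 ℓ → u (x, y) = 0 := fun y hy =>
    image_eq_zero_of_notMem_tsupport (slice_eq_zero hs hx0 hy)
  have z1 : ∀ y, y ∉ Set.Ioo 0 ℓ → px u (x, y) = 0 := fun y hy =>
    px_eq_zero_of_notMem (slice_eq_zero hs hx0 hy)
  have z2 : ∀ y, y ∉ Set.Ioo 0 ℓ → py u (x, y) = 0 := fun y hy =>
    py_eq_zero_of_notMem (slice_eq_zero hs hx0 hy)
  have hint : ∀ {g : ℝ → ℝ}, Continuous g → (∀ y, y ∉ Set.Ioo 0 ℓ → g y = 0) → Integrable g := by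
    intro g hg h0
    exact hg.integrable_of_hasCompactSupport (HasCompactSupport.intro (isCompact_Icc (a := 0) (b := ℓ))
      fun y hy => h0 y fun h => hy ⟨h.1.le, h.2.le⟩)
  have hφm : modeProj h u x ^ 2 ≤ ∫ y, u (x, y) ^ 2 :=
    sq_integral_mode_le hh hx hℓ (by fun_prop) z0
  obtain ⟨g1, g2⟩ := slice_gap (f := fun y => u (x, y)) (f' := fun y => py u (x, y)) hℓ0
    (fun y => hasDerivAt_slice_right hu x y) (by fun_prop) z0
  have hproj : (2 / ℓ) * (∫ y, u (x, y) * sin (π / ℓ * y)) ^ 2 = modeProj h u x ^ 2 := by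
    have e : ∀ y, u (x, y) * mode h (x, y) = √(2 / h) * (√(1 - x))⁻¹ * (u (x, y) * sin (π / ℓ * y)) := by
      intro y
      rw [mode, ← hℓ, div_mul_eq_mul_div]; ring
    rw [modeProj]
    simp_rw [e]
    rw [integral_const_mul, mul_pow, mul_pow, inv_pow, sq_sqrt (by positivity), sq_sqrt hx'.le, hℓ]
    field_simp
  rw [hproj] at g1
  refine ⟨hφm, ?_⟩
  set m := ∫ y, u (x, y) ^ 2
  set I₂ := ∫ y, py u (x, y) ^ 2
  set I₁ := ∫ y, px u (x, y) ^ 2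
  set φ := modeProj h u x
  have hI₂ : 0 ≤ I₂ := integral_nonneg fun y => sq_nonneg _
  have hI₁ : 0 ≤ I₁ := integral_nonneg fun y => sq_nonneg _
  set B : ℝ → ℝ := fun y => (u (x, y) / 2 + y * py u (x, y)) / (1 - x) with hB
  have hBc : Continuous B := by rw [hB]; fun_prop
  have zB : ∀ y, y ∉ Set.Ioo 0 ℓ → B y = 0 := fun y hy => by simp [hB, z0 y hy, z2 y hy]
  have hB2 : ∫ y, B y ^ 2 ≤ 3 * h ^ 2 * I₂ := by
    have e1 : ∫ y, B y ^ 2 ≤ ∫ y, (1 / (2 * (1 - x) ^ 2) * u (x, y) ^ 2 + 2 * h ^ 2 * py u (x, y) ^ 2) := by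
      refine integral_mono (hint (by fun_prop) fun y hy => by simp [zB y hy])
        (hint (by fun_prop) fun y hy => by simp [z0 y hy, z2 y hy]) fun y => ?_
      by_cases hy : y ∈ Set.Ioo 0 ℓ
      · have hy2 : (y / (1 - x)) ^ 2 ≤ h ^ 2 := by
          have : y / (1 - x) ≤ h := by rw [div_le_iff₀ hx']; exact hy.2.le
          have h0 : 0 ≤ y / (1 - x) := div_nonneg hy.1.le hx'.le
          gcongr
        have e : B y ^ 2 ≤ 1 / (2 * (1 - x) ^ 2) * u (x, y) ^ 2 + 2 * (y / (1 - x)) ^ 2 * py u (x, y) ^ 2 := by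
          have : B y = u (x, y) / (1 - x) / 2 + y / (1 - x) * py u (x, y) := by
            simp only [hB]; field_simp
          have e3 : 1 / (2 * (1 - x) ^ 2) * u (x, y) ^ 2 = (u (x, y) / (1 - x)) ^ 2 / 2 := by field_simp
          rw [this, e3]
          nlinarith [sq_nonneg (u (x, y) / (1 - x) / 2 - y / (1 - x) * py u (x, y))]
        refine e.trans ?_
        gcongr
      · simp [zB y hy, z0 y hy, z2 y hy]
    rw [integral_add (hint (by fun_prop) fun y hy => by simp [z0 y hy])
      (hint (by fun_prop) fun y hy => by simp [z2 y hy]), integral_const_mul, integral_const_mul] at e1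
    have e2 : 1 / (2 * (1 - x) ^ 2) * m ≤ h ^ 2 * I₂ := by
      have : m ≤ (ℓ / π) ^ 2 * I₂ := by
        have := mul_le_mul_of_nonneg_left g2 (by positivity : 0 ≤ (ℓ / π) ^ 2)
        rwa [← mul_assoc, ← mul_pow, div_mul_div_cancel₀ hpi.ne', div_self hℓ0.ne', one_pow, one_mul] at this
      calc 1 / (2 * (1 - x) ^ 2) * m ≤ 1 / (2 * (1 - x) ^ 2) * ((ℓ / π) ^ 2 * I₂) := by gcongr
        _ = h ^ 2 * I₂ * (1 / (2 * π ^ 2)) := by rw [hℓ]; field_simp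
        _ ≤ h ^ 2 * I₂ * 1 := by
          gcongr
          rw [div_le_one (by positivity)]
          nlinarith [pi_gt_three]
        _ = h ^ 2 * I₂ := mul_one _
    linarith
  have hφ' : modeProj' h u x ^ 2 ≤ (1 + h) * I₁ + (1 + 1 / h) * (3 * h ^ 2 * I₂) := by
    have e1 : modeProj' h u x = ∫ y, (px u (x, y) - B y) * mode h (x, y) := by
      rw [modeProj']
      simp_rw [px_mul_mode hh hu hs hx]
      have hYG : ContDiff ℝ (⊤ : ℕ∞) (fun z : ℝ × ℝ => z.2 * (u z * mode h z)) :=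
        contDiff_snd.mul (contDiff_mul_mode hh hu hs)
      have hYc : HasCompactSupport (fun z : ℝ × ℝ => z.2 * (u z * mode h z)) := hc.mul_right.mul_left
      have hYy := continuous_py hYG
      have hm : Continuous fun y => mode h (x, y) :=
        continuous_iff_continuousAt.2 fun y => (hasDerivAt_mode_right x y).continuousAt
      rw [integral_add, integral_const_mul, integral_slice_py hYG hYc, mul_zero, add_zero]
      · exact hint (by fun_prop) fun y hy => by simp [z0 y hy, z1 y hy, z2 y hy]
      · refine (Continuous.integrable_of_hasCompactSupport (by fun_prop) ?_).const_mul _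
        obtain ⟨R, hR0, hR⟩ := exists_slice_bound (hasCompactSupport_py hYc)
        exact HasCompactSupport.intro (isCompact_Icc (a := -R) (b := R))
          fun y hy => hR x y fun h => hy ⟨h.1.le, h.2.le⟩
    rw [e1]
    refine (sq_integral_mode_le hh hx hℓ (by fun_prop) fun y hy => by simp [z1 y hy, zB y hy]).trans ?_
    calc ∫ y, (px u (x, y) - B y) ^ 2 ≤ ∫ y, ((1 + h) * px u (x, y) ^ 2 + (1 + 1 / h) * B y ^ 2) := by
          refine integral_mono (hint (by fun_prop) fun y hy => by simp [z1 y hy, zB y hy])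
            (hint (by fun_prop) fun y hy => by simp [z1 y hy, zB y hy]) fun y => ?_
          have e : (1 + h) * px u (x, y) ^ 2 + (1 + 1 / h) * B y ^ 2 - (px u (x, y) - B y) ^ 2 =
            (h * px u (x, y) + B y) ^ 2 / h := by field_simp; ring
          have : 0 ≤ (h * px u (x, y) + B y) ^ 2 / h := by positivity
          show _ ≤ (1 + h) * px u (x, y) ^ 2 + (1 + 1 / h) * B y ^ 2
          linarith
      _ = (1 + h) * I₁ + (1 + 1 / h) * ∫ y, B y ^ 2 := by
          rw [integral_add (hint (by fun_prop) fun y hy => by simp [z1 y hy])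
            (hint (by fun_prop) fun y hy => by simp [zB y hy]), integral_const_mul, integral_const_mul]
      _ ≤ _ := by gcongr
  have hI₂low : (π / h) ^ 2 * ((1 + 2 * x) * φ ^ 2 + 4 * (m - φ ^ 2)) ≤ I₂ := by
    refine le_trans ?_ g1
    have e1 : (π / ℓ) ^ 2 = (π / h) ^ 2 * (1 / (1 - x) ^ 2) := by rw [hℓ]; field_simp
    have e2 : 1 + 2 * x ≤ 1 / (1 - x) ^ 2 := by
      rw [le_div_iff₀ (by positivity)]
      nlinarith [mul_nonneg hx0 (mul_nonneg hx0 hx0), mul_nonneg (mul_nonneg hx0 hx0) hx'.le]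
    have e3 : 1 ≤ 1 / (1 - x) ^ 2 := by linarith
    rw [e1, mul_assoc]
    refine mul_le_mul_of_nonneg_left ?_ (by positivity)
    have e4 : 0 ≤ m - φ ^ 2 := by linarith
    nlinarith [mul_le_mul_of_nonneg_right e2 (sq_nonneg φ), mul_le_mul_of_nonneg_right e3 e4]
  have e5 : (1 + 1 / h) * (3 * h ^ 2 * I₂) = 3 * h * (1 + h) * I₂ := by field_simp; ring
  rw [e5] at hφ'
  have h13 : 0 ≤ 1 - 3 * h := by linarith
  have e6 : (1 - 3 * h) * (1 + h) ≤ 1 := by nlinarith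
  calc (1 - 3 * h) * (modeProj' h u x ^ 2 + (π / h) ^ 2 * ((1 + 2 * x) * φ ^ 2 + 4 * (m - φ ^ 2)))
      ≤ (1 - 3 * h) * (((1 + h) * I₁ + 3 * h * (1 + h) * I₂) + I₂) := by gcongr
    _ = (1 - 3 * h) * (1 + h) * (I₁ + 3 * h * I₂) + (1 - 3 * h) * I₂ := by ring
    _ ≤ 1 * (I₁ + 3 * h * I₂) + (1 - 3 * h) * I₂ := by gcongr
    _ = I₁ + I₂ := by ring

end ThinLower

section ThinLowerGlobal

variable {h : ℝ} {u : ℝ × ℝ → ℝ}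

/-- The one-dimensional inequality governing the thin triangle, for functions vanishing on `N`. -/
def LineIneq (h Λ : ℝ) (N : Set ℝ) : Prop :=
  ∀ φ φ' : ℝ → ℝ, (∀ x, HasDerivAt φ (φ' x) x) → Continuous φ' → (∀ x, 1 ≤ x → φ x = 0) →
    (∀ s ∈ N, φ s = 0) → (Λ - (π / h) ^ 2) * (∫ x in (0 : ℝ)..1, φ x ^ 2) ≤
      ∫ x in (0 : ℝ)..1, (φ' x ^ 2 + 2 * (π / h) ^ 2 * x * φ x ^ 2)

theorem integral_half_le (hh : 0 < h) (hh3 : 3 * h ≤ 1) (hu : ContDiff ℝ (⊤ : ℕ∞) u)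
    (hc : HasCompactSupport u) (hs : tsupport u ⊆ isoTri h) {Λ : ℝ} (hΛ : Λ ≤ 4 * (π / h) ^ 2)
    {N : Set ℝ} (hN : LineIneq h Λ N) (h0 : ∀ s ∈ N, modeProj h u s = 0) :
    (1 - 3 * h) * Λ * (∫ x in (0 : ℝ)..1, ∫ y, u (x, y) ^ 2) ≤
      ∫ x in (0 : ℝ)..1, ((∫ y, px u (x, y) ^ 2) + ∫ y, py u (x, y) ^ 2) := by
  have hcsq : ∀ {g : ℝ × ℝ → ℝ}, HasCompactSupport g → HasCompactSupport fun z => g z ^ 2 :=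
    fun hg => hg.comp_left (g := fun t => t ^ 2) (by norm_num)
  have c0 : Continuous fun x => ∫ y, u (x, y) ^ 2 :=
    continuous_integral_slice (G := fun z => u z ^ 2) (hu.continuous.pow 2) (hcsq hc)
  have c1 : Continuous fun x => ∫ y, px u (x, y) ^ 2 :=
    continuous_integral_slice (G := fun z => px u z ^ 2) ((continuous_px hu).pow 2)
      (hcsq (hasCompactSupport_px hc))
  have c2 : Continuous fun x => ∫ y, py u (x, y) ^ 2 :=
    continuous_integral_slice (G := fun z => py u z ^ 2) ((continuous_py hu).pow 2)
      (hcsq (hasCompactSupport_py hc))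
  have hd := hasDerivAt_modeProj hh hu hc hs
  have cφ : Continuous (modeProj h u) := continuous_iff_continuousAt.2 fun x => (hd x).continuousAt
  have cφ' := continuous_modeProj' hh hu hc hs
  have hline := hN _ _ hd cφ' (fun x hx => by
    rw [modeProj]
    refine integral_eq_zero_of_ae (Filter.Eventually.of_forall fun y => ?_)
    show u (x, y) * mode h (x, y) = 0
    rw [image_eq_zero_of_notMem_tsupport (slice_eq_zero hs (by linarith) fun hy => ?_), zero_mul]
    have := hy.1.trans hy.2
    nlinarith) h0
  have h13 : 0 ≤ 1 - 3 * h := by linarith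
  have key : (∫ x in (0 : ℝ)..1, (1 - 3 * h) * ((modeProj' h u x ^ 2 +
      2 * (π / h) ^ 2 * x * modeProj h u x ^ 2) - (Λ - (π / h) ^ 2) * modeProj h u x ^ 2 +
      Λ * ∫ y, u (x, y) ^ 2)) ≤
      ∫ x in (0 : ℝ)..1, ((∫ y, px u (x, y) ^ 2) + ∫ y, py u (x, y) ^ 2) := by
    refine intervalIntegral.integral_mono_on_of_le_Ioo zero_le_one
      (Continuous.intervalIntegrable (by fun_prop) _ _)
      (Continuous.intervalIntegrable (by fun_prop) _ _) fun x hx => ?_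
    obtain ⟨e1, e2⟩ := thin_slice hh hh3 hu hc hs hx.1.le hx.2
    refine le_trans (mul_le_mul_of_nonneg_left ?_ h13) e2
    have e3 := mul_le_mul_of_nonneg_right hΛ (sub_nonneg.2 e1)
    linarith
  rw [intervalIntegral.integral_const_mul, intervalIntegral.integral_add, intervalIntegral.integral_sub,
    intervalIntegral.integral_const_mul, intervalIntegral.integral_const_mul] at key
  · have := mul_nonneg h13 (sub_nonneg.2 hline)
    linarith
  all_goals exact Continuous.intervalIntegrable (by fun_prop) _ _

/-- Reflection in the second coordinate axis. -/
def reflX (u : ℝ × ℝ → ℝ) (z : ℝ × ℝ) : ℝ := u (-z.1, z.2)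

theorem tsupport_reflX (u : ℝ × ℝ → ℝ) :
    tsupport (reflX u) = (fun z : ℝ × ℝ => (-z.1, z.2)) ⁻¹' tsupport u :=
  tsupport_comp_eq_preimage u ((Homeomorph.neg ℝ).prodCongr (Homeomorph.refl ℝ))

theorem hasCompactSupport_reflX (hc : HasCompactSupport u) : HasCompactSupport (reflX u) :=
  hc.comp_homeomorph ((Homeomorph.neg ℝ).prodCongr (Homeomorph.refl ℝ))

theorem contDiff_reflX (hu : ContDiff ℝ (⊤ : ℕ∞) u) : ContDiff ℝ (⊤ : ℕ∞) (reflX u) :=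
  hu.comp (by fun_prop : ContDiff ℝ (⊤ : ℕ∞) fun z : ℝ × ℝ => (-z.1, z.2))

theorem px_reflX (hu : ContDiff ℝ (⊤ : ℕ∞) u) (x y : ℝ) : px (reflX u) (x, y) = -px u (-x, y) := by
  refine (hasDerivAt_slice_left (contDiff_reflX hu) x y).unique ?_
  have := (hasDerivAt_slice_left hu (-x) y).comp x (hasDerivAt_neg x)
  exact this.congr_deriv (by ring)

theorem py_reflX (hu : ContDiff ℝ (⊤ : ℕ∞) u) (x y : ℝ) : py (reflX u) (x, y) = py u (-x, y) :=
  (hasDerivAt_slice_right (contDiff_reflX hu) x y).unique (hasDerivAt_slice_right hu (-x) y)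

theorem integral_eq_halves {g : ℝ → ℝ} (hg : Continuous g) (h0 : ∀ x, x ∉ Set.Ioo (-1) 1 → g x = 0) :
    ∫ x, g x = (∫ x in (0 : ℝ)..1, g x) + ∫ x in (0 : ℝ)..1, g (-x) := by
  rw [← integral_eq_of_eq_zero_outside (α := -1) (β := 1) (γ := -1) (δ := 1) h0 le_rfl le_rfl,
    intervalIntegral.integral_comp_neg, neg_zero, add_comm,
    intervalIntegral.integral_add_adjacent_intervals]
  all_goals exact hg.intervalIntegrable _ _

theorem le_integral_of_lineIneq (hh : 0 < h) (hh3 : 3 * h ≤ 1) (hu : ContDiff ℝ (⊤ : ℕ∞) u)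
    (hc : HasCompactSupport u) (hs : tsupport u ⊆ isoTri h) {Λ : ℝ} (hΛ : Λ ≤ 4 * (π / h) ^ 2)
    {N N' : Set ℝ} (hN : LineIneq h Λ N) (hN' : LineIneq h Λ N') (h0 : ∀ s ∈ N, modeProj h u s = 0)
    (h0' : ∀ s ∈ N', modeProj h (reflX u) s = 0) :
    (1 - 3 * h) * Λ * (∫ z, u z ^ 2) ≤ (∫ z, px u z ^ 2) + ∫ z, py u z ^ 2 := by
  have hcsq : ∀ {g : ℝ × ℝ → ℝ}, HasCompactSupport g → HasCompactSupport fun z => g z ^ 2 :=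
    fun hg => hg.comp_left (g := fun t => t ^ 2) (by norm_num)
  have hsub : tsupport (reflX u) ⊆ isoTri h := by
    rw [tsupport_reflX]
    intro z hz
    have := hs hz
    simpa [isoTri, abs_neg] using this
  have g1 := integral_half_le hh hh3 hu hc hs hΛ hN h0
  have g2 := integral_half_le hh hh3 (contDiff_reflX hu) (hasCompactSupport_reflX hc) hsub hΛ hN' h0'
  simp_rw [px_reflX hu, py_reflX hu, neg_sq, reflX] at g2
  have cu := hu.continuous
  have c1 := continuous_px hu
  have c2 := continuous_py hu
  have s1 := hasCompactSupport_px hc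
  have s2 := hasCompactSupport_py hc
  have hout : ∀ x y, x ∉ Set.Ioo (-1 : ℝ) 1 → (x, y) ∉ tsupport u := by
    intro x y hx hmem
    exact hx (abs_lt.1 (hs hmem).1)
  have d0 := continuous_integral_slice (G := fun z => u z ^ 2) (cu.pow 2) (hcsq hc)
  have d1 := continuous_integral_slice (G := fun z => px u z ^ 2) (c1.pow 2) (hcsq s1)
  have d2 := continuous_integral_slice (G := fun z => py u z ^ 2) (c2.pow 2) (hcsq s2)
  rw [integral_eq_integral_slice (G := fun z => u z ^ 2) (cu.pow 2) (hcsq hc),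
    integral_eq_integral_slice (G := fun z => px u z ^ 2) (c1.pow 2) (hcsq s1),
    integral_eq_integral_slice (G := fun z => py u z ^ 2) (c2.pow 2) (hcsq s2), integral_eq_halves d0, integral_eq_halves d1,
    integral_eq_halves d2]
  · rw [intervalIntegral.integral_add] at g1 g2
    · linarith
    · exact (d1.comp continuous_neg).intervalIntegrable _ _
    · exact (d2.comp continuous_neg).intervalIntegrable _ _
    · exact d1.intervalIntegrable _ _
    · exact d2.intervalIntegrable _ _
  · exact fun x hx => by simp [py_eq_zero_of_notMem (hout x _ hx)]
  · exact fun x hx => by simp [px_eq_zero_of_notMem (hout x _ hx)]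
  · exact fun x hx => by simp [image_eq_zero_of_notMem_tsupport (hout x _ hx)]

theorem isOpen_isoTri (h : ℝ) : IsOpen (isoTri h) :=
  ((isOpen_lt (by fun_prop : Continuous fun z : ℝ × ℝ => |z.1|) continuous_const).inter ((isOpen_lt continuous_const continuous_snd).inter
    (isOpen_lt continuous_snd (by fun_prop : Continuous fun z : ℝ × ℝ => h * (1 - |z.1|)))))

theorem isOpen_rightTri (h : ℝ) : IsOpen (rightTri h) :=
  ((isOpen_lt continuous_const continuous_fst).inter ((isOpen_lt continuous_const continuous_snd).inter
    (isOpen_lt continuous_snd (by fun_prop : Continuous fun z : ℝ × ℝ => h * (1 - z.1)))))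

theorem rightTri_subset (hh : 0 < h) : rightTri h ⊆ isoTri h := by
  rintro z ⟨h1, h2, h3⟩
  have : z.1 < 1 := by nlinarith
  exact ⟨by rwa [abs_of_pos h1], h2, by rwa [abs_of_pos h1]⟩

theorem rightTri_nonempty (hh : 0 < h) : (rightTri h).Nonempty :=
  ⟨(1 / 2, h / 4), by norm_num, by simpa using hh, by simp only; linarith⟩

theorem isoTri_nonempty (hh : 0 < h) : (isoTri h).Nonempty :=
  (rightTri_nonempty hh).mono (rightTri_subset hh)

theorem TF.integrable_slice {Ω : Set (ℝ × ℝ)} (u : TF Ω) (x : ℝ) {g : ℝ → ℝ} (hg : Continuous g) :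
    Integrable fun y => u.1 (x, y) * g y := by
  have := TF.cont u
  obtain ⟨R, -, hR⟩ := exists_slice_bound (TF.cpt u)
  exact Continuous.integrable_of_hasCompactSupport (by fun_prop)
    (HasCompactSupport.intro (isCompact_Icc (a := -R) (b := R)) fun y hy => by
      rw [hR x y fun h => hy ⟨h.1.le, h.2.le⟩, zero_mul])

/-- The functional `u ↦ ∫ u (t, y) * mode h (|t|, y) dy`. -/
noncomputable def sliceFun (Ω : Set (ℝ × ℝ)) (h t : ℝ) : TF Ω →ₗ[ℝ] ℝ :=
  have hm : Continuous fun y => mode h (|t|, y) :=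
    continuous_iff_continuousAt.2 fun y => (hasDerivAt_mode_right |t| y).continuousAt
  { toFun := fun u => ∫ y, u.1 (t, y) * mode h (|t|, y)
    map_add' := fun u v => by
      rw [← integral_add (TF.integrable_slice u t hm) (TF.integrable_slice v t hm)]
      congr 1; ext y; simp; ring
    map_smul' := fun c u => by
      simp only [Submodule.coe_smul, Pi.smul_apply, smul_eq_mul, RingHom.id_apply]
      rw [← integral_const_mul]
      congr 1; ext y; ring }

theorem energy_one_self {Ω : Set (ℝ × ℝ)} (u : TF Ω) :
    energy Ω 1 0 1 u u = (∫ z, px u.1 z ^ 2) + ∫ z, py u.1 z ^ 2 := by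
  have h1 := TF.integrable_xx u u
  have h2 := TF.integrable_yy u u
  simp only [← sq] at h1 h2
  rw [energy_apply, ← integral_add h1 h2]
  congr 1; ext z; rw [enDensity_self]; ring

theorem mass_self {Ω : Set (ℝ × ℝ)} (u : TF Ω) : mass Ω u u = ∫ z, u.1 z ^ 2 := by
  rw [mass_apply]
  congr 1; ext z; ring

theorem le_ev_isoTri (hh : 0 < h) (hh3 : 3 * h ≤ 1) {n k : ℕ} (hn : n < k) (t : Fin n → ℝ) {Λ : ℝ}
    (hΛ : Λ ≤ 4 * (π / h) ^ 2) (hN : LineIneq h Λ {s | 0 ≤ s ∧ ∃ i, t i = s})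
    (hN' : LineIneq h Λ {s | 0 ≤ s ∧ ∃ i, t i = -s}) : (1 - 3 * h) * Λ ≤ ev (isoTri h) 1 0 1 k := by
  refine le_ev (isOpen_isoTri h) (isoTri_nonempty hh) hn (fun i => sliceFun _ h (t i)) fun u hu => ?_
  rw [energy_one_self, mass_self]
  refine le_integral_of_lineIneq hh hh3 (TF.smooth u) (TF.cpt u) (TF.supp u) hΛ hN hN' ?_ ?_
  · rintro s ⟨hs, i, rfl⟩
    have := hu i
    rwa [sliceFun, LinearMap.coe_mk, AddHom.coe_mk, abs_of_nonneg hs] at this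
  · rintro s ⟨hs, i, hi⟩
    have := hu i
    rwa [sliceFun, LinearMap.coe_mk, AddHom.coe_mk, hi, abs_neg, abs_of_nonneg hs] at this

theorem lineIneq_Ici (h Λ : ℝ) : LineIneq h Λ (Set.Ici 0) := by
  intro φ φ' hd hc _ h0
  have cφ : Continuous φ := continuous_iff_continuousAt.2 fun x => (hd x).continuousAt
  have e : (∫ x in (0 : ℝ)..1, φ x ^ 2) = ∫ x in (0 : ℝ)..1, (0 : ℝ) :=
    intervalIntegral.integral_congr fun x hx => by
      rw [Set.uIcc_of_le zero_le_one] at hx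
      simp [h0 x hx.1]
  rw [e, intervalIntegral.integral_zero, mul_zero]
  refine intervalIntegral.integral_nonneg zero_le_one fun x hx => ?_
  have := hx.1
  positivity

theorem le_ev_rightTri (hh : 0 < h) (hh3 : 3 * h ≤ 1) {n k : ℕ} (hn : n < k) (t : Fin n → ℝ)
    (ht : ∀ i, 0 ≤ t i) {Λ : ℝ} (hΛ : Λ ≤ 4 * (π / h) ^ 2)
    (hN : LineIneq h Λ {s | s = 0 ∨ ∃ i, t i = s}) :
    (1 - 3 * h) * Λ ≤ ev (rightTri h) 1 0 1 k := by
  refine le_ev (isOpen_rightTri h) (rightTri_nonempty hh) hn (fun i => sliceFun _ h (t i)) fun u hu => ?_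
  rw [energy_one_self, mass_self]
  have hz : ∀ x y, x ≤ 0 → u.1 (x, y) = 0 := fun x y hx =>
    image_eq_zero_of_notMem_tsupport fun hm => not_lt.2 hx (TF.supp u hm).1
  refine le_integral_of_lineIneq hh hh3 (TF.smooth u) (TF.cpt u)
    ((TF.supp u).trans (rightTri_subset hh)) hΛ hN (lineIneq_Ici h Λ) ?_ ?_
  · rintro s (rfl | ⟨i, rfl⟩)
    · simp [modeProj, hz 0 _ le_rfl]
    · have := hu i
      rwa [sliceFun, LinearMap.coe_mk, AddHom.coe_mk, abs_of_nonneg (ht i)] at this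
  · intro s hs
    simp [modeProj, reflX, hz (-s) _ (neg_nonpos.2 hs)]

end ThinLowerGlobal

section Airy

/-- A lower bound for the Airy form on `[α, β]` with boundary terms. -/
def AiryBound (c α β r s : ℝ) : Prop :=
  ∀ φ φ' : ℝ → ℝ, (∀ x, HasDerivAt φ (φ' x) x) → Continuous φ' →
    c * (∫ x in α..β, φ x ^ 2) + (s * φ β ^ 2 - r * φ α ^ 2) ≤ ∫ x in α..β, (φ' x ^ 2 + x * φ x ^ 2)

namespace AiryBound

variable {c α β γ r s r' s' : ℝ}

theorem weaken (H : AiryBound c α β r s) (hr : r ≤ r') (hs : s' ≤ s) : AiryBound c α β r' s' := by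
  intro φ φ' hd hc
  have := H φ φ' hd hc
  nlinarith [mul_le_mul_of_nonneg_right hr (sq_nonneg (φ α)),
    mul_le_mul_of_nonneg_right hs (sq_nonneg (φ β))]

theorem chain (H : AiryBound c α β r s) (H' : AiryBound c β γ s s') : AiryBound c α γ r s' := by
  intro φ φ' hd hc
  have h1 := H φ φ' hd hc
  have h2 := H' φ φ' hd hc
  have cφ : Continuous φ := continuous_iff_continuousAt.2 fun x => (hd x).continuousAt
  rw [← intervalIntegral.integral_add_adjacent_intervals (b := β) (f := fun x => φ x ^ 2),
    ← intervalIntegral.integral_add_adjacent_intervals (b := β) (f := fun x => φ' x ^ 2 + x * φ x ^ 2)]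
  · linarith
  all_goals exact Continuous.intervalIntegrable (by fun_prop) _ _

theorem shift (H : AiryBound c α β r s) (z : ℝ) : AiryBound (c + z) (α + z) (β + z) r s := by
  intro φ φ' hd hc
  have h1 := H (fun x => φ (x + z)) (fun x => φ' (x + z)) (fun x => (hd (x + z)).comp_add_const x z)
    (by fun_prop)
  have cφ : Continuous φ := continuous_iff_continuousAt.2 fun x => (hd x).continuousAt
  have e1 := intervalIntegral.integral_comp_add_right (fun x => φ x ^ 2) z (a := α) (b := β)
  have e2 := intervalIntegral.integral_comp_add_right (fun x => φ' x ^ 2 + (x - z) * φ x ^ 2) z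
    (a := α) (b := β)
  simp only [add_sub_cancel_right] at e2
  rw [e1, e2] at h1
  have e3 : (fun x => φ' x ^ 2 + x * φ x ^ 2) =
    fun x => (φ' x ^ 2 + (x - z) * φ x ^ 2) + z * φ x ^ 2 := by ext x; ring
  rw [e3, intervalIntegral.integral_add, intervalIntegral.integral_const_mul]
  · linarith
  all_goals exact Continuous.intervalIntegrable (by fun_prop) _ _

theorem tail {κ T : ℝ} (hT : α ≤ T) (hκ : κ ^ 2 ≤ α - c) : AiryBound c α T (-κ) (-κ) := by
  intro φ φ' hd hc
  have h1 : ∀ x, HasDerivAt (fun x => exp (-κ * x)) (-κ * exp (-κ * x)) x := fun x => by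
    have := ((hasDerivAt_id x).const_mul (-κ)).exp
    exact this.congr_deriv (by simp; ring)
  have h2 : ∀ x, HasDerivAt (fun x => -κ * exp (-κ * x)) (κ ^ 2 * exp (-κ * x)) x := fun x =>
    ((h1 x).const_mul (-κ)).congr_deriv (by ring)
  have := barta hT hd hc continuous_id h1 h2 (by fun_prop) (fun x _ => exp_pos _) (c := c)
    fun x hx => mul_le_mul_of_nonneg_right (by simp only [id]; linarith [hx.1]) (exp_pos _).le
  simp only [mul_div_cancel_right₀ _ (exp_ne_zero _)] at this
  simpa using this

/-- A polynomial supersolution gives a lower bound. -/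
theorem of_poly (a₁ a₂ a₃ a₄ a₅ a₆ a₇ m l : ℝ) (hα : m - l = α) (hβ : m + l = β) (hl : 0 ≤ l)
    (hpos : ∀ t, 0 ≤ l + t → 0 ≤ l - t → 0 < 1 + a₁ * t + a₂ * t ^ 2 + a₃ * t ^ 3 + a₄ * t ^ 4 +
      a₅ * t ^ 5 + a₆ * t ^ 6 + a₇ * t ^ 7)
    (hsup : ∀ t, 0 ≤ l + t → 0 ≤ l - t → 2 * a₂ + 6 * a₃ * t + 12 * a₄ * t ^ 2 + 20 * a₅ * t ^ 3 +
      30 * a₆ * t ^ 4 + 42 * a₇ * t ^ 5 ≤ (m + t - c) * (1 + a₁ * t + a₂ * t ^ 2 + a₃ * t ^ 3 +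
      a₄ * t ^ 4 + a₅ * t ^ 5 + a₆ * t ^ 6 + a₇ * t ^ 7))
    (hr : a₁ - 2 * a₂ * l + 3 * a₃ * l ^ 2 - 4 * a₄ * l ^ 3 + 5 * a₅ * l ^ 4 - 6 * a₆ * l ^ 5 +
      7 * a₇ * l ^ 6 ≤ r * (1 - a₁ * l + a₂ * l ^ 2 - a₃ * l ^ 3 + a₄ * l ^ 4 - a₅ * l ^ 5 +
      a₆ * l ^ 6 - a₇ * l ^ 7))
    (hs : s * (1 + a₁ * l + a₂ * l ^ 2 + a₃ * l ^ 3 + a₄ * l ^ 4 + a₅ * l ^ 5 + a₆ * l ^ 6 + a₇ * l ^ 7)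
      ≤ a₁ + 2 * a₂ * l + 3 * a₃ * l ^ 2 + 4 * a₄ * l ^ 3 + 5 * a₅ * l ^ 4 + 6 * a₆ * l ^ 5 +
      7 * a₇ * l ^ 6) : AiryBound c α β r s := by
  subst hα hβ
  intro φ φ' hd hc
  have h0 : ∀ (n : ℕ) (x : ℝ), HasDerivAt (fun x => (x - m) ^ (n + 1)) ((n + 1) * (x - m) ^ n) x :=
    fun n x => by
      have := ((hasDerivAt_id x).sub_const m).pow (n + 1)
      exact this.congr_deriv (by simp)
  have h1 : ∀ x, HasDerivAt (fun x => 1 + a₁ * (x - m) ^ 1 + a₂ * (x - m) ^ 2 + a₃ * (x - m) ^ 3 +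
      a₄ * (x - m) ^ 4 + a₅ * (x - m) ^ 5 + a₆ * (x - m) ^ 6 + a₇ * (x - m) ^ 7)
      (a₁ + 2 * a₂ * (x - m) ^ 1 + 3 * a₃ * (x - m) ^ 2 + 4 * a₄ * (x - m) ^ 3 +
      5 * a₅ * (x - m) ^ 4 + 6 * a₆ * (x - m) ^ 5 + 7 * a₇ * (x - m) ^ 6) x := fun x => by
    have := ((((((((h0 0 x).const_mul a₁).const_add 1).add ((h0 1 x).const_mul a₂)).add
      ((h0 2 x).const_mul a₃)).add ((h0 3 x).const_mul a₄)).add ((h0 4 x).const_mul a₅)).add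
      ((h0 5 x).const_mul a₆)).add ((h0 6 x).const_mul a₇)
    exact this.congr_deriv (by push_cast; ring)
  have h2 : ∀ x, HasDerivAt (fun x => a₁ + 2 * a₂ * (x - m) ^ 1 + 3 * a₃ * (x - m) ^ 2 +
      4 * a₄ * (x - m) ^ 3 + 5 * a₅ * (x - m) ^ 4 + 6 * a₆ * (x - m) ^ 5 + 7 * a₇ * (x - m) ^ 6)
      (2 * a₂ + 6 * a₃ * (x - m) + 12 * a₄ * (x - m) ^ 2 + 20 * a₅ * (x - m) ^ 3 +
      30 * a₆ * (x - m) ^ 4 + 42 * a₇ * (x - m) ^ 5) x := fun x => by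
    have := (((((((h0 0 x).const_mul (2 * a₂)).const_add a₁).add ((h0 1 x).const_mul (3 * a₃))).add
      ((h0 2 x).const_mul (4 * a₄))).add ((h0 3 x).const_mul (5 * a₅))).add
      ((h0 4 x).const_mul (6 * a₆))).add ((h0 5 x).const_mul (7 * a₇))
    exact this.congr_deriv (by push_cast; ring)
  have key := barta (α := m - l) (β := m + l) (by linarith) hd hc continuous_id h1 h2 (by fun_prop)
    (fun x hx => by
      have := hpos (x - m) (by linarith [hx.1]) (by linarith [hx.2])
      linarith) (c := c) (fun x hx => by
      have := hsup (x - m) (by linarith [hx.1]) (by linarith [hx.2])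
      rw [add_sub_cancel] at this
      simp only [pow_one, id]
      exact this)
  have p1 := hpos l (by linarith) (by linarith)
  have p2 := hpos (-l) (by linarith) (by linarith)
  have e1 : m + l - m = l := by ring
  have e2 : m - l - m = -l := by ring
  simp only [e1, e2, id, pow_one] at key
  refine le_trans ?_ key
  refine add_le_add le_rfl (sub_le_sub (mul_le_mul_of_nonneg_right ?_ (sq_nonneg _))
    (mul_le_mul_of_nonneg_right ?_ (sq_nonneg _)))
  · rw [le_div_iff₀ p1]; exact hs
  · rw [div_le_iff₀ p2]
    linarith

end AiryBound

/-- The products of powers of two nonnegative numbers are nonnegative. -/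
theorem pow_mul_pow_nonneg {a b : ℝ} (ha : 0 ≤ a) (hb : 0 ≤ b) (i j : ℕ) : 0 ≤ a ^ i * b ^ j := by
  positivity

theorem airyBound_half_line {T : ℝ} (hT : 19 / 5 ≤ T) : AiryBound (58 / 25) 0 T 1000 (-6 / 5) := by
  have A : AiryBound (58 / 25) 0 (19 / 10) 1000 (-466 / 1000) := by
    refine AiryBound.of_poly (467/1000) (-691/1000) (59/1000) (119/1000) (-19/500) (-1/200) (1/250)
      (19/20) (19/20) (by norm_num) (by norm_num) (by norm_num) (fun t h1 h2 => ?_) (fun t h1 h2 => ?_)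
      (by norm_num) (by norm_num)
    · have B := pow_mul_pow_nonneg h1 h2
      linarith [B 0 7, B 1 6, B 2 5, B 3 4, B 4 3, B 5 2, B 6 1, B 7 0]
    · have B := pow_mul_pow_nonneg h1 h2
      linarith [B 0 8, B 1 7, B 2 6, B 3 5, B 4 4, B 5 3, B 6 2, B 7 1, B 8 0]
  have B : AiryBound (58 / 25) (19 / 10) (19 / 5) (-466 / 1000) (-6 / 5) := by
    refine AiryBound.of_poly (-957/1000) (253/1000) (87/1000) (-67/1000) (11/1000) (1/500) 0
      (57/20) (19/20) (by norm_num) (by norm_num) (by norm_num) (fun t h1 h2 => ?_) (fun t h1 h2 => ?_)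
      (by norm_num) (by norm_num)
    · have B := pow_mul_pow_nonneg h1 h2
      linarith [B 0 6, B 1 5, B 2 4, B 3 3, B 4 2, B 5 1, B 6 0]
    · have B := pow_mul_pow_nonneg h1 h2
      linarith [B 0 7, B 1 6, B 2 5, B 3 4, B 4 3, B 5 2, B 6 1, B 7 0]
  have C : AiryBound (58 / 25) (19 / 5) T (-(6 / 5)) (-(6 / 5)) := AiryBound.tail hT (by norm_num)
  exact (A.chain B).chain (C.weaken (by norm_num) (by norm_num))

theorem airyBound_first : AiryBound (133 / 20) 0 (5 / 4) 200 (-200) := by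
  refine AiryBound.of_poly (-11/250) (-769/250) (79/500) (783/500) (-59/500) (-29/100) 0
    (5/8) (5/8) (by norm_num) (by norm_num) (by norm_num) (fun t h1 h2 => ?_) (fun t h1 h2 => ?_)
    (by norm_num) (by norm_num)
  · have B := pow_mul_pow_nonneg h1 h2
    linarith [B 0 6, B 1 5, B 2 4, B 3 3, B 4 2, B 5 1, B 6 0]
  · have B := pow_mul_pow_nonneg h1 h2
    linarith [B 0 7, B 1 6, B 2 5, B 3 4, B 4 3, B 5 2, B 6 1, B 7 0]

theorem airyBound_second : AiryBound (133 / 20) (5 / 4) (66 / 25) 100 (-100) := by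
  refine AiryBound.of_poly (-3/50) (-121/50) (17/100) (24/25) (-1/10) (-7/50) 0
    (389/200) (139/200) (by norm_num) (by norm_num) (by norm_num) (fun t h1 h2 => ?_) (fun t h1 h2 => ?_)
    (by norm_num) (by norm_num)
  · have B := pow_mul_pow_nonneg h1 h2
    linarith [B 0 6, B 1 5, B 2 4, B 3 3, B 4 2, B 5 1, B 6 0]
  · have B := pow_mul_pow_nonneg h1 h2
    linarith [B 0 7, B 1 6, B 2 5, B 3 4, B 4 3, B 5 2, B 6 1, B 7 0]

theorem airyBound_third : AiryBound (133 / 20) (66 / 25) (433 / 100) 100 (-100) := by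
  refine AiryBound.of_poly (-1/10) (-33/20) (19/100) (43/100) (-2/25) (-1/25) 0
    (697/200) (169/200) (by norm_num) (by norm_num) (by norm_num) (fun t h1 h2 => ?_) (fun t h1 h2 => ?_)
    (by norm_num) (by norm_num)
  · have B := pow_mul_pow_nonneg h1 h2
    linarith [B 0 6, B 1 5, B 2 4, B 3 3, B 4 2, B 5 1, B 6 0]
  · have B := pow_mul_pow_nonneg h1 h2
    linarith [B 0 7, B 1 6, B 2 5, B 3 4, B 4 3, B 5 2, B 6 1, B 7 0]

theorem airyBound_unit : AiryBound (33 / 10) 0 1 3 (-3) := by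
  refine AiryBound.of_poly 0 (-33/20) 0 0 0 0 0 (1/2) (1/2) (by norm_num) (by norm_num) (by norm_num)
    (fun t h1 h2 => ?_) (fun t h1 h2 => ?_) (by norm_num) (by norm_num)
  · nlinarith
  · nlinarith [mul_nonneg h1 h2, mul_nonneg (mul_nonneg h1 h2) h1, mul_nonneg (mul_nonneg h1 h2) h2]

/-- The Airy form on `[0, T]` with Dirichlet conditions at `T` and on `N` is bounded below. -/
def AiryIneq (A T : ℝ) (N : Set ℝ) : Prop :=
  ∀ φ φ' : ℝ → ℝ, (∀ x, HasDerivAt φ (φ' x) x) → Continuous φ' → φ T = 0 → (∀ s ∈ N, φ s = 0) →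
    A * (∫ x in (0 : ℝ)..T, φ x ^ 2) ≤ ∫ x in (0 : ℝ)..T, (φ' x ^ 2 + x * φ x ^ 2)

theorem airyIneq_one {T : ℝ} (hT : 19 / 5 ≤ T) : AiryIneq (58 / 25) T {0} := by
  intro φ φ' hd hc hφT h0
  have := airyBound_half_line hT φ φ' hd hc
  rw [hφT, h0 0 rfl] at this
  linarith

theorem airyIneq_two {T : ℝ} (hT : 24 / 5 ≤ T) : AiryIneq (33 / 10) T {0, 1} := by
  intro φ φ' hd hc hφT h0
  have cφ : Continuous φ := continuous_iff_continuousAt.2 fun x => (hd x).continuousAt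
  have h1 := airyBound_unit φ φ' hd hc
  have h2 := (airyBound_half_line (T := T - 1) (by linarith)).shift 1 φ φ' hd hc
  rw [zero_add, sub_add_cancel] at h2
  rw [h0 0 (by simp), h0 1 (by simp)] at h1
  rw [h0 1 (by simp), hφT] at h2
  have n1 : 0 ≤ ∫ x in (1 : ℝ)..T, φ x ^ 2 :=
    intervalIntegral.integral_nonneg (by linarith) fun x _ => sq_nonneg _
  rw [← intervalIntegral.integral_add_adjacent_intervals (b := 1) (f := fun x => φ x ^ 2),
    ← intervalIntegral.integral_add_adjacent_intervals (b := 1) (f := fun x => φ' x ^ 2 + x * φ x ^ 2)]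
  · linarith
  all_goals exact Continuous.intervalIntegrable (by fun_prop) _ _

theorem airyIneq_four {T : ℝ} (hT : 9 ≤ T) :
    AiryIneq (133 / 20) T {0, 5 / 4, 66 / 25, 433 / 100} := by
  intro φ φ' hd hc hφT h0
  have cφ : Continuous φ := continuous_iff_continuousAt.2 fun x => (hd x).continuousAt
  have h1 := airyBound_first φ φ' hd hc
  have h2 := airyBound_second φ φ' hd hc
  have h3 := airyBound_third φ φ' hd hc
  have h4 := (airyBound_half_line (T := T - 433 / 100) (by linarith)).shift (433 / 100) φ φ' hd hc
  rw [zero_add, sub_add_cancel] at h4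
  have z0 := h0 0 (by simp)
  have z1 := h0 (5 / 4) (by simp)
  have z2 := h0 (66 / 25) (by simp)
  have z3 := h0 (433 / 100) (by simp)
  rw [z0, z1] at h1
  rw [z1, z2] at h2
  rw [z2, z3] at h3
  rw [z3, hφT] at h4
  norm_num at h4
  have i0 : ∀ a b : ℝ, IntervalIntegrable (fun x => φ x ^ 2) volume a b := fun a b =>
    Continuous.intervalIntegrable (by fun_prop) _ _
  have i1 : ∀ a b : ℝ, IntervalIntegrable (fun x => φ' x ^ 2 + x * φ x ^ 2) volume a b := fun a b =>
    Continuous.intervalIntegrable (by fun_prop) _ _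
  rw [← intervalIntegral.integral_add_adjacent_intervals (i0 0 (433 / 100)) (i0 _ T),
    ← intervalIntegral.integral_add_adjacent_intervals (i0 0 (66 / 25)) (i0 _ (433 / 100)),
    ← intervalIntegral.integral_add_adjacent_intervals (i0 0 (5 / 4)) (i0 _ (66 / 25)),
    ← intervalIntegral.integral_add_adjacent_intervals (i1 0 (433 / 100)) (i1 _ T),
    ← intervalIntegral.integral_add_adjacent_intervals (i1 0 (66 / 25)) (i1 _ (433 / 100)),
    ← intervalIntegral.integral_add_adjacent_intervals (i1 0 (5 / 4)) (i1 _ (66 / 25))]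
  linarith

theorem lineIneq_of_airyIneq {k A : ℝ} (hk : 0 < k) {N : Set ℝ}
    (hA : AiryIneq A (1 / k ^ 2) {s | k ^ 2 * s ∈ N}) :
    LineIneq (√2 * π * k ^ 3) (1 / (2 * k ^ 6) + A / k ^ 4) N := by
  intro φ φ' hd hc h1 h0
  have hk2 : k ^ 2 * (1 / k ^ 2) = 1 := by field_simp
  have cφ : Continuous φ := continuous_iff_continuousAt.2 fun x => (hd x).continuousAt
  have key := hA (fun t => φ (k ^ 2 * t)) (fun t => k ^ 2 * φ' (k ^ 2 * t))
    (fun t => by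
      have := (hd (k ^ 2 * t)).comp t ((hasDerivAt_id t).const_mul (k ^ 2))
      exact this.congr_deriv (by ring)) (by fun_prop) (by simp only [hk2]; exact h1 1 le_rfl)
    fun s hs => h0 _ hs
  have e1 := intervalIntegral.smul_integral_comp_mul_left (a := 0) (b := 1 / k ^ 2) (fun x => φ x ^ 2) (k ^ 2)
  have e2 := intervalIntegral.smul_integral_comp_mul_left (a := 0) (b := 1 / k ^ 2)
    (fun x => φ' x ^ 2 + 2 * (1 / (2 * k ^ 6)) * x * φ x ^ 2) (k ^ 2)
  rw [mul_zero, hk2, smul_eq_mul] at e1 e2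
  have hπ : (π / (√2 * π * k ^ 3)) ^ 2 = 1 / (2 * k ^ 6) := by
    rw [div_pow, mul_pow, mul_pow, sq_sqrt (by norm_num)]
    have := pi_pos
    field_simp
  rw [hπ, ← e1, ← e2, add_sub_cancel_left]
  have e3 : ∫ x in (0 : ℝ)..1 / k ^ 2, ((k ^ 2 * φ' (k ^ 2 * x)) ^ 2 + x * φ (k ^ 2 * x) ^ 2) =
      k ^ 4 * ∫ x in (0 : ℝ)..1 / k ^ 2,
        (φ' (k ^ 2 * x) ^ 2 + 2 * (1 / (2 * k ^ 6)) * (k ^ 2 * x) * φ (k ^ 2 * x) ^ 2) := by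
    rw [← intervalIntegral.integral_const_mul]
    congr 1; ext x; field_simp
  rw [e3] at key
  have := mul_le_mul_of_nonneg_left key (by positivity : 0 ≤ 1 / k ^ 2)
  calc A / k ^ 4 * (k ^ 2 * ∫ x in (0 : ℝ)..1 / k ^ 2, φ (k ^ 2 * x) ^ 2)
      = 1 / k ^ 2 * (A * ∫ x in (0 : ℝ)..1 / k ^ 2, φ (k ^ 2 * x) ^ 2) := by field_simp
    _ ≤ _ := this
    _ = _ := by field_simp

end Airy

section AiryTrials

/-- A test function for the Airy form, supported in `(α, β)`, with Rayleigh quotient below `U`. -/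
def AiryTrial (U α β : ℝ) : Prop :=
  ∃ g : ℝ → ℝ, ContDiff ℝ (⊤ : ℕ∞) g ∧ HasCompactSupport g ∧ tsupport g ⊆ Set.Ioo α β ∧
    ∫ x, (deriv g x ^ 2 + |x| * g x ^ 2) < U * ∫ x, g x ^ 2

theorem AiryTrial.of_integral {U α β : ℝ} {f f' : ℝ → ℝ} (hαβ : α < β) (hf : ContDiff ℝ (⊤ : ℕ∞) f)
    (hd : ∀ x, HasDerivAt f (f' x) x) (hα : f α = 0) (hβ : f β = 0)
    (h : ∫ x in α..β, (f' x ^ 2 + (|x| - U) * f x ^ 2) < 0) : AiryTrial U α β := by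
  refine exists_bump_lt hαβ hf hα hβ continuous_abs ?_
  have e : deriv f = f' := funext fun x => (hd x).deriv
  have cf := hf.continuous
  have cf' : Continuous f' := e ▸ hf.continuous_deriv (by simp)
  rw [e, ← intervalIntegral.integral_const_mul, ← sub_neg, ← intervalIntegral.integral_sub]
  · refine lt_of_eq_of_lt (intervalIntegral.integral_congr fun x _ => ?_) h
    ring
  all_goals exact Continuous.intervalIntegrable (by fun_prop) _ _

theorem integral_sum_pow {n : ℕ} (c : Fin n → ℝ) (a b : ℝ) :
    ∫ x in a..b, ∑ i, c i * x ^ (i : ℕ) = ∑ i, c i * ((b ^ (i + 1 : ℕ) - a ^ (i + 1 : ℕ)) / (i + 1)) := by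
  rw [intervalIntegral.integral_finsetSum]
  · simp
  · exact fun i _ => Continuous.intervalIntegrable (by fun_prop) _ _

theorem AiryTrial.of_poly {U α β : ℝ} {f f' : ℝ → ℝ} (h0 : 0 ≤ α) (hαβ : α < β)
    (hf : ContDiff ℝ (⊤ : ℕ∞) f) (hd : ∀ x, HasDerivAt f (f' x) x) (hα : f α = 0) (hβ : f β = 0)
    {n : ℕ} (c : Fin n → ℝ) (hc : ∀ x, f' x ^ 2 + (x - U) * f x ^ 2 = ∑ i, c i * x ^ (i : ℕ))
    (h : ∑ i, c i * ((β ^ (i + 1 : ℕ) - α ^ (i + 1 : ℕ)) / (i + 1)) < 0) : AiryTrial U α β := by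
  refine .of_integral hαβ hf hd hα hβ (lt_of_eq_of_lt ?_ (integral_sum_pow c α β ▸ h))
  refine intervalIntegral.integral_congr fun x hx => ?_
  rw [Set.uIcc_of_le hαβ.le] at hx
  simp only [abs_of_nonneg (h0.trans hx.1), hc]

theorem airyTrial_left : AiryTrial (823 / 200) 0 (7 / 4) := by
  refine .of_poly (f := fun x => x * (7 / 4 - x) * (1 + x * (7 / 4 - x) / 3))
    (f' := fun x => (7 / 4 - 2 * x) * (1 + 2 * (x * (7 / 4 - x)) / 3)) le_rfl (by norm_num)
    (by fun_prop) (fun x => ?_) (by norm_num) (by norm_num) ![49/16, 7/48, -715693/28800, 137039/19200, 13471561/460800, -115309/6400, -13259/4800, 2059/450, -247/200, 1/9]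
    (fun x => ?_) ?_
  · have A := (hasDerivAt_id x).mul ((hasDerivAt_id x).const_sub (7 / 4))
    exact (A.mul ((A.div_const 3).const_add 1)).congr_deriv (by simp; ring)
  · simp [Fin.sum_univ_succ]; ring
  · norm_num [Fin.sum_univ_succ]

theorem airyTrial_right : AiryTrial (823 / 200) (7 / 4) (27 / 4) := by
  refine .of_poly (f := fun x => (x - 7 / 4) * (x - 27 / 4) ^ 3)
    (f' := fun x => (x - 27 / 4) ^ 2 * (4 * x - 12)) (by norm_num) (by norm_num)
    (by fun_prop) (fun x => ?_) (by norm_num) (by norm_num)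
    ![-11705297855103/13107200, 3825709658721/1638400, -489551501619/204800, 33442969527/25600, -2202260301/5120, 287670831/3200, -9647399/800, 100931/100, -9623/200, 1]
    (fun x => ?_) ?_
  · have A := (((hasDerivAt_id x).sub_const (7 / 4)).mul (((hasDerivAt_id x).sub_const (27 / 4)).pow 3))
    exact A.congr_deriv (by simp; ring)
  · simp [Fin.sum_univ_succ]; ring
  · norm_num [Fin.sum_univ_succ]

theorem airyTrial_ground : AiryTrial (16 / 5) 0 5 := by
  refine .of_poly (f := fun x => x * (x - 5) ^ 3)
    (f' := fun x => (x - 5) ^ 2 * (4 * x - 5)) (by norm_num) (by norm_num)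
    (by fun_prop) (fun x => ?_) (by norm_num) (by norm_num)
    ![15625, -37500, -16250, 61125, -45525, 17015, -3684, 471, -166/5, 1]
    (fun x => ?_) ?_
  · have A := ((hasDerivAt_id x).mul (((hasDerivAt_id x).sub_const 5).pow 3))
    exact A.congr_deriv (by simp; ring)
  · simp [Fin.sum_univ_succ]; ring
  · norm_num [Fin.sum_univ_succ]

theorem airyTrial_symm : AiryTrial (83 / 80) (-4) 4 := by
  have hf : ContDiff ℝ (⊤ : ℕ∞) fun x : ℝ => (16 - x ^ 2) ^ 5 := by fun_prop
  refine .of_integral (f' := fun x => -10 * x * (16 - x ^ 2) ^ 4) (by norm_num) hf (fun x => ?_)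
    (by norm_num) (by norm_num) ?_
  · have A := (((hasDerivAt_id x).pow 2).const_sub 16).pow 5
    exact A.congr_deriv (by simp; ring)
  have key : ∫ x in (0 : ℝ)..4, ((-10 * x * (16 - x ^ 2) ^ 4) ^ 2 +
      (|x| - 83 / 80) * ((16 - x ^ 2) ^ 5) ^ 2) < 0 := by
    refine lt_of_eq_of_lt (b := ∫ x in (0 : ℝ)..4, ∑ i, ![-5703716569088/5, 1099511627776, 1142461300736, -687194767360, -415269650432, 193273528320, 80396419072, -32212254720, -9527361536, 3523215360, 3664510976/5, -264241152, -37216256, 13762560, 1226752, -491520, -24752, 11520, 266, -160, -83/80, 1] i * x ^ (i : ℕ)) ?_ ?_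
    · refine intervalIntegral.integral_congr fun x hx => ?_
      rw [Set.uIcc_of_le (by norm_num)] at hx
      simp only [abs_of_nonneg hx.1]
      simp [Fin.sum_univ_succ]; ring
    · rw [integral_sum_pow]
      norm_num [Fin.sum_univ_succ]
  have e := intervalIntegral.integral_comp_neg (a := 0) (b := 4) fun x : ℝ =>
    ((-10 * x * (16 - x ^ 2) ^ 4) ^ 2 + (|x| - 83 / 80) * ((16 - x ^ 2) ^ 5) ^ 2)
  simp only [abs_neg, neg_sq, mul_neg, neg_mul, neg_neg, neg_zero] at e key ⊢
  rw [← intervalIntegral.integral_add_adjacent_intervals (b := 0)]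
  · linarith
  all_goals exact Continuous.intervalIntegrable (by fun_prop) _ _

theorem airyTrial_unit (j : ℕ) (hj : j < 4) : AiryTrial 15 j (j + 1) := by
  refine .of_poly (f := fun x => (x - j) * (j + 1 - x)) (f' := fun x => 2 * j + 1 - 2 * x)
    (by positivity) (by linarith) (by fun_prop) (fun x => ?_) (by simp) (by simp)
    ![(2 * j + 1) ^ 2 - 15 * (j * (j + 1)) ^ 2,
      -4 * (2 * j + 1) + (j * (j + 1)) ^ 2 + 30 * (j * (j + 1)) * (2 * j + 1),
      4 - 2 * (j * (j + 1)) * (2 * j + 1) - 15 * ((2 * j + 1) ^ 2 + 2 * (j * (j + 1))),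
      (2 * j + 1) ^ 2 + 2 * (j * (j + 1)) + 30 * (2 * j + 1),
      -15 - 2 * (2 * j + 1), 1] (fun x => ?_) ?_
  · have A := ((hasDerivAt_id x).sub_const (j : ℝ)).mul ((hasDerivAt_id x).const_sub ((j : ℝ) + 1))
    exact A.congr_deriv (by simp; ring)
  · simp [Fin.sum_univ_succ]; ring
  · interval_cases j <;> norm_num [Fin.sum_univ_succ]

end AiryTrials

section ThinTrials

/-- A function concentrated on the first transverse mode of a thin strip of width `1 / r ^ 2`. -/
def thinFun (γ r s : ℝ → ℝ) (z : ℝ × ℝ) : ℝ := γ z.1 * r z.1 * s (z.2 * r z.1 ^ 2)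

variable {γ r s : ℝ → ℝ}

theorem contDiff_thinFun (hγ : ContDiff ℝ (⊤ : ℕ∞) γ) (hr : ContDiff ℝ (⊤ : ℕ∞) r)
    (hs : ContDiff ℝ (⊤ : ℕ∞) s) : ContDiff ℝ (⊤ : ℕ∞) (thinFun γ r s) :=
  ((hγ.comp contDiff_fst).mul (hr.comp contDiff_fst)).mul
    (hs.comp (contDiff_snd.mul ((hr.comp contDiff_fst).pow 2)))

theorem hasCompactSupport_thinFun (cr : Continuous r) (hr : ∀ x, 0 < r x) (hγ : HasCompactSupport γ)
    (hs : HasCompactSupport s) : HasCompactSupport (thinFun γ r s) ∧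
    ∀ z ∈ tsupport (thinFun γ r s), z.1 ∈ tsupport γ ∧ z.2 * r z.1 ^ 2 ∈ tsupport s := by
  set K : Set (ℝ × ℝ) := (fun p : ℝ × ℝ => (p.1, p.2 / r p.1 ^ 2)) '' (tsupport γ ×ˢ tsupport s)
  have hK : IsCompact K := (hγ.isCompact.prod hs.isCompact).image
    (continuous_fst.prodMk (continuous_snd.div₀ ((cr.comp continuous_fst).pow 2)
      fun p => (pow_pos (hr _) 2).ne'))
  have h0 : ∀ z, z ∉ K → thinFun γ r s z = 0 := by
    intro z hz
    by_contra h
    have h1 : γ z.1 ≠ 0 := fun h' => h (by simp [thinFun, h'])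
    have h2 : s (z.2 * r z.1 ^ 2) ≠ 0 := fun h' => h (by simp [thinFun, h'])
    refine hz ⟨(z.1, z.2 * r z.1 ^ 2), ⟨subset_tsupport _ h1, subset_tsupport _ h2⟩, ?_⟩
    simp [(hr z.1).ne']
  refine ⟨HasCompactSupport.intro hK h0, fun z hz => ?_⟩
  have : tsupport (thinFun γ r s) ⊆ K := closure_minimal
    (fun z hz => by_contra fun h => hz (h0 z h)) hK.isClosed
  obtain ⟨p, ⟨h1, h2⟩, rfl⟩ := this hz
  refine ⟨h1, ?_⟩
  simpa [(hr p.1).ne'] using h2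

theorem integral_comp_mul_sq {a : ℝ} (ha : 0 < a) (g : ℝ → ℝ) :
    ∫ y, g (y * a ^ 2) = (∫ y, g y) / a ^ 2 := by
  rw [Measure.integral_comp_mul_right, abs_of_pos (by positivity), smul_eq_mul]; ring

theorem integral_thinFun_sq (hγ : ContDiff ℝ (⊤ : ℕ∞) γ) (hr : ContDiff ℝ (⊤ : ℕ∞) r)
    (hs : ContDiff ℝ (⊤ : ℕ∞) s) (hr0 : ∀ x, 0 < r x) (cγ : HasCompactSupport γ)
    (cs : HasCompactSupport s) :
    ∫ z, thinFun γ r s z ^ 2 = (∫ y, s y ^ 2) * ∫ x, γ x ^ 2 := by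
  have hu := contDiff_thinFun hγ hr hs
  have hc := (hasCompactSupport_thinFun hr.continuous hr0 cγ cs).1
  rw [integral_eq_integral_slice (G := fun z => thinFun γ r s z ^ 2) (hu.continuous.pow 2)
    (hc.comp_left (g := fun t => t ^ 2) (by norm_num)), ← integral_const_mul]
  congr 1; ext x
  have := integral_comp_mul_sq (hr0 x) fun t => (γ x * r x * s t) ^ 2
  simp only [thinFun]
  rw [this]
  simp only [mul_pow _ (s _)]
  rw [integral_const_mul]
  have := (hr0 x).ne'
  field_simp

theorem integral_mul_transport (hs : ContDiff ℝ (⊤ : ℕ∞) s) (cs : HasCompactSupport s) :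
    ∫ y, s y * (s y + 2 * y * deriv s y) = 0 := by
  have h1 : ∀ y, HasDerivAt (fun y => y * s y ^ 2) (s y * (s y + 2 * y * deriv s y)) y := fun y => by
    have := (hs.differentiable (by simp) y).hasDerivAt
    exact ((hasDerivAt_id y).mul (this.pow 2)).congr_deriv (by simp; ring)
  have c1 : HasCompactSupport fun y => y * s y ^ 2 :=
    (cs.comp_left (g := fun t => t ^ 2) (by norm_num)).mul_left
  refine integral_eq_zero_of_hasDerivAt_of_integrable h1 ?_ ?_
  · have := hs.continuous_deriv (by simp)
    have := hs.continuous
    exact Continuous.integrable_of_hasCompactSupport (by fun_prop) cs.mul_right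
  · exact (by have := hs.continuous; fun_prop : Continuous fun y => y * s y ^ 2).integrable_of_hasCompactSupport c1

theorem integral_grad_thinFun_sq (hγ : ContDiff ℝ (⊤ : ℕ∞) γ) (hr : ContDiff ℝ (⊤ : ℕ∞) r)
    (hs : ContDiff ℝ (⊤ : ℕ∞) s) (hr0 : ∀ x, 0 < r x) (cγ : HasCompactSupport γ)
    (cs : HasCompactSupport s) :
    (∫ z, px (thinFun γ r s) z ^ 2) + ∫ z, py (thinFun γ r s) z ^ 2 =
      (∫ y, s y ^ 2) * (∫ x, deriv γ x ^ 2) +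
      (∫ y, (s y + 2 * y * deriv s y) ^ 2) * (∫ x, (γ x * (deriv r x / r x)) ^ 2) +
      (∫ y, deriv s y ^ 2) * ∫ x, r x ^ 4 * γ x ^ 2 := by
  have hu := contDiff_thinFun hγ hr hs
  have hc := (hasCompactSupport_thinFun hr.continuous hr0 cγ cs).1
  have hd : ∀ {f : ℝ → ℝ}, ContDiff ℝ (⊤ : ℕ∞) f → ∀ x, HasDerivAt f (deriv f x) x := fun hf x =>
    (hf.differentiable (by simp) x).hasDerivAt
  have cd : ∀ {f : ℝ → ℝ}, ContDiff ℝ (⊤ : ℕ∞) f → Continuous (deriv f) := fun hf =>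
    hf.continuous_deriv (by simp)
  have csq : ∀ {X : Type} [TopologicalSpace X] {f : X → ℝ}, HasCompactSupport f →
    HasCompactSupport fun x => f x ^ 2 := fun hf => hf.comp_left (g := fun t => t ^ 2) (by norm_num)
  have c1 := hγ.continuous
  have c2 := hr.continuous
  have c3 := hs.continuous
  have c4 := cd hγ
  have c5 := cd hr
  have c6 := cd hs
  have hpx : ∀ x y, px (thinFun γ r s) (x, y) = (fun t => deriv γ x * r x * s t +
      γ x * deriv r x * (s t + 2 * t * deriv s t)) (y * r x ^ 2) := by
    intro x y
    refine (hasDerivAt_slice_left hu x y).unique ?_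
    have A := ((hd hγ x).mul (hd hr x)).mul
      ((hd hs (y * r x ^ 2)).comp x (((hd hr x).pow 2).const_mul y))
    exact A.congr_deriv (by simp; ring)
  have hpy : ∀ x y, py (thinFun γ r s) (x, y) =
      (fun t => γ x * r x ^ 3 * deriv s t) (y * r x ^ 2) := by
    intro x y
    refine (hasDerivAt_slice_right hu x y).unique ?_
    have A := ((hd hs (y * r x ^ 2)).comp y ((hasDerivAt_id y).mul_const (r x ^ 2))).const_mul
      (γ x * r x)
    exact A.congr_deriv (by simp; ring)
  have i1 : Integrable fun y => s y ^ 2 := (c3.pow 2).integrable_of_hasCompactSupport (csq cs)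
  have i2 : Integrable fun y => s y * (s y + 2 * y * deriv s y) :=
    Continuous.integrable_of_hasCompactSupport (by fun_prop) cs.mul_right
  have i3 : Integrable fun y => (s y + 2 * y * deriv s y) ^ 2 :=
    Continuous.integrable_of_hasCompactSupport (by fun_prop) (csq (cs.add cs.deriv.mul_left))
  have sx : ∀ x, ∫ y, px (thinFun γ r s) (x, y) ^ 2 = (∫ y, s y ^ 2) * deriv γ x ^ 2 +
      (∫ y, (s y + 2 * y * deriv s y) ^ 2) * (γ x * (deriv r x / r x)) ^ 2 := by
    intro x
    simp only [hpx]
    rw [integral_comp_mul_sq (hr0 x) fun t => (deriv γ x * r x * s t +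
      γ x * deriv r x * (s t + 2 * t * deriv s t)) ^ 2]
    have e : (fun t => (deriv γ x * r x * s t + γ x * deriv r x * (s t + 2 * t * deriv s t)) ^ 2) =
      fun t => (deriv γ x * r x) ^ 2 * s t ^ 2 + (2 * (deriv γ x * r x) * (γ x * deriv r x)) *
        (s t * (s t + 2 * t * deriv s t)) + (γ x * deriv r x) ^ 2 * (s t + 2 * t * deriv s t) ^ 2 := by
      ext t; ring
    rw [e, integral_add, integral_add, integral_const_mul, integral_const_mul, integral_const_mul,
      integral_mul_transport hs cs]
    · have := (hr0 x).ne'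
      field_simp
      ring
    all_goals first | exact (i1.const_mul _) | exact i2.const_mul _ | exact i3.const_mul _ |
      exact (i1.const_mul _).add (i2.const_mul _)
  have sy : ∀ x, ∫ y, py (thinFun γ r s) (x, y) ^ 2 =
      (∫ y, deriv s y ^ 2) * (r x ^ 4 * γ x ^ 2) := by
    intro x
    simp only [hpy]
    rw [integral_comp_mul_sq (hr0 x) fun t => (γ x * r x ^ 3 * deriv s t) ^ 2]
    simp only [mul_pow _ (deriv s _)]
    rw [integral_const_mul]
    have := (hr0 x).ne'
    field_simp
  rw [integral_eq_integral_slice (G := fun z => px (thinFun γ r s) z ^ 2)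
    ((continuous_px hu).pow 2) (csq (hasCompactSupport_px hc)),
    integral_eq_integral_slice (G := fun z => py (thinFun γ r s) z ^ 2)
    ((continuous_py hu).pow 2) (csq (hasCompactSupport_py hc))]
  simp only [sx, sy]
  rw [integral_add, integral_const_mul, integral_const_mul, integral_const_mul]
  · exact ((c4.pow 2).integrable_of_hasCompactSupport (csq cγ.deriv)).const_mul _
  · refine Integrable.const_mul (Continuous.integrable_of_hasCompactSupport ?_ (csq cγ.mul_right)) _
    exact (c1.mul (c5.div₀ c2 fun x => (hr0 x).ne')).pow 2

end ThinTrials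

section ThinEstimates

theorem exists_transverse {ε : ℝ} (hε : 0 < ε) : ∃ s : ℝ → ℝ, ContDiff ℝ (⊤ : ℕ∞) s ∧
    HasCompactSupport s ∧ tsupport s ⊆ Set.Ioo 0 1 ∧
    ∫ y, deriv s y ^ 2 < π ^ 2 * (1 + ε) * ∫ y, s y ^ 2 := by
  have hd : ∀ x, HasDerivAt (fun x => sin (π * x)) (π * cos (π * x)) x := fun x => by
    have := ((hasDerivAt_id x).const_mul π).sin
    exact this.congr_deriv (by simp; ring)
  have e1 : deriv (fun x => sin (π * x)) = fun x => π * cos (π * x) := funext fun x => (hd x).deriv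
  have hi : ∫ x in (0 : ℝ)..1, sin (π * x) ^ 2 = 1 / 2 := by
    have := intervalIntegral.integral_comp_mul_left (a := 0) (b := 1) (fun x => sin x ^ 2) pi_ne_zero
    rw [this, mul_zero, mul_one, integral_sin_sq]
    simp
    field_simp
  have hi' : ∫ x in (0 : ℝ)..1, cos (π * x) ^ 2 = 1 / 2 := by
    have := intervalIntegral.integral_comp_mul_left (a := 0) (b := 1) (fun x => cos x ^ 2) pi_ne_zero
    rw [this, mul_zero, mul_one, integral_cos_sq]
    simp
    field_simp
  obtain ⟨s, h1, h2, h3, h4⟩ := exists_bump_lt (f := fun x => sin (π * x)) (V := fun _ => 0)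
    (U := π ^ 2 * (1 + ε)) zero_lt_one (by fun_prop) (by simp) (by simp) continuous_const (by
      simp only [e1, zero_mul, add_zero, mul_pow]
      rw [intervalIntegral.integral_const_mul, hi, hi']
      have : 0 < π ^ 2 * ε := by positivity
      linarith)
  exact ⟨s, h1, h2, h3, by simpa using h4⟩

theorem exists_profile {h δ : ℝ} (hh : 0 < h) (hδ : 0 < δ) (hδ1 : δ ≤ 1) : ∃ r : ℝ → ℝ,
    ContDiff ℝ (⊤ : ℕ∞) r ∧ (∀ x, 0 < r x) ∧ ∀ x, |x| ≤ 1 / 2 → (deriv r x / r x) ^ 2 ≤ 9 / 4 ∧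
      h ^ 2 * r x ^ 4 ≤ 1 + 2 * |x| + 5 * δ + 10 * x ^ 2 ∧ 1 ≤ h * r x ^ 2 * (1 - |x|) := by
  set q : ℝ → ℝ := fun x => √(x ^ 2 + δ ^ 2) with hq
  have hq0 : ∀ x, 0 < q x := fun x => sqrt_pos.2 (by positivity)
  have hqs : ∀ x, q x ^ 2 = x ^ 2 + δ ^ 2 := fun x => sq_sqrt (by positivity)
  have hq1 : ∀ x, |x| ≤ q x := fun x => abs_le_sqrt (by nlinarith)
  have hq2 : ∀ x, q x ≤ |x| + δ := fun x => sqrt_le_iff.2 ⟨by positivity, by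
    nlinarith [sq_abs x, mul_nonneg (abs_nonneg x) hδ.le]⟩
  have hqc : ContDiff ℝ (⊤ : ℕ∞) q :=
    ContDiff.sqrt (by fun_prop) fun x => (by positivity : 0 < x ^ 2 + δ ^ 2).ne'
  have hqd : ∀ x, HasDerivAt q (x / q x) x := fun x => by
    have := ((hasDerivAt_pow 2 x).add_const (δ ^ 2)).sqrt (by positivity)
    exact this.congr_deriv (by have := (hq0 x).ne'; simp only [hq] at this ⊢; field_simp; simp)
  set ρ : ℝ → ℝ := fun x => 1 + q x + 2 * x ^ 2 with hρ
  have hρ0 : ∀ x, 1 ≤ ρ x := fun x => by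
    have := hq0 x
    simp only [hρ]; nlinarith [sq_nonneg x]
  have hp : ∀ x, 0 < ρ x / h := fun x => div_pos (by linarith [hρ0 x]) hh
  have hρd : ∀ x, HasDerivAt ρ (x / q x + 4 * x) x := fun x => by
    have := ((hqd x).const_add 1).add ((hasDerivAt_pow 2 x).const_mul 2)
    exact this.congr_deriv (by simp; ring)
  have hrd : ∀ x, HasDerivAt (fun x => √(ρ x / h)) ((x / q x + 4 * x) / h / (2 * √(ρ x / h))) x :=
    fun x => ((hρd x).div_const h).sqrt (hp x).ne'
  refine ⟨fun x => √(ρ x / h), ContDiff.sqrt (by fun_prop) fun x => (hp x).ne',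
    fun x => sqrt_pos.2 (hp x), fun x hx => ?_⟩
  have hs : √(ρ x / h) ^ 2 = ρ x / h := sq_sqrt (hp x).le
  have hx0 := abs_nonneg x
  have hx2 := sq_abs x
  refine ⟨?_, ?_, ?_⟩
  · rw [(hrd x).deriv]
    have e : (x / q x + 4 * x) / h / (2 * √(ρ x / h)) / √(ρ x / h) = (x / q x + 4 * x) / (2 * ρ x) := by
      have h1 := (sqrt_pos.2 (hp x)).ne'
      have h2 : ρ x ≠ 0 := by linarith [hρ0 x]
      have e2 : (x / q x + 4 * x) / h / (2 * √(ρ x / h)) / √(ρ x / h) =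
        (x / q x + 4 * x) / (h * (2 * √(ρ x / h) ^ 2)) := by field_simp
      rw [e2, hs]; field_simp
    rw [e, ← sq_abs, show (9 / 4 : ℝ) = (3 / 2) ^ 2 by norm_num]
    refine pow_le_pow_left₀ (abs_nonneg _) ?_ 2
    rw [abs_div, abs_of_pos (by linarith [hρ0 x] : 0 < 2 * ρ x), div_le_iff₀ (by linarith [hρ0 x])]
    have h3 : |x / q x| ≤ 1 := by
      rw [abs_div, abs_of_pos (hq0 x), div_le_one (hq0 x)]; exact hq1 x
    have h4 := abs_add_le (x / q x) (4 * x)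
    rw [abs_mul, abs_of_pos (by norm_num : (0 : ℝ) < 4)] at h4
    linarith [hρ0 x]
  · have e : h ^ 2 * √(ρ x / h) ^ 4 = ρ x ^ 2 := by
      rw [show √(ρ x / h) ^ 4 = (√(ρ x / h) ^ 2) ^ 2 by ring, hs]; field_simp
    rw [e]
    have h5 : ρ x ≤ 1 + (|x| + δ + 2 * x ^ 2) := by simp only [hρ]; linarith [hq2 x]
    have h6 : ρ x ^ 2 ≤ (1 + (|x| + δ + 2 * x ^ 2)) ^ 2 :=
      pow_le_pow_left₀ (by linarith [hρ0 x]) h5 2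
    have h7 : x ^ 2 ≤ 1 / 4 := by nlinarith
    nlinarith [sq_nonneg (|x| - δ), sq_nonneg (|x| - 2 * x ^ 2), sq_nonneg (δ - 2 * x ^ 2),
      mul_nonneg hδ.le (sub_nonneg.2 hδ1), mul_nonneg (sq_nonneg x) (sub_nonneg.2 h7)]
  · have e : h * √(ρ x / h) ^ 2 = ρ x := by rw [hs]; field_simp
    rw [e]
    have h5 : 1 + |x| + 2 * |x| ^ 2 ≤ ρ x := by simp only [hρ]; nlinarith [hq1 x]
    have h6 := mul_le_mul_of_nonneg_right h5 (by linarith : 0 ≤ 1 - |x|)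
    nlinarith [mul_nonneg (sq_nonneg |x|) (by linarith : 0 ≤ 1 - 2 * |x|)]

/-- There is a test function supported in `P` with Rayleigh quotient at most `μ`. -/
def PlaneTrial (P : Set (ℝ × ℝ)) (μ : ℝ) : Prop :=
  ∃ u : ℝ × ℝ → ℝ, ContDiff ℝ (⊤ : ℕ∞) u ∧ HasCompactSupport u ∧ tsupport u ⊆ P ∧
    0 < ∫ z, u z ^ 2 ∧ (∫ z, px u z ^ 2) + (∫ z, py u z ^ 2) ≤ μ * ∫ z, u z ^ 2

theorem integral_comp_div_sq {k : ℝ} (hk : 0 < k) (g : ℝ → ℝ) :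
    ∫ x, g (x / k ^ 2) = k ^ 2 * ∫ x, g x := by
  rw [Measure.integral_comp_div, abs_of_pos (by positivity), smul_eq_mul]

set_option maxHeartbeats 1000000 in
theorem planeTrial_of_airyTrial {U α β : ℝ} (H : AiryTrial U α β) : ∃ k₀ > 0, ∀ k, 0 < k → k ≤ k₀ →
    PlaneTrial (isoTri (√2 * π * k ^ 3) ∩ {z | z.1 ∈ Set.Ioo (k ^ 2 * α) (k ^ 2 * β)})
      (1 / (2 * k ^ 6) + U / k ^ 4) := by
  obtain ⟨g, hg, cg, sg, hlt⟩ := H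
  have cg0 := hg.continuous
  have cg1 := hg.continuous_deriv (by simp)
  have csq : ∀ {X : Type} [TopologicalSpace X] {f : X → ℝ}, HasCompactSupport f →
    HasCompactSupport fun x => f x ^ 2 := fun hf => hf.comp_left (g := fun t => t ^ 2) (by norm_num)
  have i0 : Integrable fun x => g x ^ 2 := (cg0.pow 2).integrable_of_hasCompactSupport (csq cg)
  have i1 : Integrable fun x => |x| * g x ^ 2 :=
    Continuous.integrable_of_hasCompactSupport (by fun_prop) (csq cg).mul_left
  have i2 : Integrable fun x => deriv g x ^ 2 :=
    (cg1.pow 2).integrable_of_hasCompactSupport (csq cg.deriv)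
  rw [integral_add i2 i1] at hlt
  set I0 := ∫ x, g x ^ 2 with hI0
  set I1 := ∫ x, |x| * g x ^ 2 with hI1
  set I2 := ∫ x, deriv g x ^ 2 with hI2
  have p1 : 0 ≤ I1 := integral_nonneg fun x => by positivity
  have p2 : 0 ≤ I2 := integral_nonneg fun x => by positivity
  have p0 : 0 < I0 := by
    have h0 : 0 ≤ I0 := integral_nonneg fun x => by positivity
    rcases h0.eq_or_lt with h | h
    · rw [← h] at hlt; linarith
    · exact h
  set M := |α| + |β| + 1 with hM
  have hM1 : 1 ≤ M := by rw [hM]; linarith [abs_nonneg α, abs_nonneg β]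
  have hMg : ∀ x ∈ tsupport g, |x| ≤ M := fun x hx => by
    obtain ⟨h1, h2⟩ := sg hx
    rw [abs_le, hM]
    constructor <;> linarith [neg_abs_le α, neg_abs_le β, le_abs_self α, le_abs_self β,
      abs_nonneg α, abs_nonneg β]
  set C := 741 * I0 + 20 * M ^ 2 * I0 + 2 * I1 with hC
  have hC0 : 0 < C := by positivity
  set e := U * I0 - (I2 + I1) with he
  have he0 : 0 < e := by linarith
  refine ⟨min (1 / (2 * M)) (2 * e / C), by positivity, fun k hk hkk => ?_⟩
  have hkM : k * (2 * M) ≤ 1 := (le_div_iff₀ (by positivity)).1 (hkk.trans (min_le_left _ _))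
  have hkC : k * C ≤ 2 * e := (le_div_iff₀ hC0).1 (hkk.trans (min_le_right _ _))
  have hk1 : k ≤ 1 := by nlinarith
  have hk2 : k ^ 2 ≤ k := by nlinarith
  set h := √2 * π * k ^ 3 with hh
  have hhp : 0 < h := by positivity
  have hh2 : h ^ 2 = 2 * π ^ 2 * k ^ 6 := by
    rw [hh, mul_pow, mul_pow, sq_sqrt (by norm_num)]; ring
  obtain ⟨s, hs, cs, ss, hslt⟩ := exists_transverse (ε := k ^ 4) (by positivity)
  obtain ⟨r, hr, hr0, hrx⟩ := exists_profile (δ := k ^ 3) hhp (by positivity)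
    (pow_le_one₀ hk.le hk1)
  set γ : ℝ → ℝ := fun x => g (x / k ^ 2) with hγd
  have hγ : ContDiff ℝ (⊤ : ℕ∞) γ := hg.comp (contDiff_id.div_const _)
  have hcl : IsClosed {x : ℝ | x / k ^ 2 ∈ tsupport g} :=
    (isClosed_tsupport g).preimage (continuous_id.div_const _)
  have tγ : ∀ x ∈ tsupport γ, x / k ^ 2 ∈ tsupport g := fun x hx =>
    closure_minimal (t := {x : ℝ | x / k ^ 2 ∈ tsupport g}) (fun x hx => subset_tsupport g hx) hcl hx
  have cγ : HasCompactSupport γ := by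
    refine HasCompactSupport.intro (isCompact_Icc (a := -(k ^ 2 * M)) (b := k ^ 2 * M)) fun x hx => ?_
    by_contra h0
    refine hx (abs_le.1 ?_)
    have := hMg _ (subset_tsupport g h0)
    rw [abs_div, abs_of_pos (by positivity : 0 < k ^ 2), div_le_iff₀ (by positivity)] at this
    linarith
  have hγx : ∀ x, γ x ≠ 0 → |x| ≤ k ^ 2 * M := fun x hx => by
    have := hMg _ (subset_tsupport g hx)
    rw [abs_div, abs_of_pos (by positivity : 0 < k ^ 2), div_le_iff₀ (by positivity)] at this
    linarith
  have hkM2 : k ^ 2 * M ≤ 1 / 2 := by nlinarith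
  have dγ : deriv γ = fun x => deriv g (x / k ^ 2) / k ^ 2 := by
    ext x
    have := ((hg.differentiable (by simp) (x / k ^ 2)).hasDerivAt.comp x
      ((hasDerivAt_id x).div_const (k ^ 2)))
    refine HasDerivAt.deriv (this.congr_deriv ?_)
    simp [div_eq_mul_inv]
  have e0 : ∫ x, γ x ^ 2 = k ^ 2 * I0 := integral_comp_div_sq hk fun x => g x ^ 2
  have e1 : ∫ x, |x| * γ x ^ 2 = k ^ 4 * I1 := by
    have := integral_comp_div_sq hk fun x => k ^ 2 * (|x| * g x ^ 2)
    rw [show k ^ 4 * I1 = k ^ 2 * (k ^ 2 * I1) by ring, hI1, ← integral_const_mul, ← this]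
    congr 1; ext x
    rw [abs_div, abs_of_pos (by positivity : 0 < k ^ 2)]
    simp only [hγd]; field_simp
  have e2 : ∫ x, deriv γ x ^ 2 = I2 / k ^ 2 := by
    have := integral_comp_div_sq hk fun x => (deriv g x / k ^ 2) ^ 2
    rw [dγ, this]
    simp only [div_pow]
    rw [integral_div, ← hI2]
    field_simp
  have cγ0 := hγ.continuous
  have j0 : Integrable fun x => γ x ^ 2 := (cγ0.pow 2).integrable_of_hasCompactSupport (csq cγ)
  have j1 : Integrable fun x => |x| * γ x ^ 2 :=
    Continuous.integrable_of_hasCompactSupport (by fun_prop) (csq cγ).mul_left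
  have cr := hr.continuous
  have cr1 := hr.continuous_deriv (by simp)
  have b1 : ∫ x, (γ x * (deriv r x / r x)) ^ 2 ≤ 9 / 4 * (k ^ 2 * I0) := by
    rw [← e0, ← integral_const_mul]
    refine integral_mono (Continuous.integrable_of_hasCompactSupport
      ((cγ0.mul (cr1.div₀ cr fun x => (hr0 x).ne')).pow 2) (csq cγ.mul_right)) (j0.const_mul _) fun x => ?_
    by_cases hx : γ x = 0
    · simp [hx]
    · have := (hrx x ((hγx x hx).trans hkM2)).1
      rw [mul_pow]
      nlinarith [sq_nonneg (γ x)]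
  have b2 : h ^ 2 * ∫ x, r x ^ 4 * γ x ^ 2 ≤
      (1 + 5 * k ^ 3 + 10 * k ^ 4 * M ^ 2) * (k ^ 2 * I0) + 2 * (k ^ 4 * I1) := by
    rw [← e0, ← e1, ← integral_const_mul, ← integral_const_mul, ← integral_const_mul,
      ← integral_add (j0.const_mul _) (j1.const_mul _)]
    refine integral_mono ((Continuous.integrable_of_hasCompactSupport (by fun_prop)
      (csq cγ).mul_left).const_mul _) ((j0.const_mul _).add (j1.const_mul _)) fun x => ?_
    by_cases hx : γ x = 0
    · simp [hx]
    · have h1 := hγx x hx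
      have h2 := (hrx x (h1.trans hkM2)).2.1
      have h3 : x ^ 2 ≤ k ^ 4 * M ^ 2 := by
        rw [← sq_abs, show k ^ 4 * M ^ 2 = (k ^ 2 * M) ^ 2 by ring]
        exact pow_le_pow_left₀ (abs_nonneg x) h1 2
      have h4 := mul_le_mul_of_nonneg_right (h2.trans (by linarith :
        _ ≤ 1 + 2 * |x| + 5 * k ^ 3 + 10 * (k ^ 4 * M ^ 2))) (sq_nonneg (γ x))
      simp only
      linarith
  set S0 := ∫ y, s y ^ 2 with hS0
  set S2 := ∫ y, deriv s y ^ 2 with hS2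
  have q2 : 0 ≤ S2 := integral_nonneg fun x => by positivity
  have q0 : 0 < S0 := by
    have h0 : 0 ≤ S0 := integral_nonneg fun x => by positivity
    rcases h0.eq_or_lt with h | h
    · rw [← h] at hslt; linarith
    · exact h
  have cs0 := hs.continuous
  have cs1 := hs.continuous_deriv (by simp)
  have k0 : Integrable fun y => s y ^ 2 := (cs0.pow 2).integrable_of_hasCompactSupport (csq cs)
  have k2 : Integrable fun y => deriv s y ^ 2 := (cs1.pow 2).integrable_of_hasCompactSupport (csq cs.deriv)
  have b3 : ∫ y, (s y + 2 * y * deriv s y) ^ 2 ≤ 2 * S0 + 8 * S2 := by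
    rw [hS0, hS2, ← integral_const_mul, ← integral_const_mul,
      ← integral_add (k0.const_mul _) (k2.const_mul _)]
    refine integral_mono (Continuous.integrable_of_hasCompactSupport (by fun_prop)
      (csq (cs.add cs.deriv.mul_left))) ((k0.const_mul _).add (k2.const_mul _)) fun y => ?_
    simp only
    by_cases hy : y ∈ tsupport s
    · have := ss hy
      have h1 : y ^ 2 ≤ 1 := by nlinarith [this.1, this.2]
      nlinarith [sq_nonneg (s y - 2 * y * deriv s y), mul_nonneg (sub_nonneg.2 h1) (sq_nonneg (deriv s y))]
    · rw [image_eq_zero_of_notMem_tsupport hy, image_eq_zero_of_notMem_tsupport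
        (fun h' => hy (tsupport_deriv_subset h'))]
      simp
  obtain ⟨cu, su⟩ := hasCompactSupport_thinFun (s := s) cr hr0 cγ cs
  refine ⟨thinFun γ r s, contDiff_thinFun hγ hr hs, cu, fun z hz => ?_, ?_, ?_⟩
  · obtain ⟨h1, h2⟩ := su z hz
    have h3 := tγ _ h1
    have h4 := hMg _ h3
    rw [abs_div, abs_of_pos (by positivity : 0 < k ^ 2), div_le_iff₀ (by positivity)] at h4
    obtain ⟨h5, h6⟩ := sg h3
    rw [lt_div_iff₀ (by positivity)] at h5
    rw [div_lt_iff₀ (by positivity)] at h6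
    obtain ⟨h7, h8⟩ := ss h2
    have hz1 : |z.1| ≤ 1 / 2 := by linarith
    have h9 := (hrx z.1 hz1).2.2
    have h10 := pow_pos (hr0 z.1) 2
    refine ⟨⟨by linarith, (pos_iff_pos_of_mul_pos h7).2 h10, ?_⟩, by linarith, by linarith⟩
    by_contra h11
    have := mul_le_mul_of_nonneg_right (not_lt.1 h11) h10.le
    linarith
  · rw [integral_thinFun_sq hγ hr hs hr0 cγ cs, e0]
    positivity
  · rw [integral_thinFun_sq hγ hr hs hr0 cγ cs, integral_grad_thinFun_sq hγ hr hs hr0 cγ cs, e0, e2]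
    have hk4 : k ^ 4 ≤ 1 := pow_le_one₀ hk.le hk1
    have hpi : π ^ 2 ≤ 10 := by nlinarith [pi_lt_d2, pi_pos]
    have hS2 : S2 ≤ 20 * S0 := by
      refine hslt.le.trans (mul_le_mul_of_nonneg_right ?_ q0.le)
      calc π ^ 2 * (1 + k ^ 4) ≤ 10 * (1 + 1) := by gcongr
        _ = 20 := by norm_num
    have t1 : (∫ y, (s y + 2 * y * deriv s y) ^ 2) * (∫ x, (γ x * (deriv r x / r x)) ^ 2) ≤
        S0 * (365 * k ^ 2 * I0) := by
      calc _ ≤ (162 * S0) * (9 / 4 * (k ^ 2 * I0)) := by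
            refine mul_le_mul (b3.trans (by linarith)) b1 (integral_nonneg fun x => by positivity)
              (by positivity)
        _ ≤ _ := by linarith [mul_pos q0 (mul_pos (pow_pos hk 2) p0)]
    set B := (1 + 5 * k ^ 3 + 10 * k ^ 4 * M ^ 2) * (k ^ 2 * I0) + 2 * (k ^ 4 * I1) with hB
    have hB0 : 0 ≤ B := by positivity
    have t2 : S2 * (∫ x, r x ^ 4 * γ x ^ 2) ≤ S0 * ((1 + k ^ 4) / (2 * k ^ 6) * B) := by
      have h1 : ∫ x, r x ^ 4 * γ x ^ 2 ≤ B / h ^ 2 := by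
        rw [le_div_iff₀ (by positivity), mul_comm]; exact b2
      calc _ ≤ (π ^ 2 * (1 + k ^ 4) * S0) * (B / h ^ 2) :=
            mul_le_mul hslt.le h1 (integral_nonneg fun x => by positivity) (by positivity)
        _ = _ := by rw [hh2]; field_simp
    have t3 : I2 / k ^ 2 + 365 * k ^ 2 * I0 + (1 + k ^ 4) / (2 * k ^ 6) * B ≤
        (1 / (2 * k ^ 6) + U / k ^ 4) * (k ^ 2 * I0) := by
      have e3 : (1 / (2 * k ^ 6) + U / k ^ 4) * (k ^ 2 * I0) -
          (I2 / k ^ 2 + 365 * k ^ 2 * I0 + (1 + k ^ 4) / (2 * k ^ 6) * B) =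
          (2 * e - (730 * k ^ 4 * I0 + k * I0 * (5 + 10 * k * M ^ 2) + k ^ 2 * (I0 *
            (1 + 5 * k ^ 3 + 10 * k ^ 4 * M ^ 2) + 2 * k ^ 2 * I1))) / (2 * k ^ 2) := by
        rw [hB, he]; field_simp; ring
      have h0 : 0 ≤ (2 * e - (730 * k ^ 4 * I0 + k * I0 * (5 + 10 * k * M ^ 2) + k ^ 2 * (I0 *
            (1 + 5 * k ^ 3 + 10 * k ^ 4 * M ^ 2) + 2 * k ^ 2 * I1))) / (2 * k ^ 2) := by
        refine div_nonneg ?_ (by positivity)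
        have f4 : k ^ 4 ≤ k := by nlinarith [pow_le_one₀ (n := 3) hk.le hk1]
        have f3 : k ^ 3 ≤ 1 := pow_le_one₀ hk.le hk1
        have g1 : 730 * k ^ 4 * I0 ≤ 730 * k * I0 := by gcongr
        have g2 : k * I0 * (5 + 10 * k * M ^ 2) ≤ k * I0 * (5 + 10 * 1 * M ^ 2) := by gcongr
        have g3 : k ^ 2 * (I0 * (1 + 5 * k ^ 3 + 10 * k ^ 4 * M ^ 2) + 2 * k ^ 2 * I1) ≤
          k * (I0 * (1 + 5 * 1 + 10 * 1 * M ^ 2) + 2 * 1 * I1) := by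
          have : k ^ 2 ≤ 1 := by linarith
          gcongr
        rw [hC] at hkC
        linarith
      linarith
    have t4 := mul_le_mul_of_nonneg_left t3 q0.le
    linarith

end ThinEstimates

section ThinBounds

theorem mul_eq_zero_of_tsupport_disjoint {X : Type*} [TopologicalSpace X] {f g : X → ℝ} {P Q : Set X}
    (hPQ : Disjoint P Q) (hf : tsupport f ⊆ P) (hg : tsupport g ⊆ Q) {f' g' : X → ℝ}
    (hf' : ∀ z, z ∉ tsupport f → f' z = 0) (hg' : ∀ z, z ∉ tsupport g → g' z = 0) (z : X) :
    f' z * g' z = 0 := by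
  by_cases h1 : z ∈ tsupport f
  · rw [hg' z fun h2 => Set.disjoint_left.1 hPQ (hf h1) (hg h2), mul_zero]
  · rw [hf' z h1, zero_mul]

theorem ev_le_of_planeTrials {Ω : Set (ℝ × ℝ)} {k : ℕ} (hk : k ≠ 0) {μ : ℝ} (P : Fin k → Set (ℝ × ℝ))
    (hd : ∀ i j, i ≠ j → Disjoint (P i) (P j)) (hP : ∀ i, P i ⊆ Ω) (H : ∀ i, PlaneTrial (P i) μ) :
    ev Ω 1 0 1 k ≤ μ := by
  choose u h1 h2 h3 h4 h5 using H
  set v : Fin k → TF Ω := fun i => ⟨u i, h1 i, h2 i, (h3 i).trans (hP i)⟩ with hv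
  have hm0 : ∀ i j, i ≠ j → mass Ω (v i) (v j) = 0 := fun i j hij => by
    rw [mass_apply]
    refine integral_eq_zero_of_ae (Filter.Eventually.of_forall fun z => ?_)
    exact mul_eq_zero_of_tsupport_disjoint (hd i j hij) (h3 i) (h3 j)
      (fun z => image_eq_zero_of_notMem_tsupport) (fun z => image_eq_zero_of_notMem_tsupport) z
  have he0 : ∀ i j, i ≠ j → energy Ω 1 0 1 (v i) (v j) = 0 := fun i j hij => by
    rw [energy_apply]
    refine integral_eq_zero_of_ae (Filter.Eventually.of_forall fun z => ?_)
    have a1 := mul_eq_zero_of_tsupport_disjoint (hd i j hij) (h3 i) (h3 j)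
      (fun z => px_eq_zero_of_notMem) (fun z => px_eq_zero_of_notMem) z
    have a2 := mul_eq_zero_of_tsupport_disjoint (hd i j hij) (h3 i) (h3 j)
      (fun z => py_eq_zero_of_notMem) (fun z => py_eq_zero_of_notMem) z
    simp only [enDensity, hv, Pi.zero_apply]
    linear_combination a1 + a2
  have diag : ∀ (B : LinearMap.BilinForm ℝ (TF Ω)) (_ : ∀ i j, i ≠ j → B (v i) (v j) = 0)
      (x : Fin k → ℝ), B (∑ i, x i • v i) (∑ i, x i • v i) = ∑ i, x i ^ 2 * B (v i) (v i) := by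
    intro B hB x
    simp only [map_sum, LinearMap.sum_apply, map_smul, LinearMap.smul_apply, smul_eq_mul]
    refine Finset.sum_congr rfl fun i _ => ?_
    rw [Finset.sum_eq_single i]
    · ring
    · intro j _ hj; simp [hB _ _ hj]
    · simp
  have hmp : ∀ i, 0 < mass Ω (v i) (v i) := fun i => by rw [mass_self]; exact h4 i
  have hlin : LinearIndependent ℝ v := by
    rw [Fintype.linearIndependent_iff]
    intro x hx i
    have := diag (mass Ω) hm0 x
    rw [hx, map_zero] at this
    have h := (Finset.sum_eq_zero_iff_of_nonneg fun i _ =>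
      mul_nonneg (sq_nonneg (x i)) (hmp i).le).1 this.symm i (Finset.mem_univ i)
    simpa [(hmp i).ne'] using h
  refine minmax_le_of_family (fun u => energy_nonneg (fun X Y => by nlinarith [sq_nonneg X, sq_nonneg Y]) u)
    (fun u => mass_pos u) hk v hlin fun x => ?_
  rw [diag _ he0, diag _ hm0, Finset.mul_sum]
  refine Finset.sum_le_sum fun i _ => ?_
  rw [energy_one_self, mass_self]
  have := mul_le_mul_of_nonneg_left (h5 i) (sq_nonneg (x i))
  simp only [hv]
  linarith

/-- The height for which the Airy scale of a thin triangle is `k ^ 2`. -/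
noncomputable def thinHeight (k : ℝ) : ℝ := √2 * π * k ^ 3

theorem thinHeight_pos {k : ℝ} (hk : 0 < k) : 0 < thinHeight k := by
  unfold thinHeight; positivity

theorem thinHeight_le {k : ℝ} (hk : 0 < k) : thinHeight k ≤ 5 * k ^ 3 := by
  refine mul_le_mul_of_nonneg_right ?_ (by positivity)
  have h2 : √2 ≤ 3 / 2 := sqrt_le_iff.2 ⟨by norm_num, by norm_num⟩
  calc √2 * π ≤ 3 / 2 * (3.15 : ℝ) := by have := pi_lt_d2; gcongr
    _ ≤ 5 := by norm_num

theorem pi_div_thinHeight_sq {k : ℝ} (hk : 0 < k) : (π / thinHeight k) ^ 2 = 1 / (2 * k ^ 6) := by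
  rw [thinHeight, div_pow, mul_pow, mul_pow, sq_sqrt (by norm_num)]
  field_simp

theorem AiryIneq.mono {A T : ℝ} {N N' : Set ℝ} (H : AiryIneq A T N) (h : N ⊆ N') : AiryIneq A T N' :=
  fun φ φ' hd hc hT h0 => H φ φ' hd hc hT fun s hs => h0 s (h hs)

/-- Smallness of `k` sufficient for the lower bounds. -/
theorem exists_small {A A' T₀ : ℝ} (hA : A' < A) (hA0 : 0 < A) : ∃ k₀ > 0, ∀ k, 0 < k → k ≤ k₀ →
    3 * thinHeight k ≤ 1 ∧ 1 / (2 * k ^ 6) + A / k ^ 4 ≤ 4 * (π / thinHeight k) ^ 2 ∧ T₀ ≤ 1 / k ^ 2 ∧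
    1 / (2 * k ^ 6) + A' / k ^ 4 ≤ (1 - 3 * thinHeight k) * (1 / (2 * k ^ 6) + A / k ^ 4) := by
  refine ⟨min (1 / 15) (min (1 / (A + 1)) (min (1 / (|T₀| + 1)) ((A - A') / (15 * (1 + A))))),
    by have := sub_pos.2 hA; positivity, fun k hk hkk => ?_⟩
  have h1 := (le_div_iff₀ (by positivity)).1 (hkk.trans (min_le_left _ _))
  have hkk := hkk.trans (min_le_right _ _)
  have h2 := (le_div_iff₀ (by positivity)).1 (hkk.trans (min_le_left _ _))
  have hkk := hkk.trans (min_le_right _ _)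
  have h3 := (le_div_iff₀ (by positivity)).1 (hkk.trans (min_le_left _ _))
  have h4 := (le_div_iff₀ (by positivity)).1 (hkk.trans (min_le_right _ _))
  have hh := thinHeight_le hk
  have hk1 : k ≤ 1 := by linarith
  have hk3 : k ^ 3 ≤ k := by nlinarith [pow_le_one₀ (n := 2) hk.le hk1]
  have hk2 : k ^ 2 ≤ k := by nlinarith
  refine ⟨by linarith, ?_, ?_, ?_⟩
  · rw [pi_div_thinHeight_sq hk]
    have : 4 * (1 / (2 * k ^ 6)) - (1 / (2 * k ^ 6) + A / k ^ 4) = (3 - 2 * (k ^ 2 * A)) / (2 * k ^ 6) := by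
      field_simp; ring
    have h0 : 0 ≤ (3 - 2 * (k ^ 2 * A)) / (2 * k ^ 6) := div_nonneg (by nlinarith) (by positivity)
    linarith
  · rw [le_div_iff₀ (by positivity)]
    have := le_abs_self T₀
    have := mul_le_mul_of_nonneg_right this (sq_nonneg k)
    nlinarith [abs_nonneg T₀]
  · have e : (1 - 3 * thinHeight k) * (1 / (2 * k ^ 6) + A / k ^ 4) - (1 / (2 * k ^ 6) + A' / k ^ 4) =
        (2 * k ^ 2 * (A - A') - 3 * thinHeight k * (1 + 2 * (k ^ 2 * A))) / (2 * k ^ 6) := by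
      field_simp; ring
    have h5 : thinHeight k * (1 + 2 * (k ^ 2 * A)) ≤ 5 * k ^ 3 * (2 * (1 + A)) := by
      refine mul_le_mul hh ?_ (by positivity) (by positivity)
      have : k ^ 2 * A ≤ 1 * A := by gcongr; linarith
      linarith
    have h6 := mul_le_mul_of_nonneg_left h4 (sq_nonneg k)
    have h0 : 0 ≤ (2 * k ^ 2 * (A - A') - 3 * thinHeight k * (1 + 2 * (k ^ 2 * A))) / (2 * k ^ 6) :=
      div_nonneg (by linarith) (by positivity)
    linarith

theorem thin_le_ev_rightTri {A A' T₀ : ℝ} {N : Set ℝ} (hN : ∀ T, T₀ ≤ T → AiryIneq A T N) (hA : A' < A)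
    (hA0 : 0 < A) {n m : ℕ} (hn : n < m) (ν : Fin n → ℝ) (hν : ∀ i, 0 ≤ ν i)
    (hNν : ∀ s ∈ N, s = 0 ∨ ∃ i, ν i = s) : ∃ k₀ > 0, ∀ k, 0 < k → k ≤ k₀ →
    1 / (2 * k ^ 6) + A' / k ^ 4 ≤ ev (rightTri (thinHeight k)) 1 0 1 m := by
  obtain ⟨k₀, hk₀, H⟩ := exists_small (T₀ := T₀) hA hA0
  refine ⟨k₀, hk₀, fun k hk hkk => ?_⟩
  obtain ⟨h1, h2, h3, h4⟩ := H k hk hkk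
  refine h4.trans (le_ev_rightTri (thinHeight_pos hk) h1 hn (fun i => k ^ 2 * ν i)
    (fun i => mul_nonneg (sq_nonneg k) (hν i)) h2 (lineIneq_of_airyIneq hk ((hN _ h3).mono fun s hs => ?_)))
  rcases hNν s hs with h | ⟨i, h⟩
  · left; simp [h]
  · right; exact ⟨i, by rw [h]⟩

theorem thin_le_ev_isoTri {A A' T₀ : ℝ} {N : Set ℝ} (hN : ∀ T, T₀ ≤ T → AiryIneq A T N) (hA : A' < A)
    (hA0 : 0 < A) {n m : ℕ} (hn : n < m) (ν : Fin n → ℝ)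
    (hNν : ∀ s ∈ N, 0 ≤ s ∧ (∃ i, ν i = s) ∧ ∃ i, ν i = -s) : ∃ k₀ > 0, ∀ k, 0 < k → k ≤ k₀ →
    1 / (2 * k ^ 6) + A' / k ^ 4 ≤ ev (isoTri (thinHeight k)) 1 0 1 m := by
  obtain ⟨k₀, hk₀, H⟩ := exists_small (T₀ := T₀) hA hA0
  refine ⟨k₀, hk₀, fun k hk hkk => ?_⟩
  obtain ⟨h1, h2, h3, h4⟩ := H k hk hkk
  refine h4.trans (le_ev_isoTri (thinHeight_pos hk) h1 hn (fun i => k ^ 2 * ν i) h2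
    (lineIneq_of_airyIneq hk ((hN _ h3).mono fun s hs => ?_))
    (lineIneq_of_airyIneq hk ((hN _ h3).mono fun s hs => ?_)))
  · obtain ⟨h0, ⟨i, hi⟩, -⟩ := hNν s hs
    exact ⟨mul_nonneg (sq_nonneg k) h0, i, by rw [hi]⟩
  · obtain ⟨h0, -, ⟨i, hi⟩⟩ := hNν s hs
    exact ⟨mul_nonneg (sq_nonneg k) h0, i, by simp only [hi]; ring⟩

theorem thin_ev_isoTri_le {U : ℝ} {m : ℕ} (hm : m ≠ 0) (α β : Fin m → ℝ)
    (hd : ∀ i j, i ≠ j → β i ≤ α j ∨ β j ≤ α i) (H : ∀ i, AiryTrial U (α i) (β i)) :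
    ∃ k₀ > 0, ∀ k, 0 < k → k ≤ k₀ →
    ev (isoTri (thinHeight k)) 1 0 1 m ≤ 1 / (2 * k ^ 6) + U / k ^ 4 := by
  choose κ hκ hκ' using fun i => planeTrial_of_airyTrial (H i)
  have : Nonempty (Fin m) := ⟨⟨0, Nat.pos_of_ne_zero hm⟩⟩
  obtain ⟨i₀, hi₀⟩ := Finite.exists_min κ
  refine ⟨κ i₀, hκ i₀, fun k hk hkk => ?_⟩
  refine ev_le_of_planeTrials hm _ (fun i j hij => ?_) (fun i => Set.inter_subset_left)
    fun i => hκ' i k hk (hkk.trans (hi₀ i))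
  refine Set.disjoint_left.2 fun z h1 h2 => ?_
  have h1 := h1.2
  have h2 := h2.2
  have hk2 : 0 < k ^ 2 := by positivity
  rcases hd i j hij with h | h
  · have := mul_le_mul_of_nonneg_left h hk2.le
    linarith [h1.2, h2.1]
  · have := mul_le_mul_of_nonneg_left h hk2.le
    linarith [h1.1, h2.2]

theorem thin_ev_rightTri_le {U : ℝ} {m : ℕ} (hm : m ≠ 0) (α β : Fin m → ℝ) (hα : ∀ i, 0 ≤ α i)
    (hd : ∀ i j, i ≠ j → β i ≤ α j ∨ β j ≤ α i) (H : ∀ i, AiryTrial U (α i) (β i)) :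
    ∃ k₀ > 0, ∀ k, 0 < k → k ≤ k₀ →
    ev (rightTri (thinHeight k)) 1 0 1 m ≤ 1 / (2 * k ^ 6) + U / k ^ 4 := by
  choose κ hκ hκ' using fun i => planeTrial_of_airyTrial (H i)
  have : Nonempty (Fin m) := ⟨⟨0, Nat.pos_of_ne_zero hm⟩⟩
  obtain ⟨i₀, hi₀⟩ := Finite.exists_min κ
  refine ⟨κ i₀, hκ i₀, fun k hk hkk => ?_⟩
  have hk2 : 0 < k ^ 2 := by positivity
  refine ev_le_of_planeTrials hm _ (fun i j hij => ?_) (fun i => ?_)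
    fun i => hκ' i k hk (hkk.trans (hi₀ i))
  · refine Set.disjoint_left.2 fun z h1 h2 => ?_
    have h1 := h1.2
    have h2 := h2.2
    rcases hd i j hij with h | h
    · have := mul_le_mul_of_nonneg_left h hk2.le
      linarith [h1.2, h2.1]
    · have := mul_le_mul_of_nonneg_left h hk2.le
      linarith [h1.1, h2.2]
  · rintro z ⟨⟨h1, h2, h3⟩, h4, h5⟩
    have h6 : 0 < z.1 := lt_of_le_of_lt (mul_nonneg hk2.le (hα i)) h4
    rw [abs_of_pos h6] at h3
    exact ⟨h6, h2, h3⟩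

end ThinBounds

theorem ev_le_of_translate {Ω Ω' : Set (ℝ × ℝ)} {a b c : ℝ} {k : ℕ} (hΩ : IsOpen Ω)
    (hne : Ω.Nonempty) (hk : k ≠ 0) (h : PosForm a b c) (v : ℝ × ℝ) (hsub : ∀ z ∈ Ω, z + v ∈ Ω') :
    ev Ω' a b c k ≤ ev Ω a b c k := by
  have tr : ∀ u ∈ TF Ω, (fun z => u (z - v)) ∈ TF Ω' := by
    intro u hu
    refine ⟨hu.1.comp (contDiff_id.sub contDiff_const),
      hu.2.1.comp_homeomorph (Homeomorph.subRight v), ?_⟩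
    refine (tsupport_comp_subset_preimage u (f := fun z => z - v) (by fun_prop)).trans fun z hz => ?_
    simpa using hsub _ (hu.2.2 hz)
  let f : TF Ω →ₗ[ℝ] TF Ω' :=
    { toFun := fun u => ⟨fun z => u.1 (z - v), tr u.1 u.2⟩, map_add' := fun _ _ => rfl,
      map_smul' := fun _ _ => rfl }
  have hinj : Function.Injective f := by
    intro u u' hu
    refine Subtype.ext (funext fun z => ?_)
    have := congrFun (congrArg Subtype.val hu) (z + v)
    simpa [f] using this
  have hd : ∀ (u : TF Ω) (z : ℝ × ℝ), fderiv ℝ (fun z => u.1 (z - v)) z = fderiv ℝ u.1 (z - v) :=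
    fun u z => fderiv_comp_sub _
  have := minmax_le_of_map (q := energy Ω a b c) (q' := energy Ω' a b c) mass_pos (energy_nonneg h)
    mass_pos hk (exists_finrank_eq hΩ hne k) f hinj zero_le_one one_pos (fun u => ?_) (fun u => ?_)
  · simpa only [one_mul, ev] using this
  · rw [energy_apply, energy_apply, one_mul]
    refine le_of_eq (Eq.trans ?_ (integral_sub_right_eq_self (enDensity a b c u.1 u.1) v))
    refine integral_congr_ae (.of_forall fun z => ?_)
    simp only [enDensity_self, f, px, py, LinearMap.coe_mk, AddHom.coe_mk, hd]
  · rw [mass_apply, mass_apply, one_mul]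
    exact le_of_eq (integral_sub_right_eq_self (fun z => u.1 z * u.1 z) v).symm

theorem PosForm.push {a b c : ℝ} (h : PosForm a b c) (p q r s : ℝ) :
    PosForm (a * p ^ 2 + 2 * b * p * q + c * q ^ 2) (a * p * r + b * (p * s + q * r) + c * q * s)
      (a * r ^ 2 + 2 * b * r * s + c * s ^ 2) := by
  intro X Y
  have := h (p * X + r * Y) (q * X + s * Y)
  linarith

theorem ev_le_of_affine {Ω Ω' : Set (ℝ × ℝ)} {a b c a' b' c' : ℝ} {k : ℕ} (hΩ : IsOpen Ω)
    (hne : Ω.Nonempty) (hk : k ≠ 0) (h : PosForm a b c) (p q r s : ℝ) (hdet : p * s - q * r ≠ 0)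
    (v : ℝ × ℝ) (hsub : ∀ z ∈ Ω, (p * z.1 + q * z.2 + v.1, r * z.1 + s * z.2 + v.2) ∈ Ω')
    (ha : a' = a * p ^ 2 + 2 * b * p * q + c * q ^ 2)
    (hb : b' = a * p * r + b * (p * s + q * r) + c * q * s)
    (hc : c' = a * r ^ 2 + 2 * b * r * s + c * s ^ 2) :
    ev Ω' a' b' c' k ≤ ev Ω a b c k := by
  set A := planeEquiv p q r s hdet
  have hA : ∀ z, A z = (p * z.1 + q * z.2, r * z.1 + s * z.2) := planeEquiv_apply hdet
  have e := ev_image (Ω' := A.symm ⁻¹' Ω) hΩ hne hk h A (p := p) (q := q) (r := r) (s := s)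
    (by simp [hA]) (by simp [hA]) (by ext z; simp)
  subst ha hb hc
  rw [e]
  refine ev_le_of_translate (hΩ.preimage A.symm.continuous) ?_ hk (h.push p q r s) v ?_
  · obtain ⟨z, hz⟩ := hne
    exact ⟨A z, by simpa using hz⟩
  · intro z hz
    have := hsub _ hz
    have e2 := hA (A.symm z)
    rw [ContinuousLinearEquiv.apply_symm_apply] at e2
    rw [e2]; exact this

theorem ev_smul {Ω : Set (ℝ × ℝ)} {a b c s : ℝ} {k : ℕ} (hΩ : IsOpen Ω)
    (hne : Ω.Nonempty) (hk : k ≠ 0) (h : PosForm a b c) (hs : 0 < s) :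
    ev Ω (s * a) (s * b) (s * c) k = s * ev Ω a b c k := by
  have h' : PosForm (s * a) (s * b) (s * c) := fun X Y => by
    have := mul_nonneg hs.le (h X Y); linarith
  have z : ∀ x y : ℝ, x = y → x - y = 0 := fun x y h => sub_eq_zero.2 h
  have pz : PosForm 0 0 0 := fun X Y => by simp
  refine le_antisymm (ev_mono h' hΩ hne hk subset_rfl hs.le (by simpa using pz)) ?_
  have := ev_mono (a := s * a) (b := s * b) (c := s * c) h hΩ hne hk subset_rfl
    (inv_nonneg.2 hs.le) (by simpa [← mul_assoc, inv_mul_cancel₀ hs.ne'] using pz)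
  calc s * ev Ω a b c k ≤ s * (s⁻¹ * ev Ω (s * a) (s * b) (s * c) k) := by gcongr
    _ = _ := by rw [← mul_assoc, mul_inv_cancel₀ hs.ne', one_mul]

/-- The `k`-th eigenvalue of the triangle with vertices `(0, 0)`, `(1, 0)`, `(c, d)`. -/
noncomputable def lam (c d : ℝ) (k : ℕ) : ℝ :=
  ev stdTri ((c ^ 2 + d ^ 2) / d ^ 2) (-c / d ^ 2) (1 / d ^ 2) k

theorem posForm_lam (c : ℝ) {d : ℝ} (hd : 0 < d) :
    PosForm ((c ^ 2 + d ^ 2) / d ^ 2) (-c / d ^ 2) (1 / d ^ 2) := by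
  intro X Y
  have : (c ^ 2 + d ^ 2) / d ^ 2 * X ^ 2 + 2 * (-c / d ^ 2) * X * Y + 1 / d ^ 2 * Y ^ 2 =
    X ^ 2 + ((c * X - Y) / d) ^ 2 := by field_simp; ring
  rw [this]; positivity

theorem posForm_one : PosForm 1 0 1 := fun X Y => by
  have := add_nonneg (sq_nonneg X) (sq_nonneg Y); linarith

theorem ev_isoTri_le_lam {c d : ℝ} {k : ℕ} (hk : k ≠ 0) (hc : 1 / 2 ≤ c) (hd : 0 < d) :
    (1 / c ^ 2) * ev (isoTri (d / c)) 1 0 1 k ≤ lam c d k := by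
  have hc0 : 0 < c := by linarith
  have hh : 0 < d / c := by positivity
  rw [← ev_smul (isOpen_isoTri _) (isoTri_nonempty hh) hk posForm_one (by positivity)]
  refine ev_le_of_affine isOpen_stdTri stdTri_nonempty hk (posForm_lam c hd) (1 / c) 1 0 (d / c)
    (by have : 0 < 1 / c * (d / c) := by positivity
        simpa using this.ne') (-1, 0) ?_ ?_ ?_ ?_
  · rintro ⟨x, y⟩ ⟨hx, hy, hxy⟩
    simp only at hx hy hxy
    have h1 : 1 / c ≤ 2 := by rw [div_le_iff₀ hc0]; linarith
    have h0 : 0 < 1 / c := by positivity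
    have h2 : 1 / c * x ≤ 2 * x := by gcongr
    have h3 : 0 < 1 / c * x := by positivity
    refine ⟨?_, ?_, ?_⟩
    · simp only; rw [abs_lt]; constructor <;> linarith
    · simp only; have : 0 < d / c * y := by positivity
      linarith
    · simp only
      have : y < 1 - |1 / c * x + 1 * y + -1| := by
        rw [lt_sub_comm, abs_lt]; constructor <;> linarith
      have := mul_lt_mul_of_pos_left this hh
      linarith
  · field_simp; ring
  · field_simp; ring
  · field_simp; ring

theorem lam_le_ev_rightTri {c d : ℝ} {k : ℕ} (hk : k ≠ 0) (hc : 0 < c) (hc1 : c ≤ 1) (hd : 0 < d) :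
    lam c d k ≤ (1 / c ^ 2) * ev (rightTri (d / c)) 1 0 1 k := by
  have hh : 0 < d / c := by positivity
  have hop := isOpen_rightTri (d / c)
  have hne := rightTri_nonempty hh
  rw [← ev_smul hop hne hk posForm_one (by positivity)]
  refine ev_le_of_affine hop hne hk ?_ (-c) (-c / (d / c)) 0 (1 / (d / c))
    (by have : 0 < c * (1 / (d / c)) := by positivity
        linarith) (c, 0) ?_ ?_ ?_ ?_
  · intro X Y
    have := mul_nonneg (show 0 ≤ 1 / c ^ 2 by positivity) (posForm_one X Y)
    linarith
  · rintro ⟨x, y⟩ ⟨hx, hy, hxy⟩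
    simp only at hx hy hxy
    have e : y / (d / c) < 1 - x := by rw [div_lt_iff₀ hh]; linarith
    have e0 : 0 < y / (d / c) := by positivity
    refine ⟨?_, ?_, ?_⟩
    · have := mul_pos hc (sub_pos.2 e)
      show 0 < -c * x + -c / (d / c) * y + c
      have e3 : -c / (d / c) * y = -c * (y / (d / c)) := by ring
      rw [e3]; linarith
    · show 0 < 0 * x + 1 / (d / c) * y + 0
      have e3 : 1 / (d / c) * y = y / (d / c) := by ring
      linarith
    · show -c * x + -c / (d / c) * y + c + (0 * x + 1 / (d / c) * y + 0) < 1
      have e3 : -c / (d / c) * y + 1 / (d / c) * y = (1 - c) * (y / (d / c)) := by ring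
      have := mul_le_mul_of_nonneg_left e.le (sub_nonneg.2 hc1)
      have : (1 - c) * (y / (d / c)) ≤ (1 - c) * (1 - x) := this
      nlinarith
  · field_simp; ring
  · field_simp; ring
  · field_simp; ring

theorem ev_rightTri_le_lam {c d : ℝ} {k : ℕ} (hk : k ≠ 0) (hc : 0 < c) (hc1 : c ≤ 1) (hd : 0 < d) :
    ev (rightTri (d / c)) 1 0 1 k ≤ lam c d k := by
  refine ev_le_of_affine isOpen_stdTri stdTri_nonempty hk (posForm_lam c hd) (-1) (-c) 0 d
    (by simpa using hd.ne') (1, 0) ?_ ?_ ?_ ?_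
  · rintro ⟨x, y⟩ ⟨hx, hy, hxy⟩
    simp only at hx hy hxy
    have h1 : c * y ≤ 1 * y := by gcongr
    refine ⟨?_, ?_, ?_⟩
    · show 0 < -1 * x + -c * y + 1; linarith
    · show 0 < 0 * x + d * y + 0; linarith [mul_pos hd hy]
    · show 0 * x + d * y + 0 < d / c * (1 - (-1 * x + -c * y + 1))
      have e : d / c * (1 - (-1 * x + -c * y + 1)) = d / c * x + d * y := by field_simp; ring
      have : 0 < d / c * x := by positivity
      linarith
  · field_simp; ring
  · field_simp; ring
  · field_simp; ring

theorem lam_half_le {d : ℝ} {k : ℕ} (hk : k ≠ 0) (hd : 0 < d) :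
    lam (1 / 2) d k ≤ 4 * ev (isoTri (2 * d)) 1 0 1 k := by
  have hh : 0 < 2 * d := by positivity
  have hop := isOpen_isoTri (2 * d)
  have hne := isoTri_nonempty hh
  rw [← ev_smul hop hne hk posForm_one (by positivity)]
  refine ev_le_of_affine hop hne hk (fun X Y => ?_) (1 / 2) (-(1 / (4 * d))) 0 (1 / (2 * d))
    (by have : 0 < 1 / 2 * (1 / (2 * d)) := by positivity
        simpa using this.ne') (1 / 2, 0) ?_ ?_ ?_ ?_
  · have := posForm_one X Y
    linarith
  · rintro ⟨x, y⟩ ⟨hx, hy, hxy⟩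
    simp only at hx hy hxy
    have e : y / (2 * d) < 1 - |x| := by rw [div_lt_iff₀ hh]; linarith
    have e0 : 0 < y / (2 * d) := by positivity
    have e1 : 1 / (4 * d) * y = y / (2 * d) / 2 := by field_simp; norm_num
    have e2 : 1 / (2 * d) * y = y / (2 * d) := by ring
    have := le_abs_self x
    have := neg_abs_le x
    refine ⟨?_, ?_, ?_⟩
    · show 0 < 1 / 2 * x + -(1 / (4 * d)) * y + 1 / 2
      linarith
    · show 0 < 0 * x + 1 / (2 * d) * y + 0
      linarith
    · show 1 / 2 * x + -(1 / (4 * d)) * y + 1 / 2 + (0 * x + 1 / (2 * d) * y + 0) < 1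
      linarith
  · field_simp; ring
  · field_simp; ring
  · field_simp; ring

theorem AiryTrial.neg {U α β : ℝ} (h : AiryTrial U α β) : AiryTrial U (-β) (-α) := by
  obtain ⟨g, hg, hc, hs, hi⟩ := h
  refine ⟨fun x => g (-x), hg.comp contDiff_neg, hc.comp_homeomorph (Homeomorph.neg ℝ), ?_, ?_⟩
  · refine (tsupport_comp_subset_preimage g (f := fun x => -x) (by fun_prop)).trans fun z hz => ?_
    have := hs hz
    exact ⟨by linarith [this.2], by linarith [this.1]⟩
  · have e1 := integral_neg_eq_self (fun x => deriv g x ^ 2 + |x| * g x ^ 2) volume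
    have e2 := integral_neg_eq_self (fun x => g x ^ 2) volume
    simp only [abs_neg] at e1
    have e3 : ∀ x, deriv (fun x => g (-x)) x ^ 2 = deriv g (-x) ^ 2 := fun x => by
      rw [deriv_comp_neg]; ring
    simp only [e3]
    rw [e1, e2]; exact hi

theorem eventually_of_forall_small {P : ℝ → Prop} (h : ∃ k₀ > 0, ∀ k, 0 < k → k ≤ k₀ → P k) :
    ∀ᶠ k in 𝓝[>] (0 : ℝ), P k := by
  obtain ⟨k₀, hk₀, h⟩ := h
  filter_upwards [Ioc_mem_nhdsGT hk₀] with k hk using h k hk.1 hk.2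

theorem forall_small_of_thinHeight {P : ℝ → Prop} (h : ∀ᶠ k in 𝓝[>] (0 : ℝ), P (thinHeight k)) :
    ∃ δ > 0, ∀ x, 0 < x → x ≤ δ → P x := by
  obtain ⟨k₀, hk₀, h⟩ := (mem_nhdsGT_iff_exists_Ioc_subset).1 h
  refine ⟨thinHeight k₀, thinHeight_pos hk₀, fun x hx hxk => ?_⟩
  have h2 : 0 < √2 * π := by positivity
  set k := (x / (√2 * π)) ^ ((1 : ℝ) / 3) with hk
  have hk0 : 0 < k := by positivity
  have e : k ^ 3 = x / (√2 * π) := by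
    rw [hk, ← rpow_natCast, ← rpow_mul (by positivity)]; norm_num
  have e2 : thinHeight k = x := by
    rw [thinHeight, e]; field_simp
  rw [← e2]
  refine h ⟨hk0, ?_⟩
  have : k ^ 3 ≤ k₀ ^ 3 := by
    rw [e, div_le_iff₀ h2]; unfold thinHeight at hxk; linarith
  exact le_of_pow_le_pow_left₀ (by norm_num) hk₀.le this

theorem le_ev_isoTri_one {h : ℝ} (hh : 0 < h) (hh3 : 3 * h ≤ 1) {k : ℕ} (hk : k ≠ 0) :
    (1 - 3 * h) * (π / h) ^ 2 ≤ ev (isoTri h) 1 0 1 k := by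
  have H : ∀ N, LineIneq h ((π / h) ^ 2) N := by
    intro N φ φ' _ _ _ _
    rw [sub_self, zero_mul]
    refine intervalIntegral.integral_nonneg zero_le_one fun x hx => ?_
    have := hx.1
    positivity
  exact le_ev_isoTri hh hh3 (n := 0) (Nat.pos_of_ne_zero hk) Fin.elim0
    (le_mul_of_one_le_left (sq_nonneg _) (by norm_num)) (H _) (H _)

theorem ev_rightTri_four_le : ∀ᶠ k in 𝓝[>] (0 : ℝ),
    ev (rightTri (thinHeight k)) 1 0 1 4 ≤ 1 / (2 * k ^ 6) + 15 / k ^ 4 := by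
  refine eventually_of_forall_small (thin_ev_rightTri_le (by norm_num) (fun i : Fin 4 => ((i : ℕ) : ℝ))
    (fun i => ((i : ℕ) : ℝ) + 1) (fun i => by positivity) (fun i j hij => ?_)
    fun i => airyTrial_unit i i.2)
  rcases lt_or_gt_of_ne hij with h | h
  · left; exact_mod_cast h
  · right; exact_mod_cast h

theorem ev_rightTri_one_le : ∀ᶠ k in 𝓝[>] (0 : ℝ),
    ev (rightTri (thinHeight k)) 1 0 1 1 ≤ 1 / (2 * k ^ 6) + (16 / 5) / k ^ 4 :=
  eventually_of_forall_small (thin_ev_rightTri_le (by norm_num) (fun _ : Fin 1 => 0)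
    (fun _ => 5) (fun _ => le_rfl) (fun i j hij => (hij (Subsingleton.elim i j)).elim)
    fun _ => airyTrial_ground)

theorem ev_rightTri_two_le : ∀ᶠ k in 𝓝[>] (0 : ℝ),
    ev (rightTri (thinHeight k)) 1 0 1 2 ≤ 1 / (2 * k ^ 6) + (823 / 200) / k ^ 4 := by
  refine eventually_of_forall_small (thin_ev_rightTri_le (by norm_num) ![0, 7 / 4]
    ![7 / 4, 27 / 4] (fun i => ?_) (fun i j hij => ?_) fun i => ?_)
  · fin_cases i <;> norm_num
  · fin_cases i <;> fin_cases j <;> simp at hij ⊢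
  · fin_cases i
    · exact airyTrial_left
    · exact airyTrial_right

theorem le_ev_rightTri_one : ∀ᶠ k in 𝓝[>] (0 : ℝ),
    1 / (2 * k ^ 6) + (2319 / 1000) / k ^ 4 ≤ ev (rightTri (thinHeight k)) 1 0 1 1 :=
  eventually_of_forall_small (thin_le_ev_rightTri (fun _ hT => airyIneq_one hT) (by norm_num)
    (by norm_num) (n := 0) (by norm_num) Fin.elim0 (fun i => i.elim0) fun s hs => .inl hs)

theorem le_ev_rightTri_four : ∀ᶠ k in 𝓝[>] (0 : ℝ),
    1 / (2 * k ^ 6) + (6649 / 1000) / k ^ 4 ≤ ev (rightTri (thinHeight k)) 1 0 1 4 := by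
  refine eventually_of_forall_small (thin_le_ev_rightTri (fun _ hT => airyIneq_four hT) (by norm_num)
    (by norm_num) (n := 3) (by norm_num) ![5 / 4, 66 / 25, 433 / 100] (fun i => ?_) fun s hs => ?_)
  · fin_cases i <;> norm_num
  · rcases hs with h | h | h | h
    · exact .inl h
    · exact .inr ⟨0, h.symm⟩
    · exact .inr ⟨1, h.symm⟩
    · exact .inr ⟨2, h.symm⟩

theorem ev_isoTri_one_le : ∀ᶠ k in 𝓝[>] (0 : ℝ),
    ev (isoTri (thinHeight k)) 1 0 1 1 ≤ 1 / (2 * k ^ 6) + (83 / 80) / k ^ 4 :=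
  eventually_of_forall_small (thin_ev_isoTri_le (by norm_num) (fun _ : Fin 1 => -4)
    (fun _ => 4) (fun i j hij => (hij (Subsingleton.elim i j)).elim) fun _ => airyTrial_symm)

theorem ev_isoTri_four_le : ∀ᶠ k in 𝓝[>] (0 : ℝ),
    ev (isoTri (thinHeight k)) 1 0 1 4 ≤ 1 / (2 * k ^ 6) + (823 / 200) / k ^ 4 := by
  refine eventually_of_forall_small (thin_ev_isoTri_le (by norm_num) ![-(27 / 4), -(7 / 4), 0, 7 / 4]
    ![-(7 / 4), -0, 7 / 4, 27 / 4] (fun i j hij => ?_) fun i => ?_)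
  · fin_cases i <;> fin_cases j <;> first | exact absurd rfl hij | norm_num
  · fin_cases i
    · exact airyTrial_right.neg
    · exact airyTrial_left.neg
    · exact airyTrial_left
    · exact airyTrial_right

theorem le_ev_isoTri_two : ∀ᶠ k in 𝓝[>] (0 : ℝ),
    1 / (2 * k ^ 6) + (2319 / 1000) / k ^ 4 ≤ ev (isoTri (thinHeight k)) 1 0 1 2 :=
  eventually_of_forall_small (thin_le_ev_isoTri (fun _ hT => airyIneq_one hT) (by norm_num)
    (by norm_num) (n := 1) (by norm_num) (fun _ => 0) fun s hs => by
      rw [Set.mem_singleton_iff] at hs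
      simp [hs])

theorem le_ev_isoTri_four : ∀ᶠ k in 𝓝[>] (0 : ℝ),
    1 / (2 * k ^ 6) + (329 / 100) / k ^ 4 ≤ ev (isoTri (thinHeight k)) 1 0 1 4 := by
  refine eventually_of_forall_small (thin_le_ev_isoTri (fun _ hT => airyIneq_two hT) (by norm_num)
    (by norm_num) (n := 3) (by norm_num) ![-1, 0, 1] fun s hs => ?_)
  rcases hs with h | h
  · rw [h]; exact ⟨le_rfl, ⟨1, rfl⟩, 1, by simp⟩
  · rw [Set.mem_singleton_iff] at h
    rw [h]; exact ⟨zero_le_one, ⟨2, rfl⟩, 0, by simp⟩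

theorem lam_one_lt_lam_four : ∃ δ > 0, ∀ c d, 1 / 2 ≤ c → c ≤ 1 → 0 < d → d / c ≤ δ →
    lam c d 1 < lam c d 4 := by
  have : ∃ δ > 0, ∀ x, 0 < x → x ≤ δ → ev (rightTri x) 1 0 1 1 < ev (isoTri x) 1 0 1 4 := by
    refine forall_small_of_thinHeight ?_
    filter_upwards [ev_rightTri_one_le, le_ev_isoTri_four, self_mem_nhdsWithin] with k h1 h2 (hk : 0 < k)
    refine (h1.trans_lt ?_).trans_le h2
    have : (16 / 5 : ℝ) / k ^ 4 < 329 / 100 / k ^ 4 :=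
      div_lt_div_of_pos_right (by norm_num) (by positivity)
    linarith
  obtain ⟨δ, hδ, H⟩ := this
  refine ⟨δ, hδ, fun c d hc hc1 hd hdc => ?_⟩
  have hc0 : 0 < c := by linarith
  refine (lam_le_ev_rightTri one_ne_zero hc0 hc1 hd).trans_lt
    (lt_of_lt_of_le ?_ (ev_isoTri_le_lam (by norm_num) hc hd))
  exact mul_lt_mul_of_pos_left (H _ (by positivity) hdc) (by positivity)

theorem lam_four_le {ε : ℝ} (hε : 0 < ε) : ∃ δ > 0, ∀ c d, 1 / 2 ≤ c → c ≤ 1 → 0 < d → d / c ≤ δ →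
    lam c d 4 ≤ (1 + ε) * lam c d 1 := by
  have : ∃ δ > 0, ∀ x, 0 < x → x ≤ δ →
      ev (rightTri x) 1 0 1 4 ≤ (1 + ε) * ev (isoTri x) 1 0 1 1 := by
    refine forall_small_of_thinHeight ?_
    have ht : ∀ᶠ k in 𝓝[>] (0 : ℝ), k < min (1 / 15) (ε / (60 * (1 + ε))) :=
      nhdsWithin_le_nhds (eventually_lt_nhds (by positivity))
    filter_upwards [ev_rightTri_four_le, self_mem_nhdsWithin, ht] with k h1 (hk : 0 < k) hk2
    have k1 := hk2.trans_le (min_le_left _ _)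
    have k2 := (lt_div_iff₀ (by positivity)).1 (hk2.trans_le (min_le_right _ _))
    have hT := thinHeight_le hk
    have hk3 : k ^ 3 ≤ k * (1 / 15) ^ 2 := by
      have : k ^ 2 ≤ (1 / 15) ^ 2 := by gcongr
      calc k ^ 3 = k * k ^ 2 := by ring
        _ ≤ _ := by gcongr
    have h3 : 3 * thinHeight k ≤ 1 := by linarith
    have h2 := le_ev_isoTri_one (thinHeight_pos hk) h3 one_ne_zero
    rw [pi_div_thinHeight_sq hk] at h2
    refine h1.trans (le_trans ?_ (mul_le_mul_of_nonneg_left h2 (by positivity)))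
    have e : 15 / k ^ 4 = 30 * k ^ 2 * (1 / (2 * k ^ 6)) := by field_simp; norm_num
    have hE : 0 < 1 / (2 * k ^ 6) := by positivity
    rw [e, ← mul_assoc, ← one_add_mul]
    refine mul_le_mul_of_nonneg_right ?_ hE.le
    have a1 : thinHeight k ≤ k := by linarith
    have a2 : 30 * k ^ 2 ≤ 2 * k := by nlinarith
    have a3 : (1 + ε) * (3 * thinHeight k) ≤ (1 + ε) * (3 * k) := by gcongr
    nlinarith
  obtain ⟨δ, hδ, H⟩ := this
  refine ⟨δ, hδ, fun c d hc hc1 hd hdc => ?_⟩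
  have hc0 : 0 < c := by linarith
  have h1 := lam_le_ev_rightTri (k := 4) (by norm_num) hc0 hc1 hd
  have h2 := ev_isoTri_le_lam one_ne_zero hc hd
  have h3 := H (d / c) (by positivity) hdc
  calc lam c d 4 ≤ 1 / c ^ 2 * ((1 + ε) * ev (isoTri (d / c)) 1 0 1 1) :=
        h1.trans (by gcongr)
    _ = (1 + ε) * (1 / c ^ 2 * ev (isoTri (d / c)) 1 0 1 1) := by ring
    _ ≤ _ := by gcongr

theorem lam_tall : ∃ δ > 0, ∀ x, 0 < x → x ≤ δ →
    481 / 200 * lam (1 - x) x 2 < lam (1 - x) x 4 + 281 / 200 * lam (1 - x) x 1 := by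
  have : ∃ δ > 0, ∀ x, 0 < x → x ≤ δ → 481 / 200 * ((1 + x) ^ 2 * ev (rightTri x) 1 0 1 2) <
      ev (rightTri x) 1 0 1 4 + 281 / 200 * ev (rightTri x) 1 0 1 1 := by
    refine forall_small_of_thinHeight ?_
    have ht : ∀ᶠ k in 𝓝[>] (0 : ℝ), k < 1 / 100000 :=
      nhdsWithin_le_nhds (eventually_lt_nhds (by positivity))
    filter_upwards [ev_rightTri_two_le, le_ev_rightTri_one, le_ev_rightTri_four,
      self_mem_nhdsWithin, ht] with k h2 h1 h4 (hk : 0 < k) hk2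
    have hT := thinHeight_le hk
    have hT0 := thinHeight_pos hk
    have hk3 : k ^ 2 ≤ (1 / 100000) ^ 2 := by gcongr
    have hkk : k ^ 3 ≤ k * (1 / 100000) ^ 2 := by
      calc k ^ 3 = k * k ^ 2 := by ring
        _ ≤ _ := by gcongr
    have hT1 : (1 + thinHeight k) ^ 2 ≤ 1 + 15 * k ^ 3 := by nlinarith
    set E := 1 / (2 * k ^ 6) with hE
    set G := 1 / k ^ 4 with hG
    have hG0 : 0 < G := by positivity
    have e1 : k ^ 3 * E = k / 2 * G := by rw [hE, hG]; field_simp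
    have e2 : ∀ a : ℝ, a / k ^ 4 = a * G := fun a => by rw [hG]; ring
    rw [e2] at h1 h2 h4
    have e0 : 0 ≤ E + 823 / 200 * G := by positivity
    have m : (1 + thinHeight k) ^ 2 * ev (rightTri (thinHeight k)) 1 0 1 2 ≤
        (1 + 15 * k ^ 3) * (E + 823 / 200 * G) :=
      (mul_le_mul_of_nonneg_left h2 (sq_nonneg _)).trans (mul_le_mul_of_nonneg_right hT1 e0)
    have e3 : (1 + 15 * k ^ 3) * (E + 823 / 200 * G) =
        E + (823 / 200 + 15 / 2 * k + 15 * (823 / 200) * k ^ 3) * G := by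
      linear_combination 15 * e1
    have e4 : (15 / 2 * k + 15 * (823 / 200) * k ^ 3) * G ≤ 1 / 1000 * G := by
      refine mul_le_mul_of_nonneg_right ?_ hG0.le
      linarith
    linarith
  obtain ⟨δ, hδ, H⟩ := this
  refine ⟨min (1 / 2) (δ / 2), by positivity, fun x hx hxδ => ?_⟩
  have x1 := hxδ.trans (min_le_left _ _)
  have x2 := hxδ.trans (min_le_right _ _)
  have c0 : 0 < 1 - x := by linarith
  have h1 := ev_rightTri_le_lam one_ne_zero c0 (by linarith) hx
  have h4 := ev_rightTri_le_lam (k := 4) (by norm_num) c0 (by linarith) hx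
  have h2 := lam_le_ev_rightTri two_ne_zero c0 (by linarith) hx
  have h3 := H (x / (1 - x)) (by positivity) (by
    rw [div_le_iff₀ c0]; nlinarith)
  have e : (1 + x / (1 - x)) ^ 2 = 1 / (1 - x) ^ 2 := by field_simp; ring
  rw [e] at h3
  linarith

theorem lam_flat : ∃ δ > 0, ∀ x, 0 < x → x ≤ δ →
    lam (1 / 2) x 4 + 281 / 200 * lam (1 / 2) x 1 < 481 / 200 * lam (1 / 2) x 2 := by
  have : ∃ δ > 0, ∀ x, 0 < x → x ≤ δ → 
      ev (isoTri x) 1 0 1 4 + 281 / 200 * ev (isoTri x) 1 0 1 1 <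
      481 / 200 * ev (isoTri x) 1 0 1 2 := by
    refine forall_small_of_thinHeight ?_
    filter_upwards [ev_isoTri_one_le, ev_isoTri_four_le, le_ev_isoTri_two,
      self_mem_nhdsWithin] with k h1 h4 h2 (hk : 0 < k)
    set G := 1 / k ^ 4 with hG
    have hG0 : 0 < G := by positivity
    have e2 : ∀ a : ℝ, a / k ^ 4 = a * G := fun a => by rw [hG]; ring
    rw [e2] at h1 h2 h4
    linarith
  obtain ⟨δ, hδ, H⟩ := this
  refine ⟨δ / 2, by positivity, fun x hx hxδ => ?_⟩
  have h1 := lam_half_le one_ne_zero hx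
  have h4 := lam_half_le (k := 4) (by norm_num) hx
  have h2 := ev_isoTri_le_lam two_ne_zero le_rfl hx
  have e : x / (1 / 2) = 2 * x := by ring
  rw [e] at h2
  have h3 := H (2 * x) (by positivity) (by linarith)
  norm_num at h2
  norm_num at h1 h4 ⊢
  linarith

theorem posForm_of_abs_le {x y z δ : ℝ} (hx : |x| ≤ δ) (hy : |y| ≤ δ) (hz : |z| ≤ δ) :
    PosForm (2 * δ + x) y (2 * δ + z) := by
  intro X Y
  have hδ : 0 ≤ δ := (abs_nonneg x).trans hx
  obtain ⟨x1, x2⟩ := abs_le.1 hx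
  obtain ⟨y1, y2⟩ := abs_le.1 hy
  obtain ⟨z1, z2⟩ := abs_le.1 hz
  have e : (2 * δ + x) * X ^ 2 + 2 * y * X * Y + (2 * δ + z) * Y ^ 2 =
      (δ + x) * X ^ 2 + (δ + z) * Y ^ 2 + (δ + y) / 2 * (X + Y) ^ 2 + (δ - y) / 2 * (X - Y) ^ 2 := by
    ring
  rw [e]
  have := mul_nonneg (show 0 ≤ δ + x by linarith) (sq_nonneg X)
  have := mul_nonneg (show 0 ≤ δ + z by linarith) (sq_nonneg Y)
  have := mul_nonneg (show 0 ≤ (δ + y) / 2 by linarith) (sq_nonneg (X + Y))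
  have := mul_nonneg (show 0 ≤ (δ - y) / 2 by linarith) (sq_nonneg (X - Y))
  linarith

theorem abs_ev_sub_le {Ω : Set (ℝ × ℝ)} {a b c a' b' c' m δ : ℝ} {k : ℕ} (hΩ : IsOpen Ω)
    (hne : Ω.Nonempty) (hk : k ≠ 0) (h : PosForm (a - m) b (c - m)) (hm : 0 < m) (hδ : 2 * δ < m)
    (ha : |a' - a| ≤ δ) (hb : |b' - b| ≤ δ) (hc : |c' - c| ≤ δ) :
    |ev Ω a' b' c' k - ev Ω a b c k| ≤ 2 * δ / m * ev Ω a b c k := by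
  have hδ0 : 0 ≤ δ := (abs_nonneg _).trans ha
  set t := 2 * δ / m with ht
  have htm : t * m = 2 * δ := by rw [ht]; field_simp
  have ht1 : t < 1 := by rw [ht, div_lt_one hm]; exact hδ
  have ht0 : 0 ≤ t := by positivity
  have P0 : PosForm a b c := fun X Y => by
    have := h X Y
    have := mul_nonneg hm.le (add_nonneg (sq_nonneg X) (sq_nonneg Y))
    linarith
  have P1 : PosForm (a' - (1 - t) * a) (b' - (1 - t) * b) (c' - (1 - t) * c) := fun X Y => by
    have h1 := posForm_of_abs_le ha hb hc X Y
    have h2 := mul_nonneg ht0 (h X Y)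
    rw [← htm] at h1
    linarith
  have P2 : PosForm ((1 + t) * a - a') ((1 + t) * b - b') ((1 + t) * c - c') := fun X Y => by
    rw [abs_sub_comm] at ha hb hc
    have h1 := posForm_of_abs_le ha hb hc X Y
    have h2 := mul_nonneg ht0 (h X Y)
    rw [← htm] at h1
    linarith
  have h1t : 0 < 1 - t := by linarith
  have P' : PosForm a' b' c' := fun X Y => by
    have h1 := P1 X Y
    have h2 := mul_nonneg h1t.le (P0 X Y)
    linarith
  have e2 := ev_mono P' hΩ hne hk subset_rfl (by positivity : 0 ≤ 1 + t) P2
  have e1 : ev Ω ((1 - t) * a) ((1 - t) * b) ((1 - t) * c) k ≤ 1 * ev Ω a' b' c' k :=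
    ev_mono (fun X Y => by have := mul_nonneg h1t.le (P0 X Y); linarith) hΩ hne hk subset_rfl
      zero_le_one (by simpa only [one_mul] using P1)
  rw [ev_smul hΩ hne hk P0 h1t] at e1
  rw [abs_le]
  constructor <;> linarith

theorem posForm_lam_sub (c : ℝ) {d : ℝ} (hd : 0 < d) : ∃ m > 0,
    PosForm ((c ^ 2 + d ^ 2) / d ^ 2 - m) (-c / d ^ 2) (1 / d ^ 2 - m) := by
  refine ⟨1 / (1 + 2 * c ^ 2 + 2 * d ^ 2), by positivity, fun X Y => ?_⟩
  have : ((c ^ 2 + d ^ 2) / d ^ 2 - 1 / (1 + 2 * c ^ 2 + 2 * d ^ 2)) * X ^ 2 +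
      2 * (-c / d ^ 2) * X * Y + (1 / d ^ 2 - 1 / (1 + 2 * c ^ 2 + 2 * d ^ 2)) * Y ^ 2 =
    (2 * d ^ 2 * X ^ 2 + (2 * c * X - Y) ^ 2 + (1 + 2 * c ^ 2) * ((c * X - Y) / d) ^ 2) /
      (1 + 2 * c ^ 2 + 2 * d ^ 2) := by field_simp; ring
  rw [this]; positivity

theorem tendsto_of_abs_sub_le {α : Type*} {l : Filter α} {f g : α → ℝ} {x C r : ℝ} (hr : 0 < r)
    (hg : Filter.Tendsto g l (𝓝 0)) (h : ∀ a, g a < r → |f a - x| ≤ g a * C) :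
    Filter.Tendsto f l (𝓝 x) := by
  rw [tendsto_iff_norm_sub_tendsto_zero]
  refine squeeze_zero' (.of_forall fun _ => norm_nonneg _) ?_ (by simpa using hg.mul_const C)
  filter_upwards [hg.eventually_lt_const hr] with a ha using h a ha

theorem continuousAt_lam {k : ℕ} (hk : k ≠ 0) (p : ℝ × ℝ) (hp : 0 < p.2) :
    ContinuousAt (fun p : ℝ × ℝ => lam p.1 p.2 k) p := by
  obtain ⟨m, hm, h⟩ := posForm_lam_sub p.1 hp
  set A := fun p : ℝ × ℝ => (p.1 ^ 2 + p.2 ^ 2) / p.2 ^ 2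
  set B := fun p : ℝ × ℝ => -p.1 / p.2 ^ 2
  set C := fun p : ℝ × ℝ => 1 / p.2 ^ 2
  have hp2 : p.2 ^ 2 ≠ 0 := by positivity
  have hA : ContinuousAt A p := ContinuousAt.div (by fun_prop) (by fun_prop) hp2
  have hB : ContinuousAt B p := ContinuousAt.div (by fun_prop) (by fun_prop) hp2
  have hC : ContinuousAt C p := ContinuousAt.div (by fun_prop) (by fun_prop) hp2
  have hg : Filter.Tendsto (fun q => 2 * (|A q - A p| + |B q - B p| + |C q - C p|) / m) (𝓝 p)
      (𝓝 0) := by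
    have : ContinuousAt (fun q => 2 * (|A q - A p| + |B q - B p| + |C q - C p|) / m) p :=
      ((continuousAt_const.mul (((hA.sub continuousAt_const).abs.add
        (hB.sub continuousAt_const).abs).add (hC.sub continuousAt_const).abs)).div_const m)
    simpa [ContinuousAt] using this
  refine tendsto_of_abs_sub_le one_pos hg (C := lam p.1 p.2 k) fun q hq => ?_
  rw [div_lt_one hm] at hq
  have := abs_nonneg (A q - A p)
  have := abs_nonneg (B q - B p)
  have := abs_nonneg (C q - C p)
  exact abs_ev_sub_le isOpen_stdTri stdTri_nonempty hk h hm hq (by linarith) (by linarith)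
    (by linarith)

theorem lam_pos {c d : ℝ} {k : ℕ} (hk : k ≠ 0) (hd : 0 < d) : 0 < lam c d k := by
  have h1 := ev_isoTri_le_lam hk le_rfl (show (0 : ℝ) < 1 / 8 by norm_num)
  have h2 := le_ev_isoTri_one (h := 1 / 4) (by norm_num) (by norm_num) hk
  have h3 : 0 < lam (1 / 2) (1 / 8) k := by
    refine lt_of_lt_of_le ?_ h1
    norm_num
    refine lt_of_lt_of_le ?_ h2
    positivity
  obtain ⟨m, hm, h⟩ := posForm_lam_sub c hd
  have hK : ev stdTri (((1 / 2) ^ 2 + (1 / 8) ^ 2) / (1 / 8) ^ 2) (-(1 / 2) / (1 / 8) ^ 2)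
      (1 / (1 / 8) ^ 2) k ≤ 1000 / m * lam c d k := by
    refine ev_mono (posForm_lam _ (by norm_num)) isOpen_stdTri stdTri_nonempty hk subset_rfl
      (by positivity) fun X Y => ?_
    have e := mul_nonneg (show 0 ≤ 1000 / m by positivity) (h X Y)
    have e2 : 1000 / m * m = 1000 := by field_simp
    have e3 : 0 ≤ 64 * (X + Y) ^ 2 := by positivity
    have e4 := sq_nonneg X
    have e5 := sq_nonneg Y
    have e6 : 1000 / m * ((c ^ 2 + d ^ 2) / d ^ 2 * X ^ 2 + 2 * (-c / d ^ 2) * X * Y +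
        1 / d ^ 2 * Y ^ 2) - 1000 / m * m * (X ^ 2 + Y ^ 2) ≥ 0 := by linarith
    rw [e2] at e6
    have e7 : 0 ≤ (X - Y) ^ 2 := sq_nonneg _
    generalize (c ^ 2 + d ^ 2) / d ^ 2 = a at *
    generalize -c / d ^ 2 = b at *
    generalize 1 / d ^ 2 = f at *
    norm_num
    linarith
  have : 0 < 1000 / m * lam c d k := h3.trans_le hK
  exact (mul_pos_iff_of_pos_left (by positivity)).1 this

theorem dirichletEig_triangle_eq {r c d : ℝ} (hr : 0 < r) (hd : 0 < d) {k : ℕ} (hk : k ≠ 0) :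
    dirichletEig (interior (convexHull ℝ
      ({0, !₂[r, 0], !₂[r * c, r * d]} : Set (EuclideanSpace ℝ (Fin 2))))) k = lam c d k / r ^ 2 := by
  rw [dirichletEig_triangle hr hd, lam, div_eq_inv_mul (ev _ _ _ _ _),
    ← ev_smul isOpen_stdTri stdTri_nonempty hk (posForm_lam c hd) (by positivity)]
  congr 1 <;> field_simp

section Perturbation

variable {X : Type*} [AddCommGroup X] [Module ℝ X] {q d m : LinearMap.BilinForm ℝ X} {N δ : ℝ}
  {n : ℕ} {e : Fin n → X} {l : Fin n → ℝ}

theorem abs_two_mul_form_le (hq : ∀ u v, q u v = q v u) (hd : ∀ u v, d u v = d v u) (hδ : 0 < δ)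
    (h : ∀ u, |d u u| ≤ δ * q u u) (u v : X) :
    |2 * d u v| ≤ 100 * δ ^ 2 * q u u + 1 / 100 * q v v := by
  have key : ∀ w, |2 * d w v| ≤ δ * (q w w + q v v) := by
    intro w
    have h1 := h (w + v)
    have h2 := h (w - v)
    simp only [map_add, map_sub, LinearMap.add_apply, LinearMap.sub_apply] at h1 h2
    rw [hq v w, hd v w] at h1 h2
    rw [abs_le] at h1 h2 ⊢
    constructor <;> linarith [h1.1, h1.2, h2.1, h2.2]
  have h1 := key ((100 * δ) • u)
  simp only [map_smul, LinearMap.smul_apply, smul_eq_mul] at h1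
  have e1 : |2 * (100 * δ * d u v)| = 100 * δ * |2 * d u v| := by
    rw [← abs_of_pos (show 0 < 100 * δ by positivity), ← abs_mul,
      abs_of_pos (show 0 < 100 * δ by positivity)]; congr 1; ring
  rw [e1] at h1
  have h2 : 100 * δ * |2 * d u v| ≤ 100 * δ * (100 * δ ^ 2 * q u u + 1 / 100 * q v v) := by
    refine h1.trans (le_of_eq ?_); ring
  exact le_of_mul_le_mul_left h2 (by positivity)

theorem form_add_ge (hq : ∀ u v, q u v = q v u) (hd : ∀ u v, d u v = d v u)
    (hm : ∀ u v, m u v = m v u) (hm0 : ∀ u, 0 ≤ m u u) (hδ : 0 < δ) (hδ1 : δ ≤ 1 / 100)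
    (h : ∀ u, |d u u| ≤ δ * q u u) (hN : 0 < N)
    (hem : ∀ i j, m (e i) (e j) = if i = j then N else 0)
    (heq : ∀ i, q (e i) (e i) = l i * N) (k : Fin n) (hk : 0 ≤ l k) (hk1 : l k ≤ 100) {Λ : ℝ}
    (hkj : ∀ j, k < j → l k + 8 ≤ l j) (hkΛ : l k + 8 ≤ Λ) {u : X}
    (hu : ∀ i, q (e i) u = l i * m (e i) u) (hu0 : ∀ j, j < k → m (e j) u = 0)
    (hsp : Λ * m u u - ∑ j, (Λ - l j) * m (e j) u ^ 2 / N ≤ q u u) :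
    (l k + d (e k) (e k) / N - 10000 * δ ^ 2) * m u u ≤ q u u + d u u := by
  set t := m (e k) u / N with ht
  have htN : m (e k) u = t * N := by rw [ht]; field_simp
  set w := u - t • e k with hw
  have hu' : u = t • e k + w := by rw [hw]; abel
  have mw : m w w = m u u - t ^ 2 * N := by
    rw [hw]
    simp only [map_sub, LinearMap.sub_apply, map_smul, LinearMap.smul_apply, smul_eq_mul]
    rw [hm u (e k), hem, if_pos rfl, htN]; ring
  have qw : q w w = q u u - l k * t ^ 2 * N := by
    rw [hw]
    simp only [map_sub, LinearMap.sub_apply, map_smul, LinearMap.smul_apply, smul_eq_mul]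
    rw [hq u (e k), heq, hu, htN]; ring
  have bessel : ∑ j, m (e j) u ^ 2 / N ≤ m u u := by
    have := hm0 (u - ∑ j, (m (e j) u / N) • e j)
    simp only [map_sub, LinearMap.sub_apply, map_sum, LinearMap.sum_apply, map_smul,
      LinearMap.smul_apply, smul_eq_mul, hem] at this
    simp only [mul_ite, mul_zero, Finset.sum_ite_eq', Finset.mem_univ, if_true] at this
    have e1 : ∀ j, m (e j) u / N * (m u (e j) - m (e j) u / N * N) = 0 := fun j => by
      rw [hm u]; field_simp; simp
    have e2 : ∀ j, m (e j) u / N * m (e j) u = m (e j) u ^ 2 / N := fun j => by ring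
    simp only [e1, e2, Finset.sum_const_zero] at this
    linarith
  have hgap : (l k + 8) * m w w ≤ q w w := by
    have h1 : ∑ j, (Λ - l j) * m (e j) u ^ 2 / N ≤
        ∑ j, ((Λ - l k - 8) * (m (e j) u ^ 2 / N) + if j = k then 8 * t ^ 2 * N else 0) := by
      refine Finset.sum_le_sum fun j _ => ?_
      rcases lt_trichotomy j k with hj | hj | hj
      · rw [hu0 j hj, if_neg hj.ne]; simp
      · rw [if_pos hj, hj, htN]
        refine le_of_eq ?_
        field_simp; ring
      · rw [if_neg hj.ne', add_zero, mul_div_assoc]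
        refine mul_le_mul_of_nonneg_right ?_ (by positivity)
        linarith [hkj j hj]
    rw [Finset.sum_add_distrib, ← Finset.mul_sum, Finset.sum_ite_eq' _ k, if_pos (Finset.mem_univ k)] at h1
    have h2 := mul_le_mul_of_nonneg_left bessel (show 0 ≤ Λ - l k - 8 by linarith)
    rw [mw, qw]
    linarith
  have hdu : d u u = t ^ 2 * d (e k) (e k) + t * (2 * d (e k) w) + d w w := by
    rw [hu']
    simp only [map_add, LinearMap.add_apply, map_smul, LinearMap.smul_apply, smul_eq_mul]
    rw [hd w (e k)]; ring
  have h1 := abs_two_mul_form_le hq hd hδ h (t • e k) w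
  simp only [map_smul, LinearMap.smul_apply, smul_eq_mul] at h1
  rw [heq] at h1
  have h2 := h w
  have h3 := h (e k)
  rw [heq] at h3
  have mw0 := hm0 w
  have e1 : q u u = q w w + l k * t ^ 2 * N := by rw [qw]; ring
  have e2 : m u u = m w w + t ^ 2 * N := by rw [mw]; ring
  have e3 : (l k + d (e k) (e k) / N - 10000 * δ ^ 2) * m u u =
      (l k + d (e k) (e k) / N - 10000 * δ ^ 2) * m w w +
      (l k * t ^ 2 * N + t ^ 2 * d (e k) (e k) - 10000 * δ ^ 2 * (t ^ 2 * N)) := by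
    rw [e2]; field_simp
  have h4 : d (e k) (e k) / N ≤ δ * l k := by
    rw [div_le_iff₀ hN]; linarith [(abs_le.1 h3).2]
  have h5 : (l k + d (e k) (e k) / N - 10000 * δ ^ 2) * m w w ≤ 98 / 100 * q w w := by
    have : l k + d (e k) (e k) / N - 10000 * δ ^ 2 ≤ 98 / 100 * (l k + 8) := by
      have := mul_le_mul_of_nonneg_right hδ1 hk
      have := sq_nonneg δ
      linarith
    have := mul_le_mul_of_nonneg_right this mw0
    linarith
  have h6 : 100 * δ ^ 2 * (t * (t * (l k * N))) ≤ 10000 * δ ^ 2 * (t ^ 2 * N) := by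
    have := mul_le_mul_of_nonneg_left hk1 (show 0 ≤ 100 * δ ^ 2 * (t ^ 2 * N) by positivity)
    linarith
  have q0 : 0 ≤ q w w := le_trans (by positivity) hgap
  have h7 := mul_le_mul_of_nonneg_right hδ1 q0
  rw [e3, e1, hdu]
  linarith [(abs_le.1 h1).1, (abs_le.1 h2).1]

theorem form_add_le (hq : ∀ u v, q u v = q v u) (hd : ∀ u v, d u v = d v u) (hδ : 0 < δ)
    (hδ1 : δ ≤ 1 / 100) (h : ∀ u, |d u u| ≤ δ * q u u) (hN : 0 < N)
    (heq : ∀ i j, q (e i) (e j) = if i = j then l i * N else 0) (k : Fin n) (hk : 0 ≤ l k)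
    (hk1 : l k ≤ 100) (hkj : ∀ j, j < k → l j + 8 ≤ l k) (x : Fin n → ℝ) (hx : ∀ j, k < j → x j = 0) :
    q (∑ j, x j • e j) (∑ j, x j • e j) + d (∑ j, x j • e j) (∑ j, x j • e j) ≤
      (l k + d (e k) (e k) / N + 10000 * δ ^ 2) * (N * ∑ j, x j ^ 2) := by
  set t := x k
  set v := ∑ j, (if j = k then 0 else x j) • e j with hv
  have hu : ∑ j, x j • e j = t • e k + v := by
    have e1 : t • e k = ∑ j, (if j = k then t else 0) • e j := by simp
    rw [hv, e1, ← Finset.sum_add_distrib]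
    refine Finset.sum_congr rfl fun j _ => ?_
    rw [← add_smul]; congr 1
    split_ifs with hj
    · rw [hj, add_zero]
    · rw [zero_add]
  have qs : ∀ y : Fin n → ℝ, q (∑ j, y j • e j) (∑ j, y j • e j) = ∑ j, l j * N * y j ^ 2 := by
    intro y
    simp only [map_sum, LinearMap.sum_apply, map_smul, LinearMap.smul_apply, smul_eq_mul, heq,
      mul_ite, mul_zero, Finset.sum_ite_eq', Finset.mem_univ, if_true]
    exact Finset.sum_congr rfl fun j _ => by ring
  have qv : q v v = ∑ j, (if j = k then 0 else l j * N * x j ^ 2) := by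
    rw [hv, qs]
    exact Finset.sum_congr rfl fun j _ => by split_ifs <;> simp
  have hqu : q (∑ j, x j • e j) (∑ j, x j • e j) = l k * N * t ^ 2 + q v v := by
    rw [qs, qv, show l k * N * t ^ 2 = ∑ j, if j = k then l j * N * x j ^ 2 else 0 by simp [t],
      ← Finset.sum_add_distrib]
    exact Finset.sum_congr rfl fun j _ => by split_ifs <;> simp
  set M := ∑ j, (if j = k then 0 else x j ^ 2) with hM
  have hxs : ∑ j, x j ^ 2 = t ^ 2 + M := by
    rw [hM, show t ^ 2 = ∑ j, if j = k then x j ^ 2 else 0 by simp [t], ← Finset.sum_add_distrib]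
    exact Finset.sum_congr rfl fun j _ => by split_ifs <;> simp
  have M0 : 0 ≤ M := Finset.sum_nonneg fun j _ => by split_ifs <;> positivity
  have hgap : q v v ≤ (l k - 8) * (N * M) := by
    rw [qv, hM, Finset.mul_sum, Finset.mul_sum]
    refine Finset.sum_le_sum fun j _ => ?_
    split_ifs with hj
    · simp
    · rcases lt_or_gt_of_ne hj with hj | hj
      · have := mul_le_mul_of_nonneg_right (hkj j hj) (show 0 ≤ N * x j ^ 2 by positivity)
        linarith
      · rw [hx j hj]; simp
  have q0 : 0 ≤ q v v := by
    have := (abs_nonneg _).trans (h v)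
    exact nonneg_of_mul_nonneg_right this hδ
  have hdu : d (∑ j, x j • e j) (∑ j, x j • e j) =
      t ^ 2 * d (e k) (e k) + t * (2 * d (e k) v) + d v v := by
    rw [hu]
    simp only [map_add, LinearMap.add_apply, map_smul, LinearMap.smul_apply, smul_eq_mul]
    rw [hd v (e k)]; ring
  have h1 := abs_two_mul_form_le hq hd hδ h (t • e k) v
  simp only [map_smul, LinearMap.smul_apply, smul_eq_mul] at h1
  have hek : q (e k) (e k) = l k * N := by rw [heq, if_pos rfl]
  rw [hek] at h1
  have h2 := h v
  have h3 := h (e k)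
  rw [hek] at h3
  have e3 : (l k + d (e k) (e k) / N + 10000 * δ ^ 2) * (N * ∑ j, x j ^ 2) =
      (l k + d (e k) (e k) / N + 10000 * δ ^ 2) * (N * M) +
      (l k * t ^ 2 * N + t ^ 2 * d (e k) (e k) + 10000 * δ ^ 2 * (t ^ 2 * N)) := by
    rw [hxs]; field_simp; ring
  have h4 : -(δ * l k) ≤ d (e k) (e k) / N := by
    rw [le_div_iff₀ hN]; linarith [(abs_le.1 h3).1]
  have h5 : 102 / 100 * q v v ≤ (l k + d (e k) (e k) / N + 10000 * δ ^ 2) * (N * M) := by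
    have : 102 / 100 * (l k - 8) ≤ l k + d (e k) (e k) / N + 10000 * δ ^ 2 := by
      have := mul_le_mul_of_nonneg_right hδ1 hk
      have := sq_nonneg δ
      linarith
    have := mul_le_mul_of_nonneg_right this (show 0 ≤ N * M by positivity)
    linarith
  have h6 : 100 * δ ^ 2 * (t * (t * (l k * N))) ≤ 10000 * δ ^ 2 * (t ^ 2 * N) := by
    have := mul_le_mul_of_nonneg_left hk1 (show 0 ≤ 100 * δ ^ 2 * (t ^ 2 * N) by positivity)
    linarith
  have h7 := mul_le_mul_of_nonneg_right hδ1 q0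
  rw [e3, hqu, hdu]
  linarith [(abs_le.1 h1).2, (abs_le.1 h2).2]

end Perturbation

/-- Upper bound for a min-max value from approximants of a family with a good Gram matrix. -/
theorem minmax_le_of_tendsto {V : Type*} [AddCommGroup V] [Module ℝ V]
    {q m : LinearMap.BilinForm ℝ V} (hq : ∀ u, 0 ≤ q u u) (hm : ∀ u, u ≠ 0 → 0 < m u u) {k : ℕ}
    (hk : k ≠ 0) (v : ℕ → Fin k → V) (G : Fin k → Fin k → ℝ) {N μ : ℝ} (hN : 0 < N) (hμ : 0 ≤ μ)
    (hG : ∀ i j, Filter.Tendsto (fun n => q (v n i) (v n j)) Filter.atTop (𝓝 (G i j)))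
    (hM : ∀ i j, Filter.Tendsto (fun n => m (v n i) (v n j)) Filter.atTop
      (𝓝 (if i = j then N else 0)))
    (h : ∀ x : Fin k → ℝ, ∑ i, ∑ j, x i * x j * G i j ≤ μ * (N * ∑ i, x i ^ 2)) :
    minmax q m k ≤ μ := by
  have expand : ∀ (r : LinearMap.BilinForm ℝ V) (w : Fin k → V) (x : Fin k → ℝ),
      r (∑ i, x i • w i) (∑ i, x i • w i) = ∑ i, ∑ j, x i * x j * r (w i) (w j) := by
    intro r w x
    simp only [map_sum, LinearMap.sum_apply, map_smul, LinearMap.smul_apply, smul_eq_mul,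
      Finset.mul_sum]
    rw [Finset.sum_comm]
    refine Finset.sum_congr rfl fun i _ => Finset.sum_congr rfl fun j _ => by ring
  have close : ∀ (ε : ℝ) (R S : Fin k → Fin k → ℝ) (x : Fin k → ℝ), (∀ i j, |R i j - S i j| ≤ ε) →
      |∑ i, ∑ j, x i * x j * R i j - ∑ i, ∑ j, x i * x j * S i j| ≤ ε * k * ∑ i, x i ^ 2 := by
    intro ε R S x hRS
    rw [← Finset.sum_sub_distrib]
    simp_rw [← Finset.sum_sub_distrib, ← mul_sub]
    calc |∑ i, ∑ j, x i * x j * (R i j - S i j)| ≤ ∑ i, ∑ j, |x i| * |x j| * ε := by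
          refine (Finset.abs_sum_le_sum_abs _ _).trans (Finset.sum_le_sum fun i _ => ?_)
          refine (Finset.abs_sum_le_sum_abs _ _).trans (Finset.sum_le_sum fun j _ => ?_)
          rw [abs_mul, abs_mul]
          exact mul_le_mul_of_nonneg_left (hRS i j) (by positivity)
      _ ≤ ∑ i, ∑ j, (x i ^ 2 + x j ^ 2) / 2 * ε := by
          refine Finset.sum_le_sum fun i _ => Finset.sum_le_sum fun j _ => ?_
          have hε : 0 ≤ ε := (abs_nonneg _).trans (hRS i j)
          refine mul_le_mul_of_nonneg_right ?_ hε
          nlinarith [sq_nonneg (|x i| - |x j|), sq_abs (x i), sq_abs (x j)]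
      _ = ε * k * ∑ i, x i ^ 2 := by
          simp only [← Finset.sum_mul, ← Finset.sum_div, Finset.sum_add_distrib, Finset.sum_const,
            Finset.card_univ, Fintype.card_fin, nsmul_eq_mul, ← Finset.mul_sum]
          ring
  by_contra! hlt
  set Λ := minmax q m k
  have hkpos : (0 : ℝ) < k := by exact_mod_cast Nat.pos_of_ne_zero hk
  set ε : ℝ := min (N / (2 * k)) ((Λ - μ) * N / (2 * k * (1 + μ + Λ)))
  have hpos : 0 < 1 + μ + Λ := by linarith
  have hε : 0 < ε := lt_min (by positivity) (div_pos (mul_pos (by linarith) hN) (by positivity))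
  have h1 : ε * k ≤ N / 2 := by
    calc ε * k ≤ N / (2 * k) * k := by gcongr; exact min_le_left _ _
      _ = N / 2 := by field_simp
  have h2 : ε * k * (1 + Λ) < (Λ - μ) * N := by
    calc ε * k * (1 + Λ) ≤ (Λ - μ) * N / (2 * k * (1 + μ + Λ)) * k * (1 + μ + Λ) := by
          have : ε ≤ (Λ - μ) * N / (2 * k * (1 + μ + Λ)) := min_le_right _ _
          gcongr
          · linarith
          · linarith
      _ = (Λ - μ) * N / 2 := by field_simp
      _ < _ := by have := mul_pos (show 0 < Λ - μ by linarith) hN; linarith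
  have hev : ∀ᶠ n in Filter.atTop, ∀ i j, |q (v n i) (v n j) - G i j| ≤ ε ∧
      |m (v n i) (v n j) - (if i = j then N else 0)| ≤ ε := by
    rw [Filter.eventually_all]; intro i
    rw [Filter.eventually_all]; intro j
    filter_upwards [Metric.tendsto_nhds.1 (hG i j) ε hε, Metric.tendsto_nhds.1 (hM i j) ε hε]
      with n h1 h2
    rw [Real.dist_eq] at h1 h2
    exact ⟨h1.le, h2.le⟩
  obtain ⟨n, hn⟩ := hev.exists
  have hQ : ∀ x : Fin k → ℝ, q (∑ i, x i • v n i) (∑ i, x i • v n i) ≤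
      (μ * N + ε * k) * ∑ i, x i ^ 2 := by
    intro x
    rw [expand]
    have := (abs_le.1 (close ε _ _ x fun i j => (hn i j).1)).2
    linarith [h x]
  have hMM : ∀ x : Fin k → ℝ, (N - ε * k) * ∑ i, x i ^ 2 ≤
      m (∑ i, x i • v n i) (∑ i, x i • v n i) := by
    intro x
    rw [expand]
    have := (abs_le.1 (close ε _ _ x fun i j => (hn i j).2)).1
    have h3 : ∑ i, ∑ j, x i * x j * (if i = j then N else 0) = N * ∑ i, x i ^ 2 := by
      rw [Finset.mul_sum]
      refine Finset.sum_congr rfl fun i _ => ?_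
      simp; ring
    linarith
  have hD : 0 < N - ε * k := by linarith
  have hfin : Λ ≤ (μ * N + ε * k) / (N - ε * k) := by
    refine minmax_le_of_family hq hm hk (v n) ?_ fun x => (hQ x).trans ?_
    · rw [Fintype.linearIndependent_iff]
      intro x hx i
      have h4 := hMM x
      rw [hx] at h4
      simp only [map_zero] at h4
      have h5 : ∑ i, x i ^ 2 ≤ 0 := by
        by_contra! h; linarith [mul_pos hD h]
      have h6 := (Finset.sum_eq_zero_iff_of_nonneg fun i _ => sq_nonneg (x i)).1
        (le_antisymm h5 (Finset.sum_nonneg fun i _ => sq_nonneg (x i))) i (Finset.mem_univ i)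
      exact pow_eq_zero_iff (two_ne_zero) |>.1 h6
    · have : (μ * N + ε * k) * ∑ i, x i ^ 2 =
          (μ * N + ε * k) / (N - ε * k) * ((N - ε * k) * ∑ i, x i ^ 2) := by field_simp
      rw [this]
      exact mul_le_mul_of_nonneg_left (hMM x) (by positivity)
  rw [le_div_iff₀ hD] at hfin
  linarith

/-- The hemiequilateral triangle with vertices `(0, 0)`, `(π, 0)`, `(π, π / 3)`. -/
def refTri : Set (ℝ × ℝ) := {z | 0 < z.2 ∧ 3 * z.2 < z.1 ∧ z.1 < π}

theorem isOpen_refTri : IsOpen refTri :=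
  (isOpen_lt continuous_const continuous_snd).inter
    ((isOpen_lt (continuous_const.mul continuous_snd) continuous_fst).inter
      (isOpen_lt continuous_fst continuous_const))

theorem refTri_nonempty : refTri.Nonempty :=
  ⟨(2, 1 / 2), by norm_num, by norm_num, by simpa using by linarith [pi_gt_three]⟩

theorem refTri_subset : refTri ⊆ Set.Icc 0 π ×ˢ Set.Icc 0 π := fun z hz => by
  obtain ⟨h1, h2, h3⟩ := hz
  exact ⟨⟨by linarith, h3.le⟩, ⟨h1.le, by linarith⟩⟩

theorem isCompact_box : IsCompact (Set.Icc 0 π ×ˢ Set.Icc 0 π) := isCompact_Icc.prod isCompact_Icc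

theorem isBounded_refTri : Bornology.IsBounded refTri := isCompact_box.isBounded.subset refTri_subset

theorem volume_refTri_ne_top : volume refTri ≠ ⊤ := isBounded_refTri.measure_lt_top.ne

theorem integrableOn_refTri {g : ℝ × ℝ → ℝ} (hg : Continuous g) : IntegrableOn g refTri :=
  (hg.continuousOn.integrableOn_compact isCompact_box).mono_set refTri_subset

/-- Smooth functions on the plane. -/
def SM : Submodule ℝ (ℝ × ℝ → ℝ) where
  carrier := {u | ContDiff ℝ (⊤ : ℕ∞) u}
  add_mem' {u v} hu hv := by
    simp only [Set.mem_ofPred_eq] at hu hv ⊢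
    exact hu.add hv
  zero_mem' := by
    simp only [Set.mem_ofPred_eq]
    exact contDiff_const
  smul_mem' c u hu := by
    simp only [Set.mem_ofPred_eq] at hu ⊢
    exact hu.const_smul c

theorem SM.smooth (u : SM) : ContDiff ℝ (⊤ : ℕ∞) u.1 := u.2

theorem SM.integrableOn_mul (u v : SM) : IntegrableOn (fun z => u.1 z * v.1 z) refTri :=
  integrableOn_refTri ((SM.smooth u).continuous.mul (SM.smooth v).continuous)

/-- The `L²` inner product on the reference triangle. -/
noncomputable def massR : LinearMap.BilinForm ℝ SM :=
  LinearMap.mk₂ ℝ (fun u v => ∫ z in refTri, u.1 z * v.1 z)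
    (fun u u' v => by
      rw [← integral_add (SM.integrableOn_mul u v)
        (SM.integrableOn_mul u' v)]
      congr 1; ext z; simp; ring)
    (fun c u v => by
      rw [smul_eq_mul, ← integral_const_mul]
      congr 1; ext z; simp; ring)
    (fun u v v' => by
      rw [← integral_add (SM.integrableOn_mul u v)
        (SM.integrableOn_mul u v')]
      congr 1; ext z; simp; ring)
    (fun c u v => by
      rw [smul_eq_mul, ← integral_const_mul]
      congr 1; ext z; simp; ring)

theorem massR_apply (u v : SM) : massR u v = ∫ z in refTri, u.1 z * v.1 z := rfl

theorem continuous_enDensity {a b c : ℝ} (u v : SM) : Continuous (enDensity a b c u.1 v.1) := by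
  have h1 := continuous_px u.2
  have h2 := continuous_py u.2
  have h3 := continuous_px v.2
  have h4 := continuous_py v.2
  unfold enDensity
  fun_prop

/-- The energy form on the reference triangle. -/
noncomputable def energyR (a b c : ℝ) : LinearMap.BilinForm ℝ SM :=
  LinearMap.mk₂ ℝ (fun u v => ∫ z in refTri, enDensity a b c u.1 v.1 z)
    (fun u u' v => by
      rw [← integral_add (integrableOn_refTri (continuous_enDensity u v))
        (integrableOn_refTri (continuous_enDensity u' v))]
      congr 1; ext z; simp [enDensity, px_add u.2 u'.2, py_add u.2 u'.2]; ring)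
    (fun t u v => by
      rw [smul_eq_mul, ← integral_const_mul]
      congr 1; ext z; simp [enDensity, px_smul u.2, py_smul u.2]; ring)
    (fun u v v' => by
      rw [← integral_add (integrableOn_refTri (continuous_enDensity u v))
        (integrableOn_refTri (continuous_enDensity u v'))]
      congr 1; ext z; simp [enDensity, px_add v.2 v'.2, py_add v.2 v'.2]; ring)
    (fun t u v => by
      rw [smul_eq_mul, ← integral_const_mul]
      congr 1; ext z; simp [enDensity, px_smul v.2, py_smul v.2]; ring)

theorem energyR_apply {a b c : ℝ} (u v : SM) :
    energyR a b c u v = ∫ z in refTri, enDensity a b c u.1 v.1 z := rfl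

theorem massR_symm (u v : SM) : massR u v = massR v u := by
  simp only [massR_apply, mul_comm]

theorem energyR_symm {a b c : ℝ} (u v : SM) : energyR a b c u v = energyR a b c v u := by
  rw [energyR_apply, energyR_apply]
  congr 1; ext z; simp only [enDensity]; ring

theorem massR_nonneg (u : SM) : 0 ≤ massR u u := integral_nonneg fun _ => mul_self_nonneg _

theorem energyR_add {a b c a' b' c' : ℝ} (u v : SM) :
    energyR (a + a') (b + b') (c + c') u v = energyR a b c u v + energyR a' b' c' u v := by
  simp only [energyR_apply]
  rw [← integral_add (integrableOn_refTri (continuous_enDensity u v))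
        (integrableOn_refTri (continuous_enDensity u v))]
  congr 1; ext z; simp only [enDensity]; ring

theorem abs_energyR_le {a b c a' b' c' δ : ℝ} (h1 : PosForm (δ * a - a') (δ * b - b') (δ * c - c'))
    (h2 : PosForm (δ * a + a') (δ * b + b') (δ * c + c')) (u : SM) :
    |energyR a' b' c' u u| ≤ δ * energyR a b c u u := by
  rw [abs_le, energyR_apply, energyR_apply, ← integral_const_mul, ← integral_neg]
  constructor <;>
  · refine integral_mono (integrableOn_refTri (by first | exact ((continuous_enDensity u u).const_mul _).neg | exact continuous_enDensity u u))
      (integrableOn_refTri (by first | exact ((continuous_enDensity u u).const_mul _) | exact continuous_enDensity u u)) fun z => ?_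
    simp only [enDensity_self]
    linarith [h1 (px u.1 z) (py u.1 z), h2 (px u.1 z) (py u.1 z)]

/-- A test function, viewed as a smooth function. -/
def TF.toSM {Ω : Set (ℝ × ℝ)} (u : TF Ω) : SM := ⟨u.1, u.2.1⟩

theorem massR_toSM (u v : TF refTri) : massR (TF.toSM u) (TF.toSM v) = mass refTri u v := by
  rw [massR_apply, mass_apply]
  refine setIntegral_eq_integral_of_forall_compl_eq_zero fun z hz => ?_
  have : u.1 z = 0 := image_eq_zero_of_notMem_tsupport fun h => hz (TF.supp u h)
  simp [TF.toSM, this]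

theorem energyR_toSM {a b c : ℝ} (u v : TF refTri) :
    energyR a b c (TF.toSM u) (TF.toSM v) = energy refTri a b c u v := by
  rw [energyR_apply, energy_apply]
  refine setIntegral_eq_integral_of_forall_compl_eq_zero fun z hz => ?_
  have h : z ∉ tsupport u.1 := fun h => hz (TF.supp u h)
  simp [TF.toSM, enDensity, px_eq_zero_of_notMem h, py_eq_zero_of_notMem h]

/-- Boundedly convergent sequences of smooth functions on the reference triangle. -/
def BddTendsto (F : ℕ → SM) (f : SM) : Prop :=
  (∀ z ∈ refTri, ∀ᶠ n in Filter.atTop, (F n).1 z = f.1 z ∧ fderiv ℝ (F n).1 z = fderiv ℝ f.1 z) ∧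
    ∃ B, ∀ n, ∀ z ∈ refTri, |(F n).1 z| ≤ B ∧ ‖fderiv ℝ (F n).1 z‖ ≤ B

theorem bddTendsto_const (f : SM) : BddTendsto (fun _ => f) f := by
  refine ⟨fun z _ => by simp, ?_⟩
  obtain ⟨B₁, h1⟩ := isCompact_box.exists_bound_of_continuousOn (SM.smooth f).continuous.continuousOn
  obtain ⟨B₂, h2⟩ := isCompact_box.exists_bound_of_continuousOn
    ((SM.smooth f).continuous_fderiv (by simp)).continuousOn
  exact ⟨max B₁ B₂, fun n z hz => ⟨(h1 z (refTri_subset hz)).trans (le_max_left _ _),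
    (h2 z (refTri_subset hz)).trans (le_max_right _ _)⟩⟩

theorem tendsto_setIntegral_refTri {P : ℕ → ℝ × ℝ → ℝ} {p : ℝ × ℝ → ℝ} (hm : ∀ n, Continuous (P n))
    {B : ℝ} (hB : ∀ n, ∀ x ∈ refTri, |P n x| ≤ B)
    (hev : ∀ x ∈ refTri, ∀ᶠ n in Filter.atTop, P n x = p x) :
    Filter.Tendsto (fun n => ∫ x in refTri, P n x) Filter.atTop (𝓝 (∫ x in refTri, p x)) := by
  refine tendsto_integral_of_dominated_convergence (fun _ => B)
    (fun n => (hm n).aestronglyMeasurable) (integrableOn_const volume_refTri_ne_top) ?_ ?_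
  · intro n
    exact (ae_restrict_iff' isOpen_refTri.measurableSet).2 (.of_forall (hB n))
  · refine (ae_restrict_iff' isOpen_refTri.measurableSet).2 (.of_forall fun x hx => ?_)
    exact tendsto_const_nhds.congr' ((hev x hx).mono fun n hn => hn.symm)

theorem BddTendsto.massR {F G : ℕ → SM} {f g : SM} (hF : BddTendsto F f) (hG : BddTendsto G g) :
    Filter.Tendsto (fun n => massR (F n) (G n)) Filter.atTop (𝓝 (massR f g)) := by
  obtain ⟨hF, B, hB⟩ := hF
  obtain ⟨hG, B', hB'⟩ := hG
  refine tendsto_setIntegral_refTri (B := B * B')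
    (fun n => (SM.smooth (F n)).continuous.mul (SM.smooth (G n)).continuous) (fun n x hx => ?_) fun x hx => ?_
  · rw [abs_mul]
    exact mul_le_mul (hB n x hx).1 (hB' n x hx).1 (abs_nonneg _)
      ((abs_nonneg _).trans (hB n x hx).1)
  · filter_upwards [hF x hx, hG x hx] with n h1 h2
    rw [h1.1, h2.1]

theorem BddTendsto.energyR {a b c : ℝ} {F G : ℕ → SM} {f g : SM} (hF : BddTendsto F f)
    (hG : BddTendsto G g) :
    Filter.Tendsto (fun n => energyR a b c (F n) (G n)) Filter.atTop (𝓝 (energyR a b c f g)) := by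
  obtain ⟨hF, B, hB⟩ := hF
  obtain ⟨hG, B', hB'⟩ := hG
  refine tendsto_setIntegral_refTri
    (B := |a| * (B * B') + |b| * (B * B' + B * B') + |c| * (B * B'))
    (fun n => continuous_enDensity (F n) (G n)) (fun n x hx => ?_) fun x hx => ?_
  · have key : ∀ (u : ℝ × ℝ → ℝ) (K : ℝ) (w : ℝ × ℝ), ‖w‖ ≤ 1 → ‖fderiv ℝ u x‖ ≤ K →
        |fderiv ℝ u x w| ≤ K := fun u K w hw hK => by
      have := (fderiv ℝ u x).le_of_opNorm_le hK w
      rw [Real.norm_eq_abs] at this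
      refine this.trans (mul_le_of_le_one_right ((norm_nonneg _).trans hK) hw)
    have h1 : |px (F n).1 x| ≤ B := key _ _ _ (by simp [Prod.norm_def]) (hB n x hx).2
    have h2 : |py (F n).1 x| ≤ B := key _ _ _ (by simp [Prod.norm_def]) (hB n x hx).2
    have h3 : |px (G n).1 x| ≤ B' := key _ _ _ (by simp [Prod.norm_def]) (hB' n x hx).2
    have h4 : |py (G n).1 x| ≤ B' := key _ _ _ (by simp [Prod.norm_def]) (hB' n x hx).2
    have hB0 : 0 ≤ B := (abs_nonneg _).trans h1
    rw [enDensity]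
    refine (abs_add_three _ _ _).trans ?_
    simp only [abs_mul]
    gcongr
    refine (abs_add_le _ _).trans ?_
    simp only [abs_mul]
    gcongr
  · filter_upwards [hF x hx, hG x hx] with n h1 h2
    simp only [enDensity, px, py, h1.2, h2.2]

/-- Smooth functions vanishing on the sides of the reference triangle are limits of test
functions. -/
theorem exists_bddTendsto (f : SM) (h1 : ∀ x, f.1 (x, 0) = 0) (h2 : ∀ y, f.1 (3 * y, y) = 0)
    (h3 : ∀ y, f.1 (π, y) = 0) : ∃ F : ℕ → TF refTri, BddTendsto (fun n => TF.toSM (F n)) f := by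
  set D : ℝ × ℝ → ℝ := fun z => z.2 * (z.1 / 3 - z.2) * (π - z.1) with hD
  have hDs : ContDiff ℝ (⊤ : ℕ∞) D := by simp only [hD]; fun_prop
  obtain ⟨L, hL⟩ := isCompact_box.exists_bound_of_continuousOn
    ((SM.smooth f).continuous_fderiv (by simp)).continuousOn
  have hconv : Convex ℝ (Set.Icc (0 : ℝ) π ×ˢ Set.Icc (0 : ℝ) π) :=
    (convex_Icc _ _).prod (convex_Icc _ _)
  have hlip : ∀ z ∈ Set.Icc (0 : ℝ) π ×ˢ Set.Icc (0 : ℝ) π,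
      ∀ w ∈ Set.Icc (0 : ℝ) π ×ˢ Set.Icc (0 : ℝ) π, |f.1 w - f.1 z| ≤ L * ‖w - z‖ := by
    intro z hz w hw
    exact hconv.norm_image_sub_le_of_norm_fderiv_le
      (fun x _ => (SM.smooth f).differentiable (by simp) x) hL hz hw
  have hdist : ∀ z ∈ refTri, |f.1 z| ≤ L * z.2 ∧ |f.1 z| ≤ L * (z.1 / 3 - z.2) ∧
      |f.1 z| ≤ L * (π - z.1) := by
    rintro ⟨x, y⟩ hz
    have hb := refTri_subset hz
    obtain ⟨hz1, hz2, hz3⟩ := hz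
    simp only at hz1 hz2 hz3
    refine ⟨?_, ?_, ?_⟩
    · have := hlip (x, 0) ⟨hb.1, ⟨le_rfl, pi_pos.le⟩⟩ (x, y) hb
      simpa [h1, Prod.norm_def, abs_of_pos hz1, hz1.le] using this
    · have := hlip (x, x / 3) ⟨hb.1, ⟨by simp only; linarith, by simp only; linarith⟩⟩ (x, y) hb
      have h20 := h2 (x / 3)
      rw [mul_div_cancel₀ _ three_ne_zero] at h20
      have h4 : |y - x / 3| = x / 3 - y := by rw [abs_of_neg (by linarith)]; ring
      simpa [h20, Prod.norm_def, h4, show y ≤ x / 3 by linarith] using this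
    · have := hlip (π, y) ⟨⟨pi_pos.le, le_rfl⟩, hb.2⟩ (x, y) hb
      have h4 : |x - π| = π - x := by rw [abs_of_neg (by linarith)]; ring
      simpa [h3, Prod.norm_def, h4, hz3.le] using this
  have hder : ∀ z : ℝ × ℝ, HasFDerivAt D (((z.2 • ((1 / 3 : ℝ) • ContinuousLinearMap.fst ℝ ℝ ℝ -
      ContinuousLinearMap.snd ℝ ℝ ℝ) + (z.1 / 3 - z.2) • ContinuousLinearMap.snd ℝ ℝ ℝ)).smulRight (π - z.1)
      - (z.2 * (z.1 / 3 - z.2)) • ContinuousLinearMap.fst ℝ ℝ ℝ) z := by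
    intro z
    have e1 : HasFDerivAt (fun z : ℝ × ℝ => z.1) (ContinuousLinearMap.fst ℝ ℝ ℝ) z := hasFDerivAt_fst
    have e2 : HasFDerivAt (fun z : ℝ × ℝ => z.2) (ContinuousLinearMap.snd ℝ ℝ ℝ) z := hasFDerivAt_snd
    have := (e2.mul ((e1.mul_const (1 / 3)).sub e2)).mul (e1.const_sub π)
    refine (this.congr_of_eventuallyEq (.of_forall fun w => ?_)).congr_fderiv ?_
    · simp only [hD, Pi.mul_apply, Pi.sub_apply]; ring
    · ext <;> simp <;> ring
  have hnorm : ∀ z ∈ refTri, |f.1 z| * ‖fderiv ℝ D z‖ ≤ 6 * L * D z := by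
    intro z hz
    obtain ⟨d1, d2, d3⟩ := hdist z hz
    obtain ⟨hz1, hz2, hz3⟩ := hz
    have p2 : 0 < z.1 / 3 - z.2 := by linarith
    have p3 : 0 < π - z.1 := by linarith
    have hn : ‖fderiv ℝ D z‖ ≤ 2 * (z.2 * (π - z.1)) + (z.1 / 3 - z.2) * (π - z.1) +
        z.2 * (z.1 / 3 - z.2) := by
      refine ContinuousLinearMap.opNorm_le_bound _ (by positivity) fun w => ?_
      rw [(hder z).fderiv]
      have hw1 : |w.1| ≤ ‖w‖ := norm_fst_le w
      have hw2 : |w.2| ≤ ‖w‖ := norm_snd_le w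
      have q1 := mul_pos hz1 p3
      have q2 := mul_pos p2 p3
      have q3 := mul_pos hz1 p2
      simp only [_root_.sub_apply, ContinuousLinearMap.smulRight_apply,
        _root_.add_apply, _root_.smul_apply, smul_eq_mul,
        ContinuousLinearMap.coe_fst', ContinuousLinearMap.coe_snd', Real.norm_eq_abs]
      obtain ⟨a1, a2⟩ := abs_le.1 hw1
      obtain ⟨b1, b2⟩ := abs_le.1 hw2
      have nn := norm_nonneg w
      have t1 := mul_le_mul_of_nonneg_left a1 q1.le
      have t2 := mul_le_mul_of_nonneg_left a2 q1.le
      have t3 := mul_le_mul_of_nonneg_left b1 q1.le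
      have t4 := mul_le_mul_of_nonneg_left b2 q1.le
      have t5 := mul_le_mul_of_nonneg_left b1 q2.le
      have t6 := mul_le_mul_of_nonneg_left b2 q2.le
      have t7 := mul_le_mul_of_nonneg_left a1 q3.le
      have t8 := mul_le_mul_of_nonneg_left a2 q3.le
      have t9 := mul_nonneg q1.le nn
      rw [abs_le]
      constructor <;> linarith
    have hf0 := abs_nonneg (f.1 z)
    calc |f.1 z| * ‖fderiv ℝ D z‖ ≤ |f.1 z| * (2 * (z.2 * (π - z.1)) + (z.1 / 3 - z.2) * (π - z.1) +
        z.2 * (z.1 / 3 - z.2)) := by gcongr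
      _ = |f.1 z| * (2 * (z.2 * (π - z.1))) + |f.1 z| * ((z.1 / 3 - z.2) * (π - z.1)) +
        |f.1 z| * (z.2 * (z.1 / 3 - z.2)) := by ring
      _ ≤ (L * (z.1 / 3 - z.2)) * (2 * (z.2 * (π - z.1))) + (L * z.2) * ((z.1 / 3 - z.2) * (π - z.1)) +
        (L * (π - z.1)) * (z.2 * (z.1 / 3 - z.2)) := by gcongr
      _ = 4 * L * D z := by simp only [hD]; ring
      _ ≤ 6 * L * D z := by
        have hL0 : 0 ≤ L * z.2 := (abs_nonneg _).trans d1
        have : 0 ≤ L * D z := by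
          have := mul_nonneg hL0 (mul_pos p2 p3).le
          simp only [hD]; linarith
        linarith
  obtain ⟨F, hF1, hF2, ⟨B, hB⟩, -⟩ := exists_cutoff (D := D) isOpen_refTri isBounded_refTri f.2 hDs
    (fun z hz => by
      obtain ⟨hz1, hz2, hz3⟩ := hz
      exact mul_pos (mul_pos hz1 (by linarith)) (by linarith))
    (fun z hz => by
      rw [frontier, isOpen_refTri.interior_eq] at hz
      have hcl : closure refTri ⊆ {z : ℝ × ℝ | 0 ≤ z.2 ∧ 3 * z.2 ≤ z.1 ∧ z.1 ≤ π} := by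
        refine closure_minimal (fun z hz => ⟨hz.1.le, hz.2.1.le, hz.2.2.le⟩) ?_
        exact (isClosed_le continuous_const continuous_snd).inter
          ((isClosed_le (continuous_const.mul continuous_snd) continuous_fst).inter
            (isClosed_le continuous_fst continuous_const))
      obtain ⟨c1, c2, c3⟩ := hcl hz.1
      have hn : z ∉ refTri := hz.2
      by_contra h0
      have hD0 : z.2 * (z.1 / 3 - z.2) * (π - z.1) ≠ 0 := h0
      refine hn ⟨lt_of_le_of_ne c1 fun h => hD0 ?_, lt_of_le_of_ne c2 fun h => hD0 ?_,
        lt_of_le_of_ne c3 fun h => hD0 ?_⟩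
      · rw [← h]; ring
      · rw [← h]; ring
      · rw [← h]; ring) hnorm
  exact ⟨fun n => ⟨F n, hF1 n⟩, hF2, B, fun n z _ => hB n z⟩

/-- Upper bound for the eigenvalues from a family of smooth functions vanishing on the sides. -/
theorem ev_refTri_le {a b c : ℝ} (h : PosForm a b c) {k : ℕ} (hk : k ≠ 0) (e : Fin k → SM)
    (h1 : ∀ i x, (e i).1 (x, 0) = 0) (h2 : ∀ i y, (e i).1 (3 * y, y) = 0)
    (h3 : ∀ i y, (e i).1 (π, y) = 0) {N μ : ℝ} (hN : 0 < N) (hμ : 0 ≤ μ)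
    (hm : ∀ i j, massR (e i) (e j) = if i = j then N else 0)
    (he : ∀ x : Fin k → ℝ, energyR a b c (∑ i, x i • e i) (∑ i, x i • e i) ≤
      μ * (N * ∑ i, x i ^ 2)) : ev refTri a b c k ≤ μ := by
  choose F hF using fun i => exists_bddTendsto (e i) (h1 i) (h2 i) (h3 i)
  refine minmax_le_of_tendsto (energy_nonneg h) mass_pos hk (fun n i => F i n)
    (fun i j => energyR a b c (e i) (e j)) hN hμ (fun i j => ?_) (fun i j => ?_) fun x => ?_
  · simp only [← energyR_toSM]
    exact (hF i).energyR (hF j)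
  · simp only [← massR_toSM, ← hm i j]
    exact (hF i).massR (hF j)
  · refine le_trans (le_of_eq ?_) (he x)
    simp only [map_sum, LinearMap.sum_apply, map_smul, LinearMap.smul_apply, smul_eq_mul,
      Finset.mul_sum]
    rw [Finset.sum_comm]
    refine Finset.sum_congr rfl fun i _ => Finset.sum_congr rfl fun j _ => ?_
    rw [energyR_symm]; ring

/-- The function `sin (a x) sin (b y)`. -/
noncomputable def sinProd (a b : ℤ) : SM :=
  ⟨fun z => sin (a * z.1) * sin (b * z.2), by
    show ContDiff ℝ (⊤ : ℕ∞) fun z : ℝ × ℝ => sin (a * z.1) * sin (b * z.2)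
    fun_prop⟩

theorem sinProd_apply (a b : ℤ) (z : ℝ × ℝ) : (sinProd a b).1 z = sin (a * z.1) * sin (b * z.2) := rfl

theorem hasFDerivAt_mul_comp {f g : ℝ → ℝ} {f' g' : ℝ} {z : ℝ × ℝ} (hf : HasDerivAt f f' z.1)
    (hg : HasDerivAt g g' z.2) : HasFDerivAt (fun z : ℝ × ℝ => f z.1 * g z.2)
      ((f' * g z.2) • ContinuousLinearMap.fst ℝ ℝ ℝ + (f z.1 * g') • ContinuousLinearMap.snd ℝ ℝ ℝ) z := by
  have h1 : HasFDerivAt (fun z : ℝ × ℝ => f z.1) (f' • ContinuousLinearMap.fst ℝ ℝ ℝ) z :=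
    hf.comp_hasFDerivAt z hasFDerivAt_fst
  have h2 : HasFDerivAt (fun z : ℝ × ℝ => g z.2) (g' • ContinuousLinearMap.snd ℝ ℝ ℝ) z :=
    hg.comp_hasFDerivAt z hasFDerivAt_snd
  refine (h1.mul h2).congr_fderiv ?_
  ext <;> simp <;> ring

theorem px_mul_comp {f g : ℝ → ℝ} {f' : ℝ} {z : ℝ × ℝ} (hf : HasDerivAt f f' z.1)
    (hg : DifferentiableAt ℝ g z.2) : px (fun z => f z.1 * g z.2) z = f' * g z.2 := by
  rw [px, (hasFDerivAt_mul_comp hf hg.hasDerivAt).fderiv]; simp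

theorem py_mul_comp {f g : ℝ → ℝ} {g' : ℝ} {z : ℝ × ℝ} (hf : DifferentiableAt ℝ f z.1)
    (hg : HasDerivAt g g' z.2) : py (fun z => f z.1 * g z.2) z = f z.1 * g' := by
  rw [py, (hasFDerivAt_mul_comp hf.hasDerivAt hg).fderiv]; simp

theorem hasDerivAt_sin_mul (a x : ℝ) : HasDerivAt (fun x => sin (a * x)) (a * cos (a * x)) x :=
  (((hasDerivAt_id x).const_mul a).sin).congr_deriv (by simp; ring)

theorem hasDerivAt_cos_mul (a x : ℝ) : HasDerivAt (fun x => a * cos (a * x)) (-a ^ 2 * sin (a * x)) x :=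
  ((((hasDerivAt_id x).const_mul a).cos).const_mul a).congr_deriv (by simp; ring)

theorem px_sinProd (a b : ℤ) (z : ℝ × ℝ) :
    px (sinProd a b).1 z = a * cos (a * z.1) * sin (b * z.2) :=
  px_mul_comp (hasDerivAt_sin_mul a z.1) (hasDerivAt_sin_mul b z.2).differentiableAt

theorem py_sinProd (a b : ℤ) (z : ℝ × ℝ) :
    py (sinProd a b).1 z = sin (a * z.1) * (b * cos (b * z.2)) :=
  py_mul_comp (hasDerivAt_sin_mul a z.1).differentiableAt (hasDerivAt_sin_mul b z.2)

theorem integral_mul_px {Ω : Set (ℝ × ℝ)} {g : ℝ × ℝ → ℝ} (hg : ContDiff ℝ (⊤ : ℕ∞) g) (u : TF Ω) :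
    ∫ z, g z * px u.1 z = -∫ z, px g z * u.1 z := by
  refine integral_mul_fderiv_eq_neg_fderiv_mul_of_integrable ?_ ?_ ?_
    (fun x _ => hg.differentiable (by simp) x) (fun x _ => (TF.smooth u).differentiable (by simp) x)
  · exact (TF.integrable u (continuous_px hg)).congr (.of_forall fun z => mul_comm _ _)
  · exact (TF.integrable_px u hg.continuous).congr (.of_forall fun z => mul_comm _ _)
  · exact (TF.integrable u hg.continuous).congr (.of_forall fun z => mul_comm _ _)

theorem integral_mul_py {Ω : Set (ℝ × ℝ)} {g : ℝ × ℝ → ℝ} (hg : ContDiff ℝ (⊤ : ℕ∞) g) (u : TF Ω) :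
    ∫ z, g z * py u.1 z = -∫ z, py g z * u.1 z := by
  refine integral_mul_fderiv_eq_neg_fderiv_mul_of_integrable ?_ ?_ ?_
    (fun x _ => hg.differentiable (by simp) x) (fun x _ => (TF.smooth u).differentiable (by simp) x)
  · exact (TF.integrable u (continuous_py hg)).congr (.of_forall fun z => mul_comm _ _)
  · exact (TF.integrable_py u hg.continuous).congr (.of_forall fun z => mul_comm _ _)
  · exact (TF.integrable u hg.continuous).congr (.of_forall fun z => mul_comm _ _)

theorem massR_toSM_right (w : SM) (u : TF refTri) : massR w (TF.toSM u) = ∫ z, w.1 z * u.1 z := by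
  rw [massR_apply]
  refine setIntegral_eq_integral_of_forall_compl_eq_zero fun z hz => ?_
  have : u.1 z = 0 := image_eq_zero_of_notMem_tsupport fun h => hz (TF.supp u h)
  simp [TF.toSM, this]

theorem energyR_toSM_right {a b c : ℝ} (w : SM) (u : TF refTri) :
    energyR a b c w (TF.toSM u) = ∫ z, enDensity a b c w.1 u.1 z := by
  rw [energyR_apply]
  refine setIntegral_eq_integral_of_forall_compl_eq_zero fun z hz => ?_
  have h : z ∉ tsupport u.1 := fun h => hz (TF.supp u h)
  simp [TF.toSM, enDensity, px_eq_zero_of_notMem h, py_eq_zero_of_notMem h]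

theorem energyR_sinProd (a b : ℤ) (u : TF refTri) : energyR 3 0 1 (sinProd a b) (TF.toSM u) =
    (3 * (a : ℝ) ^ 2 + (b : ℝ) ^ 2) * massR (sinProd a b) (TF.toSM u) := by
  rw [energyR_toSM_right, massR_toSM_right]
  have s1 : ContDiff ℝ (⊤ : ℕ∞) fun z : ℝ × ℝ => (a * cos (a * z.1)) * sin (b * z.2) := by fun_prop
  have s2 : ContDiff ℝ (⊤ : ℕ∞) fun z : ℝ × ℝ => sin (a * z.1) * (b * cos (b * z.2)) := by fun_prop
  have h1 := integral_mul_px s1 u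
  have h2 := integral_mul_py s2 u
  have e1 : ∀ z, px (fun z : ℝ × ℝ => (a * cos (a * z.1)) * sin (b * z.2)) z =
      -(a : ℝ) ^ 2 * sin (a * z.1) * sin (b * z.2) := fun z =>
    px_mul_comp (hasDerivAt_cos_mul a z.1) (hasDerivAt_sin_mul b z.2).differentiableAt
  have e2 : ∀ z, py (fun z : ℝ × ℝ => sin (a * z.1) * (b * cos (b * z.2))) z =
      sin (a * z.1) * (-(b : ℝ) ^ 2 * sin (b * z.2)) := fun z =>
    py_mul_comp (hasDerivAt_sin_mul a z.1).differentiableAt (hasDerivAt_cos_mul b z.2)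
  have h3 : (∫ z, px (fun z : ℝ × ℝ => (a * cos (a * z.1)) * sin (b * z.2)) z * u.1 z) =
      -(a : ℝ) ^ 2 * ∫ z, (sinProd a b).1 z * u.1 z := by
    rw [← integral_const_mul]; congr 1; ext z; rw [e1, sinProd_apply]; ring
  have h4 : (∫ z, py (fun z : ℝ × ℝ => sin (a * z.1) * (b * cos (b * z.2))) z * u.1 z) =
      -(b : ℝ) ^ 2 * ∫ z, (sinProd a b).1 z * u.1 z := by
    rw [← integral_const_mul]; congr 1; ext z; rw [e2, sinProd_apply]; ring
  have h5 : ∫ z, enDensity 3 0 1 (sinProd a b).1 u.1 z =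
      3 * (∫ z, ((a * cos (a * z.1)) * sin (b * z.2)) * px u.1 z) +
        ∫ z, (sin (a * z.1) * (b * cos (b * z.2))) * py u.1 z := by
    rw [← integral_const_mul, ← integral_add]
    · congr 1; ext z; rw [enDensity, px_sinProd, py_sinProd]; ring
    · exact ((TF.integrable_px u s1.continuous).congr (.of_forall fun z => mul_comm _ _)).const_mul _
    · exact (TF.integrable_py u s2.continuous).congr (.of_forall fun z => mul_comm _ _)
  rw [h5, h1, h2, h3, h4]; ring

/-- The Dirichlet eigenfunctions of the reference triangle. -/
noncomputable def triSin (a m : ℤ) : SM :=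
  sinProd a (a - 2 * m) + sinProd m (2 * a - m) - sinProd (a - m) (a + m)

theorem triSin_apply (a m : ℤ) (z : ℝ × ℝ) : (triSin a m).1 z =
    (sinProd a (a - 2 * m)).1 z + (sinProd m (2 * a - m)).1 z - (sinProd (a - m) (a + m)).1 z := rfl

theorem triSin_bottom (a m : ℤ) (x : ℝ) : (triSin a m).1 (x, 0) = 0 := by
  simp [triSin_apply, sinProd_apply]

theorem triSin_right (a m : ℤ) (y : ℝ) : (triSin a m).1 (π, y) = 0 := by
  simp only [triSin_apply, sinProd_apply, sin_int_mul_pi]; simp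

theorem triSin_hyp (a m : ℤ) (y : ℝ) : (triSin a m).1 (3 * y, y) = 0 := by
  have h : ∀ p q : ℝ, sin p * sin q = (cos (p - q) - cos (p + q)) / 2 := fun p q => by
    rw [cos_sub, cos_add]; ring
  simp only [triSin_apply, sinProd_apply, h]
  push_cast
  rw [show (a : ℝ) * (3 * y) - (a - 2 * m) * y = (2 * a + 2 * m) * y by ring,
    show (a : ℝ) * (3 * y) + (a - 2 * m) * y = (4 * a - 2 * m) * y by ring,
    show (m : ℝ) * (3 * y) - (2 * a - m) * y = -((2 * a - 4 * m) * y) by ring,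
    show (m : ℝ) * (3 * y) + (2 * a - m) * y = (2 * a + 2 * m) * y by ring,
    show ((a : ℝ) - m) * (3 * y) - (a + m) * y = (2 * a - 4 * m) * y by ring,
    show ((a : ℝ) - m) * (3 * y) + (a + m) * y = (4 * a - 2 * m) * y by ring, cos_neg]
  ring

theorem energyR_triSin_toSM (a m : ℤ) (u : TF refTri) : energyR 3 0 1 (triSin a m) (TF.toSM u) =
    (4 * a ^ 2 - 4 * a * m + 4 * m ^ 2) * massR (triSin a m) (TF.toSM u) := by
  simp only [triSin, map_add, map_sub, LinearMap.add_apply, LinearMap.sub_apply, energyR_sinProd]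
  push_cast
  ring

theorem energyR_triSin (a m a' m' : ℤ) : energyR 3 0 1 (triSin a m) (triSin a' m') =
    (4 * a ^ 2 - 4 * a * m + 4 * m ^ 2) * massR (triSin a m) (triSin a' m') := by
  obtain ⟨F, hF⟩ := exists_bddTendsto (triSin a' m') (triSin_bottom a' m') (triSin_hyp a' m')
    (triSin_right a' m')
  refine tendsto_nhds_unique ((bddTendsto_const (triSin a m)).energyR hF) ?_
  simp only [energyR_triSin_toSM]
  exact ((bddTendsto_const (triSin a m)).massR hF).const_mul _

theorem massR_triSin_eq_zero {a m a' m' : ℤ}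
    (h : 4 * a ^ 2 - 4 * a * m + 4 * m ^ 2 ≠ 4 * a' ^ 2 - 4 * a' * m' + 4 * m' ^ 2) :
    massR (triSin a m) (triSin a' m') = 0 := by
  have h1 := energyR_triSin a m a' m'
  have h2 := energyR_triSin a' m' a m
  rw [energyR_symm, massR_symm, h1] at h2
  have h3 : ((4 * a ^ 2 - 4 * a * m + 4 * m ^ 2 : ℤ) : ℝ) ≠
      ((4 * a' ^ 2 - 4 * a' * m' + 4 * m' ^ 2 : ℤ) : ℝ) := by exact_mod_cast h
  push_cast at h3
  have h4 : ((4 * (a : ℝ) ^ 2 - 4 * a * m + 4 * m ^ 2) - (4 * (a' : ℝ) ^ 2 - 4 * a' * m' + 4 * m' ^ 2)) *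
      massR (triSin a m) (triSin a' m') = 0 := by linarith
  exact (mul_eq_zero.1 h4).resolve_left (sub_ne_zero.2 h3)

theorem setIntegral_refTri {g : ℝ × ℝ → ℝ} (hg : Continuous g) :
    ∫ z in refTri, g z = ∫ x in (0 : ℝ)..π, ∫ y in (0 : ℝ)..x / 3, g (x, y) := by
  have hi : Integrable (refTri.indicator g) :=
    (integrable_indicator_iff isOpen_refTri.measurableSet).2 (integrableOn_refTri hg)
  rw [← integral_indicator isOpen_refTri.measurableSet, Measure.volume_eq_prod, integral_prod _ hi,
    intervalIntegral.integral_of_le pi_pos.le, integral_Ioc_eq_integral_Ioo,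
    ← integral_indicator measurableSet_Ioo]
  congr 1
  ext x
  by_cases hx : x ∈ Set.Ioo 0 π
  · rw [Set.indicator_of_mem hx, intervalIntegral.integral_of_le (by linarith [hx.1]),
      integral_Ioc_eq_integral_Ioo, ← integral_indicator measurableSet_Ioo]
    congr 1
    ext y
    have : (x, y) ∈ refTri ↔ y ∈ Set.Ioo 0 (x / 3) :=
      ⟨fun h => ⟨h.1, by have := h.2.1; simp only at this; linarith⟩,
        fun h => ⟨h.1, by have := h.2; simp only; linarith, hx.2⟩⟩
    simp only [Set.indicator, this]
  · rw [Set.indicator_of_notMem hx]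
    refine integral_eq_zero_of_ae (.of_forall fun y => ?_)
    refine Set.indicator_of_notMem (fun h => hx ⟨?_, h.2.2⟩) _
    have h1 := h.1
    have h2 := h.2.1
    simp only at h1 h2
    linarith

/-- The value of `(1 - cos (k π / 3)) / k`. -/
def sinInt (k : ℤ) : ℚ :=
  if k % 6 = 0 then 0 else if k % 6 = 3 then 2 / k else if k % 2 = 0 then 3 / (2 * k) else 1 / (2 * k)

theorem one_sub_cos_eq (k : ℤ) : 1 - cos (k * (π / 3)) = k * (sinInt k : ℝ) := by
  by_cases hk : k = 0
  · simp [hk]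
  have hk' : (k : ℝ) ≠ 0 := by exact_mod_cast hk
  obtain ⟨j, r, hr, hkr⟩ : ∃ j r : ℤ, r = k % 6 ∧ k = r + 6 * j :=
    ⟨k / 6, k % 6, rfl, by omega⟩
  have hc : cos (k * (π / 3)) = cos (r * (π / 3)) := by
    rw [hkr]; push_cast
    rw [show ((r : ℝ) + 6 * j) * (π / 3) = r * (π / 3) + j * (2 * π) by ring, cos_add_int_mul_two_pi]
  have h2 : cos (2 * (π / 3)) = -1 / 2 := by rw [cos_two_mul, cos_pi_div_three]; norm_num
  have hr6 : r = 0 ∨ r = 1 ∨ r = 2 ∨ r = 3 ∨ r = 4 ∨ r = 5 := by omega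
  rw [hc, sinInt, ← hr]
  rcases hr6 with rfl | rfl | rfl | rfl | rfl | rfl
  · simp
  · have : k % 2 ≠ 0 := by omega
    simp [this]; field_simp; norm_num
  · have : k % 2 = 0 := by omega
    simp [this, h2]; field_simp; norm_num
  · have e : (3 : ℝ) * (π / 3) = π := by ring
    simp [e]; field_simp; norm_num
  · have : k % 2 = 0 := by omega
    have e : (4 : ℝ) * (π / 3) = 2 * π - 2 * (π / 3) := by ring
    simp [this, e, cos_two_pi_sub, h2]; field_simp; norm_num
  · have : k % 2 ≠ 0 := by omega
    have e : (5 : ℝ) * (π / 3) = 2 * π - π / 3 := by ring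
    simp [this, e, cos_two_pi_sub]; field_simp; norm_num

theorem integral_sin_third (k : ℤ) : ∫ x in (0 : ℝ)..π, sin (k * (x / 3)) = 3 * (sinInt k : ℝ) := by
  by_cases hk : k = 0
  · simp [hk, sinInt]
  have hk' : (k : ℝ) ≠ 0 := by exact_mod_cast hk
  have h : ∀ x ∈ Set.uIcc 0 π, HasDerivAt (fun x => -(3 / k) * cos (k * (x / 3))) (sin (k * (x / 3))) x := by
    intro x _
    refine (((((hasDerivAt_id x).div_const 3).const_mul (k : ℝ)).cos).const_mul (-(3 / k : ℝ))).congr_deriv ?_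
    simp; field_simp
  rw [intervalIntegral.integral_eq_sub_of_hasDerivAt h (Continuous.intervalIntegrable (by fun_prop) _ _)]
  have := one_sub_cos_eq k
  have h0 : -(3 / k) * cos (k * (π / 3)) - -(3 / (k : ℝ)) * cos (k * (0 / 3)) =
      3 / k * (1 - cos (k * (π / 3))) := by simp; ring
  rw [h0, this]; field_simp

/-- The rational part of the integral of `cos (m x) cos (n y)` over the reference triangle. -/
def cosInt (m n : ℤ) : ℚ :=
  if n = 0 then (if m = 0 then 0 else -sinInt (3 * m) / m)
  else 3 / (2 * n) * (sinInt (3 * m + n) + sinInt (n - 3 * m))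

/-- The indicator of `(0, 0)`. -/
def isZero (m n : ℤ) : ℚ := if m = 0 ∧ n = 0 then 1 else 0

/-- The integral of `sin (m x) sin (n y)` over the reference triangle. -/
def sinSinInt (m n : ℤ) : ℚ :=
  if n = 0 then 0
  else 1 / n * (3 * sinInt (3 * m) - 3 / 2 * (sinInt (3 * m + n) + sinInt (3 * m - n)))

theorem integral_cos_cos (m n : ℤ) : ∫ z in refTri, cos (m * z.1) * cos (n * z.2) =
    (cosInt m n : ℝ) + π ^ 2 / 6 * (isZero m n : ℝ) := by
  rw [setIntegral_refTri (by fun_prop)]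
  simp only [intervalIntegral.integral_const_mul]
  by_cases hn : n = 0
  · by_cases hm : m = 0
    · simp [hn, hm, cosInt, isZero]; ring
    · have hm' : (m : ℝ) ≠ 0 := by exact_mod_cast hm
      have h : ∀ x ∈ Set.uIcc 0 π, HasDerivAt
          (fun x => x / 3 * (sin (m * x) / m) + 1 / (3 * m ^ 2) * cos (m * x)) (cos (m * x) * (x / 3)) x := by
        intro x _
        refine ((((hasDerivAt_id x).div_const 3).mul ((hasDerivAt_sin_mul m x).div_const (m : ℝ))).add
          ((((hasDerivAt_id x).const_mul (m : ℝ)).cos).const_mul (1 / (3 * (m : ℝ) ^ 2)))).congr_deriv ?_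
        simp; field_simp; ring
      have e : ∀ x : ℝ, (∫ y in (0 : ℝ)..x / 3, cos (n * y)) = x / 3 := by intro x; simp [hn]
      simp only [e]
      rw [intervalIntegral.integral_eq_sub_of_hasDerivAt h
        (Continuous.intervalIntegrable (by fun_prop) _ _)]
      have h3 := one_sub_cos_eq (3 * m)
      have e3 : ((3 * m : ℤ) : ℝ) * (π / 3) = m * π := by push_cast; ring
      rw [e3] at h3
      have h4 : cos (m * π) = 1 - ((3 * m : ℤ) : ℝ) * (sinInt (3 * m) : ℝ) := by linarith
      simp only [h4, sin_int_mul_pi]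
      simp [cosInt, isZero, hn, hm]; field_simp; ring
  · have hn' : (n : ℝ) ≠ 0 := by exact_mod_cast hn
    have e : ∀ x : ℝ, cos (m * x) * (∫ y in (0 : ℝ)..x / 3, cos (n * y)) =
        1 / (2 * n) * (sin ((3 * m + n : ℤ) * (x / 3)) + sin ((n - 3 * m : ℤ) * (x / 3))) := by
      intro x
      rw [intervalIntegral.integral_comp_mul_left (fun y => cos y) hn', integral_cos]
      push_cast
      rw [show (3 * (m : ℝ) + n) * (x / 3) = n * (x / 3) + m * x by ring,
        show ((n : ℝ) - 3 * m) * (x / 3) = n * (x / 3) - m * x by ring, sin_add, sin_sub]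
      simp
      field_simp
      ring
    simp only [e]
    rw [intervalIntegral.integral_const_mul, intervalIntegral.integral_add
      (Continuous.intervalIntegrable (by fun_prop) _ _) (Continuous.intervalIntegrable (by fun_prop) _ _),
      integral_sin_third, integral_sin_third]
    simp [cosInt, isZero, hn]; ring

theorem integral_sin_sin (m n : ℤ) : ∫ z in refTri, sin (m * z.1) * sin (n * z.2) =
    (sinSinInt m n : ℝ) := by
  rw [setIntegral_refTri (by fun_prop)]
  simp only [intervalIntegral.integral_const_mul]
  by_cases hn : n = 0
  · simp [hn, sinSinInt]
  · have hn' : (n : ℝ) ≠ 0 := by exact_mod_cast hn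
    have e : ∀ x : ℝ, sin (m * x) * (∫ y in (0 : ℝ)..x / 3, sin (n * y)) =
        1 / n * (sin ((3 * m : ℤ) * (x / 3)) - 1 / 2 * (sin ((3 * m + n : ℤ) * (x / 3)) +
          sin ((3 * m - n : ℤ) * (x / 3)))) := by
      intro x
      rw [intervalIntegral.integral_comp_mul_left (fun y => sin y) hn', integral_sin]
      push_cast
      rw [show (3 * (m : ℝ) + n) * (x / 3) = m * x + n * (x / 3) by ring,
        show (3 * (m : ℝ) - n) * (x / 3) = m * x - n * (x / 3) by ring,
        show 3 * (m : ℝ) * (x / 3) = m * x by ring, sin_add, sin_sub]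
      simp
      field_simp
      ring
    simp only [e]
    rw [intervalIntegral.integral_const_mul, intervalIntegral.integral_sub
      (Continuous.intervalIntegrable (by fun_prop) _ _) (Continuous.intervalIntegrable (by fun_prop) _ _),
      intervalIntegral.integral_const_mul, intervalIntegral.integral_add
      (Continuous.intervalIntegrable (by fun_prop) _ _) (Continuous.intervalIntegrable (by fun_prop) _ _),
      integral_sin_third, integral_sin_third, integral_sin_third]
    simp [sinSinInt, hn]; ring

/-- The polarization `(1 / 4) (f(a - a', b - b') + s f(a + a', b - b') - f(a - a', b + b') -
s f(a + a', b + b'))`. -/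
def cosPol (s : ℚ) (f : ℤ → ℤ → ℚ) (a b a' b' : ℤ) : ℚ :=
  (f (a - a') (b - b') + s * f (a + a') (b - b') - f (a - a') (b + b') - s * f (a + a') (b + b')) / 4

theorem massR_sinProd (a b a' b' : ℤ) : massR (sinProd a b) (sinProd a' b') =
    (cosPol (-1) cosInt a b a' b' : ℝ) + π ^ 2 / 6 * (cosPol (-1) isZero a b a' b' : ℝ) := by
  have h : ∀ z : ℝ × ℝ, (sinProd a b).1 z * (sinProd a' b').1 z =
      1 / 4 * (cos ((a - a' : ℤ) * z.1) * cos ((b - b' : ℤ) * z.2)) -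
      1 / 4 * (cos ((a + a' : ℤ) * z.1) * cos ((b - b' : ℤ) * z.2)) -
      1 / 4 * (cos ((a - a' : ℤ) * z.1) * cos ((b + b' : ℤ) * z.2)) +
      1 / 4 * (cos ((a + a' : ℤ) * z.1) * cos ((b + b' : ℤ) * z.2)) := by
    intro z
    simp only [sinProd_apply]
    push_cast
    simp only [sub_mul, add_mul, cos_sub, cos_add]
    ring
  rw [massR_apply]
  simp only [h]
  rw [integral_add, integral_sub, integral_sub]
  · simp only [integral_const_mul, integral_cos_cos, cosPol]
    push_cast
    ring
  all_goals exact integrableOn_refTri (by fun_prop)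

theorem integral_px_px_sinProd (a b a' b' : ℤ) :
    ∫ z in refTri, px (sinProd a b).1 z * px (sinProd a' b').1 z =
    ((a * a' * cosPol 1 cosInt a b a' b' : ℚ) : ℝ) +
      π ^ 2 / 6 * ((a * a' * cosPol 1 isZero a b a' b' : ℚ) : ℝ) := by
  have h : ∀ z : ℝ × ℝ, px (sinProd a b).1 z * px (sinProd a' b').1 z =
      a * a' / 4 * (cos ((a - a' : ℤ) * z.1) * cos ((b - b' : ℤ) * z.2)) +
      a * a' / 4 * (cos ((a + a' : ℤ) * z.1) * cos ((b - b' : ℤ) * z.2)) -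
      a * a' / 4 * (cos ((a - a' : ℤ) * z.1) * cos ((b + b' : ℤ) * z.2)) -
      a * a' / 4 * (cos ((a + a' : ℤ) * z.1) * cos ((b + b' : ℤ) * z.2)) := by
    intro z
    simp only [px_sinProd]
    push_cast
    simp only [sub_mul, add_mul, cos_sub, cos_add]
    ring
  simp only [h]
  rw [integral_sub, integral_sub, integral_add]
  · simp only [integral_const_mul, integral_cos_cos, cosPol]
    push_cast
    ring
  all_goals exact integrableOn_refTri (by fun_prop)

/-- The polarization of `sinSinInt`. -/
def sinPol (a b a' b' : ℤ) : ℚ :=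
  a * b' / 4 * (sinSinInt (a' + a) (b + b') + sinSinInt (a' + a) (b - b') +
    sinSinInt (a' - a) (b + b') + sinSinInt (a' - a) (b - b'))

theorem integral_px_py_sinProd (a b a' b' : ℤ) :
    ∫ z in refTri, px (sinProd a b).1 z * py (sinProd a' b').1 z = (sinPol a b a' b' : ℝ) := by
  have h : ∀ z : ℝ × ℝ, px (sinProd a b).1 z * py (sinProd a' b').1 z =
      a * b' / 4 * (sin ((a' + a : ℤ) * z.1) * sin ((b + b' : ℤ) * z.2)) +
      a * b' / 4 * (sin ((a' + a : ℤ) * z.1) * sin ((b - b' : ℤ) * z.2)) +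
      a * b' / 4 * (sin ((a' - a : ℤ) * z.1) * sin ((b + b' : ℤ) * z.2)) +
      a * b' / 4 * (sin ((a' - a : ℤ) * z.1) * sin ((b - b' : ℤ) * z.2)) := by
    intro z
    simp only [px_sinProd, py_sinProd]
    push_cast
    simp only [sub_mul, add_mul, sin_sub, sin_add]
    ring
  simp only [h]
  rw [integral_add, integral_add, integral_add]
  · simp only [integral_const_mul, integral_sin_sin, sinPol]
    push_cast
    ring
  all_goals exact integrableOn_refTri (by fun_prop)

theorem energyR_sinProd_sinProd (α β : ℝ) (a b a' b' : ℤ) :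
    energyR α β 0 (sinProd a b) (sinProd a' b') =
    α * (((a * a' * cosPol 1 cosInt a b a' b' : ℚ) : ℝ) +
      π ^ 2 / 6 * ((a * a' * cosPol 1 isZero a b a' b' : ℚ) : ℝ)) +
    β * ((sinPol a b a' b' + sinPol a' b' a b : ℚ) : ℝ) := by
  have c1 := continuous_px (sinProd a b).2
  have c2 := continuous_py (sinProd a b).2
  have c3 := continuous_px (sinProd a' b').2
  have c4 := continuous_py (sinProd a' b').2
  rw [energyR_apply]
  simp only [enDensity, zero_mul, add_zero]
  rw [integral_add (integrableOn_refTri (by fun_prop)) (integrableOn_refTri (by fun_prop)),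
    integral_const_mul, integral_const_mul,
    integral_add (integrableOn_refTri (by fun_prop)) (integrableOn_refTri (by fun_prop)),
    integral_px_px_sinProd, integral_px_py_sinProd]
  simp only [mul_comm (py _ _), integral_px_py_sinProd]
  push_cast
  ring

/-- The quadratic form on `triSin` determined by a bilinear form on products of sines. -/
def triForm (f : ℤ → ℤ → ℤ → ℤ → ℚ) (a m : ℤ) : ℚ :=
  (f a (a - 2 * m) a (a - 2 * m) + f a (a - 2 * m) m (2 * a - m) - f a (a - 2 * m) (a - m) (a + m)) +
  (f m (2 * a - m) a (a - 2 * m) + f m (2 * a - m) m (2 * a - m) - f m (2 * a - m) (a - m) (a + m)) -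
  (f (a - m) (a + m) a (a - 2 * m) + f (a - m) (a + m) m (2 * a - m) -
    f (a - m) (a + m) (a - m) (a + m))

theorem massR_triSin (a m : ℤ) : massR (triSin a m) (triSin a m) =
    (triForm (cosPol (-1) cosInt) a m : ℝ) + π ^ 2 / 6 * (triForm (cosPol (-1) isZero) a m : ℝ) := by
  simp only [triSin, map_add, map_sub, LinearMap.add_apply, LinearMap.sub_apply, massR_sinProd, triForm]
  push_cast
  ring

theorem energyR_triSin_self (α β : ℝ) (a m : ℤ) : energyR α β 0 (triSin a m) (triSin a m) =
    α * ((triForm (fun a b a' b' => a * a' * cosPol 1 cosInt a b a' b') a m : ℝ) +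
      π ^ 2 / 6 * (triForm (fun a b a' b' => a * a' * cosPol 1 isZero a b a' b') a m : ℝ)) +
      2 * β * (triForm sinPol a m : ℝ) := by
  simp only [triSin, map_add, map_sub, LinearMap.add_apply, LinearMap.sub_apply,
    energyR_sinProd_sinProd α β, triForm]
  push_cast
  ring

theorem energyR_triSin_eq (α β γ : ℝ) (a m : ℤ) : energyR α β γ (triSin a m) (triSin a m) =
    energyR (α - 3 * γ) β 0 (triSin a m) (triSin a m) +
      γ * ((4 * a ^ 2 - 4 * a * m + 4 * m ^ 2) * massR (triSin a m) (triSin a m)) := by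
  rw [← energyR_triSin]
  have h : ∀ u : SM, energyR (3 * γ) 0 γ u u = γ * energyR 3 0 1 u u := by
    intro u
    rw [energyR_apply, energyR_apply, ← integral_const_mul]
    congr 1; ext z; simp only [enDensity]; ring
  rw [← h, ← energyR_add]
  congr 4 <;> ring

theorem massR_triSin_three_one : massR (triSin 3 1) (triSin 3 1) = π ^ 2 / 8 := by
  have h1 : triForm (cosPol (-1) cosInt) 3 1 = 0 := by decide +kernel
  have h2 : triForm (cosPol (-1) isZero) 3 1 = 3 / 4 := by decide +kernel
  rw [massR_triSin, h1, h2]; push_cast; ring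

theorem massR_triSin_four_one : massR (triSin 4 1) (triSin 4 1) = π ^ 2 / 8 := by
  have h1 : triForm (cosPol (-1) cosInt) 4 1 = 0 := by decide +kernel
  have h2 : triForm (cosPol (-1) isZero) 4 1 = 3 / 4 := by decide +kernel
  rw [massR_triSin, h1, h2]; push_cast; ring

theorem massR_triSin_five_two : massR (triSin 5 2) (triSin 5 2) = π ^ 2 / 8 := by
  have h1 : triForm (cosPol (-1) cosInt) 5 2 = 0 := by decide +kernel
  have h2 : triForm (cosPol (-1) isZero) 5 2 = 3 / 4 := by decide +kernel
  rw [massR_triSin, h1, h2]; push_cast; ring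

theorem massR_triSin_five_one : massR (triSin 5 1) (triSin 5 1) = π ^ 2 / 8 := by
  have h1 : triForm (cosPol (-1) cosInt) 5 1 = 0 := by decide +kernel
  have h2 : triForm (cosPol (-1) isZero) 5 1 = 3 / 4 := by decide +kernel
  rw [massR_triSin, h1, h2]; push_cast; ring

theorem energyR_triSin_three_one (α β γ : ℝ) : energyR α β γ (triSin 3 1) (triSin 3 1) =
    (α - 3 * γ) * (7 / 12 * π ^ 2 - 19683 / 12800) - 2 * β * (179209 / 69120) + γ * (28 * (π ^ 2 / 8)) := by
  have h1 : triForm (fun a b a' b' => a * a' * cosPol 1 cosInt a b a' b') 3 1 = -19683 / 12800 := by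
    decide +kernel
  have h2 : triForm (fun a b a' b' => a * a' * cosPol 1 isZero a b a' b') 3 1 = 7 / 2 := by
    decide +kernel
  have h3 : triForm sinPol 3 1 = -179209 / 69120 := by decide +kernel
  rw [energyR_triSin_eq, energyR_triSin_self, h1, h2, h3, massR_triSin_three_one]; push_cast; ring

theorem energyR_triSin_four_one (α β γ : ℝ) : energyR α β γ (triSin 4 1) (triSin 4 1) =
    (α - 3 * γ) * (13 / 12 * π ^ 2 - 19683 / 39200) - 2 * β * (302089 / 211680) +
      γ * (52 * (π ^ 2 / 8)) := by
  have h1 : triForm (fun a b a' b' => a * a' * cosPol 1 cosInt a b a' b') 4 1 = -19683 / 39200 := by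
    decide +kernel
  have h2 : triForm (fun a b a' b' => a * a' * cosPol 1 isZero a b a' b') 4 1 = 13 / 2 := by
    decide +kernel
  have h3 : triForm sinPol 4 1 = -302089 / 211680 := by decide +kernel
  rw [energyR_triSin_eq, energyR_triSin_self, h1, h2, h3, massR_triSin_four_one]; push_cast; ring

theorem energyR_triSin_five_one (α β γ : ℝ) : energyR α β γ (triSin 5 1) (triSin 5 1) =
    (α - 3 * γ) * (7 / 4 * π ^ 2) - 2 * β * (4864 / 675) + γ * (84 * (π ^ 2 / 8)) := by
  have h1 : triForm (fun a b a' b' => a * a' * cosPol 1 cosInt a b a' b') 5 1 = 0 := by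
    decide +kernel
  have h2 : triForm (fun a b a' b' => a * a' * cosPol 1 isZero a b a' b') 5 1 = 21 / 2 := by
    decide +kernel
  have h3 : triForm sinPol 5 1 = -4864 / 675 := by decide +kernel
  rw [energyR_triSin_eq, energyR_triSin_self, h1, h2, h3, massR_triSin_five_one]; push_cast; ring

theorem sine_bessel {f : ℝ → ℝ} (hc : Continuous f) (h0 : ∀ x, x ∉ Set.Ioo 0 π → f x = 0) (M : ℕ) :
    ∑ a ∈ Finset.range M, (2 / π) * (∫ x, f x * sin (a * x)) ^ 2 ≤ ∫ x, f x ^ 2 := by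
  have hpi := pi_pos
  set F : ℝ → ℂ := fun x => ((f x + -1 * f (-x) : ℝ) : ℂ) with hF
  have s1 := (hasSum_sq_fourierCoeffOn_symm hc h0 (ε := -1) (by norm_num)).nat_add_neg
  have hodd : ∀ n : ℤ, ‖fourierCoeffOn (neg_lt_self pi_pos) F n‖ ^ 2 =
      (1 / π ^ 2) * (∫ x, f x * sin (n * x)) ^ 2 := by
    intro n
    rw [← fourierCoeffOn_odd hc h0 n]
    congr 3
    ext x
    simp [hF, sub_eq_add_neg]
  have hev : ∀ n : ℕ, (∫ x, f x * sin (((-(n : ℤ) : ℤ) : ℝ) * x)) ^ 2 =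
      (∫ x, f x * sin (n * x)) ^ 2 := by
    intro n
    rw [← neg_sq, ← integral_neg]
    congr 2
    ext x
    push_cast
    rw [neg_mul, sin_neg]; ring
  have s4 := sum_le_hasSum (Finset.range M) (fun n _ => by positivity) s1
  have hz : (∫ x, f x * sin (((0 : ℤ) : ℝ) * x)) = 0 := by simp
  have e : ∀ n ∈ Finset.range M, π⁻¹ * ((2 / π) * (∫ x, f x * sin (n * x)) ^ 2) =
      ‖fourierCoeffOn (neg_lt_self pi_pos) F n‖ ^ 2 +
        ‖fourierCoeffOn (neg_lt_self pi_pos) F (-n)‖ ^ 2 := by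
    intro n _
    rw [hodd, hodd, hev]
    push_cast
    field_simp
    ring
  rw [← Finset.sum_congr rfl e, ← Finset.mul_sum, hodd, hz] at s4
  have hpp : (0 : ℝ) < π⁻¹ := by positivity
  refine le_of_mul_le_mul_left ?_ hpp
  simp only [one_div] at s4
  norm_num at s4
  linarith

section Square

variable {f : ℝ × ℝ → ℝ}

noncomputable def sinCoeff (f : ℝ × ℝ → ℝ) (a b : ℕ) : ℝ :=
  ∫ z, f z * (sin (a * z.1) * sin (b * z.2))

theorem hasDerivAt_sin_slice (hf : ContDiff ℝ (⊤ : ℕ∞) f) (hc : HasCompactSupport f) (b : ℕ) (x : ℝ) :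
    HasDerivAt (fun x => ∫ y, f (x, y) * sin (b * y)) (∫ y, px f (x, y) * sin (b * y)) x := by
  have hG : ContDiff ℝ (⊤ : ℕ∞) (fun z : ℝ × ℝ => f z * sin (b * z.2)) := by fun_prop
  have hGc : HasCompactSupport (fun z : ℝ × ℝ => f z * sin (b * z.2)) := hc.mul_right
  have h := hasDerivAt_integral_slice hG hGc x
  refine h.congr_deriv (integral_congr_ae (Filter.Eventually.of_forall fun y => ?_))
  have h1 := hasDerivAt_slice_left hG x y
  have h2 := (hasDerivAt_slice_left hf x y).mul_const (sin (b * y))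
  exact h1.unique h2

theorem gap_square (hf : ContDiff ℝ (⊤ : ℕ∞) f) (hc : HasCompactSupport f)
    (h0 : ∀ z, z ∉ Set.Ioo 0 π ×ˢ Set.Ioo 0 π → f z = 0) :
    112 * ∫ z, f z ^ 2 ≤ (3 * ∫ z, px f z ^ 2) + (∫ z, py f z ^ 2) +
      ∑ b ∈ Finset.range 11, ∑ a ∈ Finset.range 7,
        (112 - 3 * (a : ℝ) ^ 2 - (b : ℝ) ^ 2) * (4 / π ^ 2) * sinCoeff f a b ^ 2 := by
  have hpi := pi_pos
  have h0y : ∀ x y, y ∉ Set.Ioo 0 π → f (x, y) = 0 := fun x y hy => h0 _ fun h => hy h.2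
  have h0x : ∀ x y, x ∉ Set.Ioo 0 π → f (x, y) = 0 := fun x y hx => h0 _ fun h => hx h.1
  have hfc := hf.continuous
  have hpx := continuous_px hf
  have hpy := continuous_py hf
  have hpxc := hasCompactSupport_px hc
  have hpyc := hasCompactSupport_py hc
  have h0px : ∀ x y, y ∉ Set.Ioo 0 π → px f (x, y) = 0 := fun x y hy => by
    have h1 := hasDerivAt_slice_left hf x y
    have h2 : (fun t => f (t, y)) = fun _ => (0 : ℝ) := funext fun t => h0y t y hy
    rw [h2] at h1
    exact h1.unique (hasDerivAt_const x 0)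
  set g : ℕ → ℝ → ℝ := fun b x => ∫ y, f (x, y) * sin (b * y) with hg
  set g' : ℕ → ℝ → ℝ := fun b x => ∫ y, px f (x, y) * sin (b * y) with hg'
  have hgd : ∀ b x, HasDerivAt (g b) (g' b x) x := hasDerivAt_sin_slice hf hc
  have hgc : ∀ b, Continuous (g b) := fun b =>
    continuous_iff_continuousAt.2 fun x => (hgd b x).continuousAt
  have hgc' : ∀ b, Continuous (g' b) := fun b =>
    continuous_integral_slice (G := fun z => px f z * sin (b * z.2)) (by fun_prop) hpxc.mul_right
  have hg0 : ∀ b x, x ∉ Set.Ioo 0 π → g b x = 0 := fun b x hx => by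
    simp [hg, h0x x _ hx]
  have hcs : ∀ h : ℝ → ℝ, (∀ x, x ∉ Set.Ioo 0 π → h x = 0) → HasCompactSupport h := fun h hh =>
    HasCompactSupport.intro isCompact_Icc fun x hx => hh x fun hx' => hx (Set.Ioo_subset_Icc_self hx')
  have hg0' : ∀ b x, x ∉ Set.Ioo 0 π → g' b x = 0 := fun b x hx =>
    deriv_eq_zero_of_eq_zero_outside (hgd b) (hg0 b) hx
  have sqi : ∀ h : ℝ → ℝ, Continuous h → (∀ x, x ∉ Set.Ioo 0 π → h x = 0) →
      Integrable fun x => h x ^ 2 := fun h hh hh0 =>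
    (hh.pow 2).integrable_of_hasCompactSupport (hcs _ fun x hx => by simp [hh0 x hx])
  have sq2c : ∀ G : ℝ × ℝ → ℝ, HasCompactSupport G → HasCompactSupport fun z => G z ^ 2 :=
    fun G hG => hG.comp_left (g := fun t : ℝ => t ^ 2) (by norm_num)
  have iterI : ∀ G : ℝ × ℝ → ℝ, Continuous G → HasCompactSupport G →
      (∫ z, G z ^ 2) = ∫ x, ∫ y, G (x, y) ^ 2 := fun G hG hGc =>
    integral_eq_integral_slice (G := fun z => G z ^ 2) (hG.pow 2) (sq2c G hGc)
  have iterInt : ∀ G : ℝ × ℝ → ℝ, Continuous G → HasCompactSupport G →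
      Integrable fun x => ∫ y, G (x, y) ^ 2 := fun G hG hGc =>
    ((hG.pow 2).integrable_of_hasCompactSupport (sq2c G hGc)).integral_prod_left
  have A1 : 121 * (∫ z, f z ^ 2) ≤ (∫ z, py f z ^ 2) +
      ∑ b ∈ Finset.range 11, (121 - (b : ℝ) ^ 2) * (2 / π) * ∫ x, g b x ^ 2 := by
    have e : ∀ b : ℕ, (121 - (b : ℝ) ^ 2) * (2 / π) * (∫ x, g b x ^ 2) =
        ∫ x, (121 - (b : ℝ) ^ 2) * (2 / π) * g b x ^ 2 := fun b => (integral_const_mul _ _).symm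
    simp_rw [e]
    rw [iterI f hfc hc, iterI _ hpy hpyc, ← integral_const_mul]
    rw [← integral_finsetSum _ fun b _ => (sqi _ (hgc b) (hg0 b)).const_mul _,
      ← integral_add (iterInt _ hpy hpyc)
        (integrable_finsetSum _ fun b _ => (sqi _ (hgc b) (hg0 b)).const_mul _)]
    refine integral_mono ((iterInt _ hfc hc).const_mul _) ((iterInt _ hpy hpyc).add
      (integrable_finsetSum _ fun b _ => (sqi _ (hgc b) (hg0 b)).const_mul _)) fun x => ?_
    have := sine_gap (f := fun y => f (x, y)) (f' := fun y => py f (x, y))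
      (fun y => hasDerivAt_slice_right hf x y) (by fun_prop) (h0y x) 11
    norm_num at this ⊢
    exact this
  have A2 : ∑ b ∈ Finset.range 11, (2 / π) * (∫ x, g b x ^ 2) ≤ ∫ z, f z ^ 2 := by
    rw [iterI f hfc hc]
    simp_rw [← integral_const_mul]
    rw [← integral_finsetSum _ fun b _ => (sqi _ (hgc b) (hg0 b)).const_mul _]
    exact integral_mono (integrable_finsetSum _ fun b _ => (sqi _ (hgc b) (hg0 b)).const_mul _)
      (iterInt _ hfc hc) fun x => sine_bessel (f := fun y => f (x, y)) (by fun_prop) (h0y x) 11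
  have A3 : ∑ b ∈ Finset.range 11, (2 / π) * (∫ x, g' b x ^ 2) ≤ ∫ z, px f z ^ 2 := by
    rw [iterI _ hpx hpxc]
    simp_rw [← integral_const_mul]
    rw [← integral_finsetSum _ fun b _ => (sqi _ (hgc' b) (hg0' b)).const_mul _]
    exact integral_mono (integrable_finsetSum _ fun b _ => (sqi _ (hgc' b) (hg0' b)).const_mul _)
      (iterInt _ hpx hpxc) fun x =>
        sine_bessel (f := fun y => px f (x, y)) (by fun_prop) (h0px x) 11
  have hco : ∀ a b : ℕ, (∫ x, g b x * sin (a * x)) = sinCoeff f a b := fun a b => by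
    rw [sinCoeff, integral_eq_integral_slice
      (G := fun z => f z * (sin (a * z.1) * sin (b * z.2))) (by fun_prop) hc.mul_right]
    congr 1
    ext x
    simp only [hg]
    rw [← integral_mul_const]
    congr 1
    ext y
    ring
  have A4 : ∀ b ∈ Finset.range 11, (2 / π) * ((112 - (b : ℝ) ^ 2) * ∫ x, g b x ^ 2) ≤
      (2 / π) * (3 * (∫ x, g' b x ^ 2)) + ∑ a ∈ Finset.range 7,
        (112 - 3 * (a : ℝ) ^ 2 - (b : ℝ) ^ 2) * (4 / π ^ 2) * sinCoeff f a b ^ 2 := by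
    intro b _
    have B1 := sine_gap (hgd b) (hgc' b) (hg0 b) 7
    have B2 := sine_bessel (hgc b) (hg0 b) 7
    simp_rw [hco] at B1 B2
    have hb : 0 ≤ 35 + (b : ℝ) ^ 2 := by positivity
    have B3 := mul_le_mul_of_nonneg_left B2 hb
    have e : ∑ a ∈ Finset.range 7,
        (112 - 3 * (a : ℝ) ^ 2 - (b : ℝ) ^ 2) * (4 / π ^ 2) * sinCoeff f a b ^ 2 =
        (2 / π) * (3 * (∑ a ∈ Finset.range 7, (((7 : ℕ) : ℝ) ^ 2 - (a : ℝ) ^ 2) * (2 / π) *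
          sinCoeff f a b ^ 2) - (35 + (b : ℝ) ^ 2) *
          ∑ a ∈ Finset.range 7, (2 / π) * sinCoeff f a b ^ 2) := by
      rw [Finset.mul_sum, Finset.mul_sum, ← Finset.sum_sub_distrib, Finset.mul_sum]
      refine Finset.sum_congr rfl fun a _ => ?_
      push_cast
      field_simp
      ring
    rw [e, ← mul_add]
    refine mul_le_mul_of_nonneg_left ?_ (by positivity)
    push_cast at B1 ⊢
    linarith
  have A5 := Finset.sum_le_sum A4
  rw [Finset.sum_add_distrib] at A5
  have e1 : ∑ b ∈ Finset.range 11, (2 / π) * (3 * (∫ x, g' b x ^ 2)) =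
      3 * ∑ b ∈ Finset.range 11, (2 / π) * (∫ x, g' b x ^ 2) := by
    rw [Finset.mul_sum]; exact Finset.sum_congr rfl fun b _ => by ring
  have e2 : ∑ b ∈ Finset.range 11, (2 / π) * ((112 - (b : ℝ) ^ 2) * ∫ x, g b x ^ 2) =
      (∑ b ∈ Finset.range 11, (121 - (b : ℝ) ^ 2) * (2 / π) * ∫ x, g b x ^ 2) -
      9 * ∑ b ∈ Finset.range 11, (2 / π) * (∫ x, g b x ^ 2) := by
    rw [Finset.mul_sum, ← Finset.sum_sub_distrib]
    exact Finset.sum_congr rfl fun b _ => by ring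
  rw [e1, e2] at A5
  linarith

end Square

section AffineMaps

/-- The affine map `(x, y) ↦ (p x + q y + t, r x + s y + w)`. -/
def affMap (p q r s t w : ℝ) (z : ℝ × ℝ) : ℝ × ℝ := (p * z.1 + q * z.2 + t, r * z.1 + s * z.2 + w)

variable {p q r s t w : ℝ}

theorem integral_comp_affMap (h : |p * s - q * r| = 1) (g : ℝ × ℝ → ℝ) :
    ∫ z, g (affMap p q r s t w z) = ∫ z, g z := by
  have hd : p * s - q * r ≠ 0 := fun h0 => by simp [h0] at h
  set A := planeEquiv p q r s hd
  have hA : ∀ z, affMap p q r s t w z = A z + (t, w) := fun z => by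
    rw [planeEquiv_apply]; rfl
  have hdet : LinearMap.det (A : ℝ × ℝ →ₗ[ℝ] ℝ × ℝ) = p * s - q * r := by
    rw [← LinearMap.det_toMatrix (Module.Basis.finTwoProd ℝ), Matrix.det_fin_two]
    simp [LinearMap.toMatrix_apply, A, planeEquiv_apply]
  have hm : Measure.map A (volume : Measure (ℝ × ℝ)) = volume := by
    have := Measure.map_linearMap_addHaar_eq_smul_addHaar (volume : Measure (ℝ × ℝ))
      (f := (A : ℝ × ℝ →ₗ[ℝ] ℝ × ℝ)) (by rw [hdet]; exact hd)
    rw [hdet, abs_inv, h] at this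
    simpa using this
  simp_rw [hA]
  have h3 := integral_map_equiv (μ := (volume : Measure (ℝ × ℝ))) A.toHomeomorph.toMeasurableEquiv
    (fun z => g (z + (t, w)))
  have h4 : Measure.map A.toHomeomorph.toMeasurableEquiv (volume : Measure (ℝ × ℝ)) = volume := hm
  rw [h4, integral_add_right_eq_self (μ := (volume : Measure (ℝ × ℝ))) g (t, w)] at h3
  exact h3.symm

theorem contDiff_affMap : ContDiff ℝ (⊤ : ℕ∞) (affMap p q r s t w) := by
  unfold affMap; fun_prop

theorem hasFDerivAt_affMap (z : ℝ × ℝ) : ∃ A : ℝ × ℝ →L[ℝ] ℝ × ℝ,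
    HasFDerivAt (affMap p q r s t w) A z ∧ A (1, 0) = (p, r) ∧ A (0, 1) = (q, s) := by
  let l (a b : ℝ) : ℝ × ℝ →L[ℝ] ℝ :=
    a • ContinuousLinearMap.fst ℝ ℝ ℝ + b • ContinuousLinearMap.snd ℝ ℝ ℝ
  have h : ∀ a b c : ℝ, HasFDerivAt (fun z : ℝ × ℝ => a * z.1 + b * z.2 + c) (l a b) z := fun a b c =>
    ((hasFDerivAt_fst.const_mul a).add (hasFDerivAt_snd.const_mul b)).add_const c
  exact ⟨(l p q).prod (l r s), (h p q t).prodMk (h r s w), by simp [l], by simp [l]⟩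

variable {u : ℝ × ℝ → ℝ}

theorem px_comp_affMap (hu : ContDiff ℝ (⊤ : ℕ∞) u) (z : ℝ × ℝ) :
    px (fun z => u (affMap p q r s t w z)) z =
      p * px u (affMap p q r s t w z) + r * py u (affMap p q r s t w z) := by
  obtain ⟨A, hA, h1, -⟩ := hasFDerivAt_affMap (p := p) (q := q) (r := r) (s := s) (t := t) (w := w) z
  have hd := ((hu.differentiable (by simp)) (affMap p q r s t w z)).hasFDerivAt.comp z hA
  have e : ((p, r) : ℝ × ℝ) = p • (1, 0) + r • (0, 1) := by simp
  rw [px, px, py]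
  erw [hd.fderiv]
  rw [ContinuousLinearMap.comp_apply, h1, e, map_add, map_smul, map_smul, smul_eq_mul, smul_eq_mul]

theorem py_comp_affMap (hu : ContDiff ℝ (⊤ : ℕ∞) u) (z : ℝ × ℝ) :
    py (fun z => u (affMap p q r s t w z)) z =
      q * px u (affMap p q r s t w z) + s * py u (affMap p q r s t w z) := by
  obtain ⟨A, hA, -, h1⟩ := hasFDerivAt_affMap (p := p) (q := q) (r := r) (s := s) (t := t) (w := w) z
  have hd := ((hu.differentiable (by simp)) (affMap p q r s t w z)).hasFDerivAt.comp z hA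
  have e : ((q, s) : ℝ × ℝ) = q • (1, 0) + s • (0, 1) := by simp
  rw [py, px, py]
  erw [hd.fderiv]
  rw [ContinuousLinearMap.comp_apply, h1, e, map_add, map_smul, map_smul, smul_eq_mul, smul_eq_mul]

end AffineMaps

/-- The six maps from the tiles of the square `(0, π)²` to `refTri`. -/
noncomputable def tileMap : Fin 6 → ℝ × ℝ → ℝ × ℝ :=
  ![affMap 1 0 0 1 0 0, affMap (1 / 2) (3 / 2) (1 / 2) (-1 / 2) 0 0,
    affMap (1 / 2) (3 / 2) (-1 / 2) (1 / 2) 0 0, affMap (-1) 0 0 (-1) π π,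
    affMap (-1 / 2) (-3 / 2) (-1 / 2) (1 / 2) (2 * π) 0,
    affMap (-1 / 2) (-3 / 2) (1 / 2) (-1 / 2) (2 * π) 0]

noncomputable def tileInv : Fin 6 → ℝ × ℝ → ℝ × ℝ :=
  ![affMap 1 0 0 1 0 0, affMap (1 / 2) (3 / 2) (1 / 2) (-1 / 2) 0 0,
    affMap (1 / 2) (-3 / 2) (1 / 2) (1 / 2) 0 0, affMap (-1) 0 0 (-1) π π,
    affMap (-1 / 2) (-3 / 2) (-1 / 2) (1 / 2) π π,
    affMap (-1 / 2) (3 / 2) (-1 / 2) (-1 / 2) π π]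

noncomputable def tileSign : Fin 6 → ℝ := ![1, -1, 1, 1, -1, 1]

theorem tileSign_sq (i : Fin 6) : tileSign i ^ 2 = 1 := by
  fin_cases i <;> norm_num [tileSign]

theorem tileInv_tileMap (i : Fin 6) (z : ℝ × ℝ) : tileInv i (tileMap i z) = z := by
  fin_cases i <;> ext <;> simp [tileMap, tileInv, affMap] <;> ring

theorem integral_comp_tileMap (i : Fin 6) (g : ℝ × ℝ → ℝ) : ∫ z, g (tileMap i z) = ∫ z, g z := by
  fin_cases i <;> exact integral_comp_affMap (by norm_num) g

theorem contDiff_tileMap (i : Fin 6) : ContDiff ℝ (⊤ : ℕ∞) (tileMap i) := by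
  fin_cases i <;> exact contDiff_affMap

theorem contDiff_tileInv (i : Fin 6) : ContDiff ℝ (⊤ : ℕ∞) (tileInv i) := by
  fin_cases i <;> exact contDiff_affMap

theorem tileMap_disjoint {i j : Fin 6} (hij : i ≠ j) {z : ℝ × ℝ} (hi : tileMap i z ∈ refTri)
    (hj : tileMap j z ∈ refTri) : False := by
  have hpi := pi_pos
  obtain ⟨h1, h2, h3⟩ := hi
  obtain ⟨h4, h5, h6⟩ := hj
  revert hij h1 h2 h3 h4 h5 h6
  fin_cases i <;> fin_cases j <;> simp [tileMap, affMap] <;> intros <;> linarith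

theorem mem_square_of_tileMap {i : Fin 6} {z : ℝ × ℝ} (hi : tileMap i z ∈ refTri) :
    z ∈ Set.Ioo 0 π ×ˢ Set.Ioo 0 π := by
  have hpi := pi_pos
  obtain ⟨h1, h2, h3⟩ := hi
  revert h1 h2 h3
  rw [Set.mem_prod, Set.mem_Ioo, Set.mem_Ioo]
  fin_cases i <;> simp [tileMap, affMap] <;> intros <;>
    refine ⟨⟨?_, ?_⟩, ?_, ?_⟩ <;> linarith

theorem conformal_tileMap {u : ℝ × ℝ → ℝ} (hu : ContDiff ℝ (⊤ : ℕ∞) u) (i : Fin 6) (z : ℝ × ℝ) :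
    3 * px (fun z => u (tileMap i z)) z ^ 2 + py (fun z => u (tileMap i z)) z ^ 2 =
      3 * px u (tileMap i z) ^ 2 + py u (tileMap i z) ^ 2 := by
  fin_cases i <;>
  · show 3 * px (fun z => u (affMap _ _ _ _ _ _ z)) z ^ 2 +
        py (fun z => u (affMap _ _ _ _ _ _ z)) z ^ 2 =
      3 * px u (affMap _ _ _ _ _ _ z) ^ 2 + py u (affMap _ _ _ _ _ _ z) ^ 2
    rw [px_comp_affMap hu, py_comp_affMap hu]
    ring

theorem sum_sq_of_mul_eq_zero {ι : Type*} [Fintype ι] {v : ι → ℝ}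
    (h : ∀ i j, i ≠ j → v i * v j = 0) : (∑ i, v i) ^ 2 = ∑ i, v i ^ 2 := by
  rw [sq, Finset.sum_mul_sum]
  refine Finset.sum_congr rfl fun i _ => ?_
  rw [Finset.sum_eq_single i (fun j _ hj => h i j hj.symm) (by simp), sq]

/-- The odd extension of a function on `refTri` to the square `(0, π)²` by reflections. -/
noncomputable def fold (u : ℝ × ℝ → ℝ) (z : ℝ × ℝ) : ℝ := ∑ i, tileSign i * u (tileMap i z)

section Fold

variable (u : TF refTri)

theorem tile_smooth (i : Fin 6) : ContDiff ℝ (⊤ : ℕ∞) fun z => u.1 (tileMap i z) :=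
  (TF.smooth u).comp (contDiff_tileMap i)

theorem tile_tsupport (i : Fin 6) {z : ℝ × ℝ} (hz : z ∈ tsupport fun z => u.1 (tileMap i z)) :
    tileMap i z ∈ refTri :=
  TF.supp u (closure_minimal (s := Function.support fun z => u.1 (tileMap i z))
    (t := tileMap i ⁻¹' tsupport u.1) (fun _ hx => subset_tsupport _ hx)
    ((isClosed_tsupport _).preimage (contDiff_tileMap i).continuous) hz)

theorem tile_eq_zero (i : Fin 6) {z : ℝ × ℝ} (hz : tileMap i z ∉ refTri) : u.1 (tileMap i z) = 0 :=
  image_eq_zero_of_notMem_tsupport fun h => hz (TF.supp u h)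

theorem fold_smooth : ContDiff ℝ (⊤ : ℕ∞) (fold u.1) :=
  ContDiff.sum fun i _ => contDiff_const.mul (tile_smooth u i)

theorem fold_eq_zero (z : ℝ × ℝ) (hz : z ∉ Set.Ioo 0 π ×ˢ Set.Ioo 0 π) : fold u.1 z = 0 :=
  Finset.sum_eq_zero fun i _ => by
    rw [tile_eq_zero u i fun h => hz (mem_square_of_tileMap h), mul_zero]

theorem fold_cpt : HasCompactSupport (fold u.1) :=
  HasCompactSupport.intro isCompact_box fun z hz => fold_eq_zero u z fun h =>
    hz (Set.prod_mono Set.Ioo_subset_Icc_self Set.Ioo_subset_Icc_self h)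

theorem px_fold (z : ℝ × ℝ) :
    px (fold u.1) z = ∑ i, tileSign i * px (fun z => u.1 (tileMap i z)) z := by
  have hd : ∀ i, DifferentiableAt ℝ (fun z => u.1 (tileMap i z)) z := fun i =>
    (tile_smooth u i).differentiable (by simp) z
  have h : HasFDerivAt (fold u.1)
      (∑ i, tileSign i • fderiv ℝ (fun z => u.1 (tileMap i z)) z) z :=
    HasFDerivAt.fun_sum fun i _ => (hd i).hasFDerivAt.const_mul (tileSign i)
  rw [px, h.fderiv]
  simp [px]

theorem py_fold (z : ℝ × ℝ) :
    py (fold u.1) z = ∑ i, tileSign i * py (fun z => u.1 (tileMap i z)) z := by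
  have hd : ∀ i, DifferentiableAt ℝ (fun z => u.1 (tileMap i z)) z := fun i =>
    (tile_smooth u i).differentiable (by simp) z
  have h : HasFDerivAt (fold u.1)
      (∑ i, tileSign i • fderiv ℝ (fun z => u.1 (tileMap i z)) z) z :=
    HasFDerivAt.fun_sum fun i _ => (hd i).hasFDerivAt.const_mul (tileSign i)
  rw [py, h.fderiv]
  simp [py]

theorem sum_tile_sq {v : Fin 6 → ℝ} {z : ℝ × ℝ} (h : ∀ i, tileMap i z ∉ refTri → v i = 0) :
    (∑ i, tileSign i * v i) ^ 2 = ∑ i, v i ^ 2 := by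
  rw [sum_sq_of_mul_eq_zero fun i j hij => ?_]
  · simp_rw [mul_pow, tileSign_sq, one_mul]
  · by_cases hi : tileMap i z ∈ refTri
    · rw [h j fun hj => tileMap_disjoint hij hi hj]; ring
    · rw [h i hi]; ring

theorem integral_fold_sq : ∫ z, fold u.1 z ^ 2 = 6 * mass refTri u u := by
  have e : ∀ z, fold u.1 z ^ 2 = ∑ i, u.1 (tileMap i z) ^ 2 := fun z =>
    sum_tile_sq fun i hi => tile_eq_zero u i hi
  simp_rw [e]
  rw [integral_finsetSum]
  · simp_rw [integral_comp_tileMap _ fun z => u.1 z ^ 2]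
    simp [mass_apply, sq]
  · intro i _
    refine ((tile_smooth u i).continuous.pow 2).integrable_of_hasCompactSupport
      (HasCompactSupport.intro isCompact_box fun z hz => ?_)
    show u.1 (tileMap i z) ^ 2 = 0
    rw [tile_eq_zero u i fun h => hz (Set.prod_mono Set.Ioo_subset_Icc_self
      Set.Ioo_subset_Icc_self (mem_square_of_tileMap h))]
    norm_num

theorem integral_fold_energy : (3 * ∫ z, px (fold u.1) z ^ 2) + ∫ z, py (fold u.1) z ^ 2 =
    6 * energy refTri 3 0 1 u u := by
  have hi : ∀ g : ℝ × ℝ → ℝ, Continuous g → HasCompactSupport g → Integrable fun z => g z ^ 2 :=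
    fun g hg hgc => by
      have h1 : HasCompactSupport fun z => g z ^ 2 :=
        hgc.comp_left (g := fun t : ℝ => t ^ 2) (by norm_num)
      exact Continuous.integrable_of_hasCompactSupport (by fun_prop) h1
  have ix := hi _ (continuous_px (fold_smooth u)) (hasCompactSupport_px (fold_cpt u))
  have iy := hi _ (continuous_py (fold_smooth u)) (hasCompactSupport_py (fold_cpt u))
  rw [← integral_const_mul, ← integral_add (ix.const_mul _) iy]
  have e : ∀ z, 3 * px (fold u.1) z ^ 2 + py (fold u.1) z ^ 2 =
      ∑ i, (3 * px u.1 (tileMap i z) ^ 2 + py u.1 (tileMap i z) ^ 2) := fun z => by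
    rw [px_fold, py_fold, sum_tile_sq (z := z), sum_tile_sq (z := z), Finset.mul_sum,
      ← Finset.sum_add_distrib]
    · exact Finset.sum_congr rfl fun i _ => conformal_tileMap (TF.smooth u) i z
    · exact fun i hi => py_eq_zero_of_notMem fun h => hi (tile_tsupport u i h)
    · exact fun i hi => px_eq_zero_of_notMem fun h => hi (tile_tsupport u i h)
  simp_rw [e]
  rw [integral_finsetSum]
  · simp_rw [integral_comp_tileMap _ fun z => 3 * px u.1 z ^ 2 + py u.1 z ^ 2]
    simp [energy_apply, enDensity_self]
  · intro i _
    have hx := continuous_px (TF.smooth u)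
    have hy := continuous_py (TF.smooth u)
    have ht := (contDiff_tileMap i).continuous
    refine Continuous.integrable_of_hasCompactSupport (by fun_prop)
      (HasCompactSupport.intro isCompact_box fun z hz => ?_)
    have : tileMap i z ∉ refTri := fun h => hz (Set.prod_mono Set.Ioo_subset_Icc_self
      Set.Ioo_subset_Icc_self (mem_square_of_tileMap h))
    rw [px_eq_zero_of_notMem fun h => this (TF.supp u h),
      py_eq_zero_of_notMem fun h => this (TF.supp u h)]
    norm_num

theorem sinCoeff_fold (a b : ℕ) : sinCoeff (fold u.1) a b =
    ∫ z, u.1 z * ∑ i, tileSign i * (sin (a * (tileInv i z).1) * sin (b * (tileInv i z).2)) := by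
  have hcont : ∀ i, Continuous (tileInv i) := fun i => (contDiff_tileInv i).continuous
  simp_rw [sinCoeff, fold, Finset.mul_sum, Finset.sum_mul]
  rw [integral_finsetSum, integral_finsetSum]
  · refine Finset.sum_congr rfl fun i _ => ?_
    rw [← integral_comp_tileMap i fun z =>
      u.1 z * (tileSign i * (sin (a * (tileInv i z).1) * sin (b * (tileInv i z).2)))]
    simp_rw [tileInv_tileMap]
    congr 1; ext z; ring
  · exact fun i _ => TF.integrable u (by have := hcont i; fun_prop)
  · intro i _
    refine Continuous.integrable_of_hasCompactSupport (by
      have := (tile_smooth u i).continuous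
      exact (continuous_const.mul this).mul (by fun_prop))
      (HasCompactSupport.intro isCompact_box fun z hz => ?_)
    rw [tile_eq_zero u i fun h => hz (Set.prod_mono Set.Ioo_subset_Icc_self
      Set.Ioo_subset_Icc_self (mem_square_of_tileMap h))]
    ring

theorem sin_natCast_mul_pi_sub (a : ℕ) (x : ℝ) : sin (a * (π - x)) = -(-1) ^ a * sin (a * x) := by
  rw [mul_sub, sin_sub, sin_nat_mul_pi, cos_nat_mul_pi]; ring

theorem sum_tile_sin (a b : ℕ) (z : ℝ × ℝ) :
    ∑ i, tileSign i * (sin (a * (tileInv i z).1) * sin (b * (tileInv i z).2)) =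
    (1 + (-1) ^ (a + b)) * (sin (a * z.1) * sin (b * z.2) -
      sin (a * ((z.1 + 3 * z.2) / 2)) * sin (b * ((z.1 - z.2) / 2)) +
      sin (a * ((z.1 - 3 * z.2) / 2)) * sin (b * ((z.1 + z.2) / 2))) := by
  have e : ∀ i, tileSign i * (sin (a * (tileInv i z).1) * sin (b * (tileInv i z).2)) =
    ![sin (a * z.1) * sin (b * z.2),
      -(sin (a * ((z.1 + 3 * z.2) / 2)) * sin (b * ((z.1 - z.2) / 2))),
      sin (a * ((z.1 - 3 * z.2) / 2)) * sin (b * ((z.1 + z.2) / 2)),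
      sin (a * (π - z.1)) * sin (b * (π - z.2)),
      -(sin (a * (π - (z.1 + 3 * z.2) / 2)) * sin (b * (π - (z.1 - z.2) / 2))),
      sin (a * (π - (z.1 - 3 * z.2) / 2)) * sin (b * (π - (z.1 + z.2) / 2))] i := by
    intro i
    fin_cases i <;> simp [tileSign, tileInv, affMap] <;> ring_nf
  simp_rw [e, Fin.sum_univ_six]
  simp only [sin_natCast_mul_pi_sub, Matrix.cons_val]
  ring

theorem triSin_eq (a m : ℤ) (z : ℝ × ℝ) : (triSin a m).1 z =
    sin (a * z.1) * sin ((a - 2 * m : ℤ) * z.2) -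
      sin (a * ((z.1 + 3 * z.2) / 2)) * sin ((a - 2 * m : ℤ) * ((z.1 - z.2) / 2)) +
      sin (a * ((z.1 - 3 * z.2) / 2)) * sin ((a - 2 * m : ℤ) * ((z.1 + z.2) / 2)) := by
  have p : ∀ x y : ℝ, sin x * sin y = (cos (x - y) - cos (x + y)) / 2 := fun x y => by
    rw [cos_sub, cos_add]; ring
  rw [triSin_apply, sinProd_apply, sinProd_apply, sinProd_apply]
  have e1 := p (a * ((z.1 + 3 * z.2) / 2)) ((a - 2 * m : ℤ) * ((z.1 - z.2) / 2))
  have e2 := p (a * ((z.1 - 3 * z.2) / 2)) ((a - 2 * m : ℤ) * ((z.1 + z.2) / 2))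
  have e3 := p (m * z.1) ((2 * a - m : ℤ) * z.2)
  have e4 := p ((a - m : ℤ) * z.1) ((a + m : ℤ) * z.2)
  rw [e1, e2, e3, e4]
  push_cast
  ring_nf

theorem sinCoeff_fold_odd {a b : ℕ} (h : Odd (a + b)) : sinCoeff (fold u.1) a b = 0 := by
  rw [sinCoeff_fold]
  simp [sum_tile_sin, h.neg_one_pow]

theorem sinCoeff_fold_even {a b : ℕ} (m : ℤ) (h : (b : ℤ) = a - 2 * m) :
    sinCoeff (fold u.1) a b = 2 * massR (triSin a m) (TF.toSM u) := by
  have he : Even (a + b) := by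
    rw [← Int.even_coe_nat]; push_cast; rw [h]; exact ⟨a - m, by ring⟩
  rw [sinCoeff_fold, massR_toSM_right, ← integral_const_mul]
  congr 1; ext z
  rw [sum_tile_sin, he.neg_one_pow, triSin_eq, ← h]
  push_cast
  ring

end Fold

theorem sinProd_neg_left (a b : ℤ) : sinProd (-a) b = -sinProd a b :=
  Subtype.ext <| funext fun z => by
    show _ = -((sinProd a b).1 z)
    simp [sinProd_apply]

theorem sinProd_neg_right (a b : ℤ) : sinProd a (-b) = -sinProd a b :=
  Subtype.ext <| funext fun z => by
    show _ = -((sinProd a b).1 z)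
    simp [sinProd_apply]

theorem triSin_zero (a : ℤ) : triSin a 0 = 0 := by
  have h : sinProd 0 (2 * a) = 0 := Subtype.ext <| funext fun z => by simp [sinProd_apply]
  simp [triSin, h]

theorem triSin_neg_self (a : ℤ) : triSin a (-a) = 0 := by
  have h : sinProd (a - -a) (a + -a) = 0 := Subtype.ext <| funext fun z => by simp [sinProd_apply]
  rw [triSin, h, sinProd_neg_left, sub_zero, show a - 2 * -a = 2 * a - -a by ring, add_neg_cancel]

/-- The first four eigenfunctions of `refTri`. -/
noncomputable def triE : Fin 4 → SM := ![triSin 3 1, triSin 4 1, triSin 5 2, triSin 5 1]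

/-- The first four eigenvalues of `refTri`. -/
def triL : Fin 4 → ℝ := ![28, 52, 76, 84]

theorem triSin_images : (triSin 1 (-2) = triE 0 ∧ triSin 2 (-1) = -triE 0) ∧
    (triSin 1 (-3) = triE 1 ∧ triSin 3 (-1) = -triE 1) ∧
    (triSin 2 (-3) = triE 2 ∧ triSin 3 (-2) = -triE 2) ∧
    (triSin 1 (-4) = triE 3 ∧ triSin 4 (-1) = -triE 3) := by
  refine ⟨⟨?_, ?_⟩, ⟨?_, ?_⟩, ⟨?_, ?_⟩, ⟨?_, ?_⟩⟩ <;>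
  · simp [triE, triSin, sinProd_neg_left, sinProd_neg_right]
    abel

set_option maxRecDepth 4000 in
theorem subset_of_small : ((Finset.range 7 ×ˢ Finset.range 11).filter fun p : ℕ × ℕ =>
    (p.1 + p.2) % 2 = 0 ∧ 3 * p.1 ^ 2 + p.2 ^ 2 < 112 ∧ p.1 ≠ 0 ∧ p.2 ≠ 0 ∧ p.1 ≠ p.2 ∧ p.2 ≠ 3 * p.1) ⊆
    {(3, 1), (1, 5), (2, 4), (4, 2), (1, 7), (3, 5), (5, 1),
      (2, 8), (3, 7), (5, 3), (1, 9), (4, 6)} := by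
  decide

section Gap

variable (u : TF refTri)

theorem sum_sinCoeff_fold_le : ∑ b ∈ Finset.range 11, ∑ a ∈ Finset.range 7,
    (112 - 3 * (a : ℝ) ^ 2 - (b : ℝ) ^ 2) * (4 / π ^ 2) * sinCoeff (fold u.1) a b ^ 2 ≤
    6 * ∑ j, (112 - triL j) * massR (triE j) (TF.toSM u) ^ 2 / (π ^ 2 / 8) := by
  set c : Fin 4 → ℝ := fun j => massR (triE j) (TF.toSM u) with hc
  let W : ℕ → ℕ → ℝ := fun a b =>
    if (a, b) = (3, 1) ∨ (a, b) = (1, 5) ∨ (a, b) = (2, 4) then 84 * c 0 ^ 2 else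
    if (a, b) = (4, 2) ∨ (a, b) = (1, 7) ∨ (a, b) = (3, 5) then 60 * c 1 ^ 2 else
    if (a, b) = (5, 1) ∨ (a, b) = (2, 8) ∨ (a, b) = (3, 7) then 36 * c 2 ^ 2 else
    if (a, b) = (5, 3) ∨ (a, b) = (1, 9) ∨ (a, b) = (4, 6) then 28 * c 3 ^ 2 else 0
  have hW : ∑ b ∈ Finset.range 11, ∑ a ∈ Finset.range 7, W a b =
      3 * ∑ j, (112 - triL j) * c j ^ 2 := by
    simp only [Finset.sum_range_succ, Finset.sum_range_zero, W, Prod.mk.injEq]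
    have t2 : triL 2 = 76 := rfl
    have t3 : triL 3 = 84 := rfl
    norm_num [Fin.sum_univ_four, t2, t3]
    norm_num [triL]
    ring
  have key : ∀ b ∈ Finset.range 11, ∀ a ∈ Finset.range 7,
      (112 - 3 * (a : ℝ) ^ 2 - (b : ℝ) ^ 2) * (4 / π ^ 2) * sinCoeff (fold u.1) a b ^ 2 ≤
        (16 / π ^ 2) * W a b := by
    obtain ⟨⟨i1, i2⟩, ⟨i3, i4⟩, ⟨i5, i6⟩, i7, i8⟩ := triSin_images
    have hz : ∀ {x : SM}, x = 0 → massR x (TF.toSM u) = 0 := fun h => by simp [h]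
    have hp : ∀ {x : SM} (j : Fin 4), x = triE j → massR x (TF.toSM u) ^ 2 = c j ^ 2 :=
      fun j h => by rw [h]
    have hn : ∀ {x : SM} (j : Fin 4), x = -triE j → massR x (TF.toSM u) ^ 2 = c j ^ 2 :=
      fun j h => by simp [h, hc]
    have hcoef : ∀ {a b : ℕ} (m : ℤ), (b : ℤ) = a - 2 * m → sinCoeff (fold u.1) a b ^ 2 =
        4 * massR (triSin a m) (TF.toSM u) ^ 2 := fun m h => by
      rw [sinCoeff_fold_even u m h]; ring
    intro b hb a ha
    have hW0 : 0 ≤ W a b := by simp only [W]; split_ifs <;> positivity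
    have hb' := Finset.mem_range.1 hb
    have ha' := Finset.mem_range.1 ha
    by_cases hodd : Odd (a + b)
    · rw [sinCoeff_fold_odd u hodd]
      have : 0 ≤ 16 / π ^ 2 * W a b := by positivity
      linarith
    by_cases hneg : 112 ≤ 3 * a ^ 2 + b ^ 2
    · have h1 : (112 : ℝ) ≤ 3 * (a : ℝ) ^ 2 + (b : ℝ) ^ 2 := by exact_mod_cast hneg
      have h2 : 0 ≤ (3 * (a : ℝ) ^ 2 + (b : ℝ) ^ 2 - 112) * (4 / π ^ 2 * sinCoeff (fold u.1) a b ^ 2) :=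
        mul_nonneg (by linarith) (by positivity)
      have : 0 ≤ 16 / π ^ 2 * W a b := by positivity
      linarith
    have h0a : a = 0 → sinCoeff (fold u.1) a b = 0 := by rintro rfl; simp [sinCoeff]
    have h0b : b = 0 → sinCoeff (fold u.1) a b = 0 := by rintro rfl; simp [sinCoeff]
    have hs : ∀ (j : Fin 4) (t : ℝ), W a b = t * c j ^ 2 →
        (112 - 3 * (a : ℝ) ^ 2 - (b : ℝ) ^ 2) = t → sinCoeff (fold u.1) a b ^ 2 = 4 * c j ^ 2 →
        (112 - 3 * (a : ℝ) ^ 2 - (b : ℝ) ^ 2) * (4 / π ^ 2) * sinCoeff (fold u.1) a b ^ 2 ≤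
        (16 / π ^ 2) * W a b := fun j t h1 h2 h3 => by
      rw [h1, h2, h3]; apply le_of_eq; ring
    have hs0 : sinCoeff (fold u.1) a b = 0 →
        (112 - 3 * (a : ℝ) ^ 2 - (b : ℝ) ^ 2) * (4 / π ^ 2) * sinCoeff (fold u.1) a b ^ 2 ≤
        (16 / π ^ 2) * W a b := fun h => by
      rw [h]
      have : 0 ≤ 16 / π ^ 2 * W a b := by positivity
      linarith
    have hd : a = b → sinCoeff (fold u.1) a b = 0 := by
      rintro rfl; rw [sinCoeff_fold_even u 0 (by ring), triSin_zero]; simp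
    have ht : b = 3 * a → sinCoeff (fold u.1) a b = 0 := by
      rintro rfl
      rw [sinCoeff_fold_even u (-(a : ℤ)) (by push_cast; ring), triSin_neg_self]; simp
    by_cases h1 : a = 0
    · exact hs0 (h0a h1)
    by_cases h2 : b = 0
    · exact hs0 (h0b h2)
    by_cases h3 : a = b
    · exact hs0 (hd h3)
    by_cases h4 : b = 3 * a
    · exact hs0 (ht h4)
    have hlist := subset_of_small (Finset.mem_filter.2 ⟨Finset.mk_mem_product ha hb,
      Nat.even_iff.1 (Nat.not_odd_iff_even.1 hodd), not_le.1 hneg, h1, h2, h3, h4⟩)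
    simp only [Finset.mem_insert, Finset.mem_singleton, Prod.mk.injEq] at hlist
    rcases hlist with ⟨rfl, rfl⟩ | ⟨rfl, rfl⟩ | ⟨rfl, rfl⟩ | ⟨rfl, rfl⟩ | ⟨rfl, rfl⟩ | ⟨rfl, rfl⟩ |
      ⟨rfl, rfl⟩ | ⟨rfl, rfl⟩ | ⟨rfl, rfl⟩ | ⟨rfl, rfl⟩ | ⟨rfl, rfl⟩ | ⟨rfl, rfl⟩
    · exact hs 0 84 (by simp [W]) (by norm_num) (by rw [hcoef 1 (by norm_num)]; exact congrArg _ (hp 0 rfl))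
    · exact hs 0 84 (by simp [W]) (by norm_num) (by rw [hcoef (-2) (by norm_num)]; exact congrArg _ (hp 0 i1))
    · exact hs 0 84 (by simp [W]) (by norm_num) (by rw [hcoef (-1) (by norm_num)]; exact congrArg _ (hn 0 i2))
    · exact hs 1 60 (by simp [W]) (by norm_num) (by rw [hcoef 1 (by norm_num)]; exact congrArg _ (hp 1 rfl))
    · exact hs 1 60 (by simp [W]) (by norm_num) (by rw [hcoef (-3) (by norm_num)]; exact congrArg _ (hp 1 i3))
    · exact hs 1 60 (by simp [W]) (by norm_num) (by rw [hcoef (-1) (by norm_num)]; exact congrArg _ (hn 1 i4))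
    · exact hs 2 36 (by simp [W]) (by norm_num) (by rw [hcoef 2 (by norm_num)]; exact congrArg _ (hp 2 rfl))
    · exact hs 2 36 (by simp [W]) (by norm_num) (by rw [hcoef (-3) (by norm_num)]; exact congrArg _ (hp 2 i5))
    · exact hs 2 36 (by simp [W]) (by norm_num) (by rw [hcoef (-2) (by norm_num)]; exact congrArg _ (hn 2 i6))
    · exact hs 3 28 (by simp [W]) (by norm_num) (by rw [hcoef 1 (by norm_num)]; exact congrArg _ (hp 3 rfl))
    · exact hs 3 28 (by simp [W]) (by norm_num) (by rw [hcoef (-4) (by norm_num)]; exact congrArg _ (hp 3 i7))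
    · exact hs 3 28 (by simp [W]) (by norm_num) (by rw [hcoef (-1) (by norm_num)]; exact congrArg _ (hn 3 i8))
  refine (Finset.sum_le_sum fun b hb => Finset.sum_le_sum (key b hb)).trans (le_of_eq ?_)
  simp_rw [← Finset.mul_sum]
  rw [hW, Finset.mul_sum, Finset.mul_sum, Finset.mul_sum]
  refine Finset.sum_congr rfl fun j _ => ?_
  field_simp
  ring

theorem gap_refTri : 112 * massR (TF.toSM u) (TF.toSM u) -
    ∑ j, (112 - triL j) * massR (triE j) (TF.toSM u) ^ 2 / (π ^ 2 / 8) ≤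
    energyR 3 0 1 (TF.toSM u) (TF.toSM u) := by
  have h1 := gap_square (fold_smooth u) (fold_cpt u) (fold_eq_zero u)
  rw [integral_fold_sq, integral_fold_energy] at h1
  have h2 := sum_sinCoeff_fold_le u
  rw [massR_toSM, energyR_toSM]
  linarith

end Gap

theorem triE_eq (i : Fin 4) : ∃ a m : ℤ, triE i = triSin a m ∧
    triL i = 4 * a ^ 2 - 4 * a * m + 4 * m ^ 2 ∧ massR (triSin a m) (triSin a m) = π ^ 2 / 8 := by
  fin_cases i
  · exact ⟨3, 1, rfl, by norm_num [triL], massR_triSin_three_one⟩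
  · exact ⟨4, 1, rfl, by norm_num [triL], massR_triSin_four_one⟩
  · exact ⟨5, 2, rfl, by norm_num [triL], massR_triSin_five_two⟩
  · refine ⟨5, 1, rfl, ?_, massR_triSin_five_one⟩
    show (84 : ℝ) = _
    norm_num

theorem triL_injective : Function.Injective triL := by
  intro i j
  fin_cases i <;> fin_cases j <;> norm_num [triL]

theorem massR_triE (i j : Fin 4) : massR (triE i) (triE j) = if i = j then π ^ 2 / 8 else 0 := by
  obtain ⟨a, m, h1, h2, h3⟩ := triE_eq i
  obtain ⟨a', m', h1', h2', h3'⟩ := triE_eq j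
  split_ifs with h
  · rw [← h, h1, h3]
  · rw [h1, h1']
    refine massR_triSin_eq_zero fun he => h (triL_injective ?_)
    rw [h2, h2']
    exact_mod_cast he

theorem energyR_triE (i j : Fin 4) :
    energyR 3 0 1 (triE i) (triE j) = if i = j then triL i * (π ^ 2 / 8) else 0 := by
  have h0 := massR_triE i j
  obtain ⟨a, m, h1, h2, h3⟩ := triE_eq i
  obtain ⟨a', m', h1', h2', h3'⟩ := triE_eq j
  rw [h1, h1'] at h0
  rw [h1, h1', energyR_triSin, h0, ← h2]
  split_ifs <;> ring

theorem energyR_triE_toSM (i : Fin 4) (u : TF refTri) :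
    energyR 3 0 1 (triE i) (TF.toSM u) = triL i * massR (triE i) (TF.toSM u) := by
  obtain ⟨a, m, h1, h2, h3⟩ := triE_eq i
  rw [h1, energyR_triSin_toSM, h2]

/-- `TF.toSM` as a linear map. -/
def toSMLin : TF refTri →ₗ[ℝ] SM where
  toFun := TF.toSM
  map_add' _ _ := rfl
  map_smul' _ _ := rfl

theorem abs_ev_refTri_sub_le {α β γ η : ℝ} (hη : 0 < η) (hη1 : η ≤ 1 / 200) (hα : |α| ≤ η)
    (hβ : |β| ≤ η) (hγ : |γ| ≤ η) (k : Fin 4) (hk : ∀ j, k < j → triL k + 8 ≤ triL j)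
    (hk' : ∀ j, j < k → triL j + 8 ≤ triL k) :
    |ev refTri (3 + α) β (1 + γ) (k + 1) -
      (triL k + energyR α β γ (triE k) (triE k) / (π ^ 2 / 8))| ≤ 40000 * η ^ 2 := by
  have hN : 0 < π ^ 2 / 8 := by positivity
  have hl : 0 ≤ triL k ∧ triL k ≤ 100 ∧ triL k + 8 ≤ 112 := by
    have h : ∀ k, 0 ≤ triL k ∧ triL k ≤ 100 ∧ triL k + 8 ≤ 112 := by
      intro k
      fin_cases k <;> refine ⟨?_, ?_, ?_⟩ <;> norm_num [triL]
    exact h k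
  have p1 := posForm_of_abs_le hα hβ hγ
  have p2 := posForm_of_abs_le (x := -α) (y := -β) (z := -γ) (δ := η) (by rwa [abs_neg])
    (by rwa [abs_neg]) (by rwa [abs_neg])
  have hd : ∀ u : SM, |energyR α β γ u u| ≤ 2 * η * energyR 3 0 1 u u := fun u => by
    refine abs_energyR_le (fun X Y => ?_) (fun X Y => ?_) u
    · have h1 := p2 X Y
      have h2 := mul_nonneg hη.le (sq_nonneg X)
      linarith
    · have h1 := p1 X Y
      have h2 := mul_nonneg hη.le (sq_nonneg X)
      linarith
  have hpos : PosForm (3 + α) β (1 + γ) := fun X Y => by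
    have h1 := p1 X Y
    have h2 := mul_nonneg (show 0 ≤ 3 - 2 * η by linarith) (sq_nonneg X)
    have h3 := mul_nonneg (show 0 ≤ 1 - 2 * η by linarith) (sq_nonneg Y)
    linarith
  have hadd : ∀ u : SM, energyR (3 + α) β (1 + γ) u u =
      energyR 3 0 1 u u + energyR α β γ u u := fun u => by
    have := energyR_add (a := 3) (b := 0) (c := 1) (a' := α) (b' := β) (c' := γ) u u
    rwa [zero_add] at this
  have hself : ∀ i, energyR 3 0 1 (triE i) (triE i) = triL i * (π ^ 2 / 8) := fun i => by
    rw [energyR_triE, if_pos rfl]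
  have lower : triL k + energyR α β γ (triE k) (triE k) / (π ^ 2 / 8) - 10000 * (2 * η) ^ 2 ≤
      ev refTri (3 + α) β (1 + γ) (k + 1) := by
    refine le_ev isOpen_refTri refTri_nonempty (Nat.lt_succ_self k)
      (fun i => (massR (triE (i.castLE k.2.le))).comp toSMLin) fun u hu => ?_
    rw [← massR_toSM, ← energyR_toSM, hadd]
    exact form_add_ge energyR_symm energyR_symm massR_symm massR_nonneg (by positivity)
      (by linarith) hd hN massR_triE hself k hl.1 hl.2.1 hk hl.2.2 (fun i => energyR_triE_toSM i u)
      (fun j hj => hu ⟨j, hj⟩) (gap_refTri u)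
  have upper : ev refTri (3 + α) β (1 + γ) (k + 1) ≤
      triL k + energyR α β γ (triE k) (triE k) / (π ^ 2 / 8) + 10000 * (2 * η) ^ 2 := by
    refine ev_refTri_le hpos (Nat.succ_ne_zero _) (fun i => triE (i.castLE k.2)) (fun i x => ?_)
      (fun i y => ?_) (fun i y => ?_) hN ?_ (fun i j => ?_) fun x => ?_
    · obtain ⟨a, m, h1, -⟩ := triE_eq (i.castLE k.2)
      rw [h1, triSin_bottom]
    · obtain ⟨a, m, h1, -⟩ := triE_eq (i.castLE k.2)
      rw [h1, triSin_hyp]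
    · obtain ⟨a, m, h1, -⟩ := triE_eq (i.castLE k.2)
      rw [h1, triSin_right]
    · have h1 := (abs_le.1 (hd (triE k))).1
      rw [hself] at h1
      have h2 : -(2 * η * triL k) ≤ energyR α β γ (triE k) (triE k) / (π ^ 2 / 8) := by
        rw [le_div_iff₀ hN]; linarith
      have h3 : 2 * η * triL k ≤ triL k := by
        have := mul_le_mul_of_nonneg_right (show 2 * η ≤ 1 by linarith) hl.1
        linarith
      have h4 : 0 ≤ 10000 * (2 * η) ^ 2 := by positivity
      linarith
    · rw [massR_triE]
      simp
    · have h1 := form_add_le (q := energyR 3 0 1) energyR_symm energyR_symm (δ := 2 * η) (by positivity)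
        (by linarith) hd hN energyR_triE k hl.1 hl.2.1 hk'
        (fun j => if h : (j : ℕ) < k + 1 then x ⟨j, h⟩ else 0)
        (fun j hj => dif_neg (by have : (k : ℕ) < j := hj; omega))
      have hs : ∀ {M : Type} [AddCommMonoid M] (f : Fin 4 → M),
          (∀ j : Fin 4, ¬ (j : ℕ) < k + 1 → f j = 0) →
          ∑ j, f j = ∑ i : Fin (k + 1), f (i.castLE k.2) := fun f hf => by
        refine Eq.trans ?_ (Finset.sum_map (Finset.univ : Finset (Fin (k + 1))) (Fin.castLEEmb k.2) f)
        refine (Finset.sum_subset (Finset.subset_univ _) fun j _ hj => hf j fun hlt => hj ?_).symm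
        exact Finset.mem_map.2 ⟨⟨j, hlt⟩, Finset.mem_univ _, rfl⟩
      rw [hs _ (fun j hj => by rw [dif_neg hj, zero_smul]),
        hs _ (fun j hj => by rw [dif_neg hj]; norm_num)] at h1
      simp only [Fin.val_castLE, Fin.is_lt, dite_true, Fin.eta] at h1
      rw [hadd]
      exact h1
  rw [abs_le]
  constructor <;> linarith

theorem lam_eq_ev_refTri (c : ℝ) {d : ℝ} (hd : 0 < d) {k : ℕ} (hk : k ≠ 0) : lam c d k =
    4 * π ^ 2 / 9 * ev refTri (3 + (9 / 4 * ((1 - c) ^ 2 * (d ^ 2)⁻¹ + 1) - 3))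
      (-3 / 4 * ((c - c ^ 2) * (d ^ 2)⁻¹ - 1)) (1 + (1 / 4 * (c ^ 2 * (d ^ 2)⁻¹ + 1) - 1)) k := by
  have hdet : π * 0 - π * (π / 3) ≠ 0 := by
    have := mul_pos pi_pos pi_pos
    intro h
    linarith
  have hA : planeEquiv π π (π / 3) 0 hdet ⁻¹' refTri = stdTri := by
    ext z
    have hp := pi_pos
    simp only [Set.mem_preimage, planeEquiv_apply, refTri, stdTri, Set.mem_ofPred_eq]
    refine ⟨fun ⟨h1, h2, h3⟩ => ⟨?_, ?_, ?_⟩, fun ⟨h1, h2, h3⟩ => ⟨?_, ?_, ?_⟩⟩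
    · exact pos_of_mul_pos_right (show 0 < π / 3 * z.1 by linarith) (by positivity)
    · exact pos_of_mul_pos_right (show 0 < π * z.2 by linarith) hp.le
    · exact lt_of_mul_lt_mul_left (show π * (z.1 + z.2) < π * 1 by linarith) hp.le
    · have := mul_pos hp h1; linarith
    · have := mul_pos hp h2; linarith
    · have := mul_lt_mul_of_pos_left h3 hp; linarith
  have hpos : PosForm (3 + (9 / 4 * ((1 - c) ^ 2 * (d ^ 2)⁻¹ + 1) - 3))
      (-3 / 4 * ((c - c ^ 2) * (d ^ 2)⁻¹ - 1)) (1 + (1 / 4 * (c ^ 2 * (d ^ 2)⁻¹ + 1) - 1)) :=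
    fun X Y => by
      have : 0 ≤ 9 / 4 * (((1 - c) * X - c / 3 * Y) ^ 2 * (d ^ 2)⁻¹ + (X + Y / 3) ^ 2) := by
        positivity
      calc (0 : ℝ) ≤ _ := this
        _ = _ := by ring
  rw [← ev_smul isOpen_refTri refTri_nonempty hk hpos (by positivity), lam,
    ev_image isOpen_stdTri stdTri_nonempty hk (posForm_lam c hd) (planeEquiv π π (π / 3) 0 hdet)
      (p := π) (q := π) (r := π / 3) (s := 0)
      (by rw [planeEquiv_apply]; simp) (by rw [planeEquiv_apply]; simp) hA]
  congr 1 <;> field_simp <;> ring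

theorem abs_ev_refTri_sub_le_of_nonneg {α β γ η : ℝ} (hη : 0 ≤ η) (hη1 : η < 1 / 200) (hα : |α| ≤ η)
    (hβ : |β| ≤ η) (hγ : |γ| ≤ η) (k : Fin 4) (hk : ∀ j, k < j → triL k + 8 ≤ triL j)
    (hk' : ∀ j, j < k → triL j + 8 ≤ triL k) :
    |ev refTri (3 + α) β (1 + γ) (k + 1) -
      (triL k + energyR α β γ (triE k) (triE k) / (π ^ 2 / 8))| ≤ 40000 * η ^ 2 := by
  have hc : ContinuousWithinAt (fun t : ℝ => 40000 * t ^ 2) (Set.Ioi η) η := by fun_prop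
  refine ge_of_tendsto hc.tendsto ?_
  filter_upwards [Ioo_mem_nhdsGT hη1] with t ht
  exact abs_ev_refTri_sub_le (hη.trans_lt ht.1) ht.2.le (hα.trans ht.1.le) (hβ.trans ht.1.le)
    (hγ.trans ht.1.le) k hk hk'

/-- The shape point of the triangle with angles 30, 60 and 90 degrees. -/
noncomputable def refShape : ℝ × ℝ := (3 / 4, √3 / 4)

theorem hasFDerivAt_inv_sq : HasFDerivAt (fun p : ℝ × ℝ => (p.2 ^ 2)⁻¹)
    ((-128 * √3 / 9) • ContinuousLinearMap.snd ℝ ℝ ℝ) refShape := by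
  have h3 : (0 : ℝ) < √3 := by positivity
  have hs : √3 ^ 2 = 3 := Real.sq_sqrt (by norm_num)
  have h2 : HasDerivAt (fun y : ℝ => (y ^ 2)⁻¹) (-128 * √3 / 9) refShape.2 := by
    have h1 : HasDerivAt (fun y : ℝ => y ^ 2) (2 * refShape.2) refShape.2 := by
      simpa using hasDerivAt_pow 2 refShape.2
    refine (h1.inv (by rw [refShape]; positivity)).congr_deriv ?_
    rw [refShape]
    field_simp
    rw [show √3 ^ 4 = (√3 ^ 2) ^ 2 by ring, hs]
    norm_num
  exact h2.comp_hasFDerivAt refShape hasFDerivAt_snd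

theorem hasFDerivAt_quad_mul_inv_sq (a b e : ℝ) :
    HasFDerivAt (fun p : ℝ × ℝ => (a + b * p.1 + e * p.1 ^ 2) * (p.2 ^ 2)⁻¹)
      ((16 / 3 * (b + 3 / 2 * e)) • ContinuousLinearMap.fst ℝ ℝ ℝ +
        (-128 * √3 / 9 * (a + b * (3 / 4) + e * (9 / 16))) • ContinuousLinearMap.snd ℝ ℝ ℝ)
      refShape := by
  have hs : √3 ^ 2 = 3 := Real.sq_sqrt (by norm_num)
  have h2 : HasDerivAt (fun x : ℝ => a + b * x + e * x ^ 2) (b + 3 / 2 * e) refShape.1 := by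
    have h := (((hasDerivAt_id refShape.1).const_mul b).const_add a).add
      ((hasDerivAt_pow 2 refShape.1).const_mul e)
    refine h.congr_deriv ?_
    rw [refShape]
    norm_num
    ring
  have h := (h2.comp_hasFDerivAt refShape hasFDerivAt_fst).mul hasFDerivAt_inv_sq
  refine h.congr_fderiv ?_
  ext
  · simp only [refShape, Function.comp, ContinuousLinearMap.comp_apply, ContinuousLinearMap.inl_apply,
      _root_.add_apply, _root_.smul_apply, smul_eq_mul, ContinuousLinearMap.coe_fst',
      ContinuousLinearMap.coe_snd', mul_zero, zero_add, add_zero, mul_one, div_pow, hs]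
    norm_num
  · simp only [refShape, Function.comp, ContinuousLinearMap.comp_apply, ContinuousLinearMap.inr_apply,
      _root_.add_apply, _root_.smul_apply, smul_eq_mul, ContinuousLinearMap.coe_fst',
      ContinuousLinearMap.coe_snd', mul_zero, zero_add, add_zero, mul_one, div_pow, hs]
    ring

theorem hasFDerivAt_lam (k : Fin 4) (hk : ∀ j, k < j → triL k + 8 ≤ triL j)
    (hk' : ∀ j, j < k → triL j + 8 ≤ triL k) {A B : ℝ}
    (hE : ∀ α β γ, energyR α β γ (triE k) (triE k) / (π ^ 2 / 8) =
      (α - 3 * γ) * A + 2 * β * B + γ * triL k) :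
    lam refShape.1 refShape.2 (k + 1) = 4 * π ^ 2 / 9 * triL k ∧
    HasFDerivAt (fun p : ℝ × ℝ => lam p.1 p.2 (k + 1))
      ((4 * π ^ 2 / 9 * (-12 * A + 4 * B + 2 * triL k)) • ContinuousLinearMap.fst ℝ ℝ ℝ +
        (4 * π ^ 2 / 9 * (2 * √3 * (2 * A + 2 * B - triL k))) • ContinuousLinearMap.snd ℝ ℝ ℝ)
      refShape := by
  have hs : √3 ^ 2 = 3 := Real.sq_sqrt (by norm_num)
  set u : ℝ × ℝ → ℝ := fun p => 9 / 4 * ((1 - p.1) ^ 2 * (p.2 ^ 2)⁻¹ + 1) - 3 with hu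
  set v : ℝ × ℝ → ℝ := fun p => -3 / 4 * ((p.1 - p.1 ^ 2) * (p.2 ^ 2)⁻¹ - 1) with hv
  set w : ℝ × ℝ → ℝ := fun p => 1 / 4 * (p.1 ^ 2 * (p.2 ^ 2)⁻¹ + 1) - 1 with hw
  have du : HasFDerivAt u ((-6 : ℝ) • ContinuousLinearMap.fst ℝ ℝ ℝ +
      (-2 * √3) • ContinuousLinearMap.snd ℝ ℝ ℝ) refShape := by
    have h := (hasFDerivAt_quad_mul_inv_sq (9 / 4) (-9 / 2) (9 / 4)).add_const (9 / 4 - 3)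
    refine (h.congr_fderiv ?_).congr_of_eventuallyEq (.of_forall fun p => ?_)
    · congr 2 <;> ring
    · simp only [hu]; ring
  have dv : HasFDerivAt v ((2 : ℝ) • ContinuousLinearMap.fst ℝ ℝ ℝ +
      (2 * √3) • ContinuousLinearMap.snd ℝ ℝ ℝ) refShape := by
    have h := (hasFDerivAt_quad_mul_inv_sq 0 (-3 / 4) (3 / 4)).add_const (3 / 4)
    refine (h.congr_fderiv ?_).congr_of_eventuallyEq (.of_forall fun p => ?_)
    · congr 2 <;> ring
    · simp only [hv]; ring
  have dw : HasFDerivAt w ((2 : ℝ) • ContinuousLinearMap.fst ℝ ℝ ℝ +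
      (-2 * √3) • ContinuousLinearMap.snd ℝ ℝ ℝ) refShape := by
    have h := (hasFDerivAt_quad_mul_inv_sq 0 0 (1 / 4)).add_const (1 / 4 - 1)
    refine (h.congr_fderiv ?_).congr_of_eventuallyEq (.of_forall fun p => ?_)
    · congr 2 <;> ring
    · simp only [hw]; ring
  have hu0 : u refShape = 0 := by
    simp only [hu, refShape, div_pow, hs]; norm_num
  have hv0 : v refShape = 0 := by
    simp only [hv, refShape, div_pow, hs]; norm_num
  have hw0 : w refShape = 0 := by
    simp only [hw, refShape, div_pow, hs]; norm_num
  set g : ℝ × ℝ → ℝ := fun p => lam p.1 p.2 (k + 1) -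
    4 * π ^ 2 / 9 * (triL k + ((u p - 3 * w p) * A + 2 * v p * B + w p * triL k)) with hg
  have key : ∀ p : ℝ × ℝ, 0 < p.2 → ∀ η, 0 ≤ η → η < 1 / 200 → |u p| ≤ η → |v p| ≤ η →
      |w p| ≤ η → |g p| ≤ 4 * π ^ 2 / 9 * (40000 * η ^ 2) := by
    intro p hp η h0 h1 h2 h3 h4
    have h := abs_ev_refTri_sub_le_of_nonneg h0 h1 h2 h3 h4 k hk hk'
    rw [hE] at h
    have e : g p = 4 * π ^ 2 / 9 * (ev refTri (3 + u p) (v p) (1 + w p) (k + 1) -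
        (triL k + ((u p - 3 * w p) * A + 2 * v p * B + w p * triL k))) := by
      have hl : lam p.1 p.2 (k + 1) = 4 * π ^ 2 / 9 * ev refTri (3 + u p) (v p) (1 + w p) (k + 1) :=
        lam_eq_ev_refTri p.1 hp (Nat.succ_ne_zero _)
      rw [mul_sub, ← hl]
    rw [e, abs_mul, abs_of_nonneg (by positivity)]
    exact mul_le_mul_of_nonneg_left h (by positivity)
  have h02 : 0 < refShape.2 := by rw [refShape]; positivity
  have g0 : g refShape = 0 := by
    have := key refShape h02 0 le_rfl (by norm_num) (by rw [hu0, abs_zero]) (by rw [hv0, abs_zero])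
      (by rw [hw0, abs_zero])
    refine abs_eq_zero.1 (le_antisymm (this.trans_eq (by ring)) (abs_nonneg _))
  refine ⟨?_, ?_⟩
  · have h := g0
    simp only [hg, hu0, hv0, hw0] at h
    linarith
  have dg : HasFDerivAt g (0 : ℝ × ℝ →L[ℝ] ℝ) refShape := by
    obtain ⟨K, hK⟩ := du.isBigO_sub.bound
    obtain ⟨K', hK'⟩ := dv.isBigO_sub.bound
    obtain ⟨K'', hK''⟩ := dw.isBigO_sub.bound
    set M := |K| + |K'| + |K''| + 1 with hM
    have hM0 : 0 < M := by positivity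
    have hpos : ∀ᶠ p : ℝ × ℝ in 𝓝 refShape, 0 < p.2 :=
      continuous_snd.continuousAt.eventually (lt_mem_nhds h02)
    have hsm : ∀ᶠ p : ℝ × ℝ in 𝓝 refShape, M * ‖p - refShape‖ < 1 / 200 := by
      have hc : ContinuousAt (fun p : ℝ × ℝ => M * ‖p - refShape‖) refShape := by fun_prop
      refine hc.eventually (gt_mem_nhds ?_)
      norm_num
    refine Asymptotics.IsBigO.hasFDerivAt (n := 2) (Asymptotics.IsBigO.of_bound
      (4 * π ^ 2 / 9 * (40000 * M ^ 2)) ?_) one_lt_two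
    filter_upwards [hK, hK', hK'', hpos, hsm] with p h1 h2 h3 h4 h5
    rw [hu0, sub_zero, Real.norm_eq_abs] at h1
    rw [hv0, sub_zero, Real.norm_eq_abs] at h2
    rw [hw0, sub_zero, Real.norm_eq_abs] at h3
    have n0 := norm_nonneg (p - refShape)
    have b : ∀ x : ℝ, x ≤ |x| := le_abs_self
    have a1 := abs_nonneg K
    have a2 := abs_nonneg K'
    have a3 := abs_nonneg K''
    have := key p h4 (M * ‖p - refShape‖) (by positivity) h5
      (h1.trans (mul_le_mul_of_nonneg_right (by linarith [b K]) n0))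
      (h2.trans (mul_le_mul_of_nonneg_right (by linarith [b K']) n0))
      (h3.trans (mul_le_mul_of_nonneg_right (by linarith [b K'']) n0))
    rw [Real.norm_eq_abs, norm_pow, norm_norm]
    refine this.trans_eq (by ring)
  have h := dg.add (((((du.sub (dw.const_mul 3)).mul_const A).add ((dv.const_mul 2).mul_const B)).add
    (dw.mul_const (triL k))).const_add (triL k) |>.const_mul (4 * π ^ 2 / 9))
  refine (h.congr_fderiv ?_).congr_of_eventuallyEq (.of_forall fun p => ?_)
  · ext
    · simp only [ContinuousLinearMap.comp_apply, ContinuousLinearMap.inl_apply,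
        _root_.add_apply, _root_.sub_apply, _root_.zero_apply, _root_.smul_apply, smul_eq_mul,
        ContinuousLinearMap.coe_fst', ContinuousLinearMap.coe_snd']
      ring
    · simp only [ContinuousLinearMap.comp_apply, ContinuousLinearMap.inr_apply,
        _root_.add_apply, _root_.sub_apply, _root_.zero_apply, _root_.smul_apply, smul_eq_mul,
        ContinuousLinearMap.coe_fst', ContinuousLinearMap.coe_snd']
      ring
  · simp only [hg, Pi.add_apply, Pi.sub_apply]
    ring

theorem hasFDerivAt_lam_one : lam refShape.1 refShape.2 1 = 4 * π ^ 2 / 9 * 28 ∧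
    HasFDerivAt (fun p : ℝ × ℝ => lam p.1 p.2 1)
      ((4 * π ^ 2 / 9 * (349139 / 5400 * (π ^ 2)⁻¹)) • ContinuousLinearMap.fst ℝ ℝ ℝ +
        (4 * π ^ 2 / 9 * (2 * √3 * (-56 / 3 - 713743 / 10800 * (π ^ 2)⁻¹))) •
          ContinuousLinearMap.snd ℝ ℝ ℝ) refShape := by
  have h := hasFDerivAt_lam 0 (by intro j; fin_cases j <;> norm_num [triL])
    (by intro j; fin_cases j <;> norm_num [triL]) (A := 14 / 3 - 19683 / 1600 * (π ^ 2)⁻¹)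
    (B := -179209 / 8640 * (π ^ 2)⁻¹) (fun α β γ => by
      show energyR α β γ (triSin 3 1) (triSin 3 1) / (π ^ 2 / 8) = _ + γ * 28
      rw [energyR_triSin_three_one]
      field_simp
      ring)
  rw [show triL 0 = 28 from rfl] at h
  refine ⟨h.1, h.2.congr_fderiv ?_⟩
  congr 3 <;> ring

theorem hasFDerivAt_lam_two : lam refShape.1 refShape.2 2 = 4 * π ^ 2 / 9 * 52 ∧
    HasFDerivAt (fun p : ℝ × ℝ => lam p.1 p.2 2)
      ((4 * π ^ 2 / 9 * (83878 / 33075 * (π ^ 2)⁻¹)) • ContinuousLinearMap.fst ℝ ℝ ℝ +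
        (4 * π ^ 2 / 9 * (2 * √3 * (-104 / 3 - 145849 / 4725 * (π ^ 2)⁻¹))) •
          ContinuousLinearMap.snd ℝ ℝ ℝ) refShape := by
  have h := hasFDerivAt_lam 1 (by intro j; fin_cases j <;> norm_num [triL])
    (by intro j; fin_cases j <;> norm_num [triL]) (A := 26 / 3 - 19683 / 4900 * (π ^ 2)⁻¹)
    (B := -302089 / 26460 * (π ^ 2)⁻¹) (fun α β γ => by
      show energyR α β γ (triSin 4 1) (triSin 4 1) / (π ^ 2 / 8) = _ + γ * 52
      rw [energyR_triSin_four_one]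
      field_simp
      ring)
  rw [show triL 1 = 52 from rfl] at h
  refine ⟨h.1, h.2.congr_fderiv ?_⟩
  congr 3 <;> ring

theorem hasFDerivAt_lam_four : lam refShape.1 refShape.2 4 = 4 * π ^ 2 / 9 * 84 ∧
    HasFDerivAt (fun p : ℝ × ℝ => lam p.1 p.2 4)
      ((4 * π ^ 2 / 9 * (-155648 / 675 * (π ^ 2)⁻¹)) • ContinuousLinearMap.fst ℝ ℝ ℝ +
        (4 * π ^ 2 / 9 * (2 * √3 * (-56 - 77824 / 675 * (π ^ 2)⁻¹))) •
          ContinuousLinearMap.snd ℝ ℝ ℝ) refShape := by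
  have e : triL 3 = 84 := rfl
  have h := hasFDerivAt_lam 3 (fun j hj => absurd hj (by omega))
    (by rw [e]; intro j hj; fin_cases j <;> first | exact absurd hj (lt_irrefl _) | norm_num [triL])
    (A := 14)
    (B := -38912 / 675 * (π ^ 2)⁻¹) (fun α β γ => by
      show energyR α β γ (triSin 5 1) (triSin 5 1) / (π ^ 2 / 8) = _ + γ * 84
      rw [energyR_triSin_five_one]
      field_simp
      ring)
  rw [e] at h
  refine ⟨h.1, h.2.congr_fderiv ?_⟩
  congr 3 <;> ring

theorem hasFDerivAt_ratio {f g : ℝ × ℝ → ℝ} {z : ℝ × ℝ} {κ x y a b c d : ℝ} (hκ : κ ≠ 0) (hy : y ≠ 0)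
    (hf0 : f z = κ * x) (hg0 : g z = κ * y)
    (hf : HasFDerivAt f ((κ * a) • ContinuousLinearMap.fst ℝ ℝ ℝ +
      (κ * b) • ContinuousLinearMap.snd ℝ ℝ ℝ) z)
    (hg : HasFDerivAt g ((κ * c) • ContinuousLinearMap.fst ℝ ℝ ℝ +
      (κ * d) • ContinuousLinearMap.snd ℝ ℝ ℝ) z) :
    HasFDerivAt (fun p => f p / g p) (((a * y - x * c) / y ^ 2) • ContinuousLinearMap.fst ℝ ℝ ℝ +
      ((b * y - x * d) / y ^ 2) • ContinuousLinearMap.snd ℝ ℝ ℝ) z := by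
  have hg1 : g z ≠ 0 := by rw [hg0]; exact mul_ne_zero hκ hy
  have h := hf.mul ((hasDerivAt_inv hg1).comp_hasFDerivAt z hg)
  refine (h.congr_fderiv ?_).congr_of_eventuallyEq (.of_forall fun p => div_eq_mul_inv _ _)
  ext
  · simp only [Function.comp, hf0, hg0, ContinuousLinearMap.comp_apply, ContinuousLinearMap.inl_apply,
      _root_.add_apply, _root_.smul_apply, smul_eq_mul, ContinuousLinearMap.coe_fst',
      ContinuousLinearMap.coe_snd']
    field_simp
    ring
  · simp only [Function.comp, hf0, hg0, ContinuousLinearMap.comp_apply, ContinuousLinearMap.inr_apply,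
      _root_.add_apply, _root_.smul_apply, smul_eq_mul, ContinuousLinearMap.coe_fst',
      ContinuousLinearMap.coe_snd']
    field_simp
    ring

/-- A scale-invariant combination of the first, second and fourth eigenvalues, as a function of the
shape point. -/
noncomputable def specA (p : ℝ × ℝ) : ℝ :=
  (lam p.1 p.2 4 + 281 / 200 * lam p.1 p.2 1 - 481 / 200 * lam p.1 p.2 2) / lam p.1 p.2 1

/-- The ratio of the fourth and the first eigenvalue, as a function of the shape point. -/
noncomputable def specB (p : ℝ × ℝ) : ℝ := lam p.1 p.2 4 / lam p.1 p.2 1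

theorem exists_hasFDerivAt_spec : ∃ a b e f : ℝ, a * f - b * e < 0 ∧
    HasFDerivAt specA (a • ContinuousLinearMap.fst ℝ ℝ ℝ + b • ContinuousLinearMap.snd ℝ ℝ ℝ)
      refShape ∧
    HasFDerivAt specB (e • ContinuousLinearMap.fst ℝ ℝ ℝ + f • ContinuousLinearMap.snd ℝ ℝ ℝ)
      refShape := by
  obtain ⟨v1, d1⟩ := hasFDerivAt_lam_one
  obtain ⟨v2, d2⟩ := hasFDerivAt_lam_two
  obtain ⟨v4, d4⟩ := hasFDerivAt_lam_four
  have hκ : 4 * π ^ 2 / 9 ≠ 0 := by positivity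
  have n0 : lam refShape.1 refShape.2 4 + 281 / 200 * lam refShape.1 refShape.2 1 -
      481 / 200 * lam refShape.1 refShape.2 2 = 4 * π ^ 2 / 9 * (-43 / 25) := by
    rw [v1, v2, v4]; ring
  have nd := (d4.add (d1.const_mul (281 / 200))).sub (d2.const_mul (481 / 200))
  set t := (π ^ 2)⁻¹ with ht
  have nd' : HasFDerivAt (fun p : ℝ × ℝ => lam p.1 p.2 4 + 281 / 200 * lam p.1 p.2 1 -
      481 / 200 * lam p.1 p.2 2) ((4 * π ^ 2 / 9 * (-155648 / 675 * t + 281 / 200 * (349139 / 5400 * t) -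
        481 / 200 * (83878 / 33075 * t))) • ContinuousLinearMap.fst ℝ ℝ ℝ +
      (4 * π ^ 2 / 9 * (2 * √3 * (-56 - 77824 / 675 * t + 281 / 200 * (-56 / 3 - 713743 / 10800 * t) -
        481 / 200 * (-104 / 3 - 145849 / 4725 * t)))) • ContinuousLinearMap.snd ℝ ℝ ℝ) refShape := by
    refine nd.congr_fderiv ?_
    ext
    · simp only [ContinuousLinearMap.comp_apply, ContinuousLinearMap.inl_apply,
        _root_.add_apply, _root_.sub_apply, _root_.smul_apply, smul_eq_mul,
        ContinuousLinearMap.coe_fst', ContinuousLinearMap.coe_snd']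
      ring
    · simp only [ContinuousLinearMap.comp_apply, ContinuousLinearMap.inr_apply,
        _root_.add_apply, _root_.sub_apply, _root_.smul_apply, smul_eq_mul,
        ContinuousLinearMap.coe_fst', ContinuousLinearMap.coe_snd']
      ring
  refine ⟨_, _, _, _, ?_, hasFDerivAt_ratio hκ (by norm_num) n0 v1 nd' d1,
    hasFDerivAt_ratio hκ (by norm_num) v4 v1 d4 d1⟩
  have h3 : 0 < √3 * t ^ 2 := by positivity
  calc _ = -(2 * 134649216 / 1500625) * (√3 * t ^ 2) := by ring
    _ < 0 := by linarith

theorem continuousAt_specB {p : ℝ × ℝ} (hp : 0 < p.2) : ContinuousAt specB p :=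
  (continuousAt_lam (by norm_num) p hp).div (continuousAt_lam (by norm_num) p hp)
    (lam_pos (by norm_num) hp).ne'

theorem continuousAt_specA {p : ℝ × ℝ} (hp : 0 < p.2) : ContinuousAt specA p :=
  (((continuousAt_lam (by norm_num) p hp).add
    ((continuousAt_lam (by norm_num) p hp).const_mul (281 / 200))).sub
    ((continuousAt_lam (by norm_num) p hp).const_mul (481 / 200))).div
    (continuousAt_lam (by norm_num) p hp) (lam_pos (by norm_num) hp).ne'

theorem refShape_mem : refShape ∈ shapeRegion := by
  have hs : √3 ^ 2 = 3 := Real.sq_sqrt (by norm_num)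
  refine ⟨by norm_num [refShape], by rw [refShape]; positivity, ?_⟩
  simp only [refShape, div_pow, hs]
  norm_num

theorem convex_shapeRegion : Convex ℝ shapeRegion := by
  have h1 : Convex ℝ {p : ℝ × ℝ | p.1 ^ 2 + p.2 ^ 2 ≤ 1} := by
    have h : ConvexOn ℝ Set.univ (fun p : ℝ × ℝ => p.1 ^ 2 + p.2 ^ 2) :=
      ((even_two.convexOn_pow (𝕜 := ℝ)).comp_linearMap (LinearMap.fst ℝ ℝ ℝ)).add
        ((even_two.convexOn_pow (𝕜 := ℝ)).comp_linearMap (LinearMap.snd ℝ ℝ ℝ))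
    simpa using h.convex_le 1
  have h2 : Convex ℝ {p : ℝ × ℝ | 1 / 2 ≤ p.1} :=
    (convex_Ici (1 / 2 : ℝ)).linear_preimage (LinearMap.fst ℝ ℝ ℝ)
  have h3 : Convex ℝ {p : ℝ × ℝ | 0 < p.2} :=
    (convex_Ioi (0 : ℝ)).linear_preimage (LinearMap.snd ℝ ℝ ℝ)
  exact h2.inter (h3.inter h1)

theorem norm_sub_refShape_le {p : ℝ × ℝ} (hp : p ∈ shapeRegion) : ‖p - refShape‖ ≤ 1 := by
  obtain ⟨h1, h2, h3⟩ := hp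
  have hs : √3 ^ 2 = 3 := Real.sq_sqrt (by norm_num)
  have hs0 : 0 ≤ √3 := by positivity
  have hs4 : √3 ≤ 4 := by nlinarith
  have h4 : p.1 ≤ 1 := by nlinarith
  have h5 : p.2 ≤ 1 := by nlinarith
  rw [Prod.norm_def, max_le_iff]
  simp only [refShape, Prod.fst_sub, Prod.snd_sub, Real.norm_eq_abs, abs_le]
  refine ⟨⟨?_, ?_⟩, ?_, ?_⟩ <;> linarith

theorem exists_abs_sub_sub_le {G : ℝ × ℝ → ℝ} {L : ℝ × ℝ →L[ℝ] ℝ} {z : ℝ × ℝ}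
    (hG : HasFDerivAt G L z) {ε : ℝ} (hε : 0 < ε) : ∃ δ > 0, ∀ t, 0 < t → t < δ → ∀ p q : ℝ × ℝ,
    ‖p - z‖ ≤ 1 → ‖q - z‖ ≤ 1 →
    |G (z + t • (q - z)) - G (z + t • (p - z)) - t * L (q - p)| ≤ ε * t := by
  have h := (hasFDerivAt_iff_isLittleO_nhds_zero.1 hG).bound (half_pos hε)
  obtain ⟨δ, hδ, hb⟩ := Metric.eventually_nhds_iff.1 h
  refine ⟨δ, hδ, fun t ht htδ p q hp hq => ?_⟩
  have key : ∀ x : ℝ × ℝ, ‖x - z‖ ≤ 1 →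
      |G (z + t • (x - z)) - G z - t * L (x - z)| ≤ ε / 2 * t := fun x hx => by
    have hn : ‖t • (x - z)‖ ≤ t := by
      rw [norm_smul, Real.norm_of_nonneg ht.le]
      exact mul_le_of_le_one_right ht.le hx
    have := hb (y := t • (x - z)) (by rw [dist_zero_right]; exact hn.trans_lt htδ)
    rw [map_smul, smul_eq_mul, Real.norm_eq_abs] at this
    exact this.trans (mul_le_mul_of_nonneg_left hn (half_pos hε).le)
  have e : L (q - p) = L (q - z) - L (p - z) := by rw [← map_sub]; congr 1; abel
  have h1 := abs_le.1 (key p hp)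
  have h2 := abs_le.1 (key q hq)
  rw [e, abs_le]
  constructor <;> linarith

/-- The point of the unit interval nearest to `t`. -/
noncomputable def unitClamp (t : ℝ) : ℝ := max 0 (min 1 t)

theorem continuous_unitClamp : Continuous unitClamp := by unfold unitClamp; fun_prop

theorem unitClamp_nonneg (t : ℝ) : 0 ≤ unitClamp t := le_max_left _ _

theorem unitClamp_le_one (t : ℝ) : unitClamp t ≤ 1 := max_le zero_le_one (min_le_left _ _)

theorem unitClamp_of_nonpos {t : ℝ} (ht : t ≤ 0) : unitClamp t = 0 :=
  max_eq_left ((min_le_right _ _).trans ht)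

theorem unitClamp_of_one_le {t : ℝ} (ht : 1 ≤ t) : unitClamp t = 1 := by
  rw [unitClamp, min_eq_left ht, max_eq_right zero_le_one]

/-- The first of two antipodal points moving around a quadrilateral of thin triangles: it follows
the upper side towards isosceles triangles, then moves down. -/
noncomputable def quadFst (x y τ : ℝ) : ℝ × ℝ :=
  ((1 - unitClamp (2 * τ)) * (1 - x) + unitClamp (2 * τ) * (1 / 2),
    (1 - unitClamp (2 * τ - 1)) * x + unitClamp (2 * τ - 1) * y)

/-- The second of two antipodal points moving around a quadrilateral of thin triangles: it follows
the lower side towards right triangles, then moves up. -/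
noncomputable def quadSnd (x y τ : ℝ) : ℝ × ℝ :=
  ((1 - unitClamp (2 * τ)) * (1 / 2) +
      unitClamp (2 * τ) * (1 - ((1 - unitClamp (2 * τ - 1)) * y + unitClamp (2 * τ - 1) * x)),
    (1 - unitClamp (2 * τ - 1)) * y + unitClamp (2 * τ - 1) * x)

theorem continuous_quadFst (x y : ℝ) : Continuous (quadFst x y) := by
  have := continuous_unitClamp
  unfold quadFst
  fun_prop

theorem continuous_quadSnd (x y : ℝ) : Continuous (quadSnd x y) := by
  have := continuous_unitClamp
  unfold quadSnd
  fun_prop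

theorem mem_Icc_of_convex_comb {s a b l u : ℝ} (h0 : 0 ≤ s) (h1 : s ≤ 1) (ha : a ∈ Set.Icc l u)
    (hb : b ∈ Set.Icc l u) : (1 - s) * a + s * b ∈ Set.Icc l u :=
  convex_Icc l u ha hb (by linarith) h0 (by ring)

theorem mem_shapeRegion_of_le {p : ℝ × ℝ} (hc : 1 / 2 ≤ p.1) (hd : 0 < p.2) (h : p.1 + p.2 ≤ 1) :
    p ∈ shapeRegion := by
  refine ⟨hc, hd, ?_⟩
  have h1 : p.1 ^ 2 + p.2 ^ 2 ≤ (p.1 + p.2) ^ 2 := by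
    have := mul_nonneg (show 0 ≤ p.1 by linarith) hd.le
    linarith
  exact h1.trans (pow_le_one₀ (by linarith) h)

section Quad

variable {x y : ℝ}

theorem quadFst_snd_mem (hyx : y < x) (τ : ℝ) : (quadFst x y τ).2 ∈ Set.Icc y x :=
  mem_Icc_of_convex_comb (unitClamp_nonneg _) (unitClamp_le_one _) ⟨hyx.le, le_rfl⟩ ⟨le_rfl, hyx.le⟩

theorem quadSnd_snd_mem (hyx : y < x) (τ : ℝ) : (quadSnd x y τ).2 ∈ Set.Icc y x :=
  mem_Icc_of_convex_comb (unitClamp_nonneg _) (unitClamp_le_one _) ⟨le_rfl, hyx.le⟩ ⟨hyx.le, le_rfl⟩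

theorem quadFst_fst_mem (hx : x ≤ 1 / 4) (τ : ℝ) :
    (quadFst x y τ).1 ∈ Set.Icc (1 / 2) (1 - x) :=
  mem_Icc_of_convex_comb (unitClamp_nonneg _) (unitClamp_le_one _) ⟨by linarith, le_rfl⟩
    ⟨le_rfl, by linarith⟩

theorem quadSnd_fst_mem (hyx : y < x) (hx : x ≤ 1 / 4) (τ : ℝ) :
    (quadSnd x y τ).1 ∈ Set.Icc (1 / 2) (1 - (quadSnd x y τ).2) := by
  have h := (quadSnd_snd_mem hyx τ).2
  exact mem_Icc_of_convex_comb (unitClamp_nonneg _) (unitClamp_le_one _) ⟨le_rfl, by linarith⟩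
    ⟨show (1 : ℝ) / 2 ≤ 1 - (quadSnd x y τ).2 by linarith, le_rfl⟩

theorem quadFst_mem_shapeRegion (hy : 0 < y) (hyx : y < x) (hx : x ≤ 1 / 4) (τ : ℝ) :
    quadFst x y τ ∈ shapeRegion :=
  mem_shapeRegion_of_le (quadFst_fst_mem hx τ).1 (hy.trans_le (quadFst_snd_mem hyx τ).1)
    (by have h1 := (quadFst_fst_mem (y := y) hx τ).2; have h2 := (quadFst_snd_mem hyx τ).2; linarith)

theorem quadSnd_mem_shapeRegion (hy : 0 < y) (hyx : y < x) (hx : x ≤ 1 / 4) (τ : ℝ) :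
    quadSnd x y τ ∈ shapeRegion :=
  mem_shapeRegion_of_le (quadSnd_fst_mem hyx hx τ).1 (hy.trans_le (quadSnd_snd_mem hyx τ).1)
    (by have h1 := (quadSnd_fst_mem hyx hx τ).2; linarith)

end Quad

theorem quadFst_snd_of_le (x y : ℝ) {τ : ℝ} (hτ : τ ≤ 1 / 2) : (quadFst x y τ).2 = x := by
  simp [quadFst, unitClamp_of_nonpos (show 2 * τ - 1 ≤ 0 by linarith)]

theorem quadSnd_snd_of_le (x y : ℝ) {τ : ℝ} (hτ : τ ≤ 1 / 2) : (quadSnd x y τ).2 = y := by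
  simp [quadSnd, unitClamp_of_nonpos (show 2 * τ - 1 ≤ 0 by linarith)]

theorem quadFst_fst_of_ge (x y : ℝ) {τ : ℝ} (hτ : 1 / 2 ≤ τ) : (quadFst x y τ).1 = 1 / 2 := by
  simp [quadFst, unitClamp_of_one_le (show 1 ≤ 2 * τ by linarith)]

theorem quadSnd_fst_of_ge (x y : ℝ) {τ : ℝ} (hτ : 1 / 2 ≤ τ) :
    (quadSnd x y τ).1 = 1 - (quadSnd x y τ).2 := by
  simp [quadSnd, unitClamp_of_one_le (show 1 ≤ 2 * τ by linarith)]

theorem quadFst_zero (x y : ℝ) : quadFst x y 0 = (1 - x, x) := by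
  simp [quadFst, unitClamp_of_nonpos]

theorem quadSnd_zero (x y : ℝ) : quadSnd x y 0 = (1 / 2, y) := by
  simp [quadSnd, unitClamp_of_nonpos]

theorem quadFst_one (x y : ℝ) : quadFst x y 1 = (1 / 2, y) := by
  rw [quadFst, unitClamp_of_one_le (by norm_num), unitClamp_of_one_le (by norm_num)]
  simp

theorem quadSnd_one (x y : ℝ) : quadSnd x y 1 = (1 - x, x) := by
  rw [quadSnd, unitClamp_of_one_le (by norm_num), unitClamp_of_one_le (by norm_num)]
  simp

theorem exists_thin_shapes : ∃ x y : ℝ, 0 < y ∧ y < x ∧ x ≤ 1 / 4 ∧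
    (∀ c ∈ Set.Icc (1 / 2) (1 - x), ∀ c' ∈ Set.Icc (1 / 2) (1 - y), specB (c', y) < specB (c, x)) ∧
    ∀ d ∈ Set.Icc y x, 0 < specA (1 - d, d) ∧ specA (1 / 2, d) < 0 := by
  obtain ⟨δ, hδ, H⟩ := lam_one_lt_lam_four
  obtain ⟨δ', hδ', H'⟩ := lam_tall
  obtain ⟨δ'', hδ'', H''⟩ := lam_flat
  set x := min (min (1 / 4) (δ / 2)) (min δ' δ'') with hx
  have hx0 : 0 < x := by positivity
  have hx4 : x ≤ 1 / 4 := (min_le_left _ _).trans (min_le_left _ _)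
  have hxδ : x ≤ δ / 2 := (min_le_left _ _).trans (min_le_right _ _)
  have hxδ' : x ≤ δ' := (min_le_right _ _).trans (min_le_left _ _)
  have hxδ'' : x ≤ δ'' := (min_le_right _ _).trans (min_le_right _ _)
  have hratio : ∀ c d ε : ℝ, 1 / 2 ≤ c → d ≤ ε / 2 → 0 < ε → d / c ≤ ε := fun c d ε hc hd hε => by
    rw [div_le_iff₀ (by linarith)]
    have := mul_le_mul_of_nonneg_left hc hε.le
    linarith
  have hcont : ContinuousOn (fun c : ℝ => specB (c, x)) (Set.Icc (1 / 2) (1 - x)) := fun c _ =>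
    ((continuousAt_specB (p := (c, x)) hx0).comp
      (f := fun c : ℝ => (c, x)) (by fun_prop)).continuousWithinAt
  obtain ⟨c₀, hc₀, hmin⟩ := isCompact_Icc.exists_isMinOn ⟨1 / 2, le_rfl, by linarith⟩ hcont
  have hm : 1 < specB (c₀, x) := by
    rw [specB, one_lt_div (lam_pos one_ne_zero hx0)]
    exact H c₀ x hc₀.1 (by linarith [hc₀.2]) hx0 (hratio c₀ x δ hc₀.1 hxδ hδ)
  obtain ⟨ρ, hρ, K⟩ := lam_four_le (half_pos (sub_pos.2 hm))
  refine ⟨x, min (x / 2) (ρ / 2), by positivity, (min_le_left _ _).trans_lt (half_lt_self hx0), hx4,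
    fun c hc c' hc' => ?_, fun d hd => ?_⟩
  · have hy0 : 0 < min (x / 2) (ρ / 2) := by positivity
    have h1 := K c' _ hc'.1 (by linarith [hc'.2]) hy0 (hratio _ _ ρ hc'.1 (min_le_right _ _) hρ)
    have h2 : specB (c', min (x / 2) (ρ / 2)) ≤ 1 + (specB (c₀, x) - 1) / 2 := by
      rw [specB, div_le_iff₀ (lam_pos one_ne_zero hy0)]
      exact h1
    have h3 : specB (c₀, x) ≤ specB (c, x) := hmin hc
    linarith
  · have hd0 : 0 < d := lt_of_lt_of_le (by positivity) hd.1
    have h1 := H' d hd0 (hd.2.trans hxδ')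
    have h2 := H'' d hd0 (hd.2.trans hxδ'')
    refine ⟨div_pos ?_ (lam_pos one_ne_zero hd0), div_neg_of_neg_of_pos ?_ (lam_pos one_ne_zero hd0)⟩
    · show 0 < lam (1 - d) d 4 + 281 / 200 * lam (1 - d) d 1 - 481 / 200 * lam (1 - d) d 2
      linarith
    · show lam (1 / 2) d 4 + 281 / 200 * lam (1 / 2) d 1 - 481 / 200 * lam (1 / 2) d 2 < 0
      linarith

/-- The point dividing the segment from `refShape` to `p` in the ratio `t : 1 - t`. -/
noncomputable def towardRef (t : ℝ) (p : ℝ × ℝ) : ℝ × ℝ := refShape + t • (p - refShape)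

theorem towardRef_one (p : ℝ × ℝ) : towardRef 1 p = p := by simp [towardRef]

theorem towardRef_mem {t : ℝ} {p : ℝ × ℝ} (h0 : 0 ≤ t) (h1 : t ≤ 1) (hp : p ∈ shapeRegion) :
    towardRef t p ∈ shapeRegion :=
  convex_shapeRegion.add_smul_sub_mem refShape_mem hp ⟨h0, h1⟩

theorem towardRef_injective {t : ℝ} (ht : 0 < t) : Function.Injective (towardRef t) := fun p q h => by
  have h1 : t • (p - refShape) = t • (q - refShape) := add_left_cancel h
  exact sub_left_injective (smul_right_injective _ ht.ne' h1)

theorem not_injOn_spec :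
    ¬ ∀ p ∈ shapeRegion, ∀ q ∈ shapeRegion, specA p = specA q → specB p = specB q → p = q := by
  intro hinj
  obtain ⟨x, y, hy, hyx, hx, hB, hA⟩ := exists_thin_shapes
  obtain ⟨a, b, e, f, hdet, dA, dB⟩ := exists_hasFDerivAt_spec
  set m := -(a * f - b * e) * min (x - y) (1 / 4) with hm
  have hmin : 0 < min (x - y) (1 / 4) := lt_min (by linarith) (by norm_num)
  have hm0 : 0 < m := mul_pos (by linarith) hmin
  set M := |a| + |b| + |e| + |f| + 1 with hM
  have a0 := abs_nonneg a
  have b0 := abs_nonneg b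
  have e0 := abs_nonneg e
  have f0 := abs_nonneg f
  have hM0 : 0 < M := by linarith
  have hε : 0 < m / (2 * M) := by positivity
  obtain ⟨δ, hδ, HA⟩ := exists_abs_sub_sub_le dA hε
  obtain ⟨δ', hδ', HB⟩ := exists_abs_sub_sub_le dB hε
  set t₀ := min 1 (min δ δ') / 2 with ht₀
  have ht0 : 0 < t₀ := by positivity
  have ht1 : t₀ < 1 := (half_lt_self (by positivity)).trans_le (min_le_left _ _)
  have htδ : t₀ < δ := (half_lt_self (by positivity)).trans_le ((min_le_right _ _).trans (min_le_left _ _))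
  have htδ' : t₀ < δ' :=
    (half_lt_self (by positivity)).trans_le ((min_le_right _ _).trans (min_le_right _ _))
  have hp : ∀ τ, quadFst x y τ ∈ shapeRegion := quadFst_mem_shapeRegion hy hyx hx
  have hq : ∀ τ, quadSnd x y τ ∈ shapeRegion := quadSnd_mem_shapeRegion hy hyx hx
  set T : ℝ → ℝ := fun σ => 1 - (1 - t₀) * unitClamp σ with hT
  have hTc : Continuous T := by
    have := continuous_unitClamp
    fun_prop
  have hT0 : ∀ σ, 0 < T σ := fun σ => by
    have := mul_le_mul_of_nonneg_left (unitClamp_le_one σ) (show 0 ≤ 1 - t₀ by linarith)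
    simp only [hT]
    linarith
  have hT1 : ∀ σ, T σ ≤ 1 := fun σ => by
    have := mul_nonneg (show 0 ≤ 1 - t₀ by linarith) (unitClamp_nonneg σ)
    simp only [hT]
    linarith
  have hTz : T 0 = 1 := by simp [hT, unitClamp_of_nonpos]
  have hTo : T 1 = t₀ := by simp [hT, unitClamp_of_one_le]
  have hP : ∀ z : ℝ × ℝ, towardRef (T z.1) (quadFst x y z.2) ∈ shapeRegion := fun z =>
    towardRef_mem (hT0 _).le (hT1 _) (hp _)
  have hQ : ∀ z : ℝ × ℝ, towardRef (T z.1) (quadSnd x y z.2) ∈ shapeRegion := fun z =>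
    towardRef_mem (hT0 _).le (hT1 _) (hq _)
  have cP : Continuous fun z : ℝ × ℝ => towardRef (T z.1) (quadFst x y z.2) := by
    have := continuous_quadFst x y
    unfold towardRef
    fun_prop
  have cQ : Continuous fun z : ℝ × ℝ => towardRef (T z.1) (quadSnd x y z.2) := by
    have := continuous_quadSnd x y
    unfold towardRef
    fun_prop
  set u : ℝ × ℝ → ℝ := fun z => specA (towardRef (T z.1) (quadSnd x y z.2)) -
    specA (towardRef (T z.1) (quadFst x y z.2)) with hu
  set v : ℝ × ℝ → ℝ := fun z => specB (towardRef (T z.1) (quadSnd x y z.2)) -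
    specB (towardRef (T z.1) (quadFst x y z.2)) with hv
  have cu : Continuous u := continuous_iff_continuousAt.2 fun z =>
    ((continuousAt_specA (hQ z).2.1).comp
      (f := fun z : ℝ × ℝ => towardRef (T z.1) (quadSnd x y z.2)) cQ.continuousAt).sub
    ((continuousAt_specA (hP z).2.1).comp
      (f := fun z : ℝ × ℝ => towardRef (T z.1) (quadFst x y z.2)) cP.continuousAt)
  have cv : Continuous v := continuous_iff_continuousAt.2 fun z =>
    ((continuousAt_specB (hQ z).2.1).comp
      (f := fun z : ℝ × ℝ => towardRef (T z.1) (quadSnd x y z.2)) cQ.continuousAt).sub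
    ((continuousAt_specB (hP z).2.1).comp
      (f := fun z : ℝ × ℝ => towardRef (T z.1) (quadFst x y z.2)) cP.continuousAt)
  have hne : ∀ τ, quadSnd x y τ ≠ quadFst x y τ := fun τ h => by
    rcases le_total τ (1 / 2) with hτ | hτ
    · have := congrArg Prod.snd h
      rw [quadFst_snd_of_le x y hτ, quadSnd_snd_of_le x y hτ] at this
      exact hyx.ne this
    · have := congrArg Prod.fst h
      rw [quadFst_fst_of_ge x y hτ, quadSnd_fst_of_ge x y hτ] at this
      linarith [(quadSnd_snd_mem hyx τ).2]
  have hv0 : ∀ τ ≤ 1 / 2, v (0, τ) < 0 := fun τ hτ => by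
    simp only [hv, hTz, towardRef_one, sub_neg]
    have h1 := quadFst_fst_mem (y := y) hx τ
    have h2 := quadSnd_fst_mem hyx hx τ
    rw [quadSnd_snd_of_le x y hτ] at h2
    calc specB (quadSnd x y τ) = specB ((quadSnd x y τ).1, y) :=
          congrArg specB (Prod.ext rfl (quadSnd_snd_of_le x y hτ))
      _ < specB ((quadFst x y τ).1, x) := hB _ h1 _ h2
      _ = specB (quadFst x y τ) := congrArg specB (Prod.ext rfl (quadFst_snd_of_le x y hτ).symm)
  have hu0 : ∀ τ, 1 / 2 ≤ τ → 0 < u (0, τ) := fun τ hτ => by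
    simp only [hu, hTz, towardRef_one, sub_pos]
    have h1 := (hA _ (quadFst_snd_mem hyx τ)).2
    have h2 := (hA _ (quadSnd_snd_mem hyx τ)).1
    calc specA (quadFst x y τ) = specA (1 / 2, (quadFst x y τ).2) :=
          congrArg specA (Prod.ext (quadFst_fst_of_ge x y hτ) rfl)
      _ < specA (1 - (quadSnd x y τ).2, (quadSnd x y τ).2) := h1.trans h2
      _ = specA (quadSnd x y τ) := congrArg specA (Prod.ext (quadSnd_fst_of_ge x y hτ).symm rfl)
  have hu00 : u (0, 0) < 0 := by
    simp only [hu, hTz, towardRef_one, sub_neg, quadFst_zero, quadSnd_zero]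
    exact (hA y ⟨le_rfl, hyx.le⟩).2.trans (hA x ⟨hyx.le, le_rfl⟩).1
  have hu1 : ∀ τ, |u (1, τ) - t₀ * (a * ((quadSnd x y τ).1 - (quadFst x y τ).1) +
      b * ((quadSnd x y τ).2 - (quadFst x y τ).2))| ≤ m / (2 * M) * t₀ := fun τ => by
    have := HA t₀ ht0 htδ _ _ (norm_sub_refShape_le (hp τ)) (norm_sub_refShape_le (hq τ))
    simpa [hu, hTo, towardRef] using this
  have hv1 : ∀ τ, |v (1, τ) - t₀ * (e * ((quadSnd x y τ).1 - (quadFst x y τ).1) +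
      f * ((quadSnd x y τ).2 - (quadFst x y τ).2))| ≤ m / (2 * M) * t₀ := fun τ => by
    have := HB t₀ ht0 htδ' _ _ (norm_sub_refShape_le (hp τ)) (norm_sub_refShape_le (hq τ))
    simpa [hv, hTo, towardRef] using this
  have comb : ∀ k l U V X : ℝ, |k| + |l| ≤ M → |U| ≤ m / (2 * M) * t₀ → |V| ≤ m / (2 * M) * t₀ →
      X = k * U + l * V → |X| ≤ t₀ * m / 2 := by
    intro k l U V X hkl hU hV hX
    rw [hX]
    refine (abs_add_le _ _).trans ?_
    rw [abs_mul, abs_mul]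
    have h1 := mul_le_mul_of_nonneg_left hU (abs_nonneg k)
    have h2 := mul_le_mul_of_nonneg_left hV (abs_nonneg l)
    have h3 := mul_le_mul_of_nonneg_right hkl (show 0 ≤ m / (2 * M) * t₀ by positivity)
    have h4 : M * (m / (2 * M) * t₀) = t₀ * m / 2 := by field_simp
    linarith
  have hα : ∀ τ, |(-e * u (1, τ) + a * v (1, τ)) -
      t₀ * ((a * f - b * e) * ((quadSnd x y τ).2 - (quadFst x y τ).2))| ≤ t₀ * m / 2 := fun τ =>
    comb (-e) a _ _ _ (by rw [abs_neg]; linarith) (hu1 τ) (hv1 τ) (by ring)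
  have hβ : ∀ τ, |(-f * u (1, τ) + b * v (1, τ)) -
      t₀ * (-(a * f - b * e) * ((quadSnd x y τ).1 - (quadFst x y τ).1))| ≤ t₀ * m / 2 := fun τ =>
    comb (-f) b _ _ _ (by rw [abs_neg]; linarith) (hu1 τ) (hv1 τ) (by ring)
  have htm : 0 < t₀ * m := by positivity
  have hα1 : ∀ τ ≤ 1 / 2, 0 < -e * u (1, τ) + a * v (1, τ) := fun τ hτ => by
    have h1 := (abs_le.1 (hα τ)).1
    rw [quadFst_snd_of_le x y hτ, quadSnd_snd_of_le x y hτ] at h1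
    have h2 : t₀ * m ≤ t₀ * (-(a * f - b * e) * (x - y)) :=
      mul_le_mul_of_nonneg_left (mul_le_mul_of_nonneg_left (min_le_left _ _) (by linarith)) ht0.le
    linarith
  have hβ1 : ∀ τ, 1 / 2 ≤ τ → 0 < -f * u (1, τ) + b * v (1, τ) := fun τ hτ => by
    have h1 := (abs_le.1 (hβ τ)).1
    rw [quadFst_fst_of_ge x y hτ, quadSnd_fst_of_ge x y hτ] at h1
    have h2 : t₀ * m ≤ t₀ * (-(a * f - b * e) * (1 - (quadSnd x y τ).2 - 1 / 2)) :=
      mul_le_mul_of_nonneg_left (mul_le_mul_of_nonneg_left ((min_le_right _ _).trans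
        (by linarith [(quadSnd_snd_mem hyx τ).2])) (by linarith)) ht0.le
    linarith
  have hβ0 : -f * u (1, 0) + b * v (1, 0) < 0 := by
    have h1 := (abs_le.1 (hβ 0)).2
    rw [quadFst_zero, quadSnd_zero] at h1
    simp only at h1
    have h2 : t₀ * m ≤ t₀ * (-(a * f - b * e) * (1 - x - 1 / 2)) :=
      mul_le_mul_of_nonneg_left (mul_le_mul_of_nonneg_left ((min_le_right _ _).trans
        (by linarith)) (by linarith)) ht0.le
    linarith
  refine false_of_opposite_winding (fun z => (u z : ℂ) + v z * Complex.I) (by fun_prop)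
    (fun z hz => ?_) (fun σ => ?_) (-Complex.imLm) Complex.reLm
    ((-e) • Complex.reLm + a • Complex.imLm) ((-f) • Complex.reLm + b • Complex.imLm)
    (fun τ hτ => ?_) (fun τ hτ => ?_) (fun τ hτ => ?_) (fun τ hτ => ?_) ?_ ?_
  · have h1 : u z = 0 := by simpa using congrArg Complex.re hz
    have h2 : v z = 0 := by simpa using congrArg Complex.im hz
    exact hne z.2 (towardRef_injective (hT0 z.1)
      (hinj _ (hQ z) _ (hP z) (sub_eq_zero.1 h1) (sub_eq_zero.1 h2)))
  · simp only [hu, hv, quadFst_zero, quadFst_one, quadSnd_zero, quadSnd_one]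
    push_cast
    ring
  · simpa using hv0 τ hτ.2
  · simpa using hu0 τ hτ.1
  · simpa using hα1 τ hτ.2
  · simpa using hβ1 τ hτ.1
  · have h1 := mul_pos_of_neg_of_neg hu00 (show v (0, 1 / 2) < 0 from hv0 _ le_rfl)
    have h2 := mul_pos (neg_pos.2 (hv0 0 (by norm_num))) (hu0 _ le_rfl)
    simp
    linarith
  · have h1 := mul_pos (hα1 0 (by norm_num)) (hβ1 _ le_rfl)
    have h2 := mul_pos (neg_pos.2 hβ0) (hα1 _ le_rfl)
    have h3 : 0 < (a * f - b * e) * (u (1, 0) * v (1, 1 / 2) - v (1, 0) * u (1, 1 / 2)) := by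
      linarith
    have h4 := neg_of_mul_pos_right h3 hdet.le
    simpa using h4

theorem not_collinear_triangle {r c d : ℝ} (hr : 0 < r) (hd : 0 < d) :
    ¬ Collinear ℝ ({0, !₂[r, 0], !₂[r * c, r * d]} : Set (EuclideanSpace ℝ (Fin 2))) := by
  intro h
  obtain ⟨w, hw⟩ := (collinear_iff_of_mem (p₀ := (0 : EuclideanSpace ℝ (Fin 2))) (by simp)).1 h
  obtain ⟨s, hs⟩ := hw !₂[r, 0] (by simp)
  obtain ⟨t, ht⟩ := hw !₂[r * c, r * d] (by simp)
  have h0 : r = s * w 0 := by simpa using congrArg (fun z : EuclideanSpace ℝ (Fin 2) => z 0) hs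
  have h1 : 0 = s * w 1 := by simpa using congrArg (fun z : EuclideanSpace ℝ (Fin 2) => z 1) hs
  have h2 : r * d = t * w 1 := by simpa using congrArg (fun z : EuclideanSpace ℝ (Fin 2) => z 1) ht
  have hs0 : s ≠ 0 := by
    rintro rfl
    simp [hr.ne'] at h0
  have hw1 : w 1 = 0 := by simpa [hs0] using h1.symm
  rw [hw1, mul_zero] at h2
  exact (mul_pos hr hd).ne' h2

/-- there exist two non-isometric open triangular regions `A`, `B` in ℝ² with
`λ_i(A) = λ_i(B)` for `i = 1, 2, 4`. -/
theorem exists_nonisometric_triangles_sharing_three_dirichlet_eigenvalues :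
    ∃ P₁ P₂ P₃ Q₁ Q₂ Q₃ : EuclideanSpace ℝ (Fin 2),
      ¬ Collinear ℝ ({P₁, P₂, P₃} : Set (EuclideanSpace ℝ (Fin 2))) ∧
      ¬ Collinear ℝ ({Q₁, Q₂, Q₃} : Set (EuclideanSpace ℝ (Fin 2))) ∧
      (¬ ∃ f : EuclideanSpace ℝ (Fin 2) ≃ᵢ EuclideanSpace ℝ (Fin 2),
        f '' interior (convexHull ℝ ({P₁, P₂, P₃} : Set (EuclideanSpace ℝ (Fin 2)))) =
          interior (convexHull ℝ ({Q₁, Q₂, Q₃} : Set (EuclideanSpace ℝ (Fin 2))))) ∧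
      dirichletEig (interior (convexHull ℝ ({P₁, P₂, P₃} : Set (EuclideanSpace ℝ (Fin 2))))) 1 =
        dirichletEig (interior (convexHull ℝ ({Q₁, Q₂, Q₃} : Set (EuclideanSpace ℝ (Fin 2))))) 1 ∧
      dirichletEig (interior (convexHull ℝ ({P₁, P₂, P₃} : Set (EuclideanSpace ℝ (Fin 2))))) 2 =
        dirichletEig (interior (convexHull ℝ ({Q₁, Q₂, Q₃} : Set (EuclideanSpace ℝ (Fin 2))))) 2 ∧
      dirichletEig (interior (convexHull ℝ ({P₁, P₂, P₃} : Set (EuclideanSpace ℝ (Fin 2))))) 4 =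
        dirichletEig (interior (convexHull ℝ ({Q₁, Q₂, Q₃} : Set (EuclideanSpace ℝ (Fin 2))))) 4 := by
  have h := not_injOn_spec
  push Not at h
  obtain ⟨⟨c, d⟩, hp, ⟨c', d'⟩, hq, hA, hB, hne⟩ := h
  have hd : 0 < d := hp.2.1
  have hd' : 0 < d' := hq.2.1
  have l1 : 0 < lam c d 1 := lam_pos one_ne_zero hd
  have l1' : 0 < lam c' d' 1 := lam_pos one_ne_zero hd'
  have hr2 : 0 < lam c' d' 1 / lam c d 1 := div_pos l1' l1
  have hr : 0 < √(lam c' d' 1 / lam c d 1) := Real.sqrt_pos.2 hr2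
  simp only [specA, specB] at hA hB
  have hB' : lam c d 4 * lam c' d' 1 = lam c' d' 4 * lam c d 1 :=
    (div_eq_div_iff l1.ne' l1'.ne').1 hB
  have hA' := (div_eq_div_iff l1.ne' l1'.ne').1 hA
  refine ⟨0, !₂[1, 0], !₂[1 * c, 1 * d], 0, !₂[√(lam c' d' 1 / lam c d 1), 0],
    !₂[√(lam c' d' 1 / lam c d 1) * c', √(lam c' d' 1 / lam c d 1) * d'],
    not_collinear_triangle one_pos hd, not_collinear_triangle hr hd', ?_, ?_, ?_, ?_⟩
  · rintro ⟨f, hf⟩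
    obtain ⟨h1, h2⟩ := eq_of_isometric hp hq hr f hf
    exact hne (by rw [h1, h2])
  · rw [dirichletEig_triangle_eq one_pos hd one_ne_zero, dirichletEig_triangle_eq hr hd' one_ne_zero,
      Real.sq_sqrt hr2.le]
    field_simp
  · rw [dirichletEig_triangle_eq one_pos hd two_ne_zero, dirichletEig_triangle_eq hr hd' two_ne_zero,
      Real.sq_sqrt hr2.le]
    field_simp
    linarith
  · rw [dirichletEig_triangle_eq one_pos hd four_ne_zero, dirichletEig_triangle_eq hr hd' four_ne_zero,
      Real.sq_sqrt hr2.le]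
    field_simp
    linarith
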